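/- For every divergence-free initial velocity u₀ ∈ BUC(Ω)² (bounded and uniformly continuous on Ω), the nondimensionalized Navier–Stokes equations on Ω, with pressure given by p = −u₁² − 2∂₂K*(ωu₁), have a unique solution u ∈ C⁰([0,∞), BUC(Ω)²) with u(·,0) = u₀ that is smooth on Ω × (0,∞); moreover there exists a constant C > 0, depending only on ‖u₀‖_{L∞(Ω)}, such that ‖u(·,t)‖_{L∞(Ω)} ≤ C(1 + √t) for all t ≥ 0. -/

import Mathlib

noncomputable section

open MeasureTheory Real

namespace NS

/-- The measure on the cylinder `Ω = ℝ × 𝕋`, identified with `ℝ × [0,1)`. -/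
def μΩ : Measure (ℝ × ℝ) := volume.restrict (Set.univ ×ˢ Set.Ico (0:ℝ) 1)

/-- First partial derivative of a function on `ℝ²`. -/
def pd1 (g : ℝ × ℝ → ℝ) (x : ℝ × ℝ) : ℝ := deriv (fun y => g (y, x.2)) x.1

/-- Second partial derivative of a function on `ℝ²`. -/
def pd2 (g : ℝ × ℝ → ℝ) (x : ℝ × ℝ) : ℝ := deriv (fun y => g (x.1, y)) x.2

/-- Euclidean square norm of a vector in `ℝ²`. -/
def vnorm2 (v : ℝ × ℝ) : ℝ := v.1 ^ 2 + v.2 ^ 2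

/-- Euclidean norm of a vector in `ℝ²`. -/
def vnorm (v : ℝ × ℝ) : ℝ := Real.sqrt (vnorm2 v)

/-- Fundamental solution of the Laplacian on the cylinder `Ω = ℝ × 𝕋`. -/
def Kker (x : ℝ × ℝ) : ℝ :=
  (1 / (4 * π)) * Real.log (2 * Real.cosh (2 * π * x.1) - 2 * Real.cos (2 * π * x.2))

/-- Vorticity `ω = ∂₁u₂ - ∂₂u₁`. -/
def vort (u : ℝ × ℝ → ℝ × ℝ) (x : ℝ × ℝ) : ℝ :=
  pd1 (fun y => (u y).2) x - pd2 (fun y => (u y).1) x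

/-- The pressure `p = -u₁² - 2 ∂₂K * (ω u₁)` (convolution on the cylinder). -/
def pressure (u : ℝ × ℝ → ℝ × ℝ) (x : ℝ × ℝ) : ℝ :=
  -(u x).1 ^ 2 - 2 * ∫ y, pd2 Kker (x - y) * (vort u y * (u y).1) ∂μΩ

/-- Bounded, uniformly continuous, periodic vector field on `Ω`, i.e.
an element of `BUC(Ω)²`. -/
def BUCField (v : ℝ × ℝ → ℝ × ℝ) : Prop :=
  UniformContinuous v ∧ (∃ B : ℝ, ∀ x : ℝ × ℝ, vnorm (v x) ≤ B) ∧
    ∀ x : ℝ × ℝ, v (x.1, x.2 + 1) = v x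

/-- Divergence-free in the sense of distributions. -/
def WeakDivFree (v : ℝ × ℝ → ℝ × ℝ) : Prop :=
  ∀ φ : ℝ × ℝ → ℝ, ContDiff ℝ (⊤ : ℕ∞) φ → HasCompactSupport φ →
    (∫ x : ℝ × ℝ, ((v x).1 * pd1 φ x + (v x).2 * pd2 φ x)) = 0

/-- `u` is a solution of the Navier-Stokes equations on `Ω` with pressure
`p = -u₁² - 2∂₂K*(ωu₁)` and initial data `u₀`, belonging to
`C⁰([0,∞), BUC(Ω)²)` and smooth on `Ω × (0,∞)`. -/
def IsSolution (u₀ : ℝ × ℝ → ℝ × ℝ) (u : ℝ → ℝ × ℝ → ℝ × ℝ) : Prop :=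
  u 0 = u₀ ∧
  (∀ t : ℝ, 0 ≤ t → BUCField (u t)) ∧
  -- continuity of `t ↦ u(·,t)` in the uniform norm
  (∀ t : ℝ, 0 ≤ t → ∀ ε : ℝ, 0 < ε → ∃ δ > (0:ℝ), ∀ s : ℝ, 0 ≤ s → |s - t| < δ →
    ∀ x : ℝ × ℝ, vnorm (u s x - u t x) ≤ ε) ∧
  -- smoothness on `Ω × (0,∞)`
  ContDiffOn ℝ (⊤ : ℕ∞) (fun z : ℝ × (ℝ × ℝ) => u z.1 z.2) {z | 0 < z.1} ∧
  -- incompressibility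
  (∀ t : ℝ, 0 < t → ∀ x : ℝ × ℝ,
    pd1 (fun y => (u t y).1) x + pd2 (fun y => (u t y).2) x = 0) ∧
  -- momentum equation, first component
  (∀ t : ℝ, 0 < t → ∀ x : ℝ × ℝ,
    deriv (fun s => (u s x).1) t + (u t x).1 * pd1 (fun y => (u t y).1) x
        + (u t x).2 * pd2 (fun y => (u t y).1) x
      = pd1 (pd1 (fun y => (u t y).1)) x + pd2 (pd2 (fun y => (u t y).1)) x
        - pd1 (pressure (u t)) x) ∧
  -- momentum equation, second component
  (∀ t : ℝ, 0 < t → ∀ x : ℝ × ℝ,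
    deriv (fun s => (u s x).2) t + (u t x).1 * pd1 (fun y => (u t y).2) x
        + (u t x).2 * pd2 (fun y => (u t y).2) x
      = pd1 (pd1 (fun y => (u t y).2)) x + pd2 (pd2 (fun y => (u t y).2)) x
        - pd2 (pressure (u t)) x)

local notation "ℝ²" => ℝ × ℝ

section
open Set Filter Topology Function ProbabilityTheory BoundedContinuousFunction ContDiff

variable {C C' M t T τ ε q s σ A A' B' D a b r d K B E U : ℝ} {f g f' g' f1 f2 : ℝ² → ℝ}
  {F G u1 u2 v1 v2 : ℝ → ℝ² → ℝ} {j k : ℕ} {e : ℝ²} {I : Set ℝ}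

/-! ### Averages with parameters -/

theorem avg_integrable {W : Type*} [MeasurableSpace W] {m : Measure W} {κ g : W → ℝ}
    (hκ : Integrable κ m) (hg : AEStronglyMeasurable g m) (hC : ∀ w, |g w| ≤ C) :
    Integrable (fun w => κ w * g w) m := by
  refine hκ.mul_bdd (c := C) hg (.of_forall fun w => ?_)
  simpa using hC w

theorem avg_abs_le {W : Type*} [MeasurableSpace W] {m : Measure W} {κ g : W → ℝ}
    (hκ : Integrable κ m) (hC : ∀ w, |g w| ≤ C) :
    |∫ w, κ w * g w ∂m| ≤ (∫ w, |κ w| ∂m) * C := by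
  have := norm_integral_le_of_norm_le (f := fun w => κ w * g w) (hκ.abs.mul_const C)
    (.of_forall fun w => by
      simp only [norm_mul, norm_eq_abs]
      exact mul_le_mul_of_nonneg_left (hC w) (abs_nonneg _))
  rwa [integral_mul_const, norm_eq_abs] at this

theorem avg_continuousOn {W P : Type*} [MeasurableSpace W] {m : Measure W} [TopologicalSpace P]
    [FirstCountableTopology P] {κ : W → ℝ} (hκ : Integrable κ m) {g : P → W → ℝ} {s : Set P}
    (hm : ∀ p ∈ s, AEStronglyMeasurable (g p) m) (hC : ∀ p ∈ s, ∀ w, |g p w| ≤ C)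
    (hc : ∀ w, ContinuousOn (fun p => g p w) s) :
    ContinuousOn (fun p => ∫ w, κ w * g p w ∂m) s := by
  intro p hp
  refine continuousWithinAt_of_dominated (bound := fun w => |κ w| * C) ?_ ?_ (hκ.abs.mul_const C) ?_
  · filter_upwards [self_mem_nhdsWithin] with q hq
    exact hκ.aestronglyMeasurable.mul (hm q hq)
  · filter_upwards [self_mem_nhdsWithin] with q hq
    refine .of_forall fun w => ?_
    simp only [norm_mul, norm_eq_abs]
    exact mul_le_mul_of_nonneg_left (hC q hq w) (abs_nonneg _)
  · exact .of_forall fun w => continuousWithinAt_const.mul (hc w p hp)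

theorem avg_hasDerivAt {W : Type*} [MeasurableSpace W] {m : Measure W}
    {κ : W → ℝ} (hκ : Integrable κ m) {g g' : ℝ → W → ℝ} {s : Set ℝ} (hs : s ∈ 𝓝 t)
    (hm : ∀ p ∈ s, AEStronglyMeasurable (g p) m) (hC : ∀ w, |g t w| ≤ C)
    (hm' : AEStronglyMeasurable (g' t) m)
    (hC' : ∀ p ∈ s, ∀ w, |g' p w| ≤ C')
    (hd : ∀ p ∈ s, ∀ w, HasDerivAt (fun p => g p w) (g' p w) p) :
    HasDerivAt (fun p => ∫ w, κ w * g p w ∂m) (∫ w, κ w * g' t w ∂m) t := by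
  refine (hasDerivAt_integral_of_dominated_loc_of_deriv_le (F := fun p w => κ w * g p w)
    (F' := fun p w => κ w * g' p w) (bound := fun w => |κ w| * C') hs ?_
    ?_ ?_ ?_ (hκ.abs.mul_const C') ?_).2
  · filter_upwards [hs] with q hq
    exact hκ.aestronglyMeasurable.mul (hm q hq)
  · exact avg_integrable hκ (hm t (mem_of_mem_nhds hs)) hC
  · exact hκ.aestronglyMeasurable.mul hm'
  · refine .of_forall fun w p hp => ?_
    simp only [norm_mul, norm_eq_abs]
    exact mul_le_mul_of_nonneg_left (hC' p hp w) (abs_nonneg _)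
  · exact .of_forall fun w p hp => (hd p hp w).const_mul _

/-! ### Directional derivatives -/

/-- `g` is the derivative of `f` in the direction `e`. -/
def DD (e : ℝ²) (f g : ℝ² → ℝ) : Prop :=
  ∀ x, HasDerivAt (fun s : ℝ => f (x + s • e)) (g x) 0

theorem DD.at (h : DD e f g) (x : ℝ²) (s : ℝ) :
    HasDerivAt (fun s : ℝ => f (x + s • e)) (g (x + s • e)) s := by
  have h1 := h (x + s • e)
  have h3 := HasDerivAt.comp_sub_const s s (f := fun r : ℝ => f (x + s • e + r • e)) (by simpa using h1)
  refine h3.congr_of_eventuallyEq (.of_forall fun r => ?_)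
  simp only [sub_smul]
  congr 1; abel

theorem DD.unique (h : DD e f g) (h' : DD e f g') : g = g' :=
  funext fun x => (h x).unique (h' x)

theorem DD.add (h : DD e f f') (h' : DD e g g') :
    DD e (fun x => f x + g x) (fun x => f' x + g' x) := fun x => (h x).add (h' x)

theorem DD.sub (h : DD e f f') (h' : DD e g g') :
    DD e (fun x => f x - g x) (fun x => f' x - g' x) := fun x => (h x).sub (h' x)

theorem DD.neg (h : DD e f f') :
    DD e (fun x => - f x) (fun x => - f' x) := fun x => (h x).neg

theorem DD.const_mul (c : ℝ) (h : DD e f f') :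
    DD e (fun x => c * f x) (fun x => c * f' x) := fun x => (h x).const_mul c

theorem DD.const (e : ℝ²) (c : ℝ) : DD e (fun _ => c) (fun _ => 0) :=
  fun _ => hasDerivAt_const _ _

theorem DD.mul (h : DD e f f') (h' : DD e g g') :
    DD e (fun x => f x * g x) (fun x => f' x * g x + f x * g' x) := fun x => by
  simpa using HasDerivAt.fun_mul (h x) (h' x)

theorem DD.comp_add (h : DD e f f') (a : ℝ²) :
    DD e (fun x => f (x + a)) (fun x => f' (x + a)) := fun x => by
  have := h (x + a)
  refine this.congr_of_eventuallyEq (.of_forall fun r => ?_)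
  simp only []
  congr 1; abel

theorem DD.fst (h : DD (1, 0) f f') (x : ℝ²) :
    HasDerivAt (fun y => f (y, x.2)) (f' x) x.1 := by
  have := h.at (0, x.2) x.1
  simpa using this

theorem DD.snd (h : DD (0, 1) f f') (x : ℝ²) :
    HasDerivAt (fun y => f (x.1, y)) (f' x) x.2 := by
  have := h.at (x.1, 0) x.2
  simpa using this

theorem DD.of_fst (h : ∀ x : ℝ², HasDerivAt (fun y => f (y, x.2)) (f' x) x.1) :
    DD (1, 0) f f' := fun x => by
  have := HasDerivAt.comp_const_add x.1 0 (f := fun y => f (y, x.2)) (by simpa using h x)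
  refine this.congr_of_eventuallyEq (.of_forall fun r => ?_)
  simp [Prod.add_def]

theorem DD.of_snd (h : ∀ x : ℝ², HasDerivAt (fun y => f (x.1, y)) (f' x) x.2) :
    DD (0, 1) f f' := fun x => by
  have := HasDerivAt.comp_const_add x.2 0 (f := fun y => f (x.1, y)) (by simpa using h x)
  refine this.congr_of_eventuallyEq (.of_forall fun r => ?_)
  simp [Prod.add_def]

theorem DD.pd1_eq (h : DD (1, 0) f f') : pd1 f = f' :=
  funext fun x => (h.fst x).deriv

theorem DD.pd2_eq (h : DD (0, 1) f f') : pd2 f = f' :=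
  funext fun x => (h.snd x).deriv

theorem DD.lip (h : DD e f g) (hC : ∀ x, |g x| ≤ C)
    (x : ℝ²) (s : ℝ) : |f (x + s • e) - f x| ≤ C * |s| := by
  have := Convex.norm_image_sub_le_of_norm_hasDerivWithin_le (f := fun s : ℝ => f (x + s • e))
    (f' := fun s => g (x + s • e)) (s := univ) (C := C) (x := 0) (y := s)
    (fun r _ => (h.at x r).hasDerivWithinAt) (fun r _ => hC _) convex_univ trivial trivial
  simpa using this

/-! ### Hermite functions -/

/-- Hermite function: `n`-th Hermite polynomial times the standard Gaussian density. -/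
def hef (n : ℕ) (z : ℝ) : ℝ :=
  Polynomial.aeval z (Polynomial.hermite n) * ((√(2 * π))⁻¹ * rexp (-z ^ 2 / 2))

theorem hef_hasDerivAt (n : ℕ) (z : ℝ) : HasDerivAt (hef n) (-hef (n + 1) z) z := by
  have h1 := (Polynomial.hermite n).hasDerivAt_aeval z
  have h2 : HasDerivAt (fun z : ℝ => (√(2 * π))⁻¹ * rexp (-z ^ 2 / 2))
      ((√(2 * π))⁻¹ * (rexp (-z ^ 2 / 2) * (-z))) z := by
    refine HasDerivAt.const_mul _ (HasDerivAt.exp ?_)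
    refine (((hasDerivAt_pow 2 z).fun_neg).div_const 2).congr_deriv ?_
    simp; ring
  refine (h1.fun_mul h2).congr_deriv ?_
  rw [hef, Polynomial.hermite_succ]
  simp only [map_sub, map_mul, Polynomial.aeval_X]
  ring

theorem hef_continuous (n : ℕ) : Continuous (hef n) :=
  continuous_iff_continuousAt.2 fun z => (hef_hasDerivAt n z).continuousAt

theorem poly_le_exp (p : Polynomial ℤ) :
    ∃ C, 0 ≤ C ∧ ∀ z : ℝ, |Polynomial.aeval z p| ≤ C * rexp (z ^ 2 / 4) := by
  induction p using Polynomial.induction_on' with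
  | add p q hp hq =>
    obtain ⟨C, hC0, hC⟩ := hp
    obtain ⟨D, hD0, hD⟩ := hq
    refine ⟨C + D, by positivity, fun z => ?_⟩
    rw [map_add, add_mul]
    exact (abs_add_le _ _).trans (add_le_add (hC z) (hD z))
  | monomial n a =>
    refine ⟨|(a : ℝ)| * (n.factorial * rexp 1), by positivity, fun z => ?_⟩
    rw [Polynomial.aeval_monomial, abs_mul, abs_pow, mul_assoc]
    simp only [algebraMap_int_eq, eq_intCast]
    refine mul_le_mul_of_nonneg_left ?_ (abs_nonneg _)
    have h1 := pow_div_factorial_le_exp |z| (abs_nonneg z) n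
    have h2 : rexp |z| ≤ rexp 1 * rexp (z ^ 2 / 4) := by
      rw [← exp_add, exp_le_exp]
      nlinarith [sq_nonneg (|z| - 2), sq_abs z]
    rw [div_le_iff₀ (by positivity)] at h1
    nlinarith

theorem hef_bound (n : ℕ) : ∃ C, 0 ≤ C ∧ ∀ z : ℝ, |hef n z| ≤ C * rexp (-z ^ 2 / 4) := by
  obtain ⟨C, hC0, hC⟩ := poly_le_exp (Polynomial.hermite n)
  refine ⟨C * (√(2 * π))⁻¹, by positivity, fun z => ?_⟩
  rw [hef, abs_mul, abs_of_pos (a := (√(2 * π))⁻¹ * rexp (-z ^ 2 / 2)) (by positivity)]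
  have := mul_le_mul_of_nonneg_right (hC z)
    (show 0 ≤ (√(2 * π))⁻¹ * rexp (-z ^ 2 / 2) by positivity)
  refine this.trans (le_of_eq ?_)
  have h : rexp (-z ^ 2 / 4) = rexp (z ^ 2 / 4) * rexp (-z ^ 2 / 2) := by
    rw [← exp_add]; congr 1; ring
  rw [h]; ring

theorem integrable_exp_neg_sq (c : ℝ) (hc : 0 < c) : Integrable fun z : ℝ => rexp (-z ^ 2 / c) := by
  have := integrable_exp_neg_mul_sq (b := c⁻¹) (by positivity)
  refine this.congr (.of_forall fun z => ?_)
  field_simp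

theorem hef_integrable (n : ℕ) : Integrable (hef n) := by
  obtain ⟨C, hC0, hC⟩ := hef_bound n
  refine ((integrable_exp_neg_sq 4 (by norm_num)).const_mul C).mono'
    (hef_continuous n).aestronglyMeasurable (.of_forall hC)

/-- Product of Hermite functions on the plane. -/
def hk (j k : ℕ) (z : ℝ²) : ℝ := hef j z.1 * hef k z.2

theorem hk_continuous (j k : ℕ) : Continuous (hk j k) :=
  ((hef_continuous j).comp continuous_fst).mul ((hef_continuous k).comp continuous_snd)

theorem hk_integrable (j k : ℕ) : Integrable (hk j k) :=
  (hef_integrable j).mul_prod (hef_integrable k)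

theorem hef_zero (z : ℝ) : hef 0 z = (√(2 * π))⁻¹ * rexp (-z ^ 2 / 2) := by simp [hef]

theorem hef_one (z : ℝ) : hef 1 z = z * hef 0 z := by simp [hef]

theorem hef_zero_eq_pdf (z : ℝ) : hef 0 z = ProbabilityTheory.gaussianPDFReal 0 1 z := by
  simp [hef_zero, ProbabilityTheory.gaussianPDFReal]

theorem hef_zero_nonneg (z : ℝ) : 0 ≤ hef 0 z := by rw [hef_zero]; positivity

theorem integral_hef_zero : ∫ z, hef 0 z = 1 := by
  simp_rw [hef_zero_eq_pdf]
  exact ProbabilityTheory.integral_gaussianPDFReal_eq_one 0 one_ne_zero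

theorem hk_zero_nonneg (z : ℝ²) : 0 ≤ hk 0 0 z := mul_nonneg (hef_zero_nonneg _) (hef_zero_nonneg _)

theorem integral_hk_zero : ∫ z, hk 0 0 z = 1 := by
  have := integral_prod_mul (μ := volume) (ν := volume) (hef 0) (hef 0)
  rw [integral_hef_zero, mul_one] at this
  exact this

/-- `L¹` norm of the kernel `hk j k`. -/
def hm (j k : ℕ) : ℝ := ∫ z, |hk j k z|

theorem hm_nonneg (j k : ℕ) : 0 ≤ hm j k := integral_nonneg fun _ => abs_nonneg _

theorem hm_zero : hm 0 0 = 1 := by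
  rw [hm, ← integral_hk_zero]
  exact integral_congr_ae (.of_forall fun z => abs_of_nonneg (hk_zero_nonneg z))

/-! ### Gaussian averages -/

/-- Average of `f` around `x` at scale `σ` against the kernel `hk j k`. -/
def GA (j k : ℕ) (σ : ℝ) (f : ℝ² → ℝ) (x : ℝ²) : ℝ := ∫ z, hk j k z * f (x + σ • z)

theorem GA_abs_le (j k : ℕ) (σ : ℝ) (hC : ∀ x, |f x| ≤ C) (x : ℝ²) :
    |GA j k σ f x| ≤ hm j k * C :=
  avg_abs_le (hk_integrable j k) fun _ => hC _

theorem GA_integrand (j k : ℕ) (σ : ℝ) (hf : Continuous f)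
    (hC : ∀ x, |f x| ≤ C) (x : ℝ²) : Integrable fun z => hk j k z * f (x + σ • z) :=
  avg_integrable (hk_integrable j k)
    (by fun_prop : Continuous fun z : ℝ² => f (x + σ • z)).aestronglyMeasurable fun _ => hC _

theorem GA_continuous (j k : ℕ) (hf : Continuous f)
    (hC : ∀ x, |f x| ≤ C) : Continuous fun p : ℝ × ℝ² => GA j k p.1 f p.2 := by
  rw [← continuousOn_univ]
  exact avg_continuousOn (hk_integrable j k)
    (g := fun (p : ℝ × ℝ²) z => f (p.2 + p.1 • z))
    (fun p _ => (by fun_prop : Continuous fun z : ℝ² => f (p.2 + p.1 • z)).aestronglyMeasurable)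
    (fun p _ w => hC _)
    fun w => (by fun_prop : Continuous fun p : ℝ × ℝ² => f (p.2 + p.1 • w)).continuousOn

theorem GA_DD (j k : ℕ) (σ : ℝ) (h : DD e f g) (hf : Continuous f)
    (hg : Continuous g) (hC : ∀ x, |f x| ≤ C) (hC' : ∀ x, |g x| ≤ C') :
    DD e (GA j k σ f) (GA j k σ g) := fun x => by
  have := avg_hasDerivAt (hk_integrable j k) (g := fun (s : ℝ) z => f (x + s • e + σ • z))
    (g' := fun s z => g (x + s • e + σ • z)) (s := univ) (t := 0) univ_mem (C := C) (C' := C')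
    (fun p _ => (by fun_prop : Continuous fun z : ℝ² => _).aestronglyMeasurable)
    (fun _ => hC _) (by fun_prop : Continuous fun z : ℝ² => _).aestronglyMeasurable
    (fun _ _ _ => hC' _) (fun s _ z => by
      have := h.at (x + σ • z) s
      simpa only [add_right_comm x] using this)
  simpa [GA] using this

theorem hef_shift_bound (n : ℕ) (s0 : ℝ) :
    ∃ C, ∀ s ∈ Metric.ball s0 1, ∀ z, |hef n (z - s)| ≤ C * rexp (-z ^ 2 / 8) := by
  obtain ⟨C, hC0, hC⟩ := hef_bound n
  refine ⟨C * rexp ((|s0| + 1) ^ 2 / 4), fun s hs z => (hC _).trans ?_⟩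
  rw [mul_assoc, ← exp_add]
  refine mul_le_mul_of_nonneg_left (exp_le_exp.2 ?_) hC0
  rw [Metric.mem_ball, Real.dist_eq] at hs
  have h1 : |s| ≤ |s0| + 1 := by
    have := abs_sub_abs_le_abs_sub s s0
    linarith
  have h2 : s ^ 2 ≤ (|s0| + 1) ^ 2 := sq_le_sq' (by linarith [neg_abs_le s]) ((le_abs_self s).trans h1)
  nlinarith [sq_nonneg (z - 2 * s)]

theorem GA_eq_comp (j k : ℕ) (hσ : σ ≠ 0) (f : ℝ² → ℝ) (x a : ℝ²) :
    GA j k σ f (x + a) = ∫ z, hk j k (z - σ⁻¹ • a) * f (x + σ • z) := by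
  rw [GA, ← integral_sub_right_eq_self _ (σ⁻¹ • a)]
  congr 1; ext z; congr 2
  rw [smul_sub, smul_smul, mul_inv_cancel₀ hσ, one_smul]; abel

theorem GA_DD1 (j k : ℕ) (hσ : σ ≠ 0) (hf : Continuous f)
    (hC : ∀ x, |f x| ≤ C) : DD (1, 0) (GA j k σ f) (fun x => σ⁻¹ * GA (j + 1) k σ f x) := fun x => by
  obtain ⟨D, hD⟩ := hef_shift_bound (j + 1) 0
  have key := (hasDerivAt_integral_of_dominated_loc_of_deriv_le (μ := (volume : Measure ℝ²))
    (F := fun s z => hk j k (z - s • ((1:ℝ), (0:ℝ))) * f (x + σ • z))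
    (F' := fun s z => hk (j + 1) k (z - s • ((1:ℝ), (0:ℝ))) * f (x + σ • z))
    (x₀ := (0:ℝ)) (s := Metric.ball (0:ℝ) 1)
    (bound := fun z => (D * rexp (-z.1 ^ 2 / 8) * |hef k z.2|) * C)
    (Metric.ball_mem_nhds _ one_pos) (.of_forall fun s => ?_) ?_ ?_ ?_ ?_ ?_).2
  · have h2 : HasDerivAt (fun r : ℝ => σ⁻¹ * r) σ⁻¹ 0 := by
      simpa using (hasDerivAt_id (0:ℝ)).const_mul σ⁻¹
    rw [← mul_zero σ⁻¹] at key
    have h3 := HasDerivAt.scomp (0 : ℝ) key h2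
    simp only [smul_eq_mul, zero_smul, sub_zero, mul_zero] at h3
    refine h3.congr_of_eventuallyEq (.of_forall fun r => ?_)
    simp only [Function.comp, GA_eq_comp j k hσ, smul_smul]
  · have := hk_continuous j k
    exact (by fun_prop : Continuous fun z : ℝ² => _).aestronglyMeasurable
  · simpa using GA_integrand j k σ hf hC x
  · have := hk_continuous (j + 1) k
    exact (by fun_prop : Continuous fun z : ℝ² => _).aestronglyMeasurable
  · refine .of_forall fun z s hs => ?_
    rw [norm_mul, norm_eq_abs, norm_eq_abs]
    refine mul_le_mul ?_ (hC _) (abs_nonneg _) (mul_nonneg ((abs_nonneg _).trans (hD s hs _)) (abs_nonneg _))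
    · simp only [hk, Prod.fst_sub, Prod.snd_sub, Prod.smul_mk, smul_eq_mul, mul_one, mul_zero,
        sub_zero, abs_mul]
      exact mul_le_mul_of_nonneg_right (hD s hs _) (abs_nonneg _)
  · exact (((integrable_exp_neg_sq 8 (by norm_num)).const_mul D).mul_prod
      (hef_integrable k).abs).mul_const C
  · refine .of_forall fun z s _ => HasDerivAt.mul_const ?_ _
    simp only [hk, Prod.fst_sub, Prod.snd_sub, Prod.smul_mk, smul_eq_mul, mul_one, mul_zero,
        sub_zero]
    refine HasDerivAt.mul_const ?_ _
    have := HasDerivAt.comp_const_sub z.1 s (hef_hasDerivAt j (z.1 - s))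
    simpa using this

theorem GA_swap (j k : ℕ) (σ : ℝ) (f : ℝ² → ℝ) (x : ℝ²) :
    GA j k σ f x = GA k j σ (fun y => f y.swap) x.swap := by
  have h := (MeasureTheory.Measure.measurePreserving_swap (μ := (volume : Measure ℝ))
    (ν := (volume : Measure ℝ))).integral_comp (MeasurableEquiv.prodComm.measurableEmbedding)
    (fun z => hk k j z * f (x.swap + σ • z).swap)
  rw [← Measure.volume_eq_prod] at h
  rw [GA, GA, ← h]
  refine integral_congr_ae (.of_forall fun z => ?_)
  simp [hk, mul_comm]

theorem GA_DD2 (j k : ℕ) (hσ : σ ≠ 0) (hf : Continuous f)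
    (hC : ∀ x, |f x| ≤ C) : DD (0, 1) (GA j k σ f) (fun x => σ⁻¹ * GA j (k + 1) σ f x) := fun x => by
  have := GA_DD1 k j hσ (f := fun y => f y.swap) (by fun_prop) (fun y => hC _) x.swap
  simp only [GA_swap j k, GA_swap j (k + 1)]
  refine this.congr_of_eventuallyEq (.of_forall fun r => ?_)
  simp [Prod.swap]

/-! ### The heat semigroup -/

theorem gaussian_average_eq (σ : ℝ) (g : ℝ → ℝ) (hg : Continuous g) :
    ∫ z, hef 0 z * g (σ * z) = ∫ z, g z ∂(gaussianReal 0 (.mk (σ ^ 2) (sq_nonneg _))) := by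
  have h := gaussianReal_map_const_mul (μ := 0) (v := 1) σ
  rw [mul_zero, mul_one] at h
  rw [← h, integral_map (by fun_prop) hg.aestronglyMeasurable,
    integral_gaussianReal_eq_integral_smul one_ne_zero]
  simp only [hef_zero_eq_pdf, smul_eq_mul]

theorem gaussian_average_comp (a b c : ℝ) (h : a ^ 2 + b ^ 2 = c ^ 2) (g : ℝ → ℝ)
    (hg : Continuous g) (hC : ∀ x, |g x| ≤ C) :
    ∫ z, hef 0 z * ∫ w, hef 0 w * g (a * z + b * w) = ∫ z, hef 0 z * g (c * z) := by
  have h1 : ∀ y, ∫ w, hef 0 w * g (y + b * w) =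
      ∫ w, g (y + w) ∂(gaussianReal 0 (.mk (b ^ 2) (sq_nonneg _))) := fun y =>
    gaussian_average_eq b (fun w => g (y + w)) (by fun_prop)
  have h2 : Continuous fun y => ∫ w, hef 0 w * g (y + b * w) := by
    rw [← continuousOn_univ]
    exact avg_continuousOn (hef_integrable 0) (g := fun y w => g (y + b * w))
      (fun p _ => (by fun_prop : Continuous fun w : ℝ => g (p + b * w)).aestronglyMeasurable)
      (fun _ _ _ => hC _)
      fun w => (by fun_prop : Continuous fun p : ℝ => g (p + b * w)).continuousOn
  rw [gaussian_average_eq a (fun y => ∫ w, hef 0 w * g (y + b * w)) h2, gaussian_average_eq c g hg]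
  simp only [h1]
  rw [← integral_conv, gaussianReal_conv_gaussianReal]
  · congr 2
    · simp
    · exact NNReal.eq h
  · exact Integrable.of_bound (C := C) hg.aestronglyMeasurable (.of_forall hC)

/-- One-dimensional Gaussian average in the first variable. -/
def P1 (σ : ℝ) (f : ℝ² → ℝ) (x : ℝ²) : ℝ := ∫ z, hef 0 z * f (x.1 + σ * z, x.2)

/-- One-dimensional Gaussian average in the second variable. -/
def P2 (σ : ℝ) (f : ℝ² → ℝ) (x : ℝ²) : ℝ := ∫ z, hef 0 z * f (x.1, x.2 + σ * z)

theorem P1_continuous (σ : ℝ) (hf : Continuous f) (hC : ∀ x, |f x| ≤ C) : Continuous (P1 σ f) := by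
  rw [← continuousOn_univ]
  exact avg_continuousOn (hef_integrable 0) (g := fun (x : ℝ²) z => f (x.1 + σ * z, x.2))
    (fun p _ => (by fun_prop : Continuous fun z : ℝ => f (p.1 + σ * z, p.2)).aestronglyMeasurable)
    (fun _ _ _ => hC _)
    fun z => (by fun_prop : Continuous fun p : ℝ² => f (p.1 + σ * z, p.2)).continuousOn

theorem P2_continuous (σ : ℝ) (hf : Continuous f) (hC : ∀ x, |f x| ≤ C) : Continuous (P2 σ f) := by
  rw [← continuousOn_univ]
  exact avg_continuousOn (hef_integrable 0) (g := fun (x : ℝ²) z => f (x.1, x.2 + σ * z))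
    (fun p _ => (by fun_prop : Continuous fun z : ℝ => f (p.1, p.2 + σ * z)).aestronglyMeasurable)
    (fun _ _ _ => hC _)
    fun z => (by fun_prop : Continuous fun p : ℝ² => f (p.1, p.2 + σ * z)).continuousOn

theorem hef_average_le {g : ℝ → ℝ} (hC : ∀ x, |g x| ≤ C) : |∫ z, hef 0 z * g z| ≤ C := by
  have := avg_abs_le (hef_integrable 0) (g := g) hC
  have h2 : ∫ z, |hef 0 z| = 1 := by
    rw [← integral_hef_zero]
    exact integral_congr_ae (.of_forall fun z => abs_of_nonneg (hef_zero_nonneg z))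
  rwa [h2, one_mul] at this

theorem GA_eq_P1_P2 (σ : ℝ) (hf : Continuous f) (hC : ∀ x, |f x| ≤ C) :
    GA 0 0 σ f = P1 σ (P2 σ f) := by
  ext x
  rw [GA, Measure.volume_eq_prod, integral_prod _ (GA_integrand 0 0 σ hf hC x), P1]
  refine integral_congr_ae (.of_forall fun z => ?_)
  simp only [P2, hk, mul_assoc, integral_const_mul, Prod.smul_mk, smul_eq_mul,
    Prod.add_def]

theorem P2_P1_comm (σ τ : ℝ) (hf : Continuous f) (hC : ∀ x, |f x| ≤ C) :
    P2 τ (P1 σ f) = P1 σ (P2 τ f) := by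
  ext x
  simp only [P1, P2, ← integral_const_mul]
  rw [integral_integral_swap]
  · refine integral_congr_ae (.of_forall fun z => ?_)
    refine integral_congr_ae (.of_forall fun w => ?_)
    simp only []; ring
  · have := avg_integrable (hk_integrable 0 0)
      (g := fun z => f (x.1 + σ * z.2, x.2 + τ * z.1)) (by fun_prop : Continuous _).aestronglyMeasurable
      (fun _ => hC _)
    refine this.congr (.of_forall fun z => ?_)
    simp only [hk, Function.uncurry]; ring

theorem P1_P1 (a b c : ℝ) (h : a ^ 2 + b ^ 2 = c ^ 2) (hf : Continuous f)
    (hC : ∀ x, |f x| ≤ C) : P1 a (P1 b f) = P1 c f := by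
  ext x
  have := gaussian_average_comp a b c h (fun y => f (x.1 + y, x.2)) (by fun_prop) (fun _ => hC _)
  simpa only [P1, add_assoc] using this

theorem P2_P2 (a b c : ℝ) (h : a ^ 2 + b ^ 2 = c ^ 2) (hf : Continuous f)
    (hC : ∀ x, |f x| ≤ C) : P2 a (P2 b f) = P2 c f := by
  ext x
  have := gaussian_average_comp a b c h (fun y => f (x.1, x.2 + y)) (by fun_prop) (fun _ => hC _)
  simpa only [P2, add_assoc] using this

theorem GA_GA (a b c : ℝ) (h : a ^ 2 + b ^ 2 = c ^ 2) (hf : Continuous f)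
    (hC : ∀ x, |f x| ≤ C) : GA 0 0 a (GA 0 0 b f) = GA 0 0 c f := by
  have hc2 := P2_continuous b hf hC
  have hC2 : ∀ x, |P2 b f x| ≤ C := fun x => hef_average_le fun _ => hC _
  have hc1 := P1_continuous b hc2 hC2
  have hC1 : ∀ x, |P1 b (P2 b f) x| ≤ C := fun x => hef_average_le fun _ => hC2 _
  have hc3 := P2_continuous a hc2 hC2
  have hC3 : ∀ x, |P2 a (P2 b f) x| ≤ C := fun x => hef_average_le fun _ => hC2 _
  rw [GA_eq_P1_P2 b hf hC, GA_eq_P1_P2 a hc1 hC1, P2_P1_comm b a hc2 hC2, P1_P1 a b c h hc3 hC3,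
    P2_P2 a b c h hf hC, GA_eq_P1_P2 c hf hC]

/-- Derivatives `∂₁ʲ∂₂ᵏ` of the heat semigroup. -/
def HE (j k : ℕ) (q : ℝ) (f : ℝ² → ℝ) (x : ℝ²) : ℝ :=
  (√(2 * q))⁻¹ ^ (j + k) * GA j k √(2 * q) f x

/-- The heat semigroup. -/
abbrev HS (q : ℝ) (f : ℝ² → ℝ) : ℝ² → ℝ := HE 0 0 q f

theorem HS_eq (q : ℝ) (f : ℝ² → ℝ) : HS q f = GA 0 0 √(2 * q) f := by
  ext x; simp [HE]

theorem HS_zero (f : ℝ² → ℝ) : HS 0 f = f := by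
  ext x
  simp [HE, GA, integral_mul_const, integral_hk_zero]

theorem HE_abs_le (j k : ℕ) (q : ℝ) (hC : ∀ x, |f x| ≤ C) (x : ℝ²) :
    |HE j k q f x| ≤ (√(2 * q))⁻¹ ^ (j + k) * (hm j k * C) := by
  rw [HE, abs_mul, abs_of_nonneg (a := _ ^ _) (by positivity)]
  exact mul_le_mul_of_nonneg_left (GA_abs_le j k _ hC x) (by positivity)

theorem HS_abs_le (q : ℝ) (hC : ∀ x, |f x| ≤ C) (x : ℝ²) :
    |HS q f x| ≤ C := by
  simpa [hm_zero] using HE_abs_le 0 0 q hC x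

theorem HE_cont (j k : ℕ) (q : ℝ) (hf : Continuous f)
    (hC : ∀ x, |f x| ≤ C) : Continuous (HE j k q f) :=
  continuous_const.mul ((GA_continuous j k hf hC).comp (by fun_prop : Continuous fun x : ℝ² =>
    (√(2 * q), x)))

theorem HS_continuous (hf : Continuous f)
    (hC : ∀ x, |f x| ≤ C) : Continuous fun p : ℝ × ℝ² => HS p.1 f p.2 := by
  simp only [HE, add_zero, pow_zero, one_mul]
  exact ((GA_continuous 0 0 hf hC).comp (by fun_prop : Continuous fun p : ℝ × ℝ² =>
      (√(2 * p.1), p.2)))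

theorem HE_DD1 (j k : ℕ) (hq : 0 < q) (hf : Continuous f)
    (hC : ∀ x, |f x| ≤ C) : DD (1, 0) (HE j k q f) (HE (j + 1) k q f) := by
  have := (GA_DD1 j k (σ := √(2 * q)) (by positivity) hf hC).const_mul ((√(2 * q))⁻¹ ^ (j + k))
  refine (fun x => (this x).congr_deriv ?_)
  simp only [HE]; ring

theorem HE_DD2 (j k : ℕ) (hq : 0 < q) (hf : Continuous f)
    (hC : ∀ x, |f x| ≤ C) : DD (0, 1) (HE j k q f) (HE j (k + 1) q f) := by
  have := (GA_DD2 j k (σ := √(2 * q)) (by positivity) hf hC).const_mul ((√(2 * q))⁻¹ ^ (j + k))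
  refine (fun x => (this x).congr_deriv ?_)
  simp only [HE]; ring

theorem HE_DD (j k : ℕ) (q : ℝ) (h : DD e f g) (hf : Continuous f)
    (hg : Continuous g) (hC : ∀ x, |f x| ≤ C) (hC' : ∀ x, |g x| ≤ C') :
    DD e (HE j k q f) (HE j k q g) :=
  (GA_DD j k _ h hf hg hC hC').const_mul _

theorem HE_succ_left (j k : ℕ) (hq : 0 < q) (h : DD (1, 0) f g)
    (hf : Continuous f) (hg : Continuous g) (hC : ∀ x, |f x| ≤ C)
    (hC' : ∀ x, |g x| ≤ C') : HE (j + 1) k q f = HE j k q g :=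
  (HE_DD1 j k hq hf hC).unique (HE_DD j k q h hf hg hC hC')

theorem HE_succ_right (j k : ℕ) (hq : 0 < q) (h : DD (0, 1) f g)
    (hf : Continuous f) (hg : Continuous g) (hC : ∀ x, |f x| ≤ C)
    (hC' : ∀ x, |g x| ≤ C') : HE j (k + 1) q f = HE j k q g :=
  (HE_DD2 j k hq hf hC).unique (HE_DD j k q h hf hg hC hC')

theorem HS_HS (ha : 0 ≤ a) (hb : 0 ≤ b) (hf : Continuous f)
    (hC : ∀ x, |f x| ≤ C) : HS a (HS b f) = HS (a + b) f := by
  simp only [HS_eq]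
  refine GA_GA _ _ _ ?_ hf hC
  rw [sq_sqrt (by positivity), sq_sqrt (by positivity), sq_sqrt (by positivity)]; ring

theorem HS_HE (j k : ℕ) (ha : 0 ≤ a) (hb : 0 < b) (hf : Continuous f)
    (hC : ∀ x, |f x| ≤ C) : HS a (HE j k b f) = HE j k (a + b) f := by
  have hab : 0 < a + b := by positivity
  induction j with
  | zero =>
    induction k with
    | zero => exact HS_HS ha hb.le hf hC
    | succ k ih =>
      have h1 := HE_DD 0 0 a (HE_DD2 0 k hb hf hC) (HE_cont 0 k b hf hC) (HE_cont 0 (k + 1) b hf hC)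
        (HE_abs_le 0 k b hC) (HE_abs_le 0 (k + 1) b hC)
      have h2 := HE_DD2 0 k hab hf hC
      rw [← ih] at h2
      exact h1.unique h2
  | succ j ih =>
    have h1 := HE_DD 0 0 a (HE_DD1 j k hb hf hC) (HE_cont j k b hf hC) (HE_cont (j + 1) k b hf hC)
      (HE_abs_le j k b hC) (HE_abs_le (j + 1) k b hC)
    have h2 := HE_DD1 j k hab hf hC
    rw [← ih] at h2
    exact h1.unique h2

/-! ### The heat equation -/

theorem DD.hasFDerivAt (h1 : DD (1, 0) f f1) (h2 : DD (0, 1) f f2)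
    (c1 : Continuous f1) (c2 : Continuous f2) (x : ℝ²) :
    HasFDerivAt f ((ContinuousLinearMap.toSpanSingleton ℝ (f1 x)).coprod
      (ContinuousLinearMap.toSpanSingleton ℝ (f2 x))) x := by
  have := hasStrictFDerivAt_uncurry_coprod (𝕜 := ℝ) (u := x) (f := fun a b => f (a, b))
    (f₁ := fun a b => ContinuousLinearMap.toSpanSingleton ℝ (f1 (a, b)))
    (f₂ := fun a b => ContinuousLinearMap.toSpanSingleton ℝ (f2 (a, b)))
    (.of_forall fun v => (h1.fst v).hasFDerivAt)
    (.of_forall fun v => (h2.snd v).hasFDerivAt)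
    ((ContinuousLinearMap.toSpanSingletonCLE (𝕜 := ℝ) (E := ℝ)).continuous.comp c1).continuousAt
    ((ContinuousLinearMap.toSpanSingletonCLE (𝕜 := ℝ) (E := ℝ)).continuous.comp c2).continuousAt
  exact this.hasFDerivAt

theorem hk_one_zero (z : ℝ²) : hk 1 0 z = z.1 * hk 0 0 z := by rw [hk, hk, hef_one]; ring

theorem hk_zero_one (z : ℝ²) : hk 0 1 z = z.2 * hk 0 0 z := by rw [hk, hk, hef_one]; ring

theorem GA_hasDerivAt_scale (h1 : DD (1, 0) f f1) (h2 : DD (0, 1) f f2)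
    (c : Continuous f) (c1 : Continuous f1) (c2 : Continuous f2)
    (b : ∀ x, |f x| ≤ C) (b1 : ∀ x, |f1 x| ≤ C) (b2 : ∀ x, |f2 x| ≤ C) (σ : ℝ) (x : ℝ²) :
    HasDerivAt (fun σ => GA 0 0 σ f x) (GA 1 0 σ f1 x + GA 0 1 σ f2 x) σ := by
  have e : GA 1 0 σ f1 x + GA 0 1 σ f2 x =
      ∫ z, (hk 1 0 z * f1 (x + σ • z) + hk 0 1 z * f2 (x + σ • z)) :=
    (integral_add (GA_integrand 1 0 σ c1 b1 x) (GA_integrand 0 1 σ c2 b2 x)).symm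
  rw [e]
  refine (hasDerivAt_integral_of_dominated_loc_of_deriv_le (μ := (volume : Measure ℝ²))
    (F := fun σ z => hk 0 0 z * f (x + σ • z))
    (F' := fun σ z => hk 1 0 z * f1 (x + σ • z) + hk 0 1 z * f2 (x + σ • z))
    (s := univ) (bound := fun z => |hk 1 0 z| * C + |hk 0 1 z| * C) univ_mem ?_
    (GA_integrand 0 0 σ c b x) ?_ ?_ ?_ ?_).2
  · exact .of_forall fun s => (GA_integrand 0 0 s c b x).aestronglyMeasurable
  · exact ((GA_integrand 1 0 σ c1 b1 x).add (GA_integrand 0 1 σ c2 b2 x)).aestronglyMeasurable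
  · refine .of_forall fun z s _ => (norm_add_le _ _).trans ?_
    rw [norm_mul, norm_mul]
    exact add_le_add (mul_le_mul_of_nonneg_left (b1 _) (norm_nonneg _))
      (mul_le_mul_of_nonneg_left (b2 _) (norm_nonneg _))
  · exact ((hk_integrable 1 0).abs.mul_const C).add ((hk_integrable 0 1).abs.mul_const C)
  · refine .of_forall fun z s _ => ?_
    have h3 : HasDerivAt (fun s : ℝ => x + s • z) z s := by
      simpa using ((hasDerivAt_id s).smul_const z).const_add x
    have h4 := ((h1.hasFDerivAt h2 c1 c2 (x + s • z)).comp_hasDerivAt s h3).const_mul (hk 0 0 z)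
    refine h4.congr_deriv ?_
    simp [hk_one_zero, hk_zero_one]
    ring

theorem GA_one_zero (h : DD (1, 0) f g) (hf : Continuous f)
    (hg : Continuous g) (hC : ∀ x, |f x| ≤ C) (hC' : ∀ x, |g x| ≤ C')
    (hσ : σ ≠ 0) (x : ℝ²) : GA 1 0 σ f x = σ * GA 0 0 σ g x := by
  rw [← congrFun ((GA_DD1 0 0 hσ hf hC).unique (GA_DD 0 0 σ h hf hg hC hC')) x]
  field_simp

theorem GA_zero_one (h : DD (0, 1) f g) (hf : Continuous f)
    (hg : Continuous g) (hC : ∀ x, |f x| ≤ C) (hC' : ∀ x, |g x| ≤ C')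
    (hσ : σ ≠ 0) (x : ℝ²) : GA 0 1 σ f x = σ * GA 0 0 σ g x := by
  rw [← congrFun ((GA_DD2 0 0 hσ hf hC).unique (GA_DD 0 0 σ h hf hg hC hC')) x]
  field_simp

theorem HE_add (j k : ℕ) (q : ℝ) (hf : Continuous f) (hg : Continuous g)
    (hC : ∀ x, |f x| ≤ C) (hC' : ∀ x, |g x| ≤ C') (x : ℝ²) :
    HE j k q (fun y => f y + g y) x = HE j k q f x + HE j k q g x := by
  simp only [HE, GA, ← mul_add]
  rw [← integral_add (GA_integrand j k _ hf hC x) (GA_integrand j k _ hg hC' x)]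
  simp only [mul_add]

theorem HE_const_mul (j k : ℕ) (q c : ℝ) (f : ℝ² → ℝ) (x : ℝ²) :
    HE j k q (fun y => c * f y) x = c * HE j k q f x := by
  simp only [HE, GA]
  rw [mul_left_comm c, ← integral_const_mul c]
  congr 2; ext z; ring

theorem HE_neg (j k : ℕ) (q : ℝ) (f : ℝ² → ℝ) (x : ℝ²) :
    HE j k q (fun y => - f y) x = - HE j k q f x := by
  simpa using HE_const_mul j k q (-1) f x

theorem HE_sub (j k : ℕ) (q : ℝ) (hf : Continuous f) (hg : Continuous g)
    (hC : ∀ x, |f x| ≤ C) (hC' : ∀ x, |g x| ≤ C') (x : ℝ²) :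
    HE j k q (fun y => f y - g y) x = HE j k q f x - HE j k q g x := by
  have := HE_add j k q hf (g := fun y => - g y) hg.neg hC (fun x => by simpa using hC' x) x
  rw [HE_neg] at this
  simpa only [sub_eq_add_neg] using this

theorem HE_shift (j k : ℕ) (q : ℝ) (f : ℝ² → ℝ) (a x : ℝ²) :
    HE j k q (fun y => f (y + a)) x = HE j k q f (x + a) := by
  simp only [HE, GA, add_right_comm x a]

theorem HS_hasDerivAt {f11 f22 : ℝ² → ℝ} (h1 : DD (1, 0) f f1) (h2 : DD (0, 1) f f2)
    (h11 : DD (1, 0) f1 f11) (h22 : DD (0, 1) f2 f22) (c : Continuous f) (c1 : Continuous f1)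
    (c2 : Continuous f2) (c11 : Continuous f11) (c22 : Continuous f22)
    (b : ∀ x, |f x| ≤ C) (b1 : ∀ x, |f1 x| ≤ C) (b2 : ∀ x, |f2 x| ≤ C) (b11 : ∀ x, |f11 x| ≤ C)
    (b22 : ∀ x, |f22 x| ≤ C) (hq : 0 < q) (x : ℝ²) :
    HasDerivAt (fun q => HS q f x) (HS q (fun y => f11 y + f22 y) x) q := by
  have hs : √(2 * q) ≠ 0 := by positivity
  have h := GA_hasDerivAt_scale h1 h2 c c1 c2 b b1 b2 √(2 * q) x
  rw [GA_one_zero h11 c1 c11 b1 b11 hs, GA_zero_one h22 c2 c22 b2 b22 hs] at h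
  have h3 : HasDerivAt (fun q : ℝ => √(2 * q)) (√(2 * q))⁻¹ q := by
    have := (((hasDerivAt_id q).const_mul 2).sqrt (by simpa using hq.ne'))
    refine this.congr_deriv ?_
    simp only [id]; field_simp
  have h4 := h.comp q h3
  rw [HS, HE_add 0 0 q c11 c22 b11 b22]
  simp only [HE, add_zero, pow_zero, one_mul]
  refine h4.congr_deriv ?_
  field_simp

/-! ### Bounded continuous functions, with explicit bounds -/

/-- `f` is continuous and bounded by `C`. -/
structure BC (C : ℝ) (f : ℝ² → ℝ) : Prop where
  cont : Continuous f
  bd : ∀ x, |f x| ≤ C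

/-- The time dependent function `F` is jointly continuous and bounded by `C`. -/
structure TB (C : ℝ) (F : ℝ → ℝ² → ℝ) : Prop where
  cont : Continuous fun p : ℝ × ℝ² => F p.1 p.2
  bd : ∀ t x, |F t x| ≤ C

theorem BC.nonneg (h : BC C f) : 0 ≤ C := (abs_nonneg _).trans (h.bd 0)

theorem TB.nonneg (h : TB C F) : 0 ≤ C :=
  (abs_nonneg _).trans (h.bd 0 0)

theorem TB.slice (h : TB C F) (t : ℝ) : BC C (F t) :=
  ⟨h.cont.comp (by fun_prop : Continuous fun x : ℝ² => (t, x)), h.bd t⟩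

theorem TB.comp_time (h : TB C F) {φ : ℝ → ℝ} (hφ : Continuous φ) :
    TB C (fun t => F (φ t)) :=
  ⟨h.cont.comp (by fun_prop : Continuous fun p : ℝ × ℝ² => (φ p.1, p.2)), fun _ => h.bd _⟩

theorem TB.shift (h : TB C F) (a : ℝ²) :
    TB C (fun t x => F t (x + a)) :=
  ⟨h.cont.comp (by fun_prop : Continuous fun p : ℝ × ℝ² => (p.1, p.2 + a)), fun _ _ => h.bd _ _⟩

theorem TB.sub (h : TB C F) (h' : TB C' G) :
    TB (C + C') (fun t x => F t x - G t x) :=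
  ⟨h.cont.sub h'.cont, fun t x => (abs_sub _ _).trans (add_le_add (h.bd t x) (h'.bd t x))⟩

theorem TB.mul (h : TB C F) (h' : TB C' G) :
    TB (C * C') (fun t x => F t x * G t x) :=
  ⟨h.cont.mul h'.cont, fun t x => by
    rw [abs_mul]; exact mul_le_mul (h.bd t x) (h'.bd t x) (abs_nonneg _) h.nonneg⟩

theorem TB.congr_bd (h : TB C F) (h' : ∀ t x, |F t x| ≤ C') :
    TB C' F := ⟨h.cont, h'⟩

/-! ### Integrals of the third derivatives of the heat semigroup -/

theorem GA_contOn {P : Type*} [TopologicalSpace P] [FirstCountableTopology P] (j k : ℕ) {s : Set P}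
    {σ : P → ℝ} {F : P → ℝ² → ℝ} {x : P → ℝ²} (hσ : ContinuousOn σ s)
    (hF : ContinuousOn (fun p : P × ℝ² => F p.1 p.2) (s ×ˢ univ)) (hx : ContinuousOn x s)
    (hC : ∀ p ∈ s, ∀ x, |F p x| ≤ C) : ContinuousOn (fun p => GA j k (σ p) (F p) (x p)) s := by
  refine avg_continuousOn (hk_integrable j k) (g := fun p z => F p (x p + σ p • z)) ?_
    (fun p hp _ => hC p hp _) ?_
  · intro p hp
    have : Continuous (F p) := by
      rw [← continuousOn_univ]
      exact hF.comp (f := fun y => (p, y)) (by fun_prop) (fun y _ => ⟨hp, trivial⟩)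
    exact (by fun_prop : Continuous fun z : ℝ² => F p (x p + σ p • z)).aestronglyMeasurable
  · intro z
    exact hF.comp (f := fun p => (p, x p + σ p • z))
      (continuousOn_id.prodMk (hx.add (hσ.smul continuousOn_const))) (fun p hp => ⟨hp, trivial⟩)

theorem HE_contOn {P : Type*} [TopologicalSpace P] [FirstCountableTopology P] (j k : ℕ) {s : Set P}
    {q : P → ℝ} {F : P → ℝ² → ℝ} {x : P → ℝ²} (hq : ContinuousOn q s)
    (hq0 : ∀ p ∈ s, 0 < q p)
    (hF : ContinuousOn (fun p : P × ℝ² => F p.1 p.2) (s ×ˢ univ)) (hx : ContinuousOn x s)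
    (hC : ∀ p ∈ s, ∀ x, |F p x| ≤ C) : ContinuousOn (fun p => HE j k (q p) (F p) (x p)) s := by
  have h : ContinuousOn (fun p => √(2 * q p)) s := by fun_prop
  refine ContinuousOn.mul (ContinuousOn.pow (h.inv₀ fun p hp => ?_) _) (GA_contOn j k h hF hx hC)
  have := hq0 p hp
  positivity

theorem HS_contOn {P : Type*} [TopologicalSpace P] [FirstCountableTopology P] {s : Set P}
    {q : P → ℝ} {F : P → ℝ² → ℝ} {x : P → ℝ²} (hq : ContinuousOn q s)
    (hF : ContinuousOn (fun p : P × ℝ² => F p.1 p.2) (s ×ˢ univ)) (hx : ContinuousOn x s)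
    (hC : ∀ p ∈ s, ∀ x, |F p x| ≤ C) : ContinuousOn (fun p => HS (q p) (F p) (x p)) s := by
  have h : ContinuousOn (fun p => √(2 * q p)) s := by fun_prop
  simp only [HS_eq]
  exact GA_contOn 0 0 h hF hx hC

theorem hasDerivAt_inv_sqrt (hq : 0 < q) :
    HasDerivAt (fun q : ℝ => -(√(2 * q))⁻¹) ((√(2 * q))⁻¹ ^ 3) q := by
  have hs : √(2 * q) ≠ 0 := by positivity
  have := ((((hasDerivAt_id q).const_mul 2).sqrt (by simpa using hq.ne')).fun_inv
    (by simpa using hs)).fun_neg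
  refine this.congr_deriv ?_
  simp only [id]; field_simp

theorem tendsto_inv_sqrt : Tendsto (fun q : ℝ => -(√(2 * q))⁻¹) atTop (𝓝 0) := by
  rw [← neg_zero]
  refine Tendsto.neg (tendsto_inv_atTop_zero.comp (tendsto_sqrt_atTop.comp ?_))
  exact Tendsto.const_mul_atTop two_pos tendsto_id

theorem weight_integrable (hτ : 0 < τ) :
    IntegrableOn (fun q : ℝ => (√(2 * (τ + q)))⁻¹ ^ 3) (Ioi 0) := by
  refine integrableOn_Ioi_deriv_of_nonneg' (g := fun q => -(√(2 * (τ + q)))⁻¹) (l := 0) ?_ ?_ ?_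
  · intro q hq
    exact HasDerivAt.comp_const_add τ q (hasDerivAt_inv_sqrt (by have : (0:ℝ) ≤ q := hq; positivity))
  · intro q _; positivity
  · exact tendsto_inv_sqrt.comp (tendsto_atTop_add_const_left _ _ tendsto_id)

theorem weight_integral (hτ : 0 < τ) :
    ∫ q in Ioi (0:ℝ), (√(2 * (τ + q)))⁻¹ ^ 3 = (√(2 * τ))⁻¹ := by
  rw [integral_Ioi_of_hasDerivAt_of_nonneg' (g := fun q => -(√(2 * (τ + q)))⁻¹) (l := 0) ?_ ?_ ?_]
  · simp
  · intro q hq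
    exact HasDerivAt.comp_const_add τ q (hasDerivAt_inv_sqrt (by have : (0:ℝ) ≤ q := hq; positivity))
  · intro q _; positivity
  · exact tendsto_inv_sqrt.comp (tendsto_atTop_add_const_left _ _ tendsto_id)

/-- `∫_τ^∞ ∂₁ʲ∂₂ᵏ e^{qΔ} dq`, used for `j + k = 3`. -/
def HN (j k : ℕ) (τ : ℝ) (f : ℝ² → ℝ) (x : ℝ²) : ℝ := ∫ q in Ioi (0:ℝ), HE j k (τ + q) f x

theorem HE_bound3 (hjk : j + k = 3) (hC : ∀ x, |f x| ≤ C) (τ : ℝ) (x : ℝ²) (q : ℝ) :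
    ‖HE j k (τ + q) f x‖ ≤ (√(2 * (τ + q)))⁻¹ ^ 3 * (hm j k * C) := by
  have := HE_abs_le j k (τ + q) hC x
  rwa [hjk] at this

theorem HN_abs_le (hjk : j + k = 3) (hτ : 0 < τ)
    (hC : ∀ x, |f x| ≤ C) (x : ℝ²) : |HN j k τ f x| ≤ (√(2 * τ))⁻¹ * (hm j k * C) := by
  rw [← weight_integral hτ, ← integral_mul_const]
  exact norm_integral_le_of_norm_le ((weight_integrable hτ).mul_const _)
    (.of_forall fun q => HE_bound3 hjk hC τ x q)

theorem HE_q_continuousOn (j k : ℕ) (hτ : 0 < τ) (hf : BC C f)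
    (x : ℝ²) : ContinuousOn (fun q : ℝ => HE j k (τ + q) f x) (Ioi 0) :=
  HE_contOn j k (by fun_prop) (fun q hq => by have : (0:ℝ) < q := hq; positivity)
    (hf.cont.comp continuous_snd).continuousOn continuousOn_const (fun _ _ => hf.bd)

theorem HN_integrable (hjk : j + k = 3) (hτ : 0 < τ)
    (hf : BC C f) (x : ℝ²) : IntegrableOn (fun q : ℝ => HE j k (τ + q) f x) (Ioi 0) :=
  ((weight_integrable hτ).mul_const _).mono'
    ((HE_q_continuousOn j k hτ hf x).aestronglyMeasurable measurableSet_Ioi)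
    (.of_forall fun q => HE_bound3 hjk hf.bd τ x q)

theorem HN_contOn {P : Type*} [TopologicalSpace P] [FirstCountableTopology P]
    (hjk : j + k = 3) {s : Set P}
    {τ : P → ℝ} {F : P → ℝ² → ℝ} {x : P → ℝ²} (hτ : ContinuousOn τ s)
    (hτ0 : ∀ p ∈ s, 0 < τ p)
    (hF : ContinuousOn (fun p : P × ℝ² => F p.1 p.2) (s ×ˢ univ)) (hx : ContinuousOn x s)
    (hC : ∀ p ∈ s, ∀ x, |F p x| ≤ C) : ContinuousOn (fun p => HN j k (τ p) (F p) (x p)) s := by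
  intro p hp
  have hp0 := hτ0 p hp
  have hCn : 0 ≤ C := (abs_nonneg _).trans (hC p hp 0)
  refine continuousWithinAt_of_dominated
    (bound := fun q => (√(2 * (τ p / 2 + q)))⁻¹ ^ 3 * (hm j k * C)) ?_ ?_ ?_ ?_
  · filter_upwards [self_mem_nhdsWithin] with r hr
    have hc : Continuous (F r) := by
      rw [← continuousOn_univ]
      exact hF.comp (f := fun y => (r, y)) (by fun_prop) (fun y _ => ⟨hr, trivial⟩)
    exact (HE_q_continuousOn j k (hτ0 r hr) ⟨hc, hC r hr⟩ _).aestronglyMeasurable measurableSet_Ioi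
  · filter_upwards [self_mem_nhdsWithin, (hτ p hp).eventually (lt_mem_nhds (half_lt_self hp0))]
      with r hr hr2
    refine (ae_restrict_iff' measurableSet_Ioi).2 (.of_forall fun q hq => ?_)
    refine (HE_bound3 hjk (hC r hr) _ _ _).trans ?_
    have hq' : (0:ℝ) < q := hq
    have := hm_nonneg j k
    gcongr
  · exact (weight_integrable (half_pos hp0)).mul_const _
  · refine (ae_restrict_iff' measurableSet_Ioi).2 (.of_forall fun q hq => ?_)
    have hq' : (0:ℝ) < q := hq
    exact HE_contOn j k (by fun_prop) (fun r hr => by have := hτ0 r hr; positivity) hF hx hC p hp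

theorem HN_sub (hjk : j + k = 3) (hτ : 0 < τ) (hf : BC C f) (hg : BC C' g) (x : ℝ²) :
    HN j k τ (fun y => f y - g y) x = HN j k τ f x - HN j k τ g x := by
  rw [HN, HN, HN, ← integral_sub (HN_integrable hjk hτ hf x) (HN_integrable hjk hτ hg x)]
  simp only [HE_sub j k _ hf.cont hg.cont hf.bd hg.bd]

theorem HN_shift (j k : ℕ) (τ : ℝ) (f : ℝ² → ℝ) (a x : ℝ²) :
    HN j k τ (fun y => f (y + a)) x = HN j k τ f (x + a) := by
  simp only [HN, HE_shift]

theorem restrict_prod_volume (S : Set ℝ) :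
    (volume.restrict S).prod (volume : Measure ℝ²) =
      (volume : Measure (ℝ × ℝ²)).restrict (S ×ˢ univ) := by
  have := Measure.prod_restrict (μ := (volume : Measure ℝ)) (ν := (volume : Measure ℝ²)) S univ
  rwa [Measure.restrict_univ] at this

theorem integral_GA (j k : ℕ) (σ : ℝ) {S : Set ℝ} (hS : MeasurableSet S)
    (hG : ContinuousOn (fun p : ℝ × ℝ² => G p.1 p.2) (S ×ˢ univ)) {w : ℝ → ℝ}
    (hw : IntegrableOn w S) (hb : ∀ r ∈ S, ∀ x, |G r x| ≤ w r) (x : ℝ²) :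
    ∫ r in S, GA j k σ (G r) x = GA j k σ (fun y => ∫ r in S, G r y) x := by
  simp only [GA, ← integral_const_mul]
  rw [integral_integral_swap]
  have hm : AEStronglyMeasurable (fun p : ℝ × ℝ² => hk j k p.2 * G p.1 (x + σ • p.2))
      ((volume.restrict S).prod volume) := by
    rw [restrict_prod_volume]
    refine ContinuousOn.aestronglyMeasurable ?_ (hS.prod MeasurableSet.univ)
    refine ContinuousOn.mul ((hk_continuous j k).comp continuous_snd).continuousOn ?_
    exact hG.comp (f := fun p : ℝ × ℝ² => (p.1, x + σ • p.2)) (by fun_prop)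
      (fun p hp => ⟨hp.1, trivial⟩)
  refine (hw.mul_prod (hk_integrable j k).abs).mono' hm ?_
  rw [restrict_prod_volume]
  refine (ae_restrict_iff' (hS.prod MeasurableSet.univ)).2 (.of_forall fun p hp => ?_)
  simp only [Function.uncurry, norm_mul, norm_eq_abs]
  rw [mul_comm]
  exact mul_le_mul_of_nonneg_right (hb _ hp.1 _) (abs_nonneg _)

theorem integral_HS (q : ℝ) {S : Set ℝ} (hS : MeasurableSet S)
    (hG : ContinuousOn (fun p : ℝ × ℝ² => G p.1 p.2) (S ×ˢ univ)) {w : ℝ → ℝ}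
    (hw : IntegrableOn w S) (hb : ∀ r ∈ S, ∀ x, |G r x| ≤ w r) (x : ℝ²) :
    ∫ r in S, HS q (G r) x = HS q (fun y => ∫ r in S, G r y) x := by
  simp only [HS_eq]
  exact integral_GA 0 0 _ hS hG hw hb x

theorem HS_HN (hjk : j + k = 3) (ha : 0 ≤ a) (hτ : 0 < τ)
    (hf : BC C f) : HS a (HN j k τ f) = HN j k (a + τ) f := by
  ext x
  have h := integral_HS a measurableSet_Ioi (S := Ioi (0:ℝ)) (G := fun q => HE j k (τ + q) f)
    (HE_contOn j k (by fun_prop) (fun p hp => by have : (0:ℝ) < p.1 := hp.1; positivity)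
      (hf.cont.comp continuous_snd).continuousOn continuousOn_snd (fun _ _ => hf.bd))
    ((weight_integrable hτ).mul_const (hm j k * C)) (fun q _ y => HE_bound3 hjk hf.bd τ y q) x
  rw [HN, show HN j k τ f = fun y => ∫ q in Ioi (0:ℝ), HE j k (τ + q) f y from rfl, ← h]
  refine setIntegral_congr_fun measurableSet_Ioi fun q hq => ?_
  have hq' : (0:ℝ) < q := hq
  rw [HS_HE j k ha (by positivity) hf.cont hf.bd, add_assoc]

/-! ### The Duhamel operator -/

theorem inv_sqrt_integrable (t : ℝ) : IntegrableOn (fun r : ℝ => (√(2 * r))⁻¹) (Ioc 0 t) := by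
  rcases le_or_gt t 0 with ht | ht
  · simp [Ioc_eq_empty_of_le ht]
  have h := (intervalIntegral.intervalIntegrable_rpow' (a := 0) (b := t) (r := -(1/2)) (by norm_num))
  rw [intervalIntegrable_iff_integrableOn_Ioc_of_le ht.le] at h
  refine IntegrableOn.congr_fun (h.const_mul (√2)⁻¹) (fun r hr => ?_) measurableSet_Ioc
  rw [sqrt_mul (by norm_num), rpow_neg hr.1.le, ← sqrt_eq_rpow, mul_inv]

theorem hasDerivAt_sqrt_two_mul (hr : 0 < r) :
    HasDerivAt (fun q : ℝ => √(2 * q)) (√(2 * r))⁻¹ r := by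
  have := ((hasDerivAt_id r).const_mul 2).sqrt (by simp; exact hr.ne')
  refine this.congr_deriv ?_
  simp only [id]
  field_simp

theorem integral_inv_sqrt (ha : 0 ≤ a) (h : a ≤ b) :
    ∫ r in Ioc a b, (√(2 * r))⁻¹ = √(2 * b) - √(2 * a) := by
  rw [← intervalIntegral.integral_of_le h]
  refine intervalIntegral.integral_eq_sub_of_hasDerivAt_of_le h (by fun_prop)
    (fun r hr => hasDerivAt_sqrt_two_mul (ha.trans_lt hr.1)) ?_
  rw [intervalIntegrable_iff_integrableOn_Ioc_of_le h]
  exact (inv_sqrt_integrable b).mono_set (Ioc_subset_Ioc_left ha)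

/-- The Duhamel integral `∫₀ᵗ N(t - s) F(s) ds` for the kernel `HN j k`. -/
def DU (j k : ℕ) (F : ℝ → ℝ² → ℝ) (t : ℝ) (x : ℝ²) : ℝ :=
  ∫ r in Ioc 0 t, HN j k r (F (t - r)) x

theorem DU_of_nonpos (j k : ℕ) (F : ℝ → ℝ² → ℝ) (ht : t ≤ 0) (x : ℝ²) :
    DU j k F t x = 0 := by simp [DU, Ioc_eq_empty_of_le ht]

theorem DU_shift (j k : ℕ) (F : ℝ → ℝ² → ℝ) (t : ℝ) (a x : ℝ²) :
    DU j k (fun s y => F s (y + a)) t x = DU j k F t (x + a) := by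
  simp only [DU, HN_shift]

theorem DU_congr (j k : ℕ) (h : ∀ s, 0 ≤ s → s < t → F s = G s)
    (x : ℝ²) : DU j k F t x = DU j k G t x := by
  refine setIntegral_congr_fun measurableSet_Ioc fun r hr => ?_
  simp only [h (t - r) (by linarith [hr.2]) (by linarith [hr.1])]

theorem DU_contOn (hjk : j + k = 3) (hF : TB C F) (t : ℝ) {S : Set ℝ} (hS : ∀ r ∈ S, 0 < r) :
    ContinuousOn (fun p : ℝ × ℝ² => HN j k p.1 (F (t - p.1)) p.2) (S ×ˢ univ) := by
  have := hF.cont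
  refine HN_contOn hjk (C := C) (F := fun p : ℝ × ℝ² => F (t - p.1)) (τ := fun p => p.1)
    (x := fun p => p.2) (by fun_prop) (fun p hp => hS _ hp.1) ?_ (by fun_prop) (fun p _ => hF.bd _)
  exact (this.comp (by fun_prop : Continuous fun p : (ℝ × ℝ²) × ℝ² =>
    (t - p.1.1, p.2))).continuousOn

theorem DU_integrand_meas (hjk : j + k = 3) (hF : TB C F) (t : ℝ) (x : ℝ²) :
    AEStronglyMeasurable (fun r => HN j k r (F (t - r)) x) (volume.restrict (Ioc 0 t)) := by
  refine ContinuousOn.aestronglyMeasurable ?_ measurableSet_Ioc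
  exact (DU_contOn hjk hF t (S := Ioc 0 t) (fun r hr => hr.1)).comp (f := fun r : ℝ => (r, x))
    (by fun_prop) (fun r hr => ⟨hr, trivial⟩)

theorem DU_integrable (hjk : j + k = 3) (hF : TB C F)
    (t : ℝ) (x : ℝ²) : IntegrableOn (fun r => HN j k r (F (t - r)) x) (Ioc 0 t) := by
  refine Integrable.mono' ((inv_sqrt_integrable t).mul_const (hm j k * C))
    (DU_integrand_meas hjk hF t x) ?_
  filter_upwards [ae_restrict_mem measurableSet_Ioc] with r hr
  exact HN_abs_le hjk hr.1 (hF.bd _) x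

theorem DU_abs_le (hjk : j + k = 3) (hC : ∀ s, 0 ≤ s → s < t → ∀ x, |F s x| ≤ C)
    (x : ℝ²) : |DU j k F t x| ≤ √(2 * t) * (hm j k * C) := by
  rcases le_or_gt t 0 with ht | ht
  · rw [DU_of_nonpos _ _ _ ht, sqrt_eq_zero_of_nonpos (by linarith)]; simp
  have := norm_integral_le_of_norm_le (f := fun r => HN j k r (F (t - r)) x)
    ((inv_sqrt_integrable t).mul_const (hm j k * C)) (by
      filter_upwards [ae_restrict_mem measurableSet_Ioc] with r hr
      exact HN_abs_le hjk hr.1 (hC _ (by linarith [hr.2]) (by linarith [hr.1])) x)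
  rw [integral_mul_const, integral_inv_sqrt le_rfl ht.le] at this
  simpa [DU] using this

/-- A weighted bound: if `|F(s)| ≤ C s^{-1/2}` then the Duhamel integral is bounded. -/
theorem beta_integrable :
    IntegrableOn (fun r : ℝ => (√(2 * r))⁻¹ * (√(t - r))⁻¹) (Ioo 0 t) := by
  rcases le_or_gt t 0 with ht | ht
  · simp [Ioo_eq_empty_of_le ht]
  have h1 : IntegrableOn (fun r : ℝ => (√(2 * r))⁻¹ * (√(t/2))⁻¹) (Ioo 0 (t/2)) :=
    ((inv_sqrt_integrable (t/2)).mono_set Ioo_subset_Ioc_self).mul_const _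
  have h2 : IntegrableOn (fun r : ℝ => (√(2 * (t - r)))⁻¹ * √2) (Ico (t/2) t) := by
    refine Integrable.mul_const ?_ _
    have := (inv_sqrt_integrable (t/2))
    rw [← intervalIntegrable_iff_integrableOn_Ioc_of_le (by positivity)] at this
    have := this.comp_sub_left t
    rw [intervalIntegrable_iff, uIoc_comm, uIoc_of_le (by linarith)] at this
    rw [show t - t/2 = t/2 by ring, sub_zero] at this
    exact (integrableOn_Ico_iff_integrableOn_Ioo enorm_ne_top).2 (this.mono_set Ioo_subset_Ioc_self)
  have e : Ioo 0 t = Ioo 0 (t/2) ∪ Ico (t/2) t := (Ioo_union_Ico_eq_Ioo (by positivity) (by linarith)).symm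
  rw [e]
  refine IntegrableOn.union ?_ ?_
  · refine Integrable.mono' h1 (by fun_prop) ?_
    filter_upwards [ae_restrict_mem measurableSet_Ioo] with r hr
    rw [norm_of_nonneg (by positivity)]
    gcongr
    linarith [hr.2]
  · refine Integrable.mono' (h2.mul_const (√t)⁻¹) (by fun_prop) ?_
    filter_upwards [ae_restrict_mem measurableSet_Ico] with r hr
    have h0 := hr.1
    rw [norm_of_nonneg (by positivity), sqrt_mul (by norm_num) (t - r), mul_inv,
      mul_comm]
    have : (√(2 * r))⁻¹ ≤ (√t)⁻¹ := by gcongr; linarith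
    have h4 : (√2)⁻¹ * (√(t - r))⁻¹ * √2 = (√(t - r))⁻¹ := by
      field_simp
    rw [h4]
    gcongr

theorem beta_bound (ht : 0 < t) :
    ∫ r in Ioo 0 t, (√(2 * r))⁻¹ * (√(t - r))⁻¹ ≤ 4 := by
  have e : Ioo 0 t = Ioo 0 (t/2) ∪ Ico (t/2) t := (Ioo_union_Ico_eq_Ioo (by positivity) (by linarith)).symm
  have hi := beta_integrable (t := t)
  have hi1 := hi.mono_set (s := Ioo 0 (t/2)) (by rw [e]; exact subset_union_left)
  have hi2 := hi.mono_set (s := Ico (t/2) t) (by rw [e]; exact subset_union_right)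
  rw [e, setIntegral_union (by
    rw [Set.disjoint_left]; intro x hx hx'; linarith [hx.2, hx'.1]) measurableSet_Ico hi1 hi2]
  have hs : √t * (√t)⁻¹ = 1 := mul_inv_cancel₀ (by positivity)
  have b1 : ∫ r in Ioo 0 (t/2), (√(2 * r))⁻¹ * (√(t - r))⁻¹ ≤ √2 := by
    have : ∫ r in Ioo 0 (t/2), (√(2 * r))⁻¹ * (√(t/2))⁻¹ = √2 := by
      rw [integral_mul_const, ← integral_Ioc_eq_integral_Ioo, integral_inv_sqrt le_rfl (by positivity)]
      rw [show 2 * (t/2) = t by ring, sqrt_div ht.le]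
      simp
      field_simp
    rw [← this]
    refine setIntegral_mono_on hi1 ((inv_sqrt_integrable (t/2)).mono_set Ioo_subset_Ioc_self |>.mul_const _)
      measurableSet_Ioo fun r hr => ?_
    gcongr
    linarith [hr.2]
  have b2 : ∫ r in Ico (t/2) t, (√(2 * r))⁻¹ * (√(t - r))⁻¹ ≤ √2 := by
    have hsub : IntervalIntegrable (fun r => (√(2 * r))⁻¹) volume 0 (t/2) := by
      rw [intervalIntegrable_iff_integrableOn_Ioc_of_le (by positivity)]; exact inv_sqrt_integrable _
    have hsub2 := hsub.comp_sub_left t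
    rw [intervalIntegrable_iff, uIoc_comm, uIoc_of_le (by linarith),
      show t - t/2 = t/2 by ring, sub_zero] at hsub2
    have : ∫ r in Ico (t/2) t, (√(2 * (t - r)))⁻¹ * (√2 * (√t)⁻¹) = √2 := by
      rw [integral_mul_const, integral_Ico_eq_integral_Ioo, ← integral_Ioc_eq_integral_Ioo,
        ← intervalIntegral.integral_of_le (by linarith),
        intervalIntegral.integral_comp_sub_left (fun r => (√(2 * r))⁻¹) t, sub_self,
        intervalIntegral.integral_of_le (by linarith), integral_inv_sqrt le_rfl (by linarith)]
      rw [show 2 * (t - t/2) = t by ring]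
      simp
      linear_combination √2 * hs
    rw [← this]
    refine setIntegral_mono_on hi2 (((integrableOn_Ico_iff_integrableOn_Ioo enorm_ne_top).2
      (hsub2.mono_set Ioo_subset_Ioc_self)).mul_const _) measurableSet_Ico fun r hr => ?_
    have h0 := hr.1
    rw [sqrt_mul (by norm_num) (t - r), mul_inv]
    have : (√(2 * r))⁻¹ ≤ (√t)⁻¹ := by gcongr; linarith
    have h4 : (√2)⁻¹ * (√(t - r))⁻¹ * (√2 * (√t)⁻¹) = (√t)⁻¹ * (√(t - r))⁻¹ := by
      have : (√2)⁻¹ * √2 = 1 := inv_mul_cancel₀ (by positivity)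
      linear_combination (√(t - r))⁻¹ * (√t)⁻¹ * this
    rw [h4]
    gcongr
  have : √2 ≤ 2 := by rw [sqrt_le_left (by norm_num)]; norm_num
  linarith

theorem DU_abs_le_weight (hjk : j + k = 3) (ht : 0 < t) (hC0 : 0 ≤ C)
    (hC : ∀ s, 0 < s → s < t → ∀ x, |F s x| ≤ A + C * (√s)⁻¹)
    (x : ℝ²) : |DU j k F t x| ≤ hm j k * (√(2 * t) * A + 4 * C) := by
  have hi : IntegrableOn (fun r => hm j k * ((√(2 * r))⁻¹ * A + C * ((√(2 * r))⁻¹ * (√(t - r))⁻¹)))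
      (Ioo 0 t) := (((inv_sqrt_integrable t).mono_set Ioo_subset_Ioc_self).mul_const A |>.add
        (beta_integrable.const_mul C)).const_mul _
  have := norm_integral_le_of_norm_le (f := fun r => HN j k r (F (t - r)) x) hi (by
      filter_upwards [ae_restrict_mem measurableSet_Ioo] with r hr
      refine (HN_abs_le hjk hr.1 (hC (t - r) (by linarith [hr.2]) (by linarith [hr.1])) x).trans
        (le_of_eq ?_)
      ring)
  rw [integral_const_mul, integral_add (((inv_sqrt_integrable t).mono_set
    Ioo_subset_Ioc_self).mul_const A) (beta_integrable.const_mul C), integral_mul_const,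
    integral_const_mul, ← integral_Ioc_eq_integral_Ioo (f := fun r => (√(2 * r))⁻¹),
    integral_inv_sqrt le_rfl ht.le, ← integral_Ioc_eq_integral_Ioo] at this
  simp only [mul_zero, sqrt_zero, sub_zero] at this
  refine this.trans ?_
  have := beta_bound ht
  have : 0 ≤ hm j k := hm_nonneg j k
  rw [mul_comm 4 C]
  gcongr

theorem DU_sub (hjk : j + k = 3) (hF : TB C F) (hG : TB C' G) (t : ℝ) (x : ℝ²) :
    DU j k (fun s y => F s y - G s y) t x = DU j k F t x - DU j k G t x := by
  simp only [DU]
  rw [← integral_sub (DU_integrable hjk hF t x) (DU_integrable hjk hG t x)]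
  refine setIntegral_congr_fun measurableSet_Ioc fun r hr => ?_
  simp only [HN_sub hjk hr.1 (hF.slice _) (hG.slice _)]

theorem DU_eq_scaled (j k : ℕ) (F : ℝ → ℝ² → ℝ) (ht : 0 < t) (x : ℝ²) :
    DU j k F t x = ∫ θ in Ioc (0:ℝ) 1, t * HN j k (t * θ) (F (t - t * θ)) x := by
  rw [DU, ← intervalIntegral.integral_of_le ht.le, ← intervalIntegral.integral_of_le zero_le_one,
    intervalIntegral.integral_const_mul,
    intervalIntegral.integral_comp_mul_left (fun r => HN j k r (F (t - r)) x) ht.ne']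
  simp
  rw [← mul_assoc, mul_inv_cancel₀ ht.ne', one_mul]

theorem DU_cont (hjk : j + k = 3) (hF : TB C F) :
    Continuous fun p : ℝ × ℝ² => DU j k F p.1 p.2 := by
  rw [continuous_iff_continuousAt]
  intro p
  have hC := hF.nonneg
  have hm0 := hm_nonneg j k
  rcases le_or_gt p.1 0 with hp | hp
  · rw [ContinuousAt, DU_of_nonpos j k F hp]
    have h2 : Tendsto (fun p : ℝ × ℝ² => √(2 * p.1) * (hm j k * C)) (𝓝 p) (𝓝 0) := by
      have : Continuous fun p : ℝ × ℝ² => √(2 * p.1) * (hm j k * C) := by fun_prop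
      have := this.tendsto p
      rwa [sqrt_eq_zero_of_nonpos (by linarith), zero_mul] at this
    exact squeeze_zero_norm (fun q => DU_abs_le hjk (fun s _ _ => hF.bd s) q.2) h2
  · have hU : {q : ℝ × ℝ² | 0 < q.1 ∧ q.1 < p.1 + 1} ∈ 𝓝 p :=
      (IsOpen.inter (isOpen_lt continuous_const continuous_fst)
        (isOpen_lt continuous_fst continuous_const)).mem_nhds ⟨hp, by simp⟩
    have hev : (fun q : ℝ × ℝ² => DU j k F q.1 q.2) =ᶠ[𝓝 p]
        fun q => ∫ θ in Ioc (0:ℝ) 1, q.1 * HN j k (q.1 * θ) (F (q.1 - q.1 * θ)) q.2 := by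
      filter_upwards [hU] with q hq
      exact DU_eq_scaled j k F hq.1 q.2
    refine ContinuousAt.congr ?_ hev.symm
    have key : ContinuousOn (fun q : (ℝ × ℝ²) × ℝ =>
        q.1.1 * HN j k (q.1.1 * q.2) (F (q.1.1 - q.1.1 * q.2)) q.1.2)
        ({q | 0 < q.1} ×ˢ Ioc (0:ℝ) 1) := by
      refine ContinuousOn.mul (by fun_prop) (HN_contOn hjk (C := C)
        (F := fun q : (ℝ × ℝ²) × ℝ => F (q.1.1 - q.1.1 * q.2)) (τ := fun q => q.1.1 * q.2)
        (x := fun q => q.1.2) (by fun_prop) (fun q hq => mul_pos hq.1 hq.2.1) ?_ (by fun_prop)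
        (fun q _ => hF.bd _))
      exact (hF.cont.comp (by fun_prop : Continuous fun q : ((ℝ × ℝ²) × ℝ) × ℝ² =>
        (q.1.1.1 - q.1.1.1 * q.1.2, q.2))).continuousOn
    refine continuousAt_of_dominated (bound := fun θ => (p.1 + 1) * ((√(p.1 / 2))⁻¹ *
      (√(2 * θ))⁻¹ * (hm j k * C))) ?_ ?_ ?_ ?_
    · filter_upwards [hU] with q hq
      exact (key.comp (f := fun θ : ℝ => (q, θ)) (by fun_prop)
        (fun θ hθ => ⟨hq.1, hθ⟩)).aestronglyMeasurable measurableSet_Ioc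
    · have hV : {q : ℝ × ℝ² | p.1 / 2 < q.1} ∈ 𝓝 p :=
        (isOpen_lt continuous_const continuous_fst).mem_nhds (by simp; linarith)
      filter_upwards [hU, hV] with q hq hq'
      filter_upwards [ae_restrict_mem measurableSet_Ioc] with θ hθ
      rw [norm_mul, norm_of_nonneg hq.1.le]
      refine mul_le_mul hq.2.le ((HN_abs_le hjk (mul_pos hq.1 hθ.1) (hF.bd _) _).trans ?_)
        (norm_nonneg _) (by positivity)
      rw [show 2 * (q.1 * θ) = q.1 * (2 * θ) by ring, sqrt_mul hq.1.le, mul_inv]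
      gcongr
    · exact Integrable.const_mul (((inv_sqrt_integrable 1).const_mul _).mul_const _) _
    · filter_upwards [ae_restrict_mem measurableSet_Ioc] with θ hθ
      have h := key.comp (f := fun q : ℝ × ℝ² => (q, θ)) (s := {q | 0 < q.1}) (by fun_prop)
        (fun q hq => ⟨hq, hθ⟩)
      exact h.continuousAt ((isOpen_lt continuous_const continuous_fst).mem_nhds hp)

theorem DU_restart (hjk : j + k = 3) (hF : TB C F) (hs : 0 ≤ s) (hst : s ≤ t) (x : ℝ²) :
    DU j k F t x = HS (t - s) (DU j k F s) x + DU j k (fun r => F (s + r)) (t - s) x := by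
  have e : Ioc 0 t = Ioc 0 (t - s) ∪ Ioc (t - s) t := (Ioc_union_Ioc_eq_Ioc (by linarith) (by linarith)).symm
  have hi := DU_integrable hjk hF t x
  have h1 : DU j k F t x = DU j k (fun r => F (s + r)) (t - s) x
      + ∫ r in Ioc (t - s) t, HN j k r (F (t - r)) x := by
    rw [DU, e, setIntegral_union (Ioc_disjoint_Ioc_of_le le_rfl) measurableSet_Ioc
      (hi.mono_set (by rw [e]; exact subset_union_left))
      (hi.mono_set (by rw [e]; exact subset_union_right)), DU]
    congr 1
    refine setIntegral_congr_fun measurableSet_Ioc fun r _ => ?_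
    congr 2; ring
  rw [h1, add_comm]
  congr 1
  have h2 : ∫ r in Ioc (t - s) t, HN j k r (F (t - r)) x
      = ∫ r in Ioc 0 s, HN j k (t - s + r) (F (s - r)) x := by
    rw [← intervalIntegral.integral_of_le (by linarith), ← intervalIntegral.integral_of_le hs,
      ← sub_zero (t - s)]
    have := intervalIntegral.integral_comp_add_left (a := 0) (b := s)
      (fun r => HN j k r (F (t - r)) x) (t - s)
    rw [show t - s + s = t by ring, add_zero] at this
    rw [sub_zero, ← this]
    refine intervalIntegral.integral_congr fun r _ => ?_
    congr 2; ring
  have hc := DU_contOn hjk hF s (S := Ioc 0 s) (fun r hr => hr.1)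
  rw [h2]
  have h3 := integral_HS (t - s) (S := Ioc 0 s) measurableSet_Ioc (G := fun r => HN j k r (F (s - r)))
    hc ((inv_sqrt_integrable s).mul_const (hm j k * C)) (fun r hr x => HN_abs_le hjk hr.1 (hF.bd _) x) x
  refine Eq.trans ?_ h3
  refine setIntegral_congr_fun measurableSet_Ioc fun r hr => ?_
  simp only [HS_HN hjk (sub_nonneg.2 hst) hr.1 (hF.slice (s - r))]

/-! ### The bilinear Duhamel term -/

/-- The Duhamel term `∫₀ᵗ e^{(t-s)Δ} ∂₁ʲ∂₂ᵏ (-Δ)⁻¹ ((∂₁² - ∂₂²) b - 2 ∂₁∂₂ a) ds`, for `j + k = 1`. -/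
def DW (j k : ℕ) (a b : ℝ → ℝ² → ℝ) (t : ℝ) (x : ℝ²) : ℝ :=
  DU (j + 2) k b t x - DU j (k + 2) b t x - 2 * DU (j + 1) (k + 1) a t x

/-- A universal constant bounding the Duhamel terms. -/
def KW : ℝ := ((hm 2 1 + hm 0 3 + 2 * hm 1 2) + (hm 3 0 + hm 1 2 + 2 * hm 2 1)) + 1

theorem KW_pos : 0 < KW := by
  have := hm_nonneg 2 1; have := hm_nonneg 0 3; have := hm_nonneg 1 2; have := hm_nonneg 3 0
  rw [KW]
  linarith

theorem hm_le_KW (hjk : j + k = 1) :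
    hm (j + 2) k + hm j (k + 2) + 2 * hm (j + 1) (k + 1) ≤ KW := by
  have := hm_nonneg 2 1; have := hm_nonneg 0 3; have := hm_nonneg 1 2; have := hm_nonneg 3 0
  obtain ⟨rfl, rfl⟩ | ⟨rfl, rfl⟩ : (j = 0 ∧ k = 1) ∨ (j = 1 ∧ k = 0) := by omega
  all_goals simp only [zero_add, Nat.reduceAdd, KW]; linarith

theorem DW_congr (j k : ℕ) {a b a' b' : ℝ → ℝ² → ℝ} (ha : ∀ s, 0 ≤ s → s < t → a s = a' s)
    (hb : ∀ s, 0 ≤ s → s < t → b s = b' s) (x : ℝ²) : DW j k a b t x = DW j k a' b' t x := by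
  simp only [DW, DU_congr _ _ ha, DU_congr _ _ hb]

theorem DW_shift (j k : ℕ) (a b : ℝ → ℝ² → ℝ) (t : ℝ) (h x : ℝ²) :
    DW j k (fun s y => a s (y + h)) (fun s y => b s (y + h)) t x = DW j k a b t (x + h) := by
  simp only [DW, DU_shift]

theorem DW_zero (j k : ℕ) (a b : ℝ → ℝ² → ℝ) (x : ℝ²) : DW j k a b 0 x = 0 := by
  simp [DW, DU_of_nonpos]

theorem HS_sub (q : ℝ) (hf : Continuous f) (hg : Continuous g)
    (hC : ∀ x, |f x| ≤ C) (hC' : ∀ x, |g x| ≤ C') (x : ℝ²) :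
    HS q (fun y => f y - g y) x = HS q f x - HS q g x := HE_sub 0 0 q hf hg hC hC' x

theorem HS_add (q : ℝ) (hf : Continuous f) (hg : Continuous g)
    (hC : ∀ x, |f x| ≤ C) (hC' : ∀ x, |g x| ≤ C') (x : ℝ²) :
    HS q (fun y => f y + g y) x = HS q f x + HS q g x := HE_add 0 0 q hf hg hC hC' x

theorem HS_const_mul (q c : ℝ) (f : ℝ² → ℝ) (x : ℝ²) :
    HS q (fun y => c * f y) x = c * HS q f x := HE_const_mul 0 0 q c f x

theorem HS_slice (q : ℝ) (hf : BC C f) : Continuous (HS q f) :=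
  (HS_continuous hf.cont hf.bd).comp (by fun_prop : Continuous fun x : ℝ² => (q, x))

theorem HS_shift (q : ℝ) (f : ℝ² → ℝ) (a x : ℝ²) :
    HS q (fun y => f (y + a)) x = HS q f (x + a) := HE_shift 0 0 q f a x

section
variable {a b a' b' : ℝ → ℝ² → ℝ}

theorem DW_abs_le (hjk : j + k = 1) (ha : ∀ s, 0 ≤ s → s < t → ∀ x, |a s x| ≤ C)
    (hb : ∀ s, 0 ≤ s → s < t → ∀ x, |b s x| ≤ C) (hC : 0 ≤ C) (x : ℝ²) :
    |DW j k a b t x| ≤ √(2 * t) * (KW * C) := by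
  have h1 := abs_le.1 (DU_abs_le (j := j + 2) (k := k) (by omega) hb x)
  have h2 := abs_le.1 (DU_abs_le (j := j) (k := k + 2) (by omega) hb x)
  have h3 := abs_le.1 (DU_abs_le (j := j + 1) (k := k + 1) (by omega) ha x)
  have h4 := mul_le_mul_of_nonneg_left (mul_le_mul_of_nonneg_right (hm_le_KW hjk) hC)
    (sqrt_nonneg (2 * t))
  rw [DW, abs_le]
  constructor <;> nlinarith

theorem DW_abs_le_weight (hjk : j + k = 1) (ht : 0 < t) (hA : 0 ≤ A) (hC : 0 ≤ C)
    (ha : ∀ s, 0 < s → s < t → ∀ x, |a s x| ≤ A + C * (√s)⁻¹)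
    (hb : ∀ s, 0 < s → s < t → ∀ x, |b s x| ≤ A + C * (√s)⁻¹) (x : ℝ²) :
    |DW j k a b t x| ≤ KW * (√(2 * t) * A + 4 * C) := by
  have h1 := abs_le.1 (DU_abs_le_weight (j := j + 2) (k := k) (by omega) ht hC hb x)
  have h2 := abs_le.1 (DU_abs_le_weight (j := j) (k := k + 2) (by omega) ht hC hb x)
  have h3 := abs_le.1 (DU_abs_le_weight (j := j + 1) (k := k + 1) (by omega) ht hC ha x)
  have h4 := mul_le_mul_of_nonneg_right (hm_le_KW hjk)
    (by positivity : 0 ≤ √(2 * t) * A + 4 * C)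
  rw [DW, abs_le]
  constructor <;> nlinarith

theorem DW_cont (hjk : j + k = 1) (ha : TB A a) (hb : TB B b) :
    Continuous fun p : ℝ × ℝ² => DW j k a b p.1 p.2 :=
  ((DU_cont (by omega) hb).sub (DU_cont (by omega) hb)).sub
    (continuous_const.mul (DU_cont (by omega) ha))

theorem DW_sub (hjk : j + k = 1) (ha : TB A a) (hb : TB B b) (ha' : TB A' a') (hb' : TB B' b') (t : ℝ) (x : ℝ²) :
    DW j k (fun s y => a s y - a' s y) (fun s y => b s y - b' s y) t x =
      DW j k a b t x - DW j k a' b' t x := by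
  simp only [DW]
  rw [DU_sub (by omega) hb hb', DU_sub (by omega) hb hb', DU_sub (by omega) ha ha']
  ring

theorem DW_slice (hjk : j + k = 1) (ha : TB A a) (hb : TB B b) (t : ℝ) : Continuous (DW j k a b t) :=
  (DW_cont hjk ha hb).comp (by fun_prop : Continuous fun x : ℝ² => (t, x))

theorem DW_restart (hjk : j + k = 1) (ha : TB A a) (hb : TB B b) (hs : 0 ≤ s) (hst : s ≤ t) (x : ℝ²) :
    DW j k a b t x = HS (t - s) (DW j k a b s) x +
      DW j k (fun r => a (s + r)) (fun r => b (s + r)) (t - s) x := by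
  have hc (i l : ℕ) (hil : i + l = 3) {f : ℝ → ℝ² → ℝ} {F : ℝ} (hf : TB F f) :
      Continuous (DU i l f s) :=
    (DU_cont hil hf).comp (by fun_prop : Continuous fun x : ℝ² => (s, x))
  have hbd (i l : ℕ) (hil : i + l = 3) {f : ℝ → ℝ² → ℝ} {F : ℝ} (hf : TB F f) :=
    DU_abs_le hil (t := s) (fun r _ _ => hf.bd r)
  have b1 := hbd (j + 2) k (by omega) hb
  have b2 := hbd j (k + 2) (by omega) hb
  have b3 := hbd (j + 1) (k + 1) (by omega) ha
  have c1 := hc (j + 2) k (by omega) hb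
  have c2 := hc j (k + 2) (by omega) hb
  have c3 := hc (j + 1) (k + 1) (by omega) ha
  change _ = HS (t - s) (fun y => DU (j + 2) k b s y - DU j (k + 2) b s y -
    2 * DU (j + 1) (k + 1) a s y) x + _
  rw [HS_sub _ (f := fun y => DU (j + 2) k b s y - DU j (k + 2) b s y)
    (g := fun y => 2 * DU (j + 1) (k + 1) a s y) (c1.sub c2) (continuous_const.mul c3)
    (fun x => (abs_sub _ _).trans (add_le_add (b1 x) (b2 x)))
    (fun x => (abs_mul _ _).le.trans (mul_le_mul_of_nonneg_left (b3 x) (abs_nonneg _))),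
    HS_sub _ c1 c2 b1 b2, HS_const_mul]
  simp only [DW]
  rw [DU_restart (by omega) hb hs hst, DU_restart (by omega) hb hs hst,
    DU_restart (by omega) ha hs hst]
  ring

end

/-! ### Mild solutions -/

/-- The diagonal part of the traceless tensor `u ⊗ u - |u|²/2`. -/
def qa (u1 u2 : ℝ → ℝ² → ℝ) (t : ℝ) (x : ℝ²) : ℝ := (u1 t x * u1 t x - u2 t x * u2 t x) / 2

/-- The off-diagonal part of the tensor `u ⊗ u`. -/
def qb (u1 u2 : ℝ → ℝ² → ℝ) (t : ℝ) (x : ℝ²) : ℝ := u1 t x * u2 t x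

theorem TB.qb (h1 : TB M u1) (h2 : TB M u2) :
    TB (M * M) (qb u1 u2) := h1.mul h2

theorem TB.qa (h1 : TB M u1) (h2 : TB M u2) :
    TB (M * M) (qa u1 u2) := by
  have h := (h1.mul h1).sub (h2.mul h2)
  refine ⟨h.cont.div_const 2, fun t x => ?_⟩
  have := h.bd t x
  rw [NS.qa, abs_div, abs_two]
  linarith

theorem abs_mul_sub_le {p : ℝ} (hp : |p| ≤ M) (hs : |s| ≤ M) (h1 : |p - r| ≤ d)
    (h2 : |q - s| ≤ d) : |p * q - r * s| ≤ 2 * M * d := by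
  have : p * q - r * s = p * (q - s) + (p - r) * s := by ring
  have hM := (abs_nonneg _).trans hp
  rw [this]
  refine (abs_add_le _ _).trans ?_
  rw [abs_mul, abs_mul]
  have := mul_le_mul hp h2 (abs_nonneg _) hM
  have := mul_le_mul h1 hs (abs_nonneg _) ((abs_nonneg _).trans h1)
  linarith

theorem abs_qb_sub_le {x : ℝ²} (h1 : |u1 t x| ≤ M) (k2 : |v2 t x| ≤ M) (e1 : |u1 t x - v1 t x| ≤ d)
    (e2 : |u2 t x - v2 t x| ≤ d) : |qb u1 u2 t x - qb v1 v2 t x| ≤ 2 * M * d :=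
  abs_mul_sub_le h1 k2 e1 e2

theorem abs_qa_sub_le {x : ℝ²} (h1 : |u1 t x| ≤ M)
    (h2 : |u2 t x| ≤ M) (k1 : |v1 t x| ≤ M) (k2 : |v2 t x| ≤ M) (e1 : |u1 t x - v1 t x| ≤ d)
    (e2 : |u2 t x - v2 t x| ≤ d) : |qa u1 u2 t x - qa v1 v2 t x| ≤ 2 * M * d := by
  have a1 := abs_le.1 (abs_mul_sub_le h1 k1 e1 e1)
  have a2 := abs_le.1 (abs_mul_sub_le h2 k2 e2 e2)
  rw [qa, qa, abs_le]
  constructor <;> linarith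

/-- Mild solutions of the Navier-Stokes equations on `[0, T]`, bounded by `M`. -/
structure Mild (T M : ℝ) (u1 u2 : ℝ → ℝ² → ℝ) : Prop where
  tb1 : TB M u1
  tb2 : TB M u2
  eq1 : ∀ t, 0 ≤ t → t ≤ T → ∀ x, u1 t x = HS t (u1 0) x - DW 0 1 (qa u1 u2) (qb u1 u2) t x
  eq2 : ∀ t, 0 ≤ t → t ≤ T → ∀ x, u2 t x = HS t (u2 0) x + DW 1 0 (qa u1 u2) (qb u1 u2) t x

theorem Mild.mono {T' : ℝ} (h : Mild T M u1 u2) (hT : T' ≤ T) :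
    Mild T' M u1 u2 :=
  ⟨h.tb1, h.tb2, fun t ht ht' => h.eq1 t ht (ht'.trans hT), fun t ht ht' => h.eq2 t ht (ht'.trans hT)⟩

theorem Mild.shift (h : Mild T M u1 u2) (a : ℝ²) :
    Mild T M (fun t x => u1 t (x + a)) (fun t x => u2 t (x + a)) := by
  refine ⟨h.tb1.shift a, h.tb2.shift a, fun t ht ht' x => ?_, fun t ht ht' x => ?_⟩
  · rw [h.eq1 t ht ht', HS_shift]
    exact congrArg _ (DW_shift 0 1 _ _ t a x).symm
  · rw [h.eq2 t ht ht', HS_shift]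
    exact congrArg _ (DW_shift 1 0 _ _ t a x).symm

theorem Mild.restart (h : Mild T M u1 u2) (hs : 0 ≤ s)
    (hsT : s ≤ T) : Mild (T - s) M (fun t => u1 (s + t)) (fun t => u2 (s + t)) := by
  have ha := h.tb1.qa h.tb2
  have hb := h.tb1.qb h.tb2
  have hs1 : u1 s = fun x => HS s (u1 0) x - DW 0 1 (qa u1 u2) (qb u1 u2) s x :=
    funext fun x => h.eq1 s hs hsT x
  have hs2 : u2 s = fun x => HS s (u2 0) x + DW 1 0 (qa u1 u2) (qb u1 u2) s x :=
    funext fun x => h.eq2 s hs hsT x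
  have i1 := h.tb1.slice 0
  have i2 := h.tb2.slice 0
  refine ⟨h.tb1.comp_time (by fun_prop), h.tb2.comp_time (by fun_prop), fun t ht ht' x => ?_,
    fun t ht ht' x => ?_⟩
  · simp only [add_zero]
    rw [h.eq1 (s + t) (by positivity) (by linarith), DW_restart rfl ha hb hs (by linarith)]
    conv_rhs => rw [hs1]
    rw [HS_sub t (HS_slice s i1) (DW_slice rfl ha hb s)
      (HS_abs_le s i1.bd) (DW_abs_le rfl (fun s _ _ => ha.bd s) (fun s _ _ => hb.bd s) ha.nonneg)]
    have := congrFun (HS_HS ht hs i1.cont i1.bd) x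
    rw [this, show s + t - s = t by ring, add_comm t s]
    rw [← sub_sub]; rfl
  · simp only [add_zero]
    rw [h.eq2 (s + t) (by positivity) (by linarith), DW_restart rfl ha hb hs (by linarith)]
    conv_rhs => rw [hs2]
    rw [HS_add t (HS_slice s i2) (DW_slice rfl ha hb s)
      (HS_abs_le s i2.bd) (DW_abs_le (j := 1) (k := 0) rfl (fun s _ _ => ha.bd s) (fun s _ _ => hb.bd s) ha.nonneg)]
    have := congrFun (HS_HS ht hs i2.cont i2.bd) x
    rw [this, show s + t - s = t by ring, add_comm t s]
    rw [← add_assoc]; rfl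

/-- The length of the time interval of the contraction argument. -/
def T0 (M : ℝ) : ℝ := 1 / (2 * (8 * KW * (M + 1)) ^ 2)

theorem T0_pos (hM : 0 ≤ M) : 0 < T0 M := by
  have := KW_pos
  unfold T0; positivity

theorem T0_bound (hM : 0 ≤ M) (h : t ≤ T0 M) : √(2 * t) * (KW * (8 * (M + 1))) ≤ 1 := by
  have := KW_pos
  have h1 : √(2 * t) ≤ 1 / (8 * KW * (M + 1)) := by
    refine sqrt_le_iff.2 ⟨by positivity, ?_⟩
    calc 2 * t ≤ 2 * T0 M := by linarith
      _ = _ := by unfold T0; field_simp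
  calc _ ≤ 1 / (8 * KW * (M + 1)) * (KW * (8 * (M + 1))) := by gcongr
    _ = 1 := by field_simp

theorem Mild.halve (h : Mild T M u1 u2)
    (h' : Mild T M v1 v2) (hT : T ≤ T0 M) (e1 : u1 0 = v1 0) (e2 : u2 0 = v2 0) (hd : 0 ≤ d)
    (H : ∀ t, 0 ≤ t → t ≤ T → ∀ x, |u1 t x - v1 t x| ≤ d ∧ |u2 t x - v2 t x| ≤ d) :
    ∀ t, 0 ≤ t → t ≤ T → ∀ x, |u1 t x - v1 t x| ≤ d / 2 ∧ |u2 t x - v2 t x| ≤ d / 2 := by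
  intro t ht htT x
  have hM := h.tb1.nonneg
  have hK := KW_pos
  have hb := T0_bound hM (htT.trans hT)
  have key : √(2 * t) * (KW * (2 * M * d)) ≤ d / 2 := by
    have h0 : 0 ≤ √(2 * t) * KW := by positivity
    have : √(2 * t) * (KW * (8 * M)) ≤ 1 := le_trans (by gcongr; linarith) hb
    nlinarith
  have B : ∀ j k : ℕ, j + k = 1 → |DW j k (qa u1 u2) (qb u1 u2) t x -
      DW j k (qa v1 v2) (qb v1 v2) t x| ≤ √(2 * t) * (KW * (2 * M * d)) := by
    intro j k hjk
    rw [← DW_sub hjk (h.tb1.qa h.tb2) (h.tb1.qb h.tb2) (h'.tb1.qa h'.tb2) (h'.tb1.qb h'.tb2)]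
    refine DW_abs_le hjk (fun s hs hst y => ?_) (fun s hs hst y => ?_) (by positivity) x
    · exact abs_qa_sub_le (h.tb1.bd _ _) (h.tb2.bd _ _) (h'.tb1.bd _ _) (h'.tb2.bd _ _)
        (H s hs (by linarith) y).1 (H s hs (by linarith) y).2
    · exact abs_qb_sub_le (h.tb1.bd _ _) (h'.tb2.bd _ _)
        (H s hs (by linarith) y).1 (H s hs (by linarith) y).2
  constructor
  · rw [h.eq1 t ht htT, h'.eq1 t ht htT, e1, sub_sub_sub_cancel_left, abs_sub_comm]
    exact (B 0 1 rfl).trans key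
  · rw [h.eq2 t ht htT, h'.eq2 t ht htT, e2, add_sub_add_left_eq_sub]
    exact (B 1 0 rfl).trans key

theorem Mild.unique_short (h : Mild T M u1 u2)
    (h' : Mild T M v1 v2) (hT : T ≤ T0 M) (e1 : u1 0 = v1 0) (e2 : u2 0 = v2 0) :
    ∀ t, 0 ≤ t → t ≤ T → u1 t = v1 t ∧ u2 t = v2 t := by
  have hM := h.tb1.nonneg
  have H : ∀ n : ℕ, ∀ t, 0 ≤ t → t ≤ T → ∀ x, |u1 t x - v1 t x| ≤ 2 * M * (1/2) ^ n ∧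
      |u2 t x - v2 t x| ≤ 2 * M * (1/2) ^ n := by
    intro n
    induction n with
    | zero =>
      intro t _ _ x
      have h1 := (abs_sub (u1 t x) (v1 t x)).trans (add_le_add (h.tb1.bd t x) (h'.tb1.bd t x))
      have h2 := (abs_sub (u2 t x) (v2 t x)).trans (add_le_add (h.tb2.bd t x) (h'.tb2.bd t x))
      simp only [pow_zero]
      constructor <;> linarith
    | succ n ih =>
      have := h.halve h' hT e1 e2 (by positivity) ih
      simpa only [pow_succ, mul_div_assoc, mul_one_div, div_div, mul_assoc] using this
  have lim : Tendsto (fun n : ℕ => 2 * M * (1/2 : ℝ) ^ n) atTop (𝓝 0) := by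
    simpa using (tendsto_pow_atTop_nhds_zero_of_lt_one (by norm_num : (0:ℝ) ≤ 1/2)
      (by norm_num)).const_mul (2 * M)
  intro t ht htT
  constructor
  · funext x
    exact sub_eq_zero.1 (abs_nonpos_iff.1 (ge_of_tendsto' lim fun n => (H n t ht htT x).1))
  · funext x
    exact sub_eq_zero.1 (abs_nonpos_iff.1 (ge_of_tendsto' lim fun n => (H n t ht htT x).2))

theorem Mild.mono_bd {M' : ℝ} (h : Mild T M u1 u2) (hM : M ≤ M') :
    Mild T M' u1 u2 :=
  ⟨h.tb1.congr_bd fun t x => (h.tb1.bd t x).trans hM, h.tb2.congr_bd fun t x => (h.tb2.bd t x).trans hM,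
    h.eq1, h.eq2⟩

theorem Mild.unique {M' : ℝ} (h : Mild T M u1 u2)
    (h' : Mild T M' v1 v2) (e1 : u1 0 = v1 0) (e2 : u2 0 = v2 0) :
    ∀ t, 0 ≤ t → t ≤ T → u1 t = v1 t ∧ u2 t = v2 t := by
  replace h := h.mono_bd (le_max_left M M')
  replace h' := h'.mono_bd (le_max_right M M')
  set L := max M M'
  have hL := T0_pos h.tb1.nonneg
  have H : ∀ n : ℕ, ∀ t, 0 ≤ t → t ≤ T → t ≤ n * T0 L → u1 t = v1 t ∧ u2 t = v2 t := by
    intro n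
    induction n with
    | zero =>
      intro t h0 _ h1
      obtain rfl : t = 0 := le_antisymm (by simpa using h1) h0
      exact ⟨e1, e2⟩
    | succ n ih =>
      intro t h0 htT h1
      rcases le_or_gt t (n * T0 L) with hn | hn
      · exact ih t h0 htT hn
      · have hs : 0 ≤ n * T0 L := by positivity
        obtain ⟨i1, i2⟩ := ih (n * T0 L) hs (hn.le.trans htT) le_rfl
        push_cast at h1
        have := ((h.restart hs (hn.le.trans htT)).mono (T' := t - n * T0 L) (by linarith)).unique_short
          ((h'.restart hs (hn.le.trans htT)).mono (by linarith)) (by linarith)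
          (by simpa using i1) (by simpa using i2) (t - n * T0 L) (by linarith) le_rfl
        simpa using this
  intro t h0 htT
  obtain ⟨n, hn⟩ := exists_nat_ge (t / T0 L)
  exact H n t h0 htT ((div_le_iff₀ hL).1 hn)

/-! ### Local existence of mild solutions -/

theorem clamp_mem (hT : 0 ≤ T) (t : ℝ) : 0 ≤ max 0 (min t T) ∧ max 0 (min t T) ≤ T :=
  ⟨le_max_left _ _, max_le hT (min_le_right _ _)⟩

theorem clamp_eq (h0 : 0 ≤ t) (h : t ≤ T) : max 0 (min t T) = t := by
  rw [min_eq_left h, max_eq_right h0]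

theorem TB.of_bcf (v : (ℝ × ℝ²) →ᵇ ℝ²) {R : ℝ} (hv : ‖v‖ ≤ R) :
    TB R (fun t x => (v (t, x)).1) ∧ TB R (fun t x => (v (t, x)).2) := by
  have h (t : ℝ) (x : ℝ²) := (v.norm_coe_le_norm (t, x)).trans hv
  exact ⟨⟨v.continuous.fst, fun t x => (norm_fst_le _).trans (h t x)⟩,
    ⟨v.continuous.snd, fun t x => (norm_snd_le _).trans (h t x)⟩⟩

theorem Mild.exists_local (hM : 0 ≤ M) (h1 : BC M f1) (h2 : BC M f2) :
    ∃ u1 u2, Mild (T0 M) (2 * M) u1 u2 ∧ u1 0 = f1 ∧ u2 0 = f2 := by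
  have hT := T0_pos hM
  have hK := KW_pos
  set c : ℝ → ℝ := fun t => max 0 (min t (T0 M)) with hc
  have hcm := fun t => clamp_mem hT.le t
  set V1 : ((ℝ × ℝ²) →ᵇ ℝ²) → ℝ → ℝ² → ℝ := fun v t x => (v (t, x)).1 with hV1
  set V2 : ((ℝ × ℝ²) →ᵇ ℝ²) → ℝ → ℝ² → ℝ := fun v t x => (v (t, x)).2 with hV2
  have hTB (v : (ℝ × ℝ²) →ᵇ ℝ²) {R : ℝ} (hv : ‖v‖ ≤ R) : TB R (V1 v) ∧ TB R (V2 v) :=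
    TB.of_bcf v hv
  set W : ℕ → ℕ → ((ℝ × ℝ²) →ᵇ ℝ²) → ℝ → ℝ² → ℝ := fun j k v =>
    DW j k (qa (V1 v) (V2 v)) (qb (V1 v) (V2 v)) with hW
  have hWle {R : ℝ} (v) (hv : ‖v‖ ≤ R) (j k : ℕ) (hjk : j + k = 1) (t : ℝ) (x : ℝ²) :
      |W j k v (c t) x| ≤ √(2 * c t) * (KW * (R * R)) := by
    obtain ⟨t1, t2⟩ := hTB v hv
    exact DW_abs_le hjk (fun s _ _ => (t1.qa t2).bd s) (fun s _ _ => (t1.qb t2).bd s)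
      (mul_self_nonneg _) x
  have hWcont (v) (j k : ℕ) (hjk : j + k = 1) :
      Continuous fun p : ℝ × ℝ² => W j k v (c p.1) p.2 := by
    obtain ⟨t1, t2⟩ := hTB v le_rfl
    exact (DW_cont hjk (t1.qa t2) (t1.qb t2)).comp
      (by fun_prop : Continuous fun p : ℝ × ℝ² => (c p.1, p.2))
  have hScont {f : ℝ² → ℝ} (hf : BC M f) : Continuous fun p : ℝ × ℝ² => HS (c p.1) f p.2 :=
    (HS_continuous hf.cont hf.bd).comp (by fun_prop : Continuous fun p : ℝ × ℝ² => (c p.1, p.2))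
  set Φf : ((ℝ × ℝ²) →ᵇ ℝ²) → ℝ × ℝ² → ℝ² := fun v p =>
    (HS (c p.1) f1 p.2 - W 0 1 v (c p.1) p.2, HS (c p.1) f2 p.2 + W 1 0 v (c p.1) p.2) with hΦf
  have hsq (t : ℝ) := T0_bound hM (hcm t).2
  have hΦle {R : ℝ} (v) (hv : ‖v‖ ≤ R) (p) : ‖Φf v p‖ ≤ M + √(2 * c p.1) * (KW * (R * R)) := by
    refine norm_prod_le_iff.2 ⟨?_, ?_⟩
    · exact (abs_sub _ _).trans (add_le_add (HS_abs_le _ h1.bd _) (hWle v hv 0 1 rfl _ _))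
    · exact (abs_add_le _ _).trans (add_le_add (HS_abs_le _ h2.bd _) (hWle v hv 1 0 rfl _ _))
  have hΦc (v) : Continuous (Φf v) :=
    ((hScont h1).sub (hWcont v 0 1 rfl)).prodMk ((hScont h2).add (hWcont v 1 0 rfl))
  set Φ : ((ℝ × ℝ²) →ᵇ ℝ²) → ((ℝ × ℝ²) →ᵇ ℝ²) := fun v =>
    BoundedContinuousFunction.ofNormedAddCommGroup (Φf v) (hΦc v)
      (M + √(2 * T0 M) * (KW * (‖v‖ * ‖v‖))) (fun p => (hΦle v le_rfl p).trans (by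
        have := (hcm p.1).2
        gcongr)) with hΦ
  set B := Metric.closedBall (0 : (ℝ × ℝ²) →ᵇ ℝ²) (2 * M)
  have hmaps : MapsTo Φ B B := by
    intro v hv
    rw [mem_closedBall_zero_iff] at hv ⊢
    refine (BoundedContinuousFunction.norm_le (by positivity)).2 fun p => (hΦle v hv p).trans ?_
    have := hsq p.1
    nlinarith
  have hlip : LipschitzOnWith (1/2) Φ B := by
    refine LipschitzOnWith.of_dist_le_mul fun v hv w hw => ?_
    rw [mem_closedBall_zero_iff] at hv hw
    obtain ⟨a1, a2⟩ := hTB v hv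
    obtain ⟨b1, b2⟩ := hTB w hw
    refine (BoundedContinuousFunction.dist_le (by positivity)).2 fun p => ?_
    have hd (t : ℝ) (x : ℝ²) : |V1 v t x - V1 w t x| ≤ dist v w ∧ |V2 v t x - V2 w t x| ≤ dist v w := by
      have h : ‖v (t, x) - w (t, x)‖ ≤ dist v w := by
        rw [← dist_eq_norm]; exact BoundedContinuousFunction.dist_coe_le_dist _
      exact ⟨(norm_fst_le _).trans h, (norm_snd_le _).trans h⟩
    have key (j k : ℕ) (hjk : j + k = 1) : |W j k v (c p.1) p.2 - W j k w (c p.1) p.2| ≤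
        1 / 2 * dist v w := by
      have : |W j k v (c p.1) p.2 - W j k w (c p.1) p.2| ≤
          √(2 * c p.1) * (KW * (2 * (2 * M) * dist v w)) := by
        simp only [hW]
        rw [← DW_sub hjk (a1.qa a2) (a1.qb a2) (b1.qa b2) (b1.qb b2)]
        refine DW_abs_le hjk (fun s _ _ y => ?_) (fun s _ _ y => ?_) (by positivity) _
        · exact abs_qa_sub_le (a1.bd _ _) (a2.bd _ _) (b1.bd _ _) (b2.bd _ _) (hd s y).1 (hd s y).2
        · exact abs_qb_sub_le (a1.bd _ _) (b2.bd _ _) (hd s y).1 (hd s y).2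
      refine this.trans ?_
      have := hsq p.1
      have h0 : 0 ≤ √(2 * c p.1) * KW := by positivity
      have : √(2 * c p.1) * KW * (4 * M) ≤ 1 / 2 := by nlinarith
      nlinarith [dist_nonneg (x := v) (y := w)]
    rw [dist_eq_norm]
    refine norm_prod_le_iff.2 ⟨?_, ?_⟩
    · have := key 0 1 rfl
      rw [abs_sub_comm] at this
      simpa [hΦ, hΦf, norm_eq_abs] using this
    · simpa [hΦ, hΦf, norm_eq_abs] using key 1 0 rfl
  have hcw : ContractingWith (1/2) (hmaps.restrict Φ B B) :=
    ⟨by rw [← NNReal.coe_lt_coe]; norm_num, hlip.mapsToRestrict hmaps⟩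
  obtain ⟨v, hv, hfix, -⟩ := hcw.exists_fixedPoint' Metric.isClosed_closedBall.isComplete hmaps
    (x := 0) (by simp [B, hM]) (edist_ne_top _ _)
  rw [mem_closedBall_zero_iff] at hv
  obtain ⟨t1, t2⟩ := hTB v hv
  have e (t : ℝ) (x : ℝ²) : v (t, x) = Φf v (t, x) := by
    have := DFunLike.congr_fun hfix (t, x)
    exact this.symm
  have e1 (t : ℝ) (x : ℝ²) : V1 v t x = HS (c t) f1 x - W 0 1 v (c t) x :=
    congrArg Prod.fst (e t x)
  have e2 (t : ℝ) (x : ℝ²) : V2 v t x = HS (c t) f2 x + W 1 0 v (c t) x :=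
    congrArg Prod.snd (e t x)
  have c0 : c 0 = 0 := clamp_eq le_rfl hT.le
  have i1 : V1 v 0 = f1 := by
    funext x; rw [e1, c0, HS_zero]; simp [hW, DW_zero]
  have i2 : V2 v 0 = f2 := by
    funext x; rw [e2, c0, HS_zero]; simp [hW, DW_zero]
  refine ⟨V1 v, V2 v, ⟨t1, t2, fun t h0 ht x => ?_, fun t h0 ht x => ?_⟩, i1, i2⟩
  · rw [e1, i1, hc]; simp only [clamp_eq h0 ht]; rfl
  · rw [e2, i2, hc]; simp only [clamp_eq h0 ht]; rfl

theorem Mild.concat {S L : ℝ} {w1 w2 : ℝ → ℝ² → ℝ} (h : Mild T M u1 u2)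
    (hw : Mild S L w1 w2) (hT : 0 ≤ T) (e1 : w1 0 = u1 T) (e2 : w2 0 = u2 T) :
    ∃ v1 v2, Mild (T + S) (M + L + M) v1 v2 ∧ v1 0 = u1 0 ∧ v2 0 = u2 0 := by
  set v : (ℝ → ℝ² → ℝ) → (ℝ → ℝ² → ℝ) → ℝ → ℝ² → ℝ := fun u w t x =>
    u (min t T) x + w (max 0 (t - T)) x - u T x with hv
  have left {u w : ℝ → ℝ² → ℝ} (e : w 0 = u T) {t : ℝ} (ht : t ≤ T) : v u w t = u t := by
    funext x
    simp only [hv, min_eq_left ht, max_eq_left (sub_nonpos.2 ht), e, add_sub_cancel_right]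
  have right {u w : ℝ → ℝ² → ℝ} {t : ℝ} (ht : T ≤ t) : v u w t = w (t - T) := by
    funext x
    simp only [hv, min_eq_right ht, max_eq_right (sub_nonneg.2 ht), add_sub_cancel_left]
  have tb {u w : ℝ → ℝ² → ℝ} (hu : TB M u) (hw : TB L w) : TB (M + L + M) (v u w) := by
    have a := hu.comp_time (φ := fun t => min t T) (by fun_prop)
    have b := hw.comp_time (φ := fun t => max 0 (t - T)) (by fun_prop)
    have c := hu.comp_time (φ := fun _ => T) (by fun_prop)
    exact ⟨(a.cont.add b.cont).sub c.cont, fun t x => (abs_sub _ _).trans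
      (add_le_add ((abs_add_le _ _).trans (add_le_add (a.bd t x) (b.bd t x))) (c.bd t x))⟩
  have t1 := tb h.tb1 hw.tb1
  have t2 := tb h.tb2 hw.tb2
  have i1 := h.tb1.slice 0
  have i2 := h.tb2.slice 0
  have ha := t1.qa t2
  have hb := t1.qb t2
  have qal {t : ℝ} (ht : t ≤ T) : qa (v u1 w1) (v u2 w2) t = qa u1 u2 t := by
    funext x; simp only [qa, left e1 ht, left e2 ht]
  have qbl {t : ℝ} (ht : t ≤ T) : qb (v u1 w1) (v u2 w2) t = qb u1 u2 t := by
    funext x; simp only [qb, left e1 ht, left e2 ht]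
  have qar {t : ℝ} (ht : 0 ≤ t) : qa (v u1 w1) (v u2 w2) (T + t) = qa w1 w2 t := by
    funext x; simp only [qa, right (u := u1) (w := w1) (by linarith : T ≤ T + t),
      right (u := u2) (w := w2) (by linarith : T ≤ T + t), add_sub_cancel_left]
  have qbr {t : ℝ} (ht : 0 ≤ t) : qb (v u1 w1) (v u2 w2) (T + t) = qb w1 w2 t := by
    funext x; simp only [qb, right (u := u1) (w := w1) (by linarith : T ≤ T + t),
      right (u := u2) (w := w2) (by linarith : T ≤ T + t), add_sub_cancel_left]
  have DWl (j k : ℕ) {t : ℝ} (ht : t ≤ T) (x : ℝ²) :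
      DW j k (qa (v u1 w1) (v u2 w2)) (qb (v u1 w1) (v u2 w2)) t x =
      DW j k (qa u1 u2) (qb u1 u2) t x :=
    DW_congr _ _ (fun s _ hs => qal (by linarith)) (fun s _ hs => qbl (by linarith)) _
  have DWr (j k : ℕ) (t : ℝ) (x : ℝ²) :
      DW j k (fun r => qa (v u1 w1) (v u2 w2) (T + r)) (fun r => qb (v u1 w1) (v u2 w2) (T + r)) t x =
      DW j k (qa w1 w2) (qb w1 w2) t x :=
    DW_congr _ _ (fun s h0 _ => qar h0) (fun s h0 _ => qbr h0) _
  have uT1 : u1 T = fun x => HS T (u1 0) x - DW 0 1 (qa u1 u2) (qb u1 u2) T x :=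
    funext fun x => h.eq1 T hT le_rfl x
  have uT2 : u2 T = fun x => HS T (u2 0) x + DW 1 0 (qa u1 u2) (qb u1 u2) T x :=
    funext fun x => h.eq2 T hT le_rfl x
  have pa := h.tb1.qa h.tb2
  have pb := h.tb1.qb h.tb2
  refine ⟨v u1 w1, v u2 w2, ⟨t1, t2, fun t h0 ht x => ?_, fun t h0 ht x => ?_⟩, left e1 hT, left e2 hT⟩
  · rw [left e1 hT]
    rcases le_or_gt t T with h' | h'
    · rw [left e1 h', DWl 0 1 h', h.eq1 t h0 h']
    · rw [right h'.le, hw.eq1 (t - T) (by linarith) (by linarith), e1, DW_restart rfl ha hb hT h'.le,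
        DWr, ← sub_sub]
      congr 1
      conv_lhs => rw [uT1]
      rw [HS_sub _ (HS_slice T i1) (DW_slice rfl pa pb T) (HS_abs_le T i1.bd)
        (DW_abs_le rfl (fun s _ _ => pa.bd s) (fun s _ _ => pb.bd s) pa.nonneg),
        HS_HS (sub_nonneg.2 h'.le) hT i1.cont i1.bd, sub_add_cancel]
      congr 2
      funext y
      exact (DWl 0 1 le_rfl y).symm
  · rw [left e2 hT]
    rcases le_or_gt t T with h' | h'
    · rw [left e2 h', DWl 1 0 h', h.eq2 t h0 h']
    · rw [right h'.le, hw.eq2 (t - T) (by linarith) (by linarith), e2, DW_restart rfl ha hb hT h'.le,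
        DWr, ← add_assoc]
      congr 1
      conv_lhs => rw [uT2]
      rw [HS_add _ (HS_slice T i2) (DW_slice rfl pa pb T) (HS_abs_le T i2.bd)
        (DW_abs_le (j := 1) (k := 0) rfl (fun s _ _ => pa.bd s) (fun s _ _ => pb.bd s) pa.nonneg),
        HS_HS (sub_nonneg.2 h'.le) hT i2.cont i2.bd, sub_add_cancel]
      congr 2
      funext y
      exact (DWl 1 0 le_rfl y).symm

/-- Global existence from an a priori bound. -/
theorem Mild.exists_of_bound (h1 : BC M f1) (h2 : BC M f2) (hT : 0 ≤ T)
    (H : ∀ S L u1 u2, 0 ≤ S → S ≤ T → Mild S L u1 u2 → u1 0 = f1 → u2 0 = f2 →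
      ∀ x, |u1 S x| ≤ B ∧ |u2 S x| ≤ B) :
    ∃ L u1 u2, Mild T L u1 u2 ∧ u1 0 = f1 ∧ u2 0 = f2 := by
  have hM := h1.nonneg
  set B' := max M B
  have hB : 0 ≤ B' := hM.trans (le_max_left _ _)
  have hτ := T0_pos hB
  have key : ∀ n : ℕ, ∃ L u1 u2, Mild (min T (n * T0 B')) L u1 u2 ∧ u1 0 = f1 ∧ u2 0 = f2 := by
    intro n
    induction n with
    | zero =>
      obtain ⟨u1, u2, h, e1, e2⟩ := Mild.exists_local hM h1 h2
      exact ⟨_, u1, u2, h.mono (by have := T0_pos hM; simp; right; exact this.le), e1, e2⟩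
    | succ n ih =>
      obtain ⟨L, u1, u2, h, e1, e2⟩ := ih
      have h0 : 0 ≤ min T (n * T0 B') := le_min hT (by positivity)
      have hb := H _ L u1 u2 h0 (min_le_left _ _) h e1 e2
      obtain ⟨w1, w2, hw, i1, i2⟩ := Mild.exists_local hB
        (f1 := u1 (min T (n * T0 B'))) (f2 := u2 (min T (n * T0 B')))
        ⟨(h.tb1.slice _).cont, fun x => (hb x).1.trans (le_max_right _ _)⟩
        ⟨(h.tb2.slice _).cont, fun x => (hb x).2.trans (le_max_right _ _)⟩
      obtain ⟨v1, v2, hv, j1, j2⟩ := h.concat hw h0 i1 i2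
      refine ⟨_, v1, v2, hv.mono ?_, j1.trans e1, j2.trans e2⟩
      push_cast
      rcases le_total T (n * T0 B') with h | h
      · rw [min_eq_left h]; exact (min_le_left _ _).trans (by linarith)
      · rw [min_eq_right h]; exact (min_le_right _ _).trans (by linarith)
  obtain ⟨n, hn⟩ := exists_nat_ge (T / T0 B')
  obtain ⟨L, u1, u2, h, e⟩ := key n
  exact ⟨L, u1, u2, h.mono (le_min le_rfl ((div_le_iff₀ hτ).1 hn)), e⟩

/-! ### Iterated finite differences -/

/-- Iterated finite difference along a list of shifts. -/
def FD : List ℝ² → (ℝ² → ℝ) → ℝ² → ℝ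
  | [], f => f
  | h :: L, f => fun x => FD L f (x + h) - FD L f x

/-- The product of the lengths of a list of shifts. -/
def nP (L : List ℝ²) : ℝ := (L.map norm).prod

@[simp] theorem FD_nil (f : ℝ² → ℝ) : FD [] f = f := rfl

theorem FD_cons (h : ℝ²) (L : List ℝ²) (f : ℝ² → ℝ) (x : ℝ²) :
    FD (h :: L) f x = FD L f (x + h) - FD L f x := rfl

@[simp] theorem nP_nil : nP [] = 1 := rfl

theorem nP_cons (h : ℝ²) (L : List ℝ²) : nP (h :: L) = ‖h‖ * nP L := by simp [nP]

theorem nP_nonneg (L : List ℝ²) : 0 ≤ nP L := by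
  induction L with
  | nil => simp
  | cons h L ih => rw [nP_cons]; positivity

theorem FD_shift (L : List ℝ²) (f : ℝ² → ℝ) (a x : ℝ²) :
    FD L (fun y => f (y + a)) x = FD L f (x + a) := by
  induction L generalizing x with
  | nil => rfl
  | cons h L ih => rw [FD_cons, FD_cons, ih, ih, add_right_comm]

theorem FD_sub (L : List ℝ²) (f g : ℝ² → ℝ) (x : ℝ²) :
    FD L (fun y => f y - g y) x = FD L f x - FD L g x := by
  induction L generalizing x with
  | nil => rfl
  | cons h L ih => rw [FD_cons, FD_cons, FD_cons, ih, ih]; ring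

theorem FD_add (L : List ℝ²) (f g : ℝ² → ℝ) (x : ℝ²) :
    FD L (fun y => f y + g y) x = FD L f x + FD L g x := by
  induction L generalizing x with
  | nil => rfl
  | cons h L ih => rw [FD_cons, FD_cons, FD_cons, ih, ih]; ring

theorem FD_const_mul (L : List ℝ²) (c : ℝ) (f : ℝ² → ℝ) (x : ℝ²) :
    FD L (fun y => c * f y) x = c * FD L f x := by
  induction L generalizing x with
  | nil => rfl
  | cons h L ih => rw [FD_cons, FD_cons, ih, ih]; ring

theorem FD_cons' (h : ℝ²) (L : List ℝ²) (f : ℝ² → ℝ) (x : ℝ²) :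
    FD (h :: L) f x = FD L (fun y => f (y + h) - f y) x := by
  rw [FD_sub, FD_shift, FD_cons]

theorem FD_abs_le (L : List ℝ²) (hC : ∀ x, |f x| ≤ C) (x : ℝ²) :
    |FD L f x| ≤ 2 ^ L.length * C := by
  induction L generalizing x with
  | nil => simpa using hC x
  | cons h L ih =>
    rw [FD_cons, List.length_cons, pow_succ]
    have := abs_sub (FD L f (x + h)) (FD L f x)
    linarith [ih x, ih (x + h)]

theorem TB.fd (h : TB C F) (L : List ℝ²) :
    TB (2 ^ L.length * C) (fun t => FD L (F t)) := by
  refine ⟨?_, fun t => FD_abs_le L (h.bd t)⟩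
  induction L with
  | nil => exact h.cont
  | cons a L ih =>
    exact (ih.comp (by fun_prop : Continuous fun p : ℝ × ℝ² => (p.1, p.2 + a))).sub ih

theorem BC.fd (h : BC C f) (L : List ℝ²) :
    BC (2 ^ L.length * C) (FD L f) := by
  refine ⟨?_, FD_abs_le L h.bd⟩
  induction L with
  | nil => exact h.cont
  | cons a L ih => exact (ih.comp (by fun_prop : Continuous fun p : ℝ² => p + a)).sub ih

theorem HS_FD (L : List ℝ²) (q : ℝ) (h : BC C f) (x : ℝ²) :
    FD L (HS q f) x = HS q (FD L f) x := by
  induction L generalizing x with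
  | nil => rfl
  | cons a L ih =>
    have hs := (h.fd L).cont.comp (by fun_prop : Continuous fun p : ℝ² => p + a)
    change FD L (HS q f) (x + a) - FD L (HS q f) x = HS q (fun y => FD L f (y + a) - FD L f y) x
    rw [HS_sub q (f := fun y => FD L f (y + a)) hs (h.fd L).cont (fun x => (h.fd L).bd (x + a))
      (h.fd L).bd, HS_shift, ih, ih]

theorem DW_FD (hjk : j + k = 1) {a b : ℝ → ℝ² → ℝ} (ha : TB A a) (hb : TB B b)
    (L : List ℝ²) (t : ℝ) (x : ℝ²) :
    FD L (DW j k a b t) x = DW j k (fun s => FD L (a s)) (fun s => FD L (b s)) t x := by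
  induction L generalizing x with
  | nil => rfl
  | cons h L ih =>
    change FD L (DW j k a b t) (x + h) - FD L (DW j k a b t) x =
      DW j k (fun s y => FD L (a s) (y + h) - FD L (a s) y)
        (fun s y => FD L (b s) (y + h) - FD L (b s) y) t x
    rw [DW_sub hjk (a := fun s y => FD L (a s) (y + h)) (b := fun s y => FD L (b s) (y + h))
      ((ha.fd L).shift h) ((hb.fd L).shift h) (ha.fd L) (hb.fd L),
      DW_shift j k (fun s => FD L (a s)) (fun s => FD L (b s)), ih, ih]

/-- Leibniz bound for iterated finite differences of a product. -/
theorem FD_mul_le (L : List ℝ²) {a b : ℕ → ℝ}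
    (hf : ∀ S, S.Sublist L → ∀ x, |FD S f x| ≤ a S.length * nP S)
    (hg : ∀ S, S.Sublist L → ∀ x, |FD S g x| ≤ b S.length * nP S) (x : ℝ²) :
    |FD L (fun y => f y * g y) x| ≤
      (∑ p ∈ Finset.HasAntidiagonal.antidiagonal L.length, (L.length.choose p.1 : ℝ) * (a p.1 * b p.2)) * nP L := by
  induction L generalizing f g a b x with
  | nil =>
    have h1 := hf [] (List.Sublist.refl _) x
    have h2 := hg [] (List.Sublist.refl _) x
    simp only [FD_nil, List.length_nil, nP_nil, mul_one] at h1 h2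
    simpa [abs_mul] using mul_le_mul h1 h2 (abs_nonneg _) ((abs_nonneg _).trans h1)
  | cons h L ih =>
    have e : FD (h :: L) (fun y => f y * g y) x =
        FD L (fun y => f (y + h) * (g (y + h) - g y)) x + FD L (fun y => (f (y + h) - f y) * g y) x := by
      rw [FD_cons', ← FD_add]
      congr 1; funext y; ring
    have d {f : ℝ² → ℝ} {a : ℕ → ℝ}
        (hf : ∀ S, S.Sublist (h :: L) → ∀ x, |FD S f x| ≤ a S.length * nP S) :
        ∀ S, S.Sublist L → ∀ x, |FD S (fun y => f (y + h) - f y) x| ≤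
          (a (S.length + 1) * ‖h‖) * nP S := by
      intro S hS x
      have := hf (h :: S) (hS.cons_cons h) x
      rwa [FD_cons', nP_cons, List.length_cons, ← mul_assoc] at this
    have i1 := ih (f := fun y => f (y + h)) (g := fun y => g (y + h) - g y) (a := a)
      (b := fun n => b (n + 1) * ‖h‖) (fun S hS x => by
        rw [FD_shift]; exact hf S (hS.cons h) _) (d hg) x
    have i2 := ih (f := fun y => f (y + h) - f y) (g := g) (a := fun n => a (n + 1) * ‖h‖)
      (b := b) (d hf) (fun S hS x => hg S (hS.cons h) _) x
    rw [e, List.length_cons, Finset.sum_antidiagonal_choose_succ_mul (fun i j => a i * b j), nP_cons]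
    refine (abs_add_le _ _).trans ((add_le_add i1 i2).trans (le_of_eq ?_))
    rw [← add_mul, mul_comm ‖h‖, mul_comm (nP L), ← mul_assoc, add_mul _ _ ‖h‖, Finset.sum_mul, Finset.sum_mul]
    congr 2
    · refine Finset.sum_congr rfl fun p _ => by ring
    · refine Finset.sum_congr rfl fun p hp => ?_
      rw [Nat.choose_symm_of_eq_add (Finset.HasAntidiagonal.mem_antidiagonal.1 hp).symm]
      ring

theorem sum_choose_le {n : ℕ} (hn : 1 ≤ n) (hA : 0 ≤ A) (hU : 0 ≤ U) :
    ∑ p ∈ Finset.HasAntidiagonal.antidiagonal n, (n.choose p.1 : ℝ) *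
      ((if p.1 = n then U else A) * (if p.2 = n then U else A)) ≤ 2 ^ n * A ^ 2 + 2 * A * U := by
  have h : ∀ p ∈ Finset.HasAntidiagonal.antidiagonal n, (n.choose p.1 : ℝ) *
      ((if p.1 = n then U else A) * (if p.2 = n then U else A)) ≤
      (n.choose p.1 : ℝ) * A ^ 2 + ((if p.1 = n then A * U else 0) + (if p.1 = 0 then A * U else 0)) := by
    rintro ⟨i, j⟩ hp
    have hp : i + j = n := Finset.HasAntidiagonal.mem_antidiagonal.1 hp
    have hAU := mul_nonneg hA hU
    have hA2 := mul_nonneg hA hA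
    dsimp only
    by_cases h1 : i = n
    · have h2 : j ≠ n := by omega
      have h3 : i ≠ 0 := by omega
      subst h1
      simp only [h2, h3, if_true, if_false, Nat.choose_self]
      push_cast; nlinarith
    · by_cases h2 : j = n
      · have h3 : i = 0 := by omega
        rw [if_neg h1, if_pos h2, if_neg h1, if_pos h3, h3, Nat.choose_zero_right]
        push_cast; nlinarith
      · have h3 : i ≠ 0 := by omega
        simp only [h1, h2, h3, if_false]
        exact le_of_eq (by ring)
  refine (Finset.sum_le_sum h).trans (le_of_eq ?_)
  rw [Finset.sum_add_distrib, Finset.sum_add_distrib, ← Finset.sum_mul]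
  have e1 := Nat.sum_range_choose n
  rw [← Finset.Nat.sum_antidiagonal_eq_sum_range_succ (fun i _ => n.choose i)] at e1
  have e2 : (∑ p ∈ Finset.HasAntidiagonal.antidiagonal n, (n.choose p.1 : ℝ)) = 2 ^ n := by exact_mod_cast e1
  rw [e2, Finset.Nat.sum_antidiagonal_eq_sum_range_succ (fun i _ => if i = n then A * U else 0),
    Finset.Nat.sum_antidiagonal_eq_sum_range_succ (fun i _ => if i = 0 then A * U else 0)]
  simp [Finset.sum_ite_eq']
  ring

/-- Bounds for the top order finite differences of a product. -/
theorem FD_mul_top {L : List ℝ²} (hL : 1 ≤ L.length) (hA : 0 ≤ A) (hU : 0 ≤ U)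
    (hf : ∀ S, S.length < L.length → ∀ x, |FD S f x| ≤ A * nP S)
    (hg : ∀ S, S.length < L.length → ∀ x, |FD S g x| ≤ A * nP S)
    (hf' : ∀ x, |FD L f x| ≤ U * nP L) (hg' : ∀ x, |FD L g x| ≤ U * nP L) (x : ℝ²) :
    |FD L (fun y => f y * g y) x| ≤ (2 ^ L.length * A ^ 2 + 2 * A * U) * nP L := by
  have key {f : ℝ² → ℝ} (hf : ∀ S, S.length < L.length → ∀ x, |FD S f x| ≤ A * nP S)
      (hf' : ∀ x, |FD L f x| ≤ U * nP L) : ∀ S, S.Sublist L → ∀ x, |FD S f x| ≤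
        (if S.length = L.length then U else A) * nP S := by
    intro S hS x
    split_ifs with h
    · rw [hS.eq_of_length h]; exact hf' x
    · exact hf S (lt_of_le_of_ne hS.length_le h) x
  exact (FD_mul_le L (a := fun n => if n = L.length then U else A)
    (b := fun n => if n = L.length then U else A) (key hf hf') (key hg hg') x).trans
    (mul_le_mul_of_nonneg_right (sum_choose_le hL hA hU) (nP_nonneg L))

theorem lip_of_DD (h1 : DD (1, 0) f f1) (h2 : DD (0, 1) f f2) {C1 C2 : ℝ}
    (b1 : ∀ x, |f1 x| ≤ C1) (b2 : ∀ x, |f2 x| ≤ C2) (x h : ℝ²) :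
    |f (x + h) - f x| ≤ (C1 + C2) * ‖h‖ := by
  have e1 := h1.lip b1 x h.1
  have e2 := h2.lip b2 (x + h.1 • (1, 0)) h.2
  have e : x + h.1 • ((1, 0) : ℝ²) + h.2 • ((0, 1) : ℝ²) = x + h := by
    ext <;> simp
  rw [e] at e2
  have c1 : 0 ≤ C1 := (abs_nonneg _).trans (b1 0)
  have c2 : 0 ≤ C2 := (abs_nonneg _).trans (b2 0)
  have n1 : |h.1| ≤ ‖h‖ := norm_fst_le h
  have n2 : |h.2| ≤ ‖h‖ := norm_snd_le h
  have := abs_add_le (f (x + h) - f (x + h.1 • (1, 0))) (f (x + h.1 • (1, 0)) - f x)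
  rw [sub_add_sub_cancel] at this
  nlinarith

theorem HS_lip (hq : 0 < q) (hf : Continuous f) (hC : ∀ x, |f x| ≤ C) (x h : ℝ²) :
    |HS q f (x + h) - HS q f x| ≤ (√q)⁻¹ * ((hm 1 0 + hm 0 1) * C) * ‖h‖ := by
  have h0 : (√(2 * q))⁻¹ ≤ (√q)⁻¹ :=
    inv_anti₀ (sqrt_pos.2 hq) (sqrt_le_sqrt (by linarith))
  refine (lip_of_DD (HE_DD1 0 0 hq hf hC) (HE_DD2 0 0 hq hf hC) (fun x => HE_abs_le 1 0 q hC x)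
    (fun x => HE_abs_le 0 1 q hC x) x h).trans ?_
  have := hm_nonneg 1 0; have := hm_nonneg 0 1
  have hC0 : 0 ≤ C := (abs_nonneg _).trans (hC 0)
  gcongr
  simp only [zero_add, add_zero, pow_one]
  rw [← mul_add, ← add_mul]
  gcongr

/-- Weighted bounds for the finite differences of a mild solution, one contraction step. -/
theorem Mild.fd_halve (h : Mild τ M u1 u2) (hA : 0 ≤ A)
    (hE : 0 ≤ E) (hτ : 4 * τ ≤ T0 A) {L : List ℝ²} (hL : 1 ≤ L.length)
    (low : ∀ t, 0 ≤ t → t ≤ τ → ∀ S, S.length < L.length → ∀ x,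
      |FD S (u1 t) x| ≤ A * nP S ∧ |FD S (u2 t) x| ≤ A * nP S)
    (top : ∀ t, 0 < t → t ≤ τ → ∀ x,
      |FD L (u1 t) x| ≤ E * (√t)⁻¹ * nP L ∧ |FD L (u2 t) x| ≤ E * (√t)⁻¹ * nP L) :
    ∀ t, 0 < t → t ≤ τ → ∀ x,
      |FD L (u1 t) x| ≤ ((hm 1 0 + hm 0 1) * A + 2 ^ L.length * A * √τ + E / 2) * (√t)⁻¹ * nP L ∧
      |FD L (u2 t) x| ≤ ((hm 1 0 + hm 0 1) * A + 2 ^ L.length * A * √τ + E / 2) * (√t)⁻¹ * nP L := by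
  intro t ht htτ
  have hN := nP_nonneg L
  have hK := KW_pos
  have st : 0 < √t := sqrt_pos.2 ht
  -- heat part
  have heat {f : ℝ² → ℝ} (hf : BC M f) (lf : ∀ S, S.length < L.length → ∀ x, |FD S f x| ≤ A * nP S)
      (x : ℝ²) : |FD L (HS t f) x| ≤ (hm 1 0 + hm 0 1) * A * (√t)⁻¹ * nP L := by
    obtain ⟨a, S, rfl⟩ := List.exists_cons_of_length_pos hL
    rw [FD_cons, HS_FD S t hf, HS_FD S t hf, nP_cons]
    refine (HS_lip ht (hf.fd S).cont (lf S (by simp)) x a).trans (le_of_eq (by ring))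
  have i1 := heat (h.tb1.slice 0) (fun S hS x => (low 0 le_rfl (ht.le.trans htτ) S hS x).1)
  have i2 := heat (h.tb2.slice 0) (fun S hS x => (low 0 le_rfl (ht.le.trans htτ) S hS x).2)
  -- Duhamel part
  have prod {f g : ℝ → ℝ² → ℝ}
      (lf : ∀ t, 0 ≤ t → t ≤ τ → ∀ S, S.length < L.length → ∀ x, |FD S (f t) x| ≤ A * nP S)
      (lg : ∀ t, 0 ≤ t → t ≤ τ → ∀ S, S.length < L.length → ∀ x, |FD S (g t) x| ≤ A * nP S)
      (tf : ∀ t, 0 < t → t ≤ τ → ∀ x, |FD L (f t) x| ≤ E * (√t)⁻¹ * nP L)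
      (tg : ∀ t, 0 < t → t ≤ τ → ∀ x, |FD L (g t) x| ≤ E * (√t)⁻¹ * nP L) :
      ∀ s, 0 < s → s < t → ∀ x, |FD L (fun y => f s y * g s y) x| ≤
        2 ^ L.length * A ^ 2 * nP L + 2 * A * E * nP L * (√s)⁻¹ := by
    intro s hs hst x
    refine (FD_mul_top hL hA (by positivity : 0 ≤ E * (√s)⁻¹) (lf s hs.le (by linarith))
      (lg s hs.le (by linarith)) (tf s hs (by linarith)) (tg s hs (by linarith)) x).trans
      (le_of_eq (by ring))
  have l1 := fun t a b S hS x => (low t a b S hS x).1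
  have l2 := fun t a b S hS x => (low t a b S hS x).2
  have t1 := fun t a b x => (top t a b x).1
  have t2 := fun t a b x => (top t a b x).2
  have pb := prod l1 l2 t1 t2
  have p1 := prod l1 l1 t1 t1
  have p2 := prod l2 l2 t2 t2
  have pa : ∀ s, 0 < s → s < t → ∀ x, |FD L (qa u1 u2 s) x| ≤
        2 ^ L.length * A ^ 2 * nP L + 2 * A * E * nP L * (√s)⁻¹ := by
    intro s hs hst x
    have e : qa u1 u2 s = fun y => (1/2) * (u1 s y * u1 s y - u2 s y * u2 s y) := by
      funext y; rw [qa]; ring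
    have q1 := abs_le.1 (p1 s hs hst x)
    have q2 := abs_le.1 (p2 s hs hst x)
    rw [e, FD_const_mul, FD_sub, abs_le]
    constructor <;> linarith
  have duh (j k : ℕ) (hjk : j + k = 1) (x : ℝ²) : |FD L (DW j k (qa u1 u2) (qb u1 u2) t) x| ≤
      (2 ^ L.length * A * √τ + E / 2) * (√t)⁻¹ * nP L := by
    rw [DW_FD hjk (h.tb1.qa h.tb2) (h.tb1.qb h.tb2)]
    refine (DW_abs_le_weight hjk ht (A := 2 ^ L.length * A ^ 2 * nP L) (C := 2 * A * E * nP L)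
      (by positivity) (by positivity) pa pb x).trans ?_
    have hb := T0_bound hA (t := 4 * t) (by linarith)
    have e4 : √(2 * (4 * t)) = 2 * √(2 * t) := by
      rw [show 2 * (4 * t) = 2 ^ 2 * (2 * t) by ring, sqrt_mul (by norm_num),
        sqrt_sq (by norm_num)]
    rw [e4] at hb
    have s2 : √t ≤ √(2 * t) := sqrt_le_sqrt (by linarith)
    have z : KW * √(2 * t) * A ≤ 1 / 16 := by
      nlinarith
    have z' : KW * √t * A ≤ 1 / 16 := le_trans (by gcongr) z
    rw [← div_eq_mul_inv, div_mul_eq_mul_div, le_div_iff₀ st]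
    calc KW * (√(2 * t) * (2 ^ L.length * A ^ 2 * nP L) + 4 * (2 * A * E * nP L)) * √t
        = (KW * √(2 * t) * A) * (2 ^ L.length * A * √t * nP L) +
            (KW * √t * A) * (8 * E * nP L) := by ring
      _ ≤ 1 / 16 * (2 ^ L.length * A * √t * nP L) + 1 / 16 * (8 * E * nP L) := by gcongr
      _ ≤ 1 * (2 ^ L.length * A * √τ * nP L) + 1 / 16 * (8 * E * nP L) := by
          gcongr; norm_num
      _ = _ := by ring
  intro x
  constructor
  · have : u1 t = fun x => HS t (u1 0) x - DW 0 1 (qa u1 u2) (qb u1 u2) t x :=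
      funext fun x => h.eq1 t ht.le htτ x
    rw [this, FD_sub]
    refine (abs_sub _ _).trans ((add_le_add (i1 x) (duh 0 1 rfl x)).trans (le_of_eq (by ring)))
  · have : u2 t = fun x => HS t (u2 0) x + DW 1 0 (qa u1 u2) (qb u1 u2) t x :=
      funext fun x => h.eq2 t ht.le htτ x
    rw [this, FD_add]
    refine (abs_add_le _ _).trans ((add_le_add (i2 x) (duh 1 0 rfl x)).trans (le_of_eq (by ring)))

theorem FD_eq_zero {L : List ℝ²} (h : nP L = 0) (f : ℝ² → ℝ) (x : ℝ²) : FD L f x = 0 := by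
  induction L generalizing x with
  | nil => simp at h
  | cons a L ih =>
    rw [FD_cons]
    rw [nP_cons, mul_eq_zero, norm_eq_zero] at h
    rcases h with rfl | h
    · simp
    · rw [ih h, ih h, sub_zero]

theorem Mild.fd_short (h : Mild τ M u1 u2) (hA : 0 ≤ A)
    (hτ0 : 0 < τ) (hτ : 4 * τ ≤ T0 A) {L : List ℝ²} (hL : 1 ≤ L.length)
    (low : ∀ t, 0 ≤ t → t ≤ τ → ∀ S, S.length < L.length → ∀ x,
      |FD S (u1 t) x| ≤ A * nP S ∧ |FD S (u2 t) x| ≤ A * nP S) (x : ℝ²) :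
    |FD L (u1 τ) x| ≤ 2 * ((hm 1 0 + hm 0 1) * A + 2 ^ L.length * A * √τ) * (√τ)⁻¹ * nP L ∧
    |FD L (u2 τ) x| ≤ 2 * ((hm 1 0 + hm 0 1) * A + 2 ^ L.length * A * √τ) * (√τ)⁻¹ * nP L := by
  rcases (nP_nonneg L).eq_or_lt with hN | hN
  · simp [← hN, FD_eq_zero hN.symm]
  have hM := h.tb1.nonneg
  have := hm_nonneg 1 0; have := hm_nonneg 0 1
  set K := (hm 1 0 + hm 0 1) * A + 2 ^ L.length * A * √τ with hK
  set d := √τ * (2 ^ L.length * M) / nP L with hd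
  have H : ∀ n : ℕ, ∀ t, 0 < t → t ≤ τ → ∀ x,
      |FD L (u1 t) x| ≤ (2 * K + d * (1/2) ^ n) * (√t)⁻¹ * nP L ∧
      |FD L (u2 t) x| ≤ (2 * K + d * (1/2) ^ n) * (√t)⁻¹ * nP L := by
    intro n
    induction n with
    | zero =>
      intro t ht htτ x
      have key : 2 ^ L.length * M ≤ (2 * K + d * (1/2) ^ 0) * (√t)⁻¹ * nP L := by
        calc 2 ^ L.length * M = √t * (2 ^ L.length * M) * (√t)⁻¹ := by field_simp
          _ ≤ √τ * (2 ^ L.length * M) * (√t)⁻¹ := by gcongr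
          _ = (0 + d * (1/2) ^ 0) * (√t)⁻¹ * nP L := by rw [hd]; field_simp; ring
          _ ≤ _ := by gcongr; positivity
      exact ⟨(FD_abs_le L (h.tb1.bd t) x).trans key, (FD_abs_le L (h.tb2.bd t) x).trans key⟩
    | succ n ih =>
      have := h.fd_halve hA (by positivity) hτ hL low ih
      intro t ht htτ x
      have e : K + (2 * K + d * (1/2) ^ n) / 2 = 2 * K + d * (1/2) ^ (n + 1) := by ring
      simpa only [← hK, e] using this t ht htτ x
  have lim : Tendsto (fun n : ℕ => (2 * K + d * (1/2 : ℝ) ^ n) * (√τ)⁻¹ * nP L) atTop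
      (𝓝 (2 * K * (√τ)⁻¹ * nP L)) := by
    have := (tendsto_pow_atTop_nhds_zero_of_lt_one (by norm_num : (0:ℝ) ≤ 1/2)
      (by norm_num)).const_mul d
    simpa using ((this.const_add (2 * K)).mul_const (√τ)⁻¹).mul_const (nP L)
  exact ⟨ge_of_tendsto' lim fun n => (H n τ hτ0 le_rfl x).1,
    ge_of_tendsto' lim fun n => (H n τ hτ0 le_rfl x).2⟩

/-- Instantaneous smoothing of mild solutions. -/
theorem Mild.fd_bound (n : ℕ) (hM : 0 ≤ M) (hσ : 0 < σ) : ∃ A, M ≤ A ∧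
    ∀ (T : ℝ) (u1 u2 : ℝ → ℝ² → ℝ), Mild T M u1 u2 → ∀ t, σ ≤ t → t ≤ T →
      ∀ L : List ℝ², L.length ≤ n → ∀ x, |FD L (u1 t) x| ≤ A * nP L ∧ |FD L (u2 t) x| ≤ A * nP L := by
  induction n generalizing σ with
  | zero =>
    refine ⟨M, le_rfl, fun T u1 u2 h t _ _ L hL x => ?_⟩
    obtain rfl := List.eq_nil_of_length_eq_zero (Nat.le_zero.1 hL)
    simpa using ⟨h.tb1.bd t x, h.tb2.bd t x⟩
  | succ n ih =>
    obtain ⟨A, hMA, H⟩ := ih (half_pos hσ)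
    have hA := hM.trans hMA
    set τ := min (σ / 2) (T0 A / 4) with hτ
    have hτ0 : 0 < τ := lt_min (by linarith) (by linarith [T0_pos hA])
    have hτ1 : τ ≤ σ / 2 := min_le_left _ _
    have hτ2 : 4 * τ ≤ T0 A := by linarith [min_le_right (σ / 2) (T0 A / 4)]
    refine ⟨max A (2 * ((hm 1 0 + hm 0 1) * A + 2 ^ (n + 1) * A * √τ) * (√τ)⁻¹),
      hMA.trans (le_max_left _ _), fun T u1 u2 h t ht htT L hL x => ?_⟩
    rcases hL.lt_or_eq with hL | hL
    · have := H T u1 u2 h t (by linarith) htT L (by omega) x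
      exact ⟨this.1.trans (mul_le_mul_of_nonneg_right (le_max_left _ _) (nP_nonneg L)),
        this.2.trans (mul_le_mul_of_nonneg_right (le_max_left _ _) (nP_nonneg L))⟩
    · have h' := (h.restart (s := t - τ) (by linarith) (by linarith)).mono (T' := τ) (by linarith)
      have := h'.fd_short hA hτ0 hτ2 (L := L) (by omega) (fun s hs hsτ S hS x =>
        H T u1 u2 h (t - τ + s) (by linarith) (by linarith) S (by omega) x) x
      rw [hL, sub_add_cancel] at this
      exact ⟨this.1.trans (mul_le_mul_of_nonneg_right (le_max_right _ _) (nP_nonneg L)),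
        this.2.trans (mul_le_mul_of_nonneg_right (le_max_right _ _) (nP_nonneg L))⟩

/-! ### Functions with bounded spatial derivatives of all orders -/

/-- Continuous functions on `I × ℝ²` all of whose spatial derivatives are bounded, in terms of
finite differences. -/
structure SB (I : Set ℝ) (F : ℝ → ℝ² → ℝ) : Prop where
  cont : ContinuousOn (fun p : ℝ × ℝ² => F p.1 p.2) (I ×ˢ univ)
  fd : ∀ n, ∃ C, 0 ≤ C ∧ ∀ L : List ℝ², L.length = n → ∀ t ∈ I, ∀ x, |FD L (F t) x| ≤ C * nP L

section
variable {J : Set ℝ}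

theorem SB.bd (h : SB I F) : ∃ C, 0 ≤ C ∧ ∀ t ∈ I, ∀ x, |F t x| ≤ C := by
  obtain ⟨C, h0, hC⟩ := h.fd 0
  exact ⟨C, h0, fun t ht x => by simpa using hC [] rfl t ht x⟩

theorem SB.slice_cont (h : SB I F) (ht : t ∈ I) : Continuous (F t) := by
  rw [← continuousOn_univ]
  exact h.cont.comp (f := fun x : ℝ² => (t, x)) (by fun_prop) (fun x _ => ⟨ht, trivial⟩)

theorem SB.time_cont (h : SB I F) (x : ℝ²) : ContinuousOn (fun t => F t x) I :=
  h.cont.comp (f := fun t : ℝ => (t, x)) (by fun_prop) (fun t ht => ⟨ht, trivial⟩)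

theorem SB.slice (h : SB I F) (ht : t ∈ I) : SB univ (fun _ => F t) := by
  refine ⟨((h.slice_cont ht).comp continuous_snd).continuousOn, fun n => ?_⟩
  obtain ⟨C, h0, hC⟩ := h.fd n
  exact ⟨C, h0, fun L hL _ _ x => hC L hL t ht x⟩

theorem SB.congr (h : SB I F) (e : ∀ t ∈ I, F t = G t) : SB I G := by
  refine ⟨h.cont.congr fun p hp => (congrFun (e p.1 hp.1) p.2).symm, fun n => ?_⟩
  obtain ⟨C, h0, hC⟩ := h.fd n
  exact ⟨C, h0, fun L hL t ht x => by rw [← e t ht]; exact hC L hL t ht x⟩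

theorem SB.add (h : SB I F) (h' : SB I G) : SB I (fun t x => F t x + G t x) := by
  refine ⟨h.cont.add h'.cont, fun n => ?_⟩
  obtain ⟨C, h0, hC⟩ := h.fd n
  obtain ⟨D, h1, hD⟩ := h'.fd n
  refine ⟨C + D, by positivity, fun L hL t ht x => ?_⟩
  rw [FD_add, add_mul]
  exact (abs_add_le _ _).trans (add_le_add (hC L hL t ht x) (hD L hL t ht x))

theorem SB.const_mul (h : SB I F) (c : ℝ) : SB I (fun t x => c * F t x) := by
  refine ⟨continuousOn_const.mul h.cont, fun n => ?_⟩
  obtain ⟨C, h0, hC⟩ := h.fd n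
  refine ⟨|c| * C, by positivity, fun L hL t ht x => ?_⟩
  rw [FD_const_mul, abs_mul, mul_assoc]
  exact mul_le_mul_of_nonneg_left (hC L hL t ht x) (abs_nonneg c)

theorem SB.mul (h : SB I F) (h' : SB I G) : SB I (fun t x => F t x * G t x) := by
  refine ⟨h.cont.mul h'.cont, fun n => ?_⟩
  choose a ha0 ha using h.fd
  choose b hb0 hb using h'.fd
  refine ⟨∑ p ∈ Finset.HasAntidiagonal.antidiagonal n, (n.choose p.1 : ℝ) * (a p.1 * b p.2),
    Finset.sum_nonneg fun p _ => by have := ha0 p.1; have := hb0 p.2; positivity,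
    fun L hL t ht x => ?_⟩
  subst hL
  exact FD_mul_le L (fun S _ x => ha _ S rfl t ht x) (fun S _ x => hb _ S rfl t ht x) x

theorem FD_const (L : List ℝ²) (c : ℝ) (x : ℝ²) : FD L (fun _ => c) x = if L = [] then c else 0 := by
  induction L generalizing x with
  | nil => simp
  | cons a L ih => rw [FD_cons, ih, ih]; simp

theorem SB.const (I : Set ℝ) (c : ℝ) : SB I (fun _ _ => c) := by
  refine ⟨continuousOn_const, fun n => ⟨|c|, abs_nonneg c, fun L _ t _ x => ?_⟩⟩
  have := nP_nonneg L
  rw [FD_const]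
  split_ifs with h
  · simp [h]
  · simp; positivity

/-- Dyadic difference quotients. -/
def dq (e : ℝ²) (n : ℕ) (f : ℝ² → ℝ) (x : ℝ²) : ℝ :=
  2 ^ n * (f (x + ((1 / 2 : ℝ) ^ n) • e) - f x)

theorem dq_succ_sub
    (hC : ∀ L : List ℝ², L.length = 2 → ∀ x, |FD L f x| ≤ C * nP L) (n : ℕ) (x : ℝ²) :
    |dq e n f x - dq e (n + 1) f x| ≤ C * ‖e‖ ^ 2 / 4 * (1 / 2) ^ n := by
  set h := ((1 / 2 : ℝ) ^ (n + 1)) • e with hh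
  have e1 : dq e n f x - dq e (n + 1) f x = 2 ^ n * FD [h, h] f x := by
    have : ((1 / 2 : ℝ) ^ n) • e = h + h := by rw [hh, ← add_smul]; congr 1; ring
    simp only [dq, FD_cons, FD_nil, this, ← hh]
    rw [← add_assoc]; ring
  have e2 : nP [h, h] = ((1/2 : ℝ) ^ (n + 1)) ^ 2 * ‖e‖ ^ 2 := by
    rw [nP_cons, nP_cons, nP_nil, hh, norm_smul, norm_eq_abs, abs_of_pos (by positivity)]; ring
  rw [e1, abs_mul, abs_of_pos (by positivity)]
  calc 2 ^ n * |FD [h, h] f x| ≤ 2 ^ n * (C * nP [h, h]) :=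
        mul_le_mul_of_nonneg_left (hC _ rfl x) (by positivity)
    _ = ((2 : ℝ) ^ n * (1/2) ^ n) * (C * ‖e‖ ^ 2 / 4 * (1 / 2) ^ n) := by rw [e2]; ring
    _ = _ := by rw [← mul_pow]; norm_num

theorem FD_dq (L : List ℝ²) (e : ℝ²) (n : ℕ) (f : ℝ² → ℝ) (x : ℝ²) :
    FD L (dq e n f) x = 2 ^ n * FD (((1 / 2 : ℝ) ^ n) • e :: L) f x := by
  rw [FD_cons', ← FD_const_mul]; rfl

theorem FD_tendsto (L : List ℝ²) {f : ℕ → ℝ² → ℝ}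
    (h : ∀ x, Tendsto (fun n => f n x) atTop (𝓝 (g x))) (x : ℝ²) :
    Tendsto (fun n => FD L (f n) x) atTop (𝓝 (FD L g x)) := by
  induction L generalizing x with
  | nil => exact h x
  | cons a L ih => exact (ih (x + a)).sub (ih x)

theorem SB.exists_deriv (h : SB I F) (e : ℝ²) : ∃ G, SB I G ∧ (∀ t ∈ I, DD e (F t) (G t)) ∧
    ∃ C, ∀ n, ∀ t ∈ I, ∀ x, |dq e n (F t) x - G t x| ≤ C * (1 / 2) ^ n := by
  obtain ⟨C, hC0, hC⟩ := h.fd 2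
  have hq : ∀ t ∈ I, ∀ x, ∃ g, Tendsto (fun n => dq e n (F t) x) atTop (𝓝 g) := fun t ht x =>
    cauchySeq_tendsto_of_complete (cauchySeq_of_le_geometric (1/2) (C * ‖e‖ ^ 2 / 4) (by norm_num)
      fun n => dq_succ_sub (fun L hL x => hC L hL t ht x) n x)
  choose! G hG using hq
  have hu : ∀ n, ∀ t ∈ I, ∀ x, |dq e n (F t) x - G t x| ≤ C * ‖e‖ ^ 2 / 2 * (1 / 2) ^ n := by
    intro n t ht x
    have := dist_le_of_le_geometric_of_tendsto (1/2) (C * ‖e‖ ^ 2 / 4) (by norm_num)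
      (fun n => dq_succ_sub (fun L hL x => hC L hL t ht x) n x) (hG t ht x) n
    rw [Real.dist_eq] at this
    exact this.trans (le_of_eq (by ring))
  have lim : Tendsto (fun n : ℕ => C * ‖e‖ ^ 2 / 2 * (1 / 2 : ℝ) ^ n) atTop (𝓝 0) := by
    simpa using (tendsto_pow_atTop_nhds_zero_of_lt_one (by norm_num : (0:ℝ) ≤ 1/2)
      (by norm_num)).const_mul (C * ‖e‖ ^ 2 / 2)
  have hdq : ∀ n, ContinuousOn (fun p : ℝ × ℝ² => dq e n (F p.1) p.2) (I ×ˢ univ) := by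
    intro n
    refine continuousOn_const.mul (ContinuousOn.sub ?_ h.cont)
    exact h.cont.comp (f := fun p : ℝ × ℝ² => (p.1, p.2 + ((1/2 : ℝ) ^ n) • e)) (by fun_prop)
      (fun p hp => ⟨hp.1, trivial⟩)
  have hGc : ContinuousOn (fun p : ℝ × ℝ² => G p.1 p.2) (I ×ˢ univ) := by
    refine TendstoUniformlyOn.continuousOn (F := fun n (p : ℝ × ℝ²) => dq e n (F p.1) p.2)
      (p := atTop) ?_ (Eventually.of_forall hdq).frequently
    rw [Metric.tendstoUniformlyOn_iff]
    intro ε hε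
    filter_upwards [lim.eventually_lt_const hε] with n hn p hp
    rw [dist_comm, Real.dist_eq]
    exact (hu n p.1 hp.1 p.2).trans_lt hn
  refine ⟨G, ⟨hGc, fun m => ?_⟩, fun t ht x => ?_, _, hu⟩
  · obtain ⟨D, hD0, hD⟩ := h.fd (m + 1)
    refine ⟨‖e‖ * D, by positivity, fun L hL t ht x => ?_⟩
    refine le_of_tendsto (FD_tendsto L (hG t ht) x).abs (.of_forall fun n => ?_)
    rw [FD_dq, abs_mul, abs_of_pos (by positivity)]
    calc 2 ^ n * |FD (((1 / 2 : ℝ) ^ n) • e :: L) (F t) x|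
        ≤ 2 ^ n * (D * nP (((1 / 2 : ℝ) ^ n) • e :: L)) :=
          mul_le_mul_of_nonneg_left (hD _ (by simp [hL]) t ht x) (by positivity)
      _ = ((2 : ℝ) ^ n * (1/2) ^ n) * (‖e‖ * D * nP L) := by
          rw [nP_cons, norm_smul, norm_eq_abs, abs_of_pos (by positivity)]; ring
      _ = _ := by rw [← mul_pow]; norm_num
  · set f : ℝ → ℝ := fun s => F t (x + s • e) with hf
    have fc : Continuous f := (h.slice_cont ht).comp (by fun_prop)
    set P : ℝ → ℝ := fun s => ∫ r in (0:ℝ)..s, f r with hP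
    have hPd : ∀ s, HasDerivAt P (f s) s := fun s =>
      intervalIntegral.integral_hasDerivAt_right (fc.intervalIntegrable _ _)
        (fc.stronglyMeasurableAtFilter _ _) fc.continuousAt
    refine hasDerivAt_of_tendstoUniformly (l := atTop) (f := fun n s =>
        2 ^ n * (P (s + (1/2 : ℝ) ^ n) - P s))
      (f' := fun n s => dq e n (F t) (x + s • e)) (g' := fun s => G t (x + s • e)) ?_ ?_ ?_ 0 |>.congr_deriv
        (by simp)
    · rw [Metric.tendstoUniformly_iff]
      intro ε hε
      filter_upwards [lim.eventually_lt_const hε] with n hn s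
      rw [dist_comm, Real.dist_eq]
      exact (hu n t ht _).trans_lt hn
    · refine .of_forall fun n s => ?_
      have := ((HasDerivAt.comp_add_const s ((1/2 : ℝ) ^ n) (hPd _)).sub (hPd s)).const_mul ((2:ℝ) ^ n)
      refine this.congr_deriv ?_
      simp only [hf, dq, add_smul, add_assoc]
    · intro s
      have h1 := (hPd s).tendsto_slope_zero
      have h2 : Tendsto (fun n : ℕ => (1/2 : ℝ) ^ n) atTop (𝓝[≠] 0) :=
        tendsto_nhdsWithin_iff.2 ⟨tendsto_pow_atTop_nhds_zero_of_lt_one (by norm_num) (by norm_num),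
          Eventually.of_forall fun n => by simp⟩
      refine (h1.comp h2).congr fun n => ?_
      simp

theorem SB.dd1 (h : SB I F) (ht : t ∈ I) : DD (1, 0) (F t) (pd1 (F t)) := by
  obtain ⟨G, _, hd, _⟩ := h.exists_deriv (1, 0)
  rw [(hd t ht).pd1_eq]; exact hd t ht

theorem SB.dd2 (h : SB I F) (ht : t ∈ I) : DD (0, 1) (F t) (pd2 (F t)) := by
  obtain ⟨G, _, hd, _⟩ := h.exists_deriv (0, 1)
  rw [(hd t ht).pd2_eq]; exact hd t ht

theorem SB.d1 (h : SB I F) : SB I (fun t => pd1 (F t)) := by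
  obtain ⟨G, hG, hd, _⟩ := h.exists_deriv (1, 0)
  exact hG.congr fun t ht => (hd t ht).pd1_eq.symm

theorem SB.d2 (h : SB I F) : SB I (fun t => pd2 (F t)) := by
  obtain ⟨G, hG, hd, _⟩ := h.exists_deriv (0, 1)
  exact hG.congr fun t ht => (hd t ht).pd2_eq.symm

theorem SB.dq_lim (h : SB I F) (hG : ∀ t ∈ I, DD e (F t) (G t)) :
    ∃ C, ∀ n, ∀ t ∈ I, ∀ x, |dq e n (F t) x - G t x| ≤ C * (1 / 2) ^ n := by
  obtain ⟨G', _, hd, C, hC⟩ := h.exists_deriv e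
  exact ⟨C, fun n t ht x => by rw [(hG t ht).unique (hd t ht)]; exact hC n t ht x⟩

/-- Exchanging a time derivative and a spatial derivative. -/
theorem SB.time_deriv_swap (hI : IsOpen I) (hF : SB I F) (hG : SB I G)
    (hd : ∀ t ∈ I, ∀ x, HasDerivAt (fun s => F s x) (G t x) t) {F' G' : ℝ → ℝ² → ℝ}
    (hF' : ∀ t ∈ I, DD e (F t) (F' t)) (hG' : ∀ t ∈ I, DD e (G t) (G' t)) :
    ∀ t ∈ I, ∀ x, HasDerivAt (fun s => F' s x) (G' t x) t := by
  intro t ht x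
  obtain ⟨C, hC⟩ := hF.dq_lim hF'
  obtain ⟨D, hD⟩ := hG.dq_lim hG'
  have lim (C : ℝ) : Tendsto (fun n : ℕ => C * (1 / 2 : ℝ) ^ n) atTop (𝓝 0) := by
    simpa using (tendsto_pow_atTop_nhds_zero_of_lt_one (by norm_num : (0:ℝ) ≤ 1/2)
      (by norm_num)).const_mul C
  refine hasDerivAt_of_tendstoUniformlyOn (l := atTop) (f := fun n s => dq e n (F s) x)
    (f' := fun n s => dq e n (G s) x) (g' := fun s => G' s x) hI ?_ ?_ ?_ ht
  · rw [Metric.tendstoUniformlyOn_iff]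
    intro ε hε
    filter_upwards [(lim D).eventually_lt_const hε] with n hn s hs
    rw [dist_comm, Real.dist_eq]
    exact (hD n s hs x).trans_lt hn
  · exact .of_forall fun n s hs => ((hd s hs _).sub (hd s hs _)).const_mul _
  · intro s hs
    rw [tendsto_iff_norm_sub_tendsto_zero]
    exact squeeze_zero (fun _ => norm_nonneg _) (fun n => hC n s hs x) (lim C)

end

/-! ### Averaging operators -/

/-- The averaging operator with kernel `κ` and displacement `φ`. -/
def AV {W : Type} [MeasurableSpace W] (m : Measure W) (κ : W → ℝ) (φ : W → ℝ²) (f : ℝ² → ℝ)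
    (x : ℝ²) : ℝ := ∫ w, κ w * f (x + φ w) ∂m

section
variable {W : Type} [MeasurableSpace W] {m : Measure W} {κ : W → ℝ} {φ : W → ℝ²}

theorem AV_abs_le (hκ : Integrable κ m) (hC : ∀ x, |f x| ≤ C) (x : ℝ²) :
    |AV m κ φ f x| ≤ (∫ w, |κ w| ∂m) * C := avg_abs_le hκ fun _ => hC _

theorem AV_integrable (hκ : Integrable κ m) (hφ : Measurable φ) (hf : Continuous f)
    (hC : ∀ x, |f x| ≤ C) (x : ℝ²) : Integrable (fun w => κ w * f (x + φ w)) m :=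
  avg_integrable hκ (hf.measurable.comp (hφ.const_add x)).aestronglyMeasurable fun _ => hC _

theorem AV_shift (f : ℝ² → ℝ) (a x : ℝ²) :
    AV m κ φ (fun y => f (y + a)) x = AV m κ φ f (x + a) := by
  simp only [AV, add_right_comm x a]

theorem AV_sub (hκ : Integrable κ m) (hφ : Measurable φ) (hf : BC C f)
    (hg : BC D g) (x : ℝ²) : AV m κ φ (fun y => f y - g y) x = AV m κ φ f x - AV m κ φ g x := by
  simp only [AV, mul_sub]
  exact integral_sub (AV_integrable hκ hφ hf.cont hf.bd x) (AV_integrable hκ hφ hg.cont hg.bd x)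

theorem AV_add (hκ : Integrable κ m) (hφ : Measurable φ) (hf : BC C f)
    (hg : BC D g) (x : ℝ²) : AV m κ φ (fun y => f y + g y) x = AV m κ φ f x + AV m κ φ g x := by
  simp only [AV, mul_add]
  exact integral_add (AV_integrable hκ hφ hf.cont hf.bd x) (AV_integrable hκ hφ hg.cont hg.bd x)

theorem AV_const_mul (c : ℝ) (f : ℝ² → ℝ) (x : ℝ²) :
    AV m κ φ (fun y => c * f y) x = c * AV m κ φ f x := by
  simp only [AV, mul_left_comm _ c, integral_const_mul]

theorem AV_contOn {P : Type*} [TopologicalSpace P] [FirstCountableTopology P] {s : Set P}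
    (hκ : Integrable κ m) (hφ : Measurable φ) {F : P → ℝ² → ℝ}
    (hF : ContinuousOn (fun p : P × ℝ² => F p.1 p.2) (s ×ˢ univ)) (hC : ∀ p ∈ s, ∀ x, |F p x| ≤ C) :
    ContinuousOn (fun p : P × ℝ² => AV m κ φ (F p.1) p.2) (s ×ˢ univ) := by
  refine avg_continuousOn hκ (C := C) (fun p hp => ?_) (fun p hp w => hC _ hp.1 _) (fun w => ?_)
  · have : Continuous (F p.1) := by
      rw [← continuousOn_univ]
      exact hF.comp (f := fun x : ℝ² => (p.1, x)) (by fun_prop) (fun x _ => ⟨hp.1, trivial⟩)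
    exact (this.measurable.comp (hφ.const_add _)).aestronglyMeasurable
  · exact hF.comp (f := fun p : P × ℝ² => (p.1, p.2 + φ w)) (by fun_prop)
      (fun x hx => ⟨hx.1, trivial⟩)

theorem AV_FD (hκ : Integrable κ m) (hφ : Measurable φ) (L : List ℝ²)
    (h : BC C f) (x : ℝ²) : FD L (AV m κ φ f) x = AV m κ φ (FD L f) x := by
  induction L generalizing x with
  | nil => rfl
  | cons a L ih =>
    have hs : BC _ (fun y => FD L f (y + a)) :=
      ⟨(h.fd L).cont.comp (by fun_prop : Continuous fun p : ℝ² => p + a), fun x => (h.fd L).bd _⟩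
    change FD L (AV m κ φ f) (x + a) - FD L (AV m κ φ f) x =
      AV m κ φ (fun y => FD L f (y + a) - FD L f y) x
    rw [AV_sub hκ hφ hs (h.fd L), AV_shift, ih, ih]

theorem AV_DD (hκ : Integrable κ m) (hφ : Measurable φ) (hd : DD e f g)
    (hf : BC C f) (hg : BC D g) : DD e (AV m κ φ f) (AV m κ φ g) := by
  intro x
  have := avg_hasDerivAt hκ (g := fun s w => f (x + φ w + s • e)) (g' := fun s w => g (x + φ w + s • e))
    (s := univ) (t := 0) univ_mem (C := C) (C' := D)
    (fun p _ => (hf.cont.measurable.comp ((hφ.const_add x).add_const _)).aestronglyMeasurable)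
    (fun w => hf.bd _)
    (hg.cont.measurable.comp ((hφ.const_add x).add_const _)).aestronglyMeasurable
    (fun p _ w => hg.bd _) (fun p _ w => hd.at _ _)
  simp only [zero_smul, add_zero] at this
  simpa only [AV, add_right_comm x] using this

theorem SB.bc (h : SB I F) : ∃ C, ∀ t ∈ I, BC C (F t) := by
  obtain ⟨C, _, hC⟩ := h.bd
  exact ⟨C, fun t ht => ⟨h.slice_cont ht, hC t ht⟩⟩

theorem SB.av (h : SB I F) (hκ : Integrable κ m) (hφ : Measurable φ) :
    SB I (fun t => AV m κ φ (F t)) := by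
  obtain ⟨C, hC⟩ := h.bc
  refine ⟨AV_contOn hκ hφ h.cont fun t ht => (hC t ht).bd, fun n => ?_⟩
  obtain ⟨D, hD0, hD⟩ := h.fd n
  refine ⟨(∫ w, |κ w| ∂m) * D, mul_nonneg (integral_nonneg fun _ => abs_nonneg _) hD0,
    fun L hL t ht x => ?_⟩
  rw [AV_FD hκ hφ L (hC t ht), mul_assoc]
  exact AV_abs_le hκ (hD L hL t ht) x

theorem SB.av_time (I : Set ℝ) (hI : IsOpen I) (hF : SB I F) (hG : SB I G)
    (hd : ∀ t ∈ I, ∀ x, HasDerivAt (fun s => F s x) (G t x) t) (hκ : Integrable κ m)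
    (hφ : Measurable φ) :
    ∀ t ∈ I, ∀ x, HasDerivAt (fun s => AV m κ φ (F s) x) (AV m κ φ (G t) x) t := by
  intro t ht x
  obtain ⟨C, hC⟩ := hF.bc
  obtain ⟨D, hD⟩ := hG.bc
  exact avg_hasDerivAt hκ (g := fun s w => F s (x + φ w)) (g' := fun s w => G s (x + φ w))
    (hI.mem_nhds ht) (fun p hp => ((hC p hp).cont.measurable.comp (hφ.const_add x)).aestronglyMeasurable)
    (fun w => (hC t ht).bd _) ((hD t ht).cont.measurable.comp (hφ.const_add x)).aestronglyMeasurable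
    (fun p hp w => (hD p hp).bd _) (fun p hp w => hd p hp _)

end

/-! ### Smooth functions of time and space -/

/-- Functions having `j` time derivatives, all of them with bounded spatial derivatives. -/
def TS (I : Set ℝ) : ℕ → (ℝ → ℝ² → ℝ) → Prop
  | 0, F => SB I F
  | j + 1, F => SB I F ∧ ∃ G, TS I j G ∧ ∀ t ∈ I, ∀ x, HasDerivAt (fun s => F s x) (G t x) t

theorem TS.sb (h : TS I j F) : SB I F := by
  cases j with
  | zero => exact h
  | succ j => exact h.1

theorem TS.pred (h : TS I (j + 1) F) : TS I j F := by
  induction j generalizing F with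
  | zero => exact h.1
  | succ j ih =>
    obtain ⟨h0, G, hG, hd⟩ := h
    exact ⟨h0, G, ih hG, hd⟩

theorem TS.congr (hI : IsOpen I) (h : TS I j F) (e : ∀ t ∈ I, F t = G t) : TS I j G := by
  cases j with
  | zero => exact SB.congr h e
  | succ j =>
    obtain ⟨h0, H, hH, hd⟩ := h
    refine ⟨h0.congr e, H, hH, fun t ht x => (hd t ht x).congr_of_eventuallyEq ?_⟩
    filter_upwards [hI.mem_nhds ht] with s hs
    rw [e s hs]

theorem TS.add (h : TS I j F) (h' : TS I j G) : TS I j (fun t x => F t x + G t x) := by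
  induction j generalizing F G with
  | zero => exact SB.add h h'
  | succ j ih =>
    obtain ⟨h0, H, hH, hd⟩ := h
    obtain ⟨h0', H', hH', hd'⟩ := h'
    exact ⟨h0.add h0', _, ih hH hH', fun t ht x => (hd t ht x).add (hd' t ht x)⟩

theorem TS.const_mul (h : TS I j F) (c : ℝ) : TS I j (fun t x => c * F t x) := by
  induction j generalizing F with
  | zero => exact SB.const_mul h c
  | succ j ih =>
    obtain ⟨h0, H, hH, hd⟩ := h
    exact ⟨h0.const_mul c, _, ih hH, fun t ht x => (hd t ht x).const_mul c⟩

theorem TS.mul (h : TS I j F) (h' : TS I j G) : TS I j (fun t x => F t x * G t x) := by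
  induction j generalizing F G with
  | zero => exact SB.mul h h'
  | succ j ih =>
    have p := h.pred
    have p' := h'.pred
    obtain ⟨h0, H, hH, hd⟩ := h
    obtain ⟨h0', H', hH', hd'⟩ := h'
    exact ⟨h0.mul h0', _, (ih hH p').add (ih p hH'), fun t ht x => (hd t ht x).fun_mul (hd' t ht x)⟩

theorem TS.d1 (hI : IsOpen I) (h : TS I j F) : TS I j (fun t => pd1 (F t)) := by
  induction j generalizing F with
  | zero => exact SB.d1 h
  | succ j ih =>
    obtain ⟨h0, H, hH, hd⟩ := h
    exact ⟨h0.d1, _, ih hH, h0.time_deriv_swap hI hH.sb hd (fun t ht => h0.dd1 ht)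
      (fun t ht => hH.sb.dd1 ht)⟩

theorem TS.d2 (hI : IsOpen I) (h : TS I j F) : TS I j (fun t => pd2 (F t)) := by
  induction j generalizing F with
  | zero => exact SB.d2 h
  | succ j ih =>
    obtain ⟨h0, H, hH, hd⟩ := h
    exact ⟨h0.d2, _, ih hH, h0.time_deriv_swap hI hH.sb hd (fun t ht => h0.dd2 ht)
      (fun t ht => hH.sb.dd2 ht)⟩

theorem TS.av (hI : IsOpen I) (h : TS I j F) {W : Type} [MeasurableSpace W] {m : Measure W} {κ : W → ℝ}
    {φ : W → ℝ²} (hκ : Integrable κ m) (hφ : Measurable φ) : TS I j (fun t => AV m κ φ (F t)) := by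
  induction j generalizing F with
  | zero => exact SB.av h hκ hφ
  | succ j ih =>
    obtain ⟨h0, H, hH, hd⟩ := h
    exact ⟨h0.av hκ hφ, _, ih hH, SB.av_time I hI h0 hH.sb hd hκ hφ⟩

theorem SB.hasFDerivAt (hI : IsOpen I) (hF : SB I F) (hG : SB I G)
    (hd : ∀ t ∈ I, ∀ x, HasDerivAt (fun s => F s x) (G t x) t) (ht : t ∈ I) (x : ℝ²) :
    HasFDerivAt (fun p : ℝ × ℝ² => F p.1 p.2)
      (G t x • ContinuousLinearMap.fst ℝ ℝ ℝ² +
        (pd1 (F t) x • (ContinuousLinearMap.fst ℝ ℝ ℝ ∘L ContinuousLinearMap.snd ℝ ℝ ℝ²) +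
        pd2 (F t) x • (ContinuousLinearMap.snd ℝ ℝ ℝ ∘L ContinuousLinearMap.snd ℝ ℝ ℝ²))) (t, x) := by
  have hn : I ×ˢ (univ : Set ℝ²) ∈ 𝓝 (t, x) := (hI.prod isOpen_univ).mem_nhds ⟨ht, trivial⟩
  have hca {H : ℝ → ℝ² → ℝ} (h : SB I H) : ContinuousAt (fun p : ℝ × ℝ² => H p.1 p.2) (t, x) :=
    h.cont.continuousAt hn
  have := hasStrictFDerivAt_uncurry_coprod (𝕜 := ℝ) (u := (t, x)) (f := F)
    (f₁ := fun s y => ContinuousLinearMap.toSpanSingleton ℝ (G s y))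
    (f₂ := fun s y => pd1 (F s) y • ContinuousLinearMap.fst ℝ ℝ ℝ +
      pd2 (F s) y • ContinuousLinearMap.snd ℝ ℝ ℝ) ?_ ?_ ?_ ?_
  · refine this.hasFDerivAt.congr_fderiv ?_
    ext <;> simp [Function.HasUncurry.uncurry]
  · filter_upwards [hn] with v hv
    exact (hd v.1 hv.1 v.2).hasFDerivAt
  · filter_upwards [hn] with v hv
    refine (DD.hasFDerivAt (hF.dd1 hv.1) (hF.dd2 hv.1) (hF.d1.slice_cont hv.1)
      (hF.d2.slice_cont hv.1) v.2).congr_fderiv ?_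
    ext <;> simp [Function.HasUncurry.uncurry]
  · exact (ContinuousLinearMap.toSpanSingletonCLE (𝕜 := ℝ) (E := ℝ)).continuous.continuousAt.comp (hca hG)
  · exact ((hca hF.d1).smul continuousAt_const).add ((hca hF.d2).smul continuousAt_const)

theorem TS.contDiffOn (hI : IsOpen I) (h : TS I j F) :
    ContDiffOn ℝ j (fun p : ℝ × ℝ² => F p.1 p.2) (I ×ˢ univ) := by
  induction j generalizing F with
  | zero => exact contDiffOn_zero.2 h.sb.cont
  | succ j ih =>
    have p := h.pred
    obtain ⟨h0, H, hH, hd⟩ := h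
    have ho : IsOpen (I ×ˢ (univ : Set ℝ²)) := hI.prod isOpen_univ
    have hf := fun t (ht : t ∈ I) x => h0.hasFDerivAt hI hH.sb hd ht x
    push_cast
    rw [contDiffOn_succ_iff_fderiv_of_isOpen ho]
    refine ⟨fun z hz => (hf z.1 hz.1 z.2).differentiableAt.differentiableWithinAt, by simp, ?_⟩
    refine ContDiffOn.congr ?_ fun z hz => (hf z.1 hz.1 z.2).fderiv
    exact ((ih hH).smul contDiffOn_const).add (((ih (p.d1 hI)).smul contDiffOn_const).add
      ((ih (p.d2 hI)).smul contDiffOn_const))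

theorem contDiffOn_of_TS (hI : IsOpen I) (h : ∀ j, TS I j F) :
    ContDiffOn ℝ ∞ (fun p : ℝ × ℝ² => F p.1 p.2) (I ×ˢ univ) :=
  contDiffOn_infty.2 fun j => (h j).contDiffOn hI

/-! ### The strip and its integrals -/

theorem μΩ_eq_prod : μΩ = (volume : Measure ℝ).prod (volume.restrict (Ico (0:ℝ) 1)) := by
  rw [μΩ, Measure.volume_eq_prod, ← Measure.prod_restrict, Measure.restrict_univ]

theorem integrable_of_even {f : ℝ → ℝ} (hf : IntegrableOn f (Ioi 0)) : Integrable fun x => f |x| := by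
  have h1 : IntegrableOn (fun x => f |x|) (Ioi 0) :=
    hf.congr_fun (fun x hx => by rw [abs_of_pos hx]) measurableSet_Ioi
  have h2 : IntegrableOn (fun x => f |x|) (Iic 0) := by
    have := h1.comp_neg
    simp only [abs_neg] at this
    rw [integrableOn_Iic_iff_integrableOn_Iio]
    simpa using this
  rw [← integrableOn_univ, ← Iic_union_Ioi (a := (0:ℝ))]
  exact h2.union h1

/-- The exponentially decaying weight `1 / cosh (2πx₁)`. -/
def cw (x : ℝ²) : ℝ := (cosh (2 * π * x.1))⁻¹

theorem cw_pos (x : ℝ²) : 0 < cw x := inv_pos.2 (cosh_pos _)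

theorem cw_continuous : Continuous cw :=
  (continuous_cosh.comp (by fun_prop)).inv₀ fun _ => (cosh_pos _).ne'

theorem inv_cosh_le (y : ℝ) : (cosh y)⁻¹ ≤ 2 * exp (-|y|) := by
  rw [inv_le_iff_one_le_mul₀ (cosh_pos _), ← cosh_abs, cosh_eq]
  have : exp |y| * exp (-|y|) = 1 := by rw [← exp_add]; simp
  nlinarith [exp_pos (-|y|), sq_nonneg (exp (-|y|))]

theorem tanh_half_hasDerivAt (x : ℝ) :
    HasDerivAt (fun x => sinh (2 * π * x) / (2 * cosh (2 * π * x))) (π / cosh (2 * π * x) ^ 2) x := by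
  have h : HasDerivAt (fun x : ℝ => 2 * π * x) (2 * π) x := by
    simpa using (hasDerivAt_id x).const_mul (2 * π)
  have h1 := (h.sinh).fun_div (h.cosh.const_mul 2) (mul_ne_zero two_ne_zero (cosh_pos _).ne')
  refine h1.congr_deriv ?_
  have := cosh_sq (2 * π * x)
  field_simp
  linear_combination this

theorem integrable_inv_cosh : Integrable fun x : ℝ => (cosh (2 * π * x))⁻¹ := by
  have h : Integrable fun x : ℝ => 2 * exp (-(2 * π) * |x|) :=
    (integrable_of_even (f := fun x => exp (-(2 * π) * x))
      (exp_neg_integrableOn_Ioi 0 (by positivity))).const_mul 2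
  refine h.mono' (Continuous.aestronglyMeasurable
    ((continuous_cosh.comp (by fun_prop)).inv₀ fun _ => (cosh_pos _).ne'))
    (.of_forall fun x => ?_)
  rw [norm_eq_abs, abs_of_pos (inv_pos.2 (cosh_pos _))]
  refine (inv_cosh_le _).trans (le_of_eq ?_)
  rw [abs_mul, abs_of_pos (by positivity : (0:ℝ) < 2 * π)]
  ring_nf

theorem cw_integrable : Integrable cw μΩ := by
  rw [μΩ_eq_prod]
  exact integrable_inv_cosh.comp_fst _

theorem tendsto_inv_cosh {l : Filter ℝ} (h : Tendsto (fun x : ℝ => |x|) l atTop) :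
    Tendsto (fun x : ℝ => (cosh (2 * π * x))⁻¹) l (𝓝 0) := by
  have h1 : Tendsto (fun x : ℝ => 2 * exp (-|2 * π * x|)) l (𝓝 0) := by
    have : Tendsto (fun x : ℝ => |2 * π * x|) l atTop := by
      simp only [abs_mul (2 * π)]
      exact h.const_mul_atTop (by positivity)
    simpa using (tendsto_exp_neg_atTop_nhds_zero.comp this).const_mul 2
  exact squeeze_zero (fun x => (inv_pos.2 (cosh_pos _)).le) (fun x => inv_cosh_le _) h1

theorem cw_dom_integrable (c : Continuous f) (b : ∀ x, |f x| ≤ C * cw x) :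
    Integrable f μΩ :=
  (cw_integrable.const_mul C).mono' c.aestronglyMeasurable (.of_forall b)

theorem integral_strip_fst {V : ℝ² → ℝ} (c : Continuous f) (b : ∀ x, |f x| ≤ C * cw x)
    (bV : ∀ x, |V x| ≤ C * cw x) (d : DD (1, 0) V f) : ∫ x, f x ∂μΩ = 0 := by
  have hi := cw_dom_integrable c b
  rw [μΩ_eq_prod] at hi ⊢
  rw [integral_prod_symm _ hi]
  refine integral_eq_zero_of_ae (.of_forall fun y => ?_)
  have lim {l : Filter ℝ} (h : Tendsto (fun x : ℝ => |x|) l atTop) :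
      Tendsto (fun x : ℝ => V (x, y)) l (𝓝 0) := by
    refine squeeze_zero_norm (fun x => bV (x, y)) ?_
    simpa [cw] using (tendsto_inv_cosh h).const_mul C
  have := integral_of_hasDerivAt_of_tendsto (f := fun x => V (x, y)) (f' := fun x => f (x, y))
    (fun x => d.fst (x, y)) ((integrable_inv_cosh.const_mul C).mono'
      (c.comp (by fun_prop : Continuous fun x : ℝ => (x, y))).aestronglyMeasurable
      (.of_forall fun x => b (x, y)))
    (lim tendsto_abs_atBot_atTop) (lim tendsto_abs_atTop_atTop)
  simpa using this

theorem integral_strip_snd {V : ℝ² → ℝ} (c : Continuous f) (i : Integrable f μΩ)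
    (d : DD (0, 1) V f) (per : ∀ x, V (x.1, x.2 + 1) = V x) : ∫ x, f x ∂μΩ = 0 := by
  rw [μΩ_eq_prod] at i ⊢
  rw [integral_prod _ i]
  refine integral_eq_zero_of_ae (.of_forall fun y => ?_)
  change ∫ z in Ico (0:ℝ) 1, f (y, z) = 0
  rw [integral_Ico_eq_integral_Ioc, ← intervalIntegral.integral_of_le zero_le_one,
    intervalIntegral.integral_eq_sub_of_hasDerivAt (f := fun z => V (y, z)) (fun z _ => d.snd (y, z))
      ((c.comp (by fun_prop : Continuous fun z : ℝ => (y, z))).intervalIntegrable _ _)]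
  have := per (y, 0)
  simp only [zero_add] at this
  rw [this, sub_self]

theorem integral_cw_sq : ∫ x, π * cw x ^ 2 ∂μΩ = 1 := by
  have e : ∫ x : ℝ, π / cosh (2 * π * x) ^ 2 = 1 := by
    have l0 (x : ℝ) : sinh (2 * π * x) / (2 * cosh (2 * π * x)) = 1/2 - exp (-(2 * π * x)) * (cosh (2 * π * x))⁻¹ / 2 := by
      field_simp
      linarith [cosh_sub_sinh (2 * π * x)]
    have l0' (x : ℝ) : sinh (2 * π * x) / (2 * cosh (2 * π * x)) = -(1/2) + exp (2 * π * x) * (cosh (2 * π * x))⁻¹ / 2 := by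
      field_simp
      linarith [cosh_add_sinh (2 * π * x)]
    have hex {l : Filter ℝ} {g : ℝ → ℝ} (h : Tendsto (fun x : ℝ => |x|) l atTop) (hg : ∀ᶠ x in l, g x ≤ 0) :
        Tendsto (fun x : ℝ => exp (g x) * (cosh (2 * π * x))⁻¹ / 2) l (𝓝 0) := by
      have h1 := (tendsto_inv_cosh h).div_const 2
      rw [zero_div] at h1
      refine squeeze_zero' (.of_forall fun x => ?_) ?_ h1
      · have := cosh_pos (2 * π * x); positivity
      · filter_upwards [hg] with x hx
        have h2 : exp (g x) ≤ 1 := by simpa using hx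
        have : 0 < (cosh (2 * π * x))⁻¹ := by positivity
        nlinarith
    have hint : Integrable fun x : ℝ => π / cosh (2 * π * x) ^ 2 := by
      refine (integrable_inv_cosh.const_mul π).mono' (Continuous.aestronglyMeasurable
        (continuous_const.div ((continuous_cosh.comp (by fun_prop)).pow 2) fun _ =>
          pow_ne_zero 2 (cosh_pos _).ne')) (.of_forall fun x => ?_)
      have h1 := one_le_cosh (2 * π * x)
      rw [norm_eq_abs, abs_of_nonneg (by positivity), div_eq_mul_inv]
      gcongr
      nlinarith
    rw [integral_of_hasDerivAt_of_tendsto tanh_half_hasDerivAt hint (m := -(1/2)) (n := 1/2)]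
    · norm_num
    · simp only [l0']
      have := hex (l := atBot) (g := fun x => 2 * π * x) tendsto_abs_atBot_atTop (by
        filter_upwards [eventually_le_atBot 0] with x hx
        exact mul_nonpos_of_nonneg_of_nonpos (by positivity) hx)
      simpa only [add_zero] using this.const_add (-(1/2))
    · simp only [l0]
      have := hex (l := atTop) (g := fun x => -(2 * π * x)) tendsto_abs_atTop_atTop (by
        filter_upwards [eventually_ge_atTop 0] with x hx
        have : 0 ≤ 2 * π * x := by positivity
        linarith)
      simpa only [sub_zero] using this.const_sub (1/2)
  change ∫ x, π * (cosh (2 * π * x.1))⁻¹ ^ 2 ∂μΩ = 1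
  rw [μΩ_eq_prod, integral_fun_fst (μ := (volume : Measure ℝ)) (ν := volume.restrict (Ico (0:ℝ) 1))
    (fun y => π * (cosh (2 * π * y))⁻¹ ^ 2)]
  simp only [inv_pow, ← div_eq_mul_inv, e]
  simp

/-! ### The singular weight -/

/-- The denominator `2 cosh(2πx₁) - 2 cos(2πx₂) + ε`. -/
def Dk (ε : ℝ) (x : ℝ²) : ℝ := 2 * cosh (2 * π * x.1) - 2 * cos (2 * π * x.2) + ε

theorem Dk_zero_eq (x : ℝ²) : Dk 0 x = 4 * sinh (π * x.1) ^ 2 + 4 * sin (π * x.2) ^ 2 := by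
  rw [Dk, mul_assoc, mul_assoc, cosh_two_mul, cos_two_mul, cosh_sq]
  linear_combination (-4 : ℝ) * sin_sq_add_cos_sq (π * x.2)

theorem Dk_zero_nonneg (x : ℝ²) : 0 ≤ Dk 0 x := by rw [Dk_zero_eq]; positivity

theorem Dk_eq (ε : ℝ) (x : ℝ²) : Dk ε x = Dk 0 x + ε := by simp [Dk]

theorem Dk_pos (hε : 0 < ε) (x : ℝ²) : 0 < Dk ε x := by
  rw [Dk_eq]; linarith [Dk_zero_nonneg x]

theorem Dk_continuous (ε : ℝ) : Continuous (Dk ε) := by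
  unfold Dk; fun_prop

theorem half_mul_exp_le_sinh {y : ℝ} (hy : 0 ≤ y) : y / 2 * exp (y / 2) ≤ sinh y := by
  have h := sinh_two_mul (y / 2)
  rw [mul_div_cancel₀ y two_ne_zero] at h
  have h1 : y / 2 ≤ sinh (y / 2) := self_le_sinh_iff.2 (by positivity)
  have h2 : exp (y / 2) / 2 ≤ cosh (y / 2) := by rw [cosh_eq]; linarith [exp_pos (-(y/2))]
  rw [h]
  nlinarith [exp_pos (y/2)]

theorem min_le_sin_pi {y : ℝ} (h0 : 0 ≤ y) (h1 : y ≤ 1) : 2 * min y (1 - y) ≤ sin (π * y) := by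
  have key {z : ℝ} (hz0 : 0 ≤ z) (hz : z ≤ 1 / 2) : 2 * z ≤ sin (π * z) := by
    have := mul_le_sin (x := π * z) (by positivity) (by nlinarith [pi_pos])
    calc 2 * z = 2 / π * (π * z) := by field_simp
      _ ≤ _ := this
  rcases le_total y (1/2) with h | h
  · rw [min_eq_left (by linarith)]; exact key h0 h
  · rw [min_eq_right (by linarith)]
    have := key (z := 1 - y) (by linarith) (by linarith)
    rwa [show π * (1 - y) = π - π * y by ring, sin_pi_sub] at this

theorem integrable_sing_fst :
    Integrable fun x : ℝ => |x| ^ (-(1/2) : ℝ) * exp (-(1/2) * |x|) := by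
  have := integrableOn_rpow_mul_exp_neg_mul_rpow (p := 1) (s := -(1/2)) (b := 1/2) (by norm_num)
    one_pos (by norm_num)
  simp only [rpow_one] at this
  exact integrable_of_even (f := fun x => x ^ (-(1/2) : ℝ) * exp (-(1/2) * x)) this

theorem integrable_sing_snd :
    IntegrableOn (fun y : ℝ => y ^ (-(1/2) : ℝ) + (1 - y) ^ (-(1/2) : ℝ)) (Ico 0 1) := by
  have h1 : IntervalIntegrable (fun y : ℝ => y ^ (-(1/2) : ℝ)) volume 0 1 :=
    intervalIntegral.intervalIntegrable_rpow' (by norm_num)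
  have h2 : IntervalIntegrable (fun y : ℝ => (1 - y) ^ (-(1/2) : ℝ)) volume 0 1 := by
    simpa using (h1.comp_sub_left 1).symm
  have := h1.add h2
  rw [intervalIntegrable_iff_integrableOn_Ico_of_le zero_le_one] at this
  exact this

theorem ae_strip : ∀ᵐ x ∂μΩ, x.1 ≠ 0 ∧ 0 < x.2 ∧ x.2 < 1 := by
  rw [μΩ_eq_prod]
  have h1 : ∀ᵐ x ∂((volume : Measure ℝ).prod (volume.restrict (Ico (0:ℝ) 1))), x.1 ≠ 0 :=
    Measure.quasiMeasurePreserving_fst.ae (Measure.ae_ne volume (0:ℝ))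
  have h2 : ∀ᵐ x ∂((volume : Measure ℝ).prod (volume.restrict (Ico (0:ℝ) 1))), 0 < x.2 ∧ x.2 < 1 := by
    refine Measure.quasiMeasurePreserving_snd.ae (p := fun y => 0 < y ∧ y < 1) ?_
    filter_upwards [ae_restrict_mem measurableSet_Ico, ae_restrict_of_ae (Measure.ae_ne volume (0:ℝ))]
      with y hy h0
    exact ⟨lt_of_le_of_ne hy.1 (Ne.symm h0), hy.2⟩
  filter_upwards [h1, h2] with x a b using ⟨a, b⟩

theorem Dk_zero_pos_ae : ∀ᵐ x ∂μΩ, 0 < Dk 0 x := by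
  filter_upwards [ae_strip] with x hx
  rw [Dk_zero_eq]
  have : 0 < sin (π * x.2) := by
    refine sin_pos_of_pos_of_lt_pi (mul_pos pi_pos hx.2.1) ?_
    nlinarith [pi_pos, hx.2.2]
  positivity

theorem inv_sqrt_Dk_integrable : Integrable (fun x => (√(Dk 0 x))⁻¹) μΩ := by
  have hi : Integrable (fun x : ℝ² => (|x.1| ^ (-(1/2) : ℝ) * exp (-(1/2) * |x.1|)) *
      (x.2 ^ (-(1/2) : ℝ) + (1 - x.2) ^ (-(1/2) : ℝ))) μΩ := by
    rw [μΩ_eq_prod]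
    exact integrable_sing_fst.mul_prod integrable_sing_snd
  refine hi.mono' (Measurable.aestronglyMeasurable
    ((Dk_continuous 0).measurable.sqrt.inv)) ?_
  filter_upwards [ae_strip] with x hx
  obtain ⟨x1, x2⟩ := x
  obtain ⟨h1, h2, h3⟩ := hx
  simp only at h1 h2 h3 ⊢
  have ha : 0 < |x1| := abs_pos.2 h1
  set m := min x2 (1 - x2) with hm
  have hm0 : 0 < m := lt_min h2 (by linarith)
  have hs : 2 * m ≤ sin (π * x2) := min_le_sin_pi h2.le h3.le
  have hsh : |x1| * exp |x1| ≤ |sinh (π * x1)| := by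
    rw [abs_sinh, abs_mul, abs_of_pos pi_pos]
    refine le_trans ?_ (half_mul_exp_le_sinh (by positivity))
    have := pi_gt_three
    have h4 : |x1| ≤ π * |x1| / 2 := by nlinarith
    gcongr
  have hD : |x1| * exp |x1| * m ≤ Dk 0 (x1, x2) := by
    rw [Dk_zero_eq, ← sq_abs (sinh _)]
    simp only
    set A := |x1| * exp |x1|
    have hA : 0 < A := by positivity
    nlinarith [sq_nonneg (|sinh (π * x1)| - sin (π * x2)), mul_le_mul hsh hs (by positivity) (abs_nonneg _),
      mul_pos hA hm0]
  have e1 : (√(|x1| * exp |x1| * m))⁻¹ = |x1| ^ (-(1/2) : ℝ) * exp (-(1/2) * |x1|) * m ^ (-(1/2) : ℝ) := by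
    rw [sqrt_eq_rpow, ← rpow_neg (by positivity), mul_rpow (by positivity) hm0.le,
      mul_rpow ha.le (exp_pos _).le, ← exp_mul]
    ring_nf
  rw [norm_eq_abs, abs_of_nonneg (by positivity)]
  calc (√(Dk 0 (x1, x2)))⁻¹ ≤ (√(|x1| * exp |x1| * m))⁻¹ :=
        inv_anti₀ (by positivity) (sqrt_le_sqrt hD)
    _ = _ := e1
    _ ≤ _ := by
        refine mul_le_mul_of_nonneg_left ?_ (by positivity)
        have p1 : 0 ≤ x2 ^ (-(1/2) : ℝ) := by positivity
        have p2 : 0 ≤ (1 - x2) ^ (-(1/2) : ℝ) := rpow_nonneg (by linarith) _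
        rcases min_choice x2 (1 - x2) with h | h <;> rw [hm, h] <;> linarith

/-! ### The kernel `∂₂K` and its regularisations -/

/-- The regularised kernel `∂₂K`. -/
def kk (ε : ℝ) (x : ℝ²) : ℝ := sin (2 * π * x.2) / Dk ε x

theorem abs_sin_le_sqrt_Dk (x : ℝ²) : |sin (2 * π * x.2)| ≤ √(Dk 0 x) := by
  refine le_sqrt_of_sq_le ?_
  rw [sq_abs, Dk_zero_eq, mul_assoc, sin_two_mul]
  have := sin_sq_add_cos_sq (π * x.2)
  nlinarith [sq_nonneg (sinh (π * x.1)), mul_nonneg (sq_nonneg (sin (π * x.2))) (sq_nonneg (sin (π * x.2)))]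

theorem kk_abs_le (hε : 0 ≤ ε) (x : ℝ²) : |kk ε x| ≤ (√(Dk 0 x))⁻¹ := by
  have h0 := Dk_zero_nonneg x
  rcases h0.eq_or_lt with h | h
  · have := abs_sin_le_sqrt_Dk x
    rw [← h, sqrt_zero] at this
    have h1 : sin (2 * π * x.2) = 0 := abs_eq_zero.1 (le_antisymm this (abs_nonneg _))
    rw [kk, h1]; simp
  · rw [kk, abs_div, Dk_eq, abs_of_pos (by linarith : 0 < Dk 0 x + ε), div_le_iff₀ (by linarith)]
    refine (abs_sin_le_sqrt_Dk x).trans ?_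
    have : (√(Dk 0 x))⁻¹ * Dk 0 x = √(Dk 0 x) := by
      field_simp
      exact (sq_sqrt h0).symm
    rw [mul_add, this]
    have : 0 ≤ (√(Dk 0 x))⁻¹ * ε := by positivity
    linarith

theorem kk_measurable (ε : ℝ) : Measurable (kk ε) :=
  (by fun_prop : Continuous fun x : ℝ² => sin (2 * π * x.2)).measurable.div (Dk_continuous ε).measurable

theorem kk_integrable (hε : 0 ≤ ε) : Integrable (kk ε) μΩ :=
  inv_sqrt_Dk_integrable.mono' (kk_measurable ε).aestronglyMeasurable
    (.of_forall (kk_abs_le hε))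

theorem kk_per (ε : ℝ) (x : ℝ²) : kk ε (x.1, x.2 + 1) = kk ε x := by
  simp only [kk, Dk, mul_add, mul_one, sin_add_two_pi, cos_add_two_pi]

theorem pd2_Kker (x : ℝ²) : pd2 Kker x = kk 0 x := by
  have h1 : HasDerivAt (fun y : ℝ => 2 * π * y) (2 * π) x.2 := by
    simpa using (hasDerivAt_id x.2).const_mul (2 * π)
  have h2 := (h1.cos.const_mul 2).const_sub (2 * cosh (2 * π * x.1))
  rcases (Dk_zero_nonneg x).eq_or_lt with h | h
  · have hk : kk 0 x = 0 := by simp [kk, ← h]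
    rw [hk, pd2]
    refine deriv_zero_of_not_differentiableAt fun hd => ?_
    -- near `x.2` the logarithm is unbounded, while differentiability would give continuity
    have hx := Dk_zero_eq x
    rw [← h] at hx
    have s1 : sinh (π * x.1) = 0 := by nlinarith [sq_nonneg (sinh (π * x.1)), sq_nonneg (sin (π * x.2))]
    have s2 : sin (π * x.2) = 0 := by nlinarith [sq_nonneg (sinh (π * x.1)), sq_nonneg (sin (π * x.2))]
    have hc := hd.continuousAt
    have hlog : Tendsto (fun y => log (2 * cosh (2 * π * x.1) - 2 * cos (2 * π * y))) (𝓝[≠] x.2) atBot := by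
      refine tendsto_log_nhdsNE_zero.comp ?_
      refine tendsto_nhdsWithin_iff.2 ⟨?_, ?_⟩
      · have : ContinuousAt (fun y => 2 * cosh (2 * π * x.1) - 2 * cos (2 * π * y)) x.2 := h2.continuousAt
        have h3 := this.tendsto
        have h4 : 2 * cosh (2 * π * x.1) - 2 * cos (2 * π * x.2) = 0 := by
          have := h.symm; simpa [Dk] using this
        rw [h4] at h3
        exact h3.mono_left nhdsWithin_le_nhds
      · have hs : HasDerivAt (fun y => sin (π * y)) (cos (π * x.2) * π) x.2 := by
          have : HasDerivAt (fun y : ℝ => π * y) π x.2 := by simpa using (hasDerivAt_id x.2).const_mul π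
          exact this.sin
        have hne : cos (π * x.2) * π ≠ 0 := by
          have := sin_sq_add_cos_sq (π * x.2)
          rw [s2] at this
          refine mul_ne_zero (fun h => ?_) pi_ne_zero
          rw [h] at this; norm_num at this
        filter_upwards [hs.eventually_ne hne (c := 0)] with y hy
        have e := Dk_zero_eq (x.1, y)
        simp only [Dk, add_zero] at e
        rw [mem_compl_iff, mem_singleton_iff, e, s1]
        simpa using hy
    have hK : Tendsto (fun y => Kker (x.1, y)) (𝓝[≠] x.2) atBot := hlog.const_mul_atBot (by positivity)
    exact not_tendsto_nhds_of_tendsto_atBot hK _ (hc.tendsto.mono_left nhdsWithin_le_nhds)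
  · have h' : 2 * cosh (2 * π * x.1) - 2 * cos (2 * π * x.2) ≠ 0 := by
      simp only [Dk, add_zero] at h; exact h.ne'
    have := (h2.log h').const_mul (1 / (4 * π))
    rw [pd2, kk, Dk, add_zero]
    refine this.deriv.trans ?_
    field_simp
    ring

/-! ### Periodic functions and the strip -/

/-- Functions that are `1`-periodic in the second variable. -/
def Per (f : ℝ² → ℝ) : Prop := ∀ x, f (x.1, x.2 + 1) = f x

theorem Per.int (h : Per f) (a b : ℝ) (n : ℤ) : f (a, b - n) = f (a, b) := by
  have : Function.Periodic (fun y => f (a, y)) 1 := fun y => h (a, y)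
  simpa using this.sub_int_mul_eq n (x := b)

theorem Per.fract (h : Per f) (a b : ℝ) : f (a, Int.fract b) = f (a, b) :=
  h.int a b _

theorem lintegral_Ioc_periodic {f : ℝ → ENNReal} (hf : Function.Periodic f 1) (t s : ℝ) :
    ∫⁻ x in Ioc t (t + 1), f x = ∫⁻ x in Ioc s (s + 1), f x := by
  refine IsAddFundamentalDomain.setLIntegral_eq (G := AddSubgroup.zmultiples (1:ℝ))
    (isAddFundamentalDomain_Ioc one_pos t) (isAddFundamentalDomain_Ioc one_pos s) f ?_
  rintro ⟨_, n, rfl⟩ x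
  rw [AddSubgroup.vadd_def, vadd_eq_add, add_comm]
  simpa using hf.int_mul n x

theorem mp_fract_sub (c : ℝ) : MeasurePreserving (fun y : ℝ => Int.fract (c - y))
    (volume.restrict (Ico (0:ℝ) 1)) (volume.restrict (Ico (0:ℝ) 1)) := by
  have hm : Measurable fun y : ℝ => Int.fract (c - y) := measurable_fract.comp (by fun_prop)
  refine ⟨hm, Measure.ext fun A hA => ?_⟩
  have hp : Function.Periodic (fun z : ℝ => A.indicator (1 : ℝ → ENNReal) (Int.fract z)) 1 := fun z => by
    simp
  have e0 : ∫⁻ z in Ioc (0:ℝ) (0 + 1), A.indicator (1 : ℝ → ENNReal) (Int.fract z) =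
      (volume.restrict (Ico (0:ℝ) 1)) A := by
    rw [zero_add, Measure.restrict_congr_set Ico_ae_eq_Ioc.symm, ← lintegral_indicator_one hA]
    refine setLIntegral_congr_fun measurableSet_Ico fun z hz => ?_
    simp only [Int.fract_eq_self.2 hz]
  rw [Measure.map_apply hm hA, ← e0, lintegral_Ioc_periodic hp 0 (c - 1), ← lintegral_indicator_one (hm hA)]
  have e1 := (Measure.measurePreserving_sub_left (volume : Measure ℝ) c).setLIntegral_comp_preimage_emb
    (MeasurableEquiv.subLeft c).measurableEmbedding
    (fun z => A.indicator (1 : ℝ → ENNReal) (Int.fract z)) (Ioc (c - 1) (c - 1 + 1))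
  rw [← e1]
  congr 2
  ext z
  simp only [mem_Ico, mem_preimage, mem_Ioc]
  constructor <;> rintro ⟨a, b⟩ <;> constructor <;> linarith

theorem mp_strip_sub (x : ℝ²) :
    MeasurePreserving (fun y : ℝ² => (x.1 - y.1, Int.fract (x.2 - y.2))) μΩ μΩ := by
  rw [μΩ_eq_prod]
  exact (Measure.measurePreserving_sub_left volume x.1).prod (mp_fract_sub x.2)

theorem integrable_strip_sub {h : ℝ² → ℝ} (hp : Per h) (hi : Integrable h μΩ) (x : ℝ²) :
    Integrable (fun y => h (x - y)) μΩ := by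
  have := (mp_strip_sub x).integrable_comp_of_integrable hi
  refine this.congr (.of_forall fun y => hp.fract _ _)

theorem integral_strip_sub {h : ℝ² → ℝ} (hp : Per h) (hm : AEStronglyMeasurable h μΩ) (x : ℝ²) :
    ∫ y, h (x - y) ∂μΩ = ∫ y, h y ∂μΩ := by
  have hmp := mp_strip_sub x
  conv_rhs => rw [← hmp.map_eq]
  rw [integral_map hmp.measurable.aemeasurable (by rwa [hmp.map_eq])]
  exact integral_congr_ae (.of_forall fun y => (hp.fract _ _).symm)

theorem kk_Per (ε : ℝ) : Per (kk ε) := kk_per ε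

/-- Convolution with `∂₂K`. -/
def BB (f : ℝ² → ℝ) : ℝ² → ℝ := AV μΩ (kk 0) (fun w => -w) f

theorem conv_eq_BB (hp : Per f) (hf : Measurable f) (x : ℝ²) :
    ∫ y, pd2 Kker (x - y) * f y ∂μΩ = BB f x := by
  have := integral_strip_sub (h := fun w => kk 0 w * f (x + -w)) (fun w => by
    have h1 := kk_Per 0 w
    have h2 := hp.int (x.1 + -w.1) (x.2 + -w.2) 1
    simp only at h1 ⊢
    rw [h1]
    congr 1
    rw [show x + -w = (x.1 + -w.1, x.2 + -w.2) from rfl, ← h2]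
    congr 1
    ext <;> simp
    ring) ((kk_measurable 0).mul (hf.comp (by fun_prop))).aestronglyMeasurable x
  rw [BB, AV, ← this]
  refine integral_congr_ae (.of_forall fun y => ?_)
  simp only [pd2_Kker]
  congr 2
  abel

/-! ### The identity `∂₂K * Δg = ∂₂g` -/

theorem SB.translate (hg : SB univ (fun _ => g)) (e : ℝ²) :
    SB univ (fun t x => g (x + t • e)) := by
  refine ⟨((hg.slice_cont (mem_univ (0:ℝ))).comp (by fun_prop :
    Continuous fun p : ℝ × ℝ² => p.2 + p.1 • e)).continuousOn, fun n => ?_⟩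
  obtain ⟨C, h0, hC⟩ := hg.fd n
  refine ⟨C, h0, fun L hL t _ x => ?_⟩
  rw [FD_shift]
  exact hC L hL 0 trivial _

theorem pd_comm (hg : SB univ (fun _ => g)) : pd1 (pd2 g) = pd2 (pd1 g) := by
  have h1 : SB univ (fun _ : ℝ => pd1 g) := hg.d1
  have u : (0:ℝ) ∈ (univ : Set ℝ) := trivial
  have := SB.time_deriv_swap isOpen_univ (hg.translate (1, 0)) (h1.translate (1, 0))
    (fun t _ x => (hg.dd1 u).at x t) (e := (0, 1))
    (fun t _ => (hg.dd2 u).comp_add _) (fun t _ => (h1.dd2 u).comp_add _)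
  refine DD.pd1_eq fun x => ?_
  simpa using this 0 trivial x

theorem DD.refl (h : DD e f f') (x : ℝ²) :
    DD e (fun w => f (x - w)) (fun w => -f' (x - w)) := fun w => by
  have h1 : HasDerivAt (fun s : ℝ => f (x - w + s • e)) (f' (x - w + (-0:ℝ) • e)) (-0) := h.at _ _
  have h2 := h1.scomp (0:ℝ) (hasDerivAt_neg (0:ℝ))
  simp only [neg_zero, zero_smul, add_zero, neg_smul, one_smul] at h2
  refine h2.congr_of_eventuallyEq (.of_forall fun s => ?_)
  simp only [Function.comp_def, neg_smul]
  congr 1; abel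

/-- The regularised Laplacian of the Green function. -/
def Mk (ε : ℝ) (x : ℝ²) : ℝ := 2 * π * ε * (cosh (2 * π * x.1) + cos (2 * π * x.2)) / Dk ε x ^ 2

/-- A decaying modification of the regularised kernel `∂₁K`. -/
def hh (ε : ℝ) (x : ℝ²) : ℝ :=
  sinh (2 * π * x.1) / Dk ε x - sinh (2 * π * x.1) / (2 * cosh (2 * π * x.1))

/-- The mixed derivative of the regularised Green function. -/
def k1 (ε : ℝ) (x : ℝ²) : ℝ := -(4 * π * sin (2 * π * x.2) * sinh (2 * π * x.1)) / Dk ε x ^ 2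

/-- The second derivative in `x₂` of the regularised Green function. -/
def k2 (ε : ℝ) (x : ℝ²) : ℝ :=
  2 * π * (cos (2 * π * x.2) * Dk ε x - 2 * sin (2 * π * x.2) ^ 2) / Dk ε x ^ 2

theorem two_pi_hasDerivAt (y : ℝ) : HasDerivAt (fun y : ℝ => 2 * π * y) (2 * π) y := by
  simpa using (hasDerivAt_id y).const_mul (2 * π)

theorem Dk_d1 (ε : ℝ) (x : ℝ²) :
    HasDerivAt (fun y => Dk ε (y, x.2)) (4 * π * sinh (2 * π * x.1)) x.1 :=
  ((((two_pi_hasDerivAt x.1).cosh.const_mul 2).sub_const (2 * cos (2 * π * x.2))).add_const ε).congr_deriv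
    (by ring)

theorem Dk_d2 (ε : ℝ) (x : ℝ²) :
    HasDerivAt (fun y => Dk ε (x.1, y)) (4 * π * sin (2 * π * x.2)) x.2 :=
  ((((two_pi_hasDerivAt x.2).cos.const_mul 2).const_sub (2 * cosh (2 * π * x.1))).add_const ε).congr_deriv
    (by ring)

theorem kk_DD1 (hε : 0 < ε) : DD (1, 0) (kk ε) (k1 ε) := by
  refine DD.of_fst fun x => ?_
  have h := Dk_pos hε x
  refine ((hasDerivAt_const x.1 (sin (2 * π * x.2))).fun_div (Dk_d1 ε x) h.ne').congr_deriv ?_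
  rw [k1]; ring

theorem kk_DD2 (hε : 0 < ε) : DD (0, 1) (kk ε) (k2 ε) := by
  refine DD.of_snd fun x => ?_
  have h := Dk_pos hε x
  refine ((two_pi_hasDerivAt x.2).sin.fun_div (Dk_d2 ε x) h.ne').congr_deriv ?_
  rw [k2]; ring

theorem hh_DD2 (hε : 0 < ε) : DD (0, 1) (hh ε) (k1 ε) := by
  refine DD.of_snd fun x => ?_
  have h := Dk_pos hε x
  refine (((hasDerivAt_const x.2 (sinh (2 * π * x.1))).fun_div (Dk_d2 ε x) h.ne').sub_const
    (sinh (2 * π * x.1) / (2 * cosh (2 * π * x.1)))).congr_deriv ?_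
  rw [k1]; ring

theorem hh_DD1 (hε : 0 < ε) : DD (1, 0) (hh ε) (fun x => Mk ε x - k2 ε x - π * cw x ^ 2) := by
  refine DD.of_fst fun x => ?_
  have h := Dk_pos hε x
  refine (((two_pi_hasDerivAt x.1).sinh.fun_div (Dk_d1 ε x) h.ne').fun_sub
    (tanh_half_hasDerivAt x.1)).congr_deriv ?_
  rw [Mk, k2, cw, inv_pow, ← div_eq_mul_inv]
  congr 1
  rw [← sub_div]
  congr 1
  simp only [Dk]
  linear_combination (4 * π) * cosh_sq (2 * π * x.1) - 4 * π * sin_sq_add_cos_sq (2 * π * x.2)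

theorem Dk_ge (hε1 : ε ≤ 1) (x : ℝ²) : ε * cosh (2 * π * x.1) ≤ Dk ε x := by
  have h1 := one_le_cosh (2 * π * x.1)
  have h2 := cos_le_one (2 * π * x.2)
  rw [Dk]; nlinarith

theorem inv_Dk_le (hε : 0 < ε) (hε1 : ε ≤ 1) (x : ℝ²) : (Dk ε x)⁻¹ ≤ ε⁻¹ * cw x := by
  rw [cw, ← mul_inv]
  exact inv_anti₀ (mul_pos hε (cosh_pos _)) (Dk_ge hε1 x)

theorem kk_cw (hε : 0 < ε) (hε1 : ε ≤ 1) (x : ℝ²) : |kk ε x| ≤ ε⁻¹ * cw x := by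
  rw [kk, abs_div, abs_of_pos (Dk_pos hε x), div_eq_mul_inv]
  calc _ ≤ 1 * (Dk ε x)⁻¹ := mul_le_mul_of_nonneg_right (abs_sin_le_one _) (inv_pos.2 (Dk_pos hε x)).le
    _ ≤ _ := by rw [one_mul]; exact inv_Dk_le hε hε1 x

theorem inv_Dk_sq_cosh_le (hε : 0 < ε) (hε1 : ε ≤ 1) (x : ℝ²) :
    cosh (2 * π * x.1) / Dk ε x ^ 2 ≤ ε⁻¹ ^ 2 * cw x := by
  have h := inv_Dk_le hε hε1 x
  have h0 := inv_pos.2 (Dk_pos hε x)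
  rw [div_eq_mul_inv, ← inv_pow]
  calc _ ≤ cosh (2 * π * x.1) * (ε⁻¹ * cw x) ^ 2 := by gcongr
    _ = _ := by rw [cw]; field_simp

theorem abs_sinh_le_cosh (y : ℝ) : |sinh y| ≤ cosh y := by
  rw [abs_sinh, ← cosh_abs]; exact (sinh_lt_cosh _).le

theorem k1_cw (hε : 0 < ε) (hε1 : ε ≤ 1) (x : ℝ²) : |k1 ε x| ≤ 4 * π * ε⁻¹ ^ 2 * cw x := by
  have hD := Dk_pos hε x
  have h := inv_Dk_sq_cosh_le hε hε1 x
  rw [k1, abs_div, abs_neg, abs_mul, abs_mul, abs_of_pos (by positivity : 0 < 4 * π),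
    abs_of_pos (by positivity : 0 < Dk ε x ^ 2), mul_assoc (4 * π) (ε⁻¹ ^ 2)]
  have h2 := abs_sin_le_one (2 * π * x.2)
  have h3 := abs_sinh_le_cosh (2 * π * x.1)
  calc _ ≤ 4 * π * 1 * cosh (2 * π * x.1) / Dk ε x ^ 2 := by gcongr
    _ = 4 * π * (cosh (2 * π * x.1) / Dk ε x ^ 2) := by ring
    _ ≤ _ := by gcongr

theorem Mk_nonneg (hε : 0 < ε) (x : ℝ²) : 0 ≤ Mk ε x := by
  have h1 := one_le_cosh (2 * π * x.1)
  have h2 := neg_one_le_cos (2 * π * x.2)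
  have : 0 ≤ cosh (2 * π * x.1) + cos (2 * π * x.2) := by linarith
  unfold Mk; positivity

theorem Mk_cw (hε : 0 < ε) (hε1 : ε ≤ 1) (x : ℝ²) : |Mk ε x| ≤ 4 * π * ε⁻¹ ^ 2 * cw x := by
  have h := inv_Dk_sq_cosh_le hε hε1 x
  have h1 := one_le_cosh (2 * π * x.1)
  have h2 := cos_le_one (2 * π * x.2)
  rw [abs_of_nonneg (Mk_nonneg hε x), Mk, mul_assoc (4 * π)]
  calc _ ≤ 2 * π * 1 * (2 * cosh (2 * π * x.1)) / Dk ε x ^ 2 := by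
        have h3 := neg_one_le_cos (2 * π * x.2)
        have : 0 ≤ cosh (2 * π * x.1) + cos (2 * π * x.2) := by linarith
        gcongr; linarith
    _ = 4 * π * (cosh (2 * π * x.1) / Dk ε x ^ 2) := by ring
    _ ≤ _ := by gcongr

theorem k2_cw (hε : 0 < ε) (hε1 : ε ≤ 1) (x : ℝ²) : |k2 ε x| ≤ 10 * π * ε⁻¹ ^ 2 * cw x := by
  have hD := Dk_pos hε x
  have h := inv_Dk_sq_cosh_le hε hε1 x
  have h1 := one_le_cosh (2 * π * x.1)
  have h2 := abs_le.1 (abs_cos_le_one (2 * π * x.2))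
  have h3 := sin_sq_le_one (2 * π * x.2)
  rw [k2, abs_div, abs_mul, abs_of_pos (by positivity : 0 < 2 * π),
    abs_of_pos (by positivity : 0 < Dk ε x ^ 2), mul_assoc (10 * π)]
  have h4' : |cos (2 * π * x.2) * Dk ε x - 2 * sin (2 * π * x.2) ^ 2| ≤ 5 * cosh (2 * π * x.1) := by
    have h5 := cos_sq' (2 * π * x.2)
    have : cos (2 * π * x.2) * Dk ε x - 2 * sin (2 * π * x.2) ^ 2 =
        cos (2 * π * x.2) * (2 * cosh (2 * π * x.1) + ε) - 2 := by
      rw [Dk]; linear_combination (-2 : ℝ) * h5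
    rw [this, abs_le]; constructor <;> nlinarith
  calc _ ≤ 2 * π * (5 * cosh (2 * π * x.1)) / Dk ε x ^ 2 := by gcongr
    _ = 10 * π * (cosh (2 * π * x.1) / Dk ε x ^ 2) := by ring
    _ ≤ _ := by gcongr

theorem hh_cw (hε : 0 < ε) (hε1 : ε ≤ 1) (x : ℝ²) : |hh ε x| ≤ 2 * ε⁻¹ * cw x := by
  have hD := Dk_pos hε x
  have hc := cosh_pos (2 * π * x.1)
  have e : hh ε x = sinh (2 * π * x.1) * (2 * cos (2 * π * x.2) - ε) / (2 * cosh (2 * π * x.1)) * (Dk ε x)⁻¹ := by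
    rw [hh]; field_simp; rw [Dk]; ring
  rw [e, abs_mul, abs_of_pos (inv_pos.2 hD), mul_assoc (2:ℝ) ε⁻¹ (cw x)]
  refine mul_le_mul ?_ (inv_Dk_le hε hε1 x) (inv_pos.2 hD).le (by norm_num)
  rw [abs_div, abs_mul, abs_of_pos (by positivity : 0 < 2 * cosh (2 * π * x.1)), div_le_iff₀ (by positivity)]
  have h3 := abs_sinh_le_cosh (2 * π * x.1)
  have h2 := abs_le.1 (abs_cos_le_one (2 * π * x.2))
  have h4 : |2 * cos (2 * π * x.2) - ε| ≤ 3 := by rw [abs_le]; constructor <;> linarith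
  calc _ ≤ cosh (2 * π * x.1) * 3 := by gcongr
    _ ≤ _ := by linarith

theorem kk_continuous (hε : 0 < ε) : Continuous (kk ε) :=
  Continuous.div (by fun_prop) (Dk_continuous ε) fun x => (Dk_pos hε x).ne'

theorem continuous_div_Dk_sq (hε : 0 < ε) (hf : Continuous f) : Continuous fun x => f x / Dk ε x ^ 2 :=
  hf.div ((Dk_continuous ε).pow 2) fun x => (pow_pos (Dk_pos hε x) 2).ne'

theorem k1_continuous (hε : 0 < ε) : Continuous (k1 ε) :=
  continuous_div_Dk_sq hε (by fun_prop)

theorem k2_continuous (hε : 0 < ε) : Continuous (k2 ε) := by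
  have := Dk_continuous ε
  exact continuous_div_Dk_sq hε (by fun_prop)

theorem Mk_continuous (hε : 0 < ε) : Continuous (Mk ε) :=
  continuous_div_Dk_sq hε (by fun_prop)

theorem hh_continuous (hε : 0 < ε) : Continuous (hh ε) := by
  exact Continuous.sub (Continuous.div (by fun_prop) (Dk_continuous ε) fun x => (Dk_pos hε x).ne')
    (Continuous.div (by fun_prop) (by fun_prop) fun x => mul_ne_zero two_ne_zero (cosh_pos _).ne')

theorem hh_per (ε : ℝ) : Per (hh ε) := fun x => by
  simp only [hh, Dk, mul_add, mul_one, cos_add_two_pi]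

theorem Mk_sqrt_le (hε : 0 < ε) (hε1 : ε ≤ 1) (x : ℝ²) :
    Mk ε x * √(Dk 0 x) ≤ 2 * π * (√(Dk 0 x))⁻¹ := by
  rcases (Dk_zero_nonneg x).eq_or_lt with h | h
  · simp [← h]
  set s := √(Dk 0 x) with hs
  have hs0 : 0 < s := sqrt_pos.2 h
  have e : Dk 0 x = s ^ 2 := (sq_sqrt h.le).symm
  have hc : cosh (2 * π * x.1) + cos (2 * π * x.2) ≤ s ^ 2 + 2 := by
    rw [← e, Dk]
    have h1 := one_le_cosh (2 * π * x.1)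
    have h2 := cos_le_one (2 * π * x.2)
    linarith
  rw [Mk, Dk_eq, e, ← div_eq_mul_inv, div_mul_eq_mul_div, div_le_div_iff₀ (by positivity) hs0]
  have h3 : ε * (cosh (2 * π * x.1) + cos (2 * π * x.2)) * s ^ 2 ≤ (s ^ 2 + ε) ^ 2 := by
    have h4 : ε * (cosh (2 * π * x.1) + cos (2 * π * x.2)) * s ^ 2 ≤ ε * (s ^ 2 + 2) * s ^ 2 := by gcongr
    nlinarith [sq_nonneg ε, mul_nonneg (sub_nonneg.2 hε1) (by positivity : 0 ≤ s ^ 2 * s ^ 2)]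
  nlinarith [pi_pos]

/-- Smooth functions all of whose finite differences are bounded. -/
abbrev Sm (g : ℝ² → ℝ) : Prop := SB univ (fun _ : ℝ => g)

theorem Sm.pd1 (h : Sm g) : Sm (pd1 g) := SB.d1 h
theorem Sm.pd2 (h : Sm g) : Sm (pd2 g) := SB.d2 h
theorem Sm.DD1 (h : Sm g) : DD (1, 0) g (NS.pd1 g) := SB.dd1 h (mem_univ (0:ℝ))
theorem Sm.DD2 (h : Sm g) : DD (0, 1) g (NS.pd2 g) := SB.dd2 h (mem_univ (0:ℝ))
theorem Sm.continuous (h : Sm g) : Continuous g := SB.slice_cont h (mem_univ (0:ℝ))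
theorem Sm.bc (h : Sm g) : ∃ C, 0 ≤ C ∧ BC C g := by
  obtain ⟨C, h0, hC⟩ := SB.bd h
  exact ⟨C, h0, h.continuous, hC 0 trivial⟩
theorem Sm.add (hf : Sm f) (hg : Sm g) : Sm (fun x => f x + g x) := SB.add hf hg
theorem Sm.mul (hf : Sm f) (hg : Sm g) : Sm (fun x => f x * g x) := SB.mul hf hg
theorem Sm.const_mul (hf : Sm f) (c : ℝ) : Sm (fun x => c * f x) := SB.const_mul hf c
theorem Sm.sub (hf : Sm f) (hg : Sm g) : Sm (fun x => f x - g x) := by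
  have := hf.add (hg.const_mul (-1))
  simpa [sub_eq_add_neg] using this

theorem Per.pd1 (h : Per g) : Per (pd1 g) := fun x => by
  simp only [NS.pd1, h (_, x.2)]

theorem Per.pd2 (h : Per g) : Per (pd2 g) := fun x => by
  simp only [NS.pd2]
  rw [← deriv_comp_add_const]
  congr 1
  funext y
  exact h (x.1, y)

theorem Per.refl (h : Per g) (x : ℝ²) : Per fun w => g (x - w) := fun w => by
  have := h.int (x.1 - w.1) (x.2 - w.2) 1
  change g (x.1 - w.1, x.2 - (w.2 + 1)) = g (x.1 - w.1, x.2 - w.2)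
  rw [← this, Int.cast_one, sub_sub]

theorem abs_mul_le_cw {k f : ℝ² → ℝ} (bk : ∀ x, |k x| ≤ C * cw x) (hf : BC D f) (x w : ℝ²) :
    |k w * f (x - w)| ≤ C * D * cw w := by
  rw [abs_mul, mul_right_comm]
  exact mul_le_mul (bk w) (hf.bd _) (abs_nonneg _) ((abs_nonneg _).trans (bk w))

theorem cw_integrable_mul {k f : ℝ² → ℝ} (hk : Continuous k) (bk : ∀ x, |k x| ≤ C * cw x) (hf : BC D f)
    (x : ℝ²) : Integrable (fun w => k w * f (x - w)) μΩ :=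
  cw_dom_integrable (hk.mul (hf.cont.comp (by fun_prop))) (abs_mul_le_cw bk hf x)

theorem ibp_fst {K K' : ℝ² → ℝ} (hK : Continuous K) (hK' : Continuous K')
    (bK : ∀ x, |K x| ≤ C * cw x) (bK' : ∀ x, |K' x| ≤ C * cw x) (dK : DD (1, 0) K K')
    (hg : BC D g) (hg' : BC D g') (dg : DD (1, 0) g g') (x : ℝ²) :
    ∫ w, K' w * g (x - w) ∂μΩ = ∫ w, K w * g' (x - w) ∂μΩ := by
  have := hg.cont
  have := hg'.cont
  rw [← sub_eq_zero, ← integral_sub (cw_integrable_mul hK' bK' hg x) (cw_integrable_mul hK bK hg' x)]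
  refine integral_strip_fst (C := 2 * (C * D)) (V := fun w => K w * g (x - w)) (by fun_prop) (fun w => ?_)
    (fun w => ?_) fun w => (dK.mul (dg.refl x) w).congr_deriv (by ring)
  · linarith [abs_sub (K' w * g (x - w)) (K w * g' (x - w)), abs_mul_le_cw bK' hg x w,
      abs_mul_le_cw bK hg' x w]
  · linarith [abs_mul_le_cw bK hg x w, abs_nonneg (K w * g (x - w))]

theorem ibp_snd {K K' : ℝ² → ℝ} (hK : Continuous K) (hK' : Continuous K')
    (bK : ∀ x, |K x| ≤ C * cw x) (bK' : ∀ x, |K' x| ≤ C * cw x) (dK : DD (0, 1) K K') (pK : Per K)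
    (hg : BC D g) (hg' : BC D g') (dg : DD (0, 1) g g') (pg : Per g) (x : ℝ²) :
    ∫ w, K' w * g (x - w) ∂μΩ = ∫ w, K w * g' (x - w) ∂μΩ := by
  have := hg.cont
  have := hg'.cont
  have i1 := cw_integrable_mul hK' bK' hg x
  have i2 := cw_integrable_mul hK bK hg' x
  rw [← sub_eq_zero, ← integral_sub i1 i2]
  exact integral_strip_snd (V := fun w => K w * g (x - w)) (by fun_prop) (i1.sub i2)
    (fun w => (dK.mul (dg.refl x) w).congr_deriv (by ring)) fun w => congrArg₂ (· * ·) (pK w) (pg.refl x w)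

theorem cw_le_one (x : ℝ²) : cw x ≤ 1 := inv_le_one_of_one_le₀ (one_le_cosh _)

theorem inv_le_inv_sq (hε : 0 < ε) (hε1 : ε ≤ 1) : ε⁻¹ ≤ ε⁻¹ ^ 2 := by
  have : 1 ≤ ε⁻¹ := (one_le_inv₀ hε).2 hε1
  nlinarith

/-- A common constant for the exponential bounds on the regularised kernels. -/
def kC (ε : ℝ) : ℝ := 20 * π * ε⁻¹ ^ 2

theorem pi_sq_le (hε : 0 < ε) (hε1 : ε ≤ 1) : 1 ≤ ε⁻¹ ^ 2 :=
  one_le_pow₀ ((one_le_inv₀ hε).2 hε1)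

theorem cwsq_le (hε : 0 < ε) (hε1 : ε ≤ 1) (x : ℝ²) : |π * cw x ^ 2| ≤ kC ε * cw x := by
  have h1 := cw_pos x
  have h2 := cw_le_one x
  have h3 := pi_sq_le hε hε1
  rw [abs_of_nonneg (by positivity), kC]
  calc π * cw x ^ 2 = π * cw x * cw x := by ring
    _ ≤ π * cw x * (20 * ε⁻¹ ^ 2) := by gcongr; linarith
    _ = _ := by ring

theorem kk_kC (hε : 0 < ε) (hε1 : ε ≤ 1) (x : ℝ²) : |kk ε x| ≤ kC ε * cw x := by
  refine (kk_cw hε hε1 x).trans (mul_le_mul_of_nonneg_right ?_ (cw_pos x).le)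
  rw [kC]; nlinarith [pi_gt_three, inv_le_inv_sq hε hε1, pi_sq_le hε hε1]

theorem hh_kC (hε : 0 < ε) (hε1 : ε ≤ 1) (x : ℝ²) : |hh ε x| ≤ kC ε * cw x := by
  refine (hh_cw hε hε1 x).trans (mul_le_mul_of_nonneg_right ?_ (cw_pos x).le)
  rw [kC]; nlinarith [pi_gt_three, inv_le_inv_sq hε hε1, pi_sq_le hε hε1]

theorem k1_kC (hε : 0 < ε) (hε1 : ε ≤ 1) (x : ℝ²) : |k1 ε x| ≤ kC ε * cw x := by
  refine (k1_cw hε hε1 x).trans (mul_le_mul_of_nonneg_right ?_ (cw_pos x).le)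
  rw [kC]; nlinarith [pi_gt_three, pi_sq_le hε hε1]

theorem k2_kC (hε : 0 < ε) (hε1 : ε ≤ 1) (x : ℝ²) : |k2 ε x| ≤ kC ε * cw x := by
  refine (k2_cw hε hε1 x).trans (mul_le_mul_of_nonneg_right ?_ (cw_pos x).le)
  rw [kC]; nlinarith [pi_gt_three, pi_sq_le hε hε1]

theorem h1d_kC (hε : 0 < ε) (hε1 : ε ≤ 1) (x : ℝ²) :
    |Mk ε x - k2 ε x - π * cw x ^ 2| ≤ kC ε * cw x := by
  have h1 := Mk_cw hε hε1 x
  have h2 := k2_cw hε hε1 x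
  have h3 := cw_pos x
  have h4 : |π * cw x ^ 2| ≤ π * ε⁻¹ ^ 2 * cw x := by
    have h5 := pi_sq_le hε hε1
    have h6 := cw_le_one x
    rw [abs_of_nonneg (by positivity)]
    calc π * cw x ^ 2 = π * cw x * cw x := by ring
      _ ≤ π * cw x * ε⁻¹ ^ 2 := by gcongr; linarith
      _ = _ := by ring
  have h7 := (abs_sub (Mk ε x - k2 ε x) (π * cw x ^ 2)).trans (add_le_add_left (abs_sub (Mk ε x) (k2 ε x)) _)
  have : (0:ℝ) ≤ π * ε⁻¹ ^ 2 * cw x := by positivity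
  rw [kC]
  nlinarith

theorem cw_sq_continuous : Continuous fun x => π * cw x ^ 2 := (cw_continuous.pow 2).const_mul π

theorem integral_Mk (hε : 0 < ε) (hε1 : ε ≤ 1) : ∫ w, Mk ε w ∂μΩ = 1 := by
  have one : BC 1 (fun _ : ℝ² => (1:ℝ)) := ⟨continuous_const, fun _ => by simp⟩
  have zero : BC 1 (fun _ : ℝ² => (0:ℝ)) := ⟨continuous_const, fun _ => by simp⟩
  have cM := Mk_continuous hε
  have c2 := k2_continuous hε
  have ccw := cw_sq_continuous
  have cs : Continuous fun w => Mk ε w - k2 ε w - π * cw w ^ 2 := (cM.sub c2).sub ccw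
  have a := ibp_fst (hh_continuous hε) cs (hh_kC hε hε1) (h1d_kC hε hε1) (hh_DD1 hε)
    one zero (DD.const _ 1) 0
  have b := ibp_snd (kk_continuous hε) c2 (kk_kC hε hε1) (k2_kC hε hε1) (kk_DD2 hε) (kk_Per ε)
    one zero (DD.const _ 1) (fun _ => rfl) 0
  have iM := cw_dom_integrable cM (Mk_cw hε hε1)
  have i2 := cw_dom_integrable c2 (k2_cw hε hε1)
  have i3 := cw_dom_integrable ccw (cwsq_le hε hε1)
  simp only [mul_one, mul_zero, integral_zero] at a b
  rw [integral_sub (f := fun w => Mk ε w - k2 ε w) (iM.sub i2) i3, integral_sub iM i2, b, integral_cw_sq] at a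
  linarith

theorem kk_lap (hε : 0 < ε) (hε1 : ε ≤ 1) (hg : Sm g) (hp : Per g) (x : ℝ²) :
    ∫ w, kk ε w * (pd1 (pd1 g) (x - w) + pd2 (pd2 g) (x - w)) ∂μΩ = ∫ w, Mk ε w * pd2 g (x - w) ∂μΩ := by
  have g1 := hg.pd1
  have g2 := hg.pd2
  have g11 := g1.pd1
  have g12 := g2.pd1
  have g22 := g2.pd2
  obtain ⟨C0, p0, b0⟩ := hg.bc
  obtain ⟨C1, p1, b1⟩ := g1.bc
  obtain ⟨C2, p2, b2⟩ := g2.bc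
  obtain ⟨C3, p3, b3⟩ := g11.bc
  obtain ⟨C4, p4, b4⟩ := g12.bc
  obtain ⟨C5, p5, b5⟩ := g22.bc
  set C := C0 + C1 + C2 + C3 + C4 + C5
  have up {f : ℝ² → ℝ} {c : ℝ} (h : BC c f) (hc : c ≤ C) : BC C f := ⟨h.cont, fun x => (h.bd x).trans hc⟩
  have b0 := up b0 (by simp only [C]; linarith)
  have b1 := up b1 (by simp only [C]; linarith)
  have b2 := up b2 (by simp only [C]; linarith)
  have b3 := up b3 (by simp only [C]; linarith)
  have b4 := up b4 (by simp only [C]; linarith)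
  have b5 := up b5 (by simp only [C]; linarith)
  have ck := kk_continuous hε
  have cM := Mk_continuous hε
  have c1 := k1_continuous hε
  have c2 := k2_continuous hε
  have ch := hh_continuous hε
  have ccw := cw_sq_continuous
  have cs : Continuous fun w => Mk ε w - k2 ε w - π * cw w ^ 2 := (cM.sub c2).sub ccw
  have ii {k f : ℝ² → ℝ} {c : ℝ} (hk : Continuous k) (bk : ∀ x, |k x| ≤ c * cw x) (hf : BC C f) :
      Integrable (fun w => k w * f (x - w)) μΩ := by
    refine cw_dom_integrable (C := c * C) (hk.mul (hf.cont.comp (by fun_prop))) fun w => ?_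
    rw [abs_mul]
    calc _ ≤ c * cw w * C := mul_le_mul (bk w) (hf.bd _) (abs_nonneg _) ((abs_nonneg _).trans (bk w))
      _ = _ := by ring
  have e1 := ibp_fst ck c1 (kk_kC hε hε1) (k1_kC hε hε1) (kk_DD1 hε) b1 b3 g1.DD1 x
  have b4' : BC C (pd2 (pd1 g)) := by rw [← pd_comm hg]; exact b4
  have e2 := ibp_snd ch c1 (hh_kC hε hε1) (k1_kC hε hε1) (hh_DD2 hε) (hh_per ε) b1 b4' g1.DD2 hp.pd1 x
  have e3 := ibp_fst ch cs (hh_kC hε hε1) (h1d_kC hε hε1) (hh_DD1 hε) b2 b4 g2.DD1 x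
  have e4 := ibp_snd ck c2 (kk_kC hε hε1) (k2_kC hε hε1) (kk_DD2 hε) (kk_Per ε) b2 b5 g2.DD2 hp.pd2 x
  have dz : DD (0, 1) (fun w => π * cw w ^ 2) (fun _ => 0) := fun w => by
    simp only [cw, Prod.fst_add, Prod.smul_fst, smul_zero, add_zero]
    exact hasDerivAt_const _ _
  have e5 := ibp_snd ccw continuous_const (cwsq_le hε hε1)
    (fun w => by rw [abs_zero]; exact (abs_nonneg _).trans (kk_kC hε hε1 w)) dz
    (fun w => by simp [cw]) b0 b2 hg.DD2 hp x
  simp only [zero_mul, integral_zero] at e5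
  simp only [mul_add]
  rw [integral_add (ii ck (kk_kC hε hε1) b3) (ii ck (kk_kC hε hε1) b5), ← e1, e2, ← e4, ← pd_comm hg, ← e3]
  simp only [sub_mul]
  rw [integral_sub (f := fun w => Mk ε w * pd2 g (x - w) - k2 ε w * pd2 g (x - w)) ((ii cM (Mk_cw hε hε1) b2).sub (ii c2 (k2_cw hε hε1) b2)) (ii ccw (cwsq_le hε hε1) b2),
    integral_sub (ii cM (Mk_cw hε hε1) b2) (ii c2 (k2_cw hε hε1) b2), ← e5]
  ring

theorem strip_lip (h1 : DD (1, 0) f f1) (h2 : DD (0, 1) f f2) {C1 C2 : ℝ}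
    (b1 : ∀ x, |f1 x| ≤ C1) (b2 : ∀ x, |f2 x| ≤ C2) (hp : Per f) (x w : ℝ²) (w0 : 0 ≤ w.2) (w1 : w.2 ≤ 1) :
    |f (x - w) - f x| ≤ (C1 + C2) * √(Dk 0 w) := by
  have hC : 0 ≤ C1 + C2 := add_nonneg ((abs_nonneg _).trans (b1 0)) ((abs_nonneg _).trans (b2 0))
  have s1 : |w.1| ≤ √(Dk 0 w) := by
    refine abs_le_sqrt ?_
    rw [Dk_zero_eq]
    have h : |w.1| ≤ |sinh (π * w.1)| := by
      rw [abs_sinh, abs_mul, abs_of_pos pi_pos]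
      have := self_le_sinh_iff.2 (by positivity : 0 ≤ π * |w.1|)
      nlinarith [pi_gt_three, abs_nonneg w.1]
    have := sq_le_sq.2 h
    nlinarith [sq_nonneg (sin (π * w.2))]
  have s2 : min w.2 (1 - w.2) ≤ √(Dk 0 w) := by
    refine le_sqrt_of_sq_le ?_
    rw [Dk_zero_eq]
    have h := min_le_sin_pi w0 w1
    have h0 : 0 ≤ min w.2 (1 - w.2) := le_min w0 (by linarith)
    nlinarith [sq_nonneg (sinh (π * w.1))]
  have key (h : ℝ²) (e : f (x + h) = f (x - w)) (n1 : |h.1| = |w.1|) (n2 : |h.2| = min w.2 (1 - w.2)) :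
      |f (x - w) - f x| ≤ (C1 + C2) * √(Dk 0 w) := by
    rw [← e]
    refine (lip_of_DD h1 h2 b1 b2 x h).trans (mul_le_mul_of_nonneg_left ?_ hC)
    rw [Prod.norm_def, norm_eq_abs, norm_eq_abs, n1, n2]
    exact max_le s1 s2
  rcases le_total w.2 (1 - w.2) with h | h
  · refine key (-w) (by rw [sub_eq_add_neg]) (by simp) ?_
    rw [min_eq_left h]; simp [abs_of_nonneg w0]
  · refine key (-w.1, 1 - w.2) ?_ (by simp) ?_
    · have := hp (x - w)
      rw [← this]
      congr 1
      ext <;> simp <;> ring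
    · rw [min_eq_right h]; exact abs_of_nonneg (by linarith)

theorem BB_lap (hg : Sm g) (hp : Per g) (x : ℝ²) :
    BB (fun y => pd1 (pd1 g) y + pd2 (pd2 g) y) x = pd2 g x := by
  set e : ℕ → ℝ := fun n => 1 / ((n:ℝ) + 1)
  have e0 (n : ℕ) : 0 < e n := Nat.one_div_pos_of_nat
  have e1 (n : ℕ) : e n ≤ 1 := by
    simp only [e]; rw [div_le_one (by positivity)]; linarith [n.cast_nonneg (α := ℝ)]
  have et : Tendsto e atTop (𝓝 0) := tendsto_one_div_add_atTop_nhds_zero_nat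
  have hΔ := hg.pd1.pd1.add hg.pd2.pd2
  obtain ⟨D, hD0, hD⟩ := hΔ.bc
  have g2 := hg.pd2
  obtain ⟨C1, _, b1⟩ := g2.pd1.bc
  obtain ⟨C2, _, b2⟩ := g2.pd2.bc
  obtain ⟨C, _, bC⟩ := g2.bc
  have l1 : Tendsto (fun n => ∫ w, kk (e n) w * (pd1 (pd1 g) (x - w) + pd2 (pd2 g) (x - w)) ∂μΩ) atTop
      (𝓝 (BB (fun y => pd1 (pd1 g) y + pd2 (pd2 g) y) x)) := by
    refine tendsto_integral_of_dominated_convergence (fun w => (√(Dk 0 w))⁻¹ * D) (fun n => ?_)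
      (inv_sqrt_Dk_integrable.mul_const D) (fun n => Eventually.of_forall fun w => ?_) ?_
    · exact ((kk_continuous (e0 n)).mul (hΔ.continuous.comp (by fun_prop :
        Continuous fun w : ℝ² => x - w))).aestronglyMeasurable
    · rw [norm_eq_abs, abs_mul]
      exact mul_le_mul (kk_abs_le (e0 n).le w) (hD.bd _) (abs_nonneg _) (by positivity)
    · filter_upwards [Dk_zero_pos_ae] with w hw
      simp only [← sub_eq_add_neg]
      refine Tendsto.mul_const _ ?_
      simp only [kk, Dk_eq (e _)]
      refine Tendsto.div tendsto_const_nhds ?_ hw.ne'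
      simpa using et.const_add (Dk 0 w)
  have l2 : Tendsto (fun n => ∫ w, Mk (e n) w * (pd2 g (x - w) - pd2 g x) ∂μΩ) atTop (𝓝 0) := by
    have : Tendsto (fun n => ∫ w, Mk (e n) w * (pd2 g (x - w) - pd2 g x) ∂μΩ) atTop
        (𝓝 (∫ _, (0:ℝ) ∂μΩ)) := by
      refine tendsto_integral_of_dominated_convergence (fun w => (C1 + C2) * (2 * π * (√(Dk 0 w))⁻¹))
        (fun n => ?_) ((inv_sqrt_Dk_integrable.const_mul (2 * π)).const_mul _) (fun n => ?_) ?_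
      · exact ((Mk_continuous (e0 n)).mul ((g2.continuous.comp (by fun_prop :
          Continuous fun w : ℝ² => x - w)).sub continuous_const)).aestronglyMeasurable
      · filter_upwards [ae_strip] with w hw
        rw [norm_eq_abs, abs_mul, abs_of_nonneg (Mk_nonneg (e0 n) w)]
        have hC : 0 ≤ C1 + C2 := add_nonneg ((abs_nonneg _).trans (b1.bd 0)) ((abs_nonneg _).trans (b2.bd 0))
        calc _ ≤ Mk (e n) w * ((C1 + C2) * √(Dk 0 w)) :=
              mul_le_mul_of_nonneg_left (strip_lip g2.DD1 g2.DD2 b1.bd b2.bd hp.pd2 x w hw.2.1.le hw.2.2.le)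
                (Mk_nonneg (e0 n) w)
          _ = (C1 + C2) * (Mk (e n) w * √(Dk 0 w)) := by ring
          _ ≤ _ := mul_le_mul_of_nonneg_left (Mk_sqrt_le (e0 n) (e1 n) w) hC
      · filter_upwards [Dk_zero_pos_ae] with w hw
        rw [← zero_mul (pd2 g (x - w) - pd2 g x)]
        refine Tendsto.mul_const _ ?_
        have a1 : Tendsto (fun n => 2 * π * e n * (cosh (2 * π * w.1) + cos (2 * π * w.2))) atTop (𝓝 0) := by
          simpa using (et.const_mul (2 * π)).mul_const (cosh (2 * π * w.1) + cos (2 * π * w.2))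
        have a2 : Tendsto (fun n => (Dk 0 w + e n) ^ 2) atTop (𝓝 (Dk 0 w ^ 2)) := by
          simpa using (et.const_add (Dk 0 w)).pow 2
        simpa [Mk, Dk_eq (e _), Pi.div_def] using a1.div a2 (by positivity)
    simpa using this
  have l3 (n : ℕ) : ∫ w, kk (e n) w * (pd1 (pd1 g) (x - w) + pd2 (pd2 g) (x - w)) ∂μΩ =
      ∫ w, Mk (e n) w * (pd2 g (x - w) - pd2 g x) ∂μΩ + pd2 g x := by
    have iM := cw_dom_integrable (Mk_continuous (e0 n)) (Mk_cw (e0 n) (e1 n))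
    have i2 : Integrable (fun w => Mk (e n) w * pd2 g (x - w)) μΩ :=
      iM.mul_bdd (c := C) ((g2.continuous.comp (by fun_prop :
        Continuous fun w : ℝ² => x - w)).aestronglyMeasurable) (.of_forall fun w => bC.bd _)
    rw [kk_lap (e0 n) (e1 n) hg hp]
    simp only [mul_sub]
    rw [integral_sub i2 (iM.mul_const _), integral_mul_const, integral_Mk (e0 n) (e1 n)]
    ring
  refine tendsto_nhds_unique l1 ?_
  simp only [l3]
  simpa using l2.add_const (pd2 g x)

theorem BB_sm (h : Sm f) : Sm (BB f) := SB.av h (kk_integrable le_rfl) measurable_neg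

theorem BB_per (h : Per f) : Per (BB f) := fun x => by
  simp only [BB, AV]
  congr 1
  funext w
  congr 1
  exact h (x + -w) ▸ by congr 1; ext <;> simp; ring

theorem BB_DD (hd : DD e f g) (hf : BC C f) (hg : BC D g) :
    DD e (BB f) (BB g) := AV_DD (kk_integrable le_rfl) measurable_neg hd hf hg

theorem pd1_add (hf : Sm f) (hg : Sm g) : pd1 (fun x => f x + g x) = fun x => pd1 f x + pd1 g x :=
  (hf.DD1.add hg.DD1).pd1_eq
theorem pd2_add (hf : Sm f) (hg : Sm g) : pd2 (fun x => f x + g x) = fun x => pd2 f x + pd2 g x :=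
  (hf.DD2.add hg.DD2).pd2_eq
theorem pd1_sub (hf : Sm f) (hg : Sm g) : pd1 (fun x => f x - g x) = fun x => pd1 f x - pd1 g x :=
  (hf.DD1.sub hg.DD1).pd1_eq
theorem pd2_sub (hf : Sm f) (hg : Sm g) : pd2 (fun x => f x - g x) = fun x => pd2 f x - pd2 g x :=
  (hf.DD2.sub hg.DD2).pd2_eq
theorem pd1_const_mul (c : ℝ) (hf : Sm f) : pd1 (fun x => c * f x) = fun x => c * pd1 f x :=
  (hf.DD1.const_mul c).pd1_eq
theorem pd2_const_mul (c : ℝ) (hf : Sm f) : pd2 (fun x => c * f x) = fun x => c * pd2 f x :=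
  (hf.DD2.const_mul c).pd2_eq
theorem pd1_mul (hf : Sm f) (hg : Sm g) :
    pd1 (fun x => f x * g x) = fun x => pd1 f x * g x + f x * pd1 g x :=
  (hf.DD1.mul hg.DD1).pd1_eq
theorem pd2_mul (hf : Sm f) (hg : Sm g) :
    pd2 (fun x => f x * g x) = fun x => pd2 f x * g x + f x * pd2 g x :=
  (hf.DD2.mul hg.DD2).pd2_eq

theorem HE_pd1 (j k : ℕ) (hq : 0 < q) (hf : Sm f) : HE (j + 1) k q f = HE j k q (pd1 f) := by
  obtain ⟨C, -, hC⟩ := hf.bc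
  obtain ⟨D, -, hD⟩ := hf.pd1.bc
  exact HE_succ_left j k hq hf.DD1 hC.cont hD.cont hC.bd hD.bd

theorem HE_pd2 (j k : ℕ) (hq : 0 < q) (hf : Sm f) : HE j (k + 1) q f = HE j k q (pd2 f) := by
  obtain ⟨C, -, hC⟩ := hf.bc
  obtain ⟨D, -, hD⟩ := hf.pd2.bc
  exact HE_succ_right j k hq hf.DD2 hC.cont hD.cont hC.bd hD.bd

/-- The Laplacian on `ℝ²`. -/
def lap (g : ℝ² → ℝ) (x : ℝ²) : ℝ := pd1 (pd1 g) x + pd2 (pd2 g) x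

theorem Sm.lap (h : Sm g) : Sm (lap g) := h.pd1.pd1.add h.pd2.pd2

theorem lap_sub (hf : Sm f) (hg : Sm g) : lap (fun x => f x - g x) = fun x => lap f x - lap g x := by
  funext x
  simp only [lap, pd1_sub hf hg, pd2_sub hf hg, pd1_sub hf.pd1 hg.pd1, pd2_sub hf.pd2 hg.pd2]
  ring

theorem lap_const_mul (c : ℝ) (hf : Sm f) : lap (fun x => c * f x) = fun x => c * lap f x := by
  funext x
  simp only [lap, pd1_const_mul c hf, pd2_const_mul c hf, pd1_const_mul c hf.pd1,
    pd2_const_mul c hf.pd2]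
  ring

theorem lap_pd1 (hf : Sm f) : lap (pd1 f) = pd1 (lap f) := by
  have : pd1 (lap f) = _ := pd1_add hf.pd1.pd1 hf.pd2.pd2
  rw [this, pd_comm hf.pd2, pd_comm hf]
  rfl

theorem lap_pd2 (hf : Sm f) : lap (pd2 f) = pd2 (lap f) := by
  have : pd2 (lap f) = _ := pd2_add hf.pd1.pd1 hf.pd2.pd2
  rw [this, ← pd_comm hf.pd1, ← pd_comm hf]
  rfl

theorem Sm.HS_hasDerivAt (h : Sm f) (hq : 0 < q) (x : ℝ²) :
    HasDerivAt (fun q => HS q f x) (HS q (NS.lap f) x) q := by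
  obtain ⟨C, h0, c⟩ := h.bc
  obtain ⟨C1, h1, c1⟩ := h.pd1.bc
  obtain ⟨C2, h2, c2⟩ := h.pd2.bc
  obtain ⟨C3, h3, c3⟩ := h.pd1.pd1.bc
  obtain ⟨C4, h4, c4⟩ := h.pd2.pd2.bc
  exact NS.HS_hasDerivAt (C := C + C1 + C2 + C3 + C4) h.DD1 h.DD2 h.pd1.DD1 h.pd2.DD2 c.cont c1.cont
    c2.cont c3.cont c4.cont (fun x => (c.bd x).trans (by linarith)) (fun x => (c1.bd x).trans (by linarith))
    (fun x => (c2.bd x).trans (by linarith)) (fun x => (c3.bd x).trans (by linarith))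
    (fun x => (c4.bd x).trans (by linarith)) hq x

theorem HS_div_tendsto {g1 g2 : ℝ² → ℝ} (h1 : Sm g1) (h2 : Sm g2)
    (x : ℝ²) : Tendsto (fun q => HS q (fun y => pd1 g1 y + pd2 g2 y) x) atTop (𝓝 0) := by
  obtain ⟨C1, -, c1⟩ := h1.bc
  obtain ⟨C2, -, c2⟩ := h2.bc
  have hs : Tendsto (fun q : ℝ => (√(2 * q))⁻¹ * (hm 1 0 * C1 + hm 0 1 * C2)) atTop (𝓝 0) := by
    have : Tendsto (fun q : ℝ => √(2 * q)) atTop atTop :=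
      tendsto_sqrt_atTop.comp (tendsto_id.const_mul_atTop two_pos)
    simpa using this.inv_tendsto_atTop.mul_const (hm 1 0 * C1 + hm 0 1 * C2)
  refine squeeze_zero_norm' ?_ hs
  filter_upwards [eventually_gt_atTop 0] with q hq
  obtain ⟨D1, -, d1⟩ := h1.pd1.bc
  obtain ⟨D2, -, d2⟩ := h2.pd2.bc
  rw [HS_add (f := pd1 g1) (g := pd2 g2) q d1.cont d2.cont d1.bd d2.bd, norm_eq_abs]
  have e1 := HE_abs_le 1 0 q c1.bd x
  have e2 := HE_abs_le 0 1 q c2.bd x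
  rw [HE_pd1 0 0 hq h1] at e1
  rw [HE_pd2 0 0 hq h2] at e2
  rw [add_zero, pow_one] at e1
  rw [zero_add, pow_one] at e2
  refine (abs_add_le _ _).trans ((add_le_add e1 e2).trans_eq (by ring))

theorem integral_HS_lap {G g1 g2 : ℝ² → ℝ} (hG : Sm G) (h1 : Sm g1) (h2 : Sm g2)
    (e : G = fun y => pd1 g1 y + pd2 g2 y) (hτ : 0 < τ) (x : ℝ²) {w : ℝ → ℝ}
    (hw : IntegrableOn w (Ioi 0)) (hwe : ∀ q > 0, w q = HS (τ + q) (lap G) x) :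
    ∫ q in Ioi (0:ℝ), w q = - HS τ G x := by
  have hi : IntegrableOn (fun q => HS (τ + q) (lap G) x) (Ioi 0) :=
    hw.congr_fun (fun q hq => hwe q hq) measurableSet_Ioi
  rw [setIntegral_congr_fun measurableSet_Ioi (fun q hq => hwe q hq)]
  have ht : Tendsto (fun q => HS (τ + q) G x) atTop (𝓝 0) := by
    rw [e]
    exact (HS_div_tendsto h1 h2 x).comp (tendsto_atTop_add_const_left _ τ tendsto_id)
  rw [integral_Ioi_of_hasDerivAt_of_tendsto' (fun q (hq : 0 ≤ q) =>
    (hG.HS_hasDerivAt (by linarith : 0 < τ + q) x).comp_const_add τ q) hi ht]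
  simp

/-- The source term `∂₁b - ∂₂a` of the pressure. -/
def cF (a b : ℝ² → ℝ) (y : ℝ²) : ℝ := pd1 b y - pd2 a y

/-- First component of the projected nonlinearity. -/
def QF1 (a b : ℝ² → ℝ) (x : ℝ²) : ℝ := pd2 b x - 2 * pd1 (BB (cF a b)) x

/-- Second component of the projected nonlinearity. -/
def QF2 (a b : ℝ² → ℝ) (x : ℝ²) : ℝ := 2 * cF a b x - pd1 b x - 2 * pd2 (BB (cF a b)) x

section
variable {a b : ℝ² → ℝ}

theorem cF_sm (ha : Sm a) (hb : Sm b) : Sm (cF a b) := hb.pd1.sub ha.pd2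
theorem cF_per (ha : Per a) (hb : Per b) : Per (cF a b) := fun x => by
  simp only [cF, hb.pd1 x, ha.pd2 x]
theorem QF1_sm (ha : Sm a) (hb : Sm b) : Sm (QF1 a b) :=
  hb.pd2.sub ((BB_sm (cF_sm ha hb)).pd1.const_mul 2)
theorem QF2_sm (ha : Sm a) (hb : Sm b) : Sm (QF2 a b) :=
  (((cF_sm ha hb).const_mul 2).sub hb.pd1).sub ((BB_sm (cF_sm ha hb)).pd2.const_mul 2)

theorem lap_BB (hf : Sm f) (hp : Per f) : lap (BB f) = pd2 f := by
  obtain ⟨C, -, c⟩ := hf.bc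
  obtain ⟨C1, -, c1⟩ := hf.pd1.bc
  obtain ⟨C2, -, c2⟩ := hf.pd2.bc
  obtain ⟨C3, -, c3⟩ := hf.pd1.pd1.bc
  obtain ⟨C4, -, c4⟩ := hf.pd2.pd2.bc
  funext x
  rw [← BB_lap hf hp x, lap, (BB_DD hf.DD1 c c1).pd1_eq, (BB_DD hf.DD2 c c2).pd2_eq,
    (BB_DD hf.pd1.DD1 c1 c3).pd1_eq, (BB_DD hf.pd2.DD2 c2 c4).pd2_eq]
  exact (AV_add (kk_integrable le_rfl) measurable_neg c3 c4 x).symm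

theorem lap_QF1 (ha : Sm a) (hb : Sm b) (pa : Per a) (pb : Per b) (x : ℝ²) :
    lap (QF1 a b) x = pd2 (pd2 (pd2 b)) x - pd1 (pd1 (pd2 b)) x + 2 * pd1 (pd2 (pd2 a)) x := by
  have hf := cF_sm ha hb
  have e : lap (QF1 a b) = _ := lap_sub hb.pd2 ((BB_sm hf).pd1.const_mul 2)
  have e2 : pd2 (cF a b) = _ := pd2_sub hb.pd1 ha.pd2
  rw [e, lap_const_mul 2 (BB_sm hf).pd1, lap_pd1 (BB_sm hf), lap_BB hf (cF_per pa pb), e2,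
    pd1_sub hb.pd1.pd2 ha.pd2.pd2, ← pd_comm hb]
  simp only [lap]
  ring

theorem lap_QF2 (ha : Sm a) (hb : Sm b) (pa : Per a) (pb : Per b) (x : ℝ²) :
    lap (QF2 a b) x = pd1 (pd1 (pd1 b)) x - pd1 (pd2 (pd2 b)) x - 2 * pd1 (pd1 (pd2 a)) x := by
  have hf := cF_sm ha hb
  have e : lap (QF2 a b) = _ := lap_sub ((hf.const_mul 2).sub hb.pd1) ((BB_sm hf).pd2.const_mul 2)
  have e2 : lap (cF a b) = _ := lap_sub hb.pd1 ha.pd2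
  have e3 : pd2 (cF a b) = _ := pd2_sub hb.pd1 ha.pd2
  rw [e, lap_const_mul 2 (BB_sm hf).pd2, lap_pd2 (BB_sm hf), lap_BB hf (cF_per pa pb),
    lap_sub (hf.const_mul 2) hb.pd1, lap_const_mul 2 hf, e2, e3, pd2_sub hb.pd1.pd2 ha.pd2.pd2]
  simp only [lap]
  rw [← pd_comm hb, ← pd_comm hb.pd2]
  ring

theorem HS_pd3 {f₃ : ℝ² → ℝ} (c1 c2 c₃ : ℝ) (q : ℝ) (h1 : Sm f1) (h2 : Sm f2) (h₃ : Sm f₃)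
    (x : ℝ²) : HS q (fun y => c1 * f1 y + c2 * f2 y + c₃ * f₃ y) x =
      c1 * HS q f1 x + c2 * HS q f2 x + c₃ * HS q f₃ x := by
  obtain ⟨C12, -, b12⟩ := ((h1.const_mul c1).add (h2.const_mul c2)).bc
  obtain ⟨C1, -, b1⟩ := (h1.const_mul c1).bc
  obtain ⟨C2, -, b2⟩ := (h2.const_mul c2).bc
  obtain ⟨C3, -, b3⟩ := (h₃.const_mul c₃).bc
  rw [HS_add (f := fun y => c1 * f1 y + c2 * f2 y) (g := fun y => c₃ * f₃ y) q b12.cont b3.cont b12.bd b3.bd,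
    HS_add (f := fun y => c1 * f1 y) (g := fun y => c2 * f2 y) q b1.cont b2.cont b1.bd b2.bd,
    HS_const_mul, HS_const_mul, HS_const_mul]

theorem HN_eq_QF1 (ha : Sm a) (hb : Sm b) (pa : Per a) (pb : Per b) (hτ : 0 < τ) (x : ℝ²) :
    HN 2 1 τ b x - HN 0 3 τ b x - 2 * HN 1 2 τ a x = HS τ (QF1 a b) x := by
  obtain ⟨A, -, hA⟩ := ha.bc
  obtain ⟨B, -, hB⟩ := hb.bc
  have i1 := HN_integrable (j := 2) (k := 1) rfl hτ hB x
  have i2 := HN_integrable (j := 0) (k := 3) rfl hτ hB x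
  have i3 := (HN_integrable (j := 1) (k := 2) rfl hτ hA x).const_mul 2
  have hG := (QF1_sm ha hb).const_mul (-1)
  have key := integral_HS_lap hG ((BB_sm (cF_sm ha hb)).const_mul 2) (hb.const_mul (-1)) (by
      rw [pd1_const_mul 2 (BB_sm (cF_sm ha hb)), pd2_const_mul _ hb]; funext y; simp only [QF1]; ring)
    hτ x ((i1.sub i2).sub i3) (fun q hq => by
      have hq' : 0 < τ + q := by linarith [show 0 < q from hq]
      rw [lap_const_mul _ (QF1_sm ha hb)]
      have e : (fun y => -1 * lap (QF1 a b) y) = fun y => 1 * pd1 (pd1 (pd2 b)) y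
          + (-1) * pd2 (pd2 (pd2 b)) y + (-2) * pd1 (pd2 (pd2 a)) y := by
        funext y; rw [lap_QF1 ha hb pa pb]; ring
      rw [e, HS_pd3 _ _ _ _ hb.pd2.pd1.pd1 hb.pd2.pd2.pd2 ha.pd2.pd2.pd1]
      simp only [Pi.sub_apply]
      rw [HE_pd2 2 0 hq' hb, HE_pd1 1 0 hq' hb.pd2, HE_pd1 0 0 hq' hb.pd2.pd1, HE_pd2 0 2 hq' hb,
        HE_pd2 0 1 hq' hb.pd2, HE_pd2 0 0 hq' hb.pd2.pd2, HE_pd2 1 1 hq' ha, HE_pd2 1 0 hq' ha.pd2,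
        HE_pd1 0 0 hq' ha.pd2.pd2]
      ring)
  rw [integral_sub' (i1.sub i2) i3, integral_sub' i1 i2, integral_const_mul, HS_const_mul] at key
  simp only [HN]
  linarith

theorem HN_eq_QF2 (ha : Sm a) (hb : Sm b) (pa : Per a) (pb : Per b) (hτ : 0 < τ) (x : ℝ²) :
    HN 3 0 τ b x - HN 1 2 τ b x - 2 * HN 2 1 τ a x = - HS τ (QF2 a b) x := by
  obtain ⟨A, -, hA⟩ := ha.bc
  obtain ⟨B, -, hB⟩ := hb.bc
  have i1 := HN_integrable (j := 3) (k := 0) rfl hτ hB x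
  have i2 := HN_integrable (j := 1) (k := 2) rfl hτ hB x
  have i3 := (HN_integrable (j := 2) (k := 1) rfl hτ hA x).const_mul 2
  have hBB := BB_sm (cF_sm ha hb)
  have key := integral_HS_lap (QF2_sm ha hb) hb ((ha.const_mul (-2)).sub (hBB.const_mul 2)) (by
      rw [pd2_sub (ha.const_mul (-2)) (hBB.const_mul 2), pd2_const_mul 2 hBB, pd2_const_mul _ ha]
      funext y; simp only [QF2, cF]; ring)
    hτ x ((i1.sub i2).sub i3) (fun q hq => by
      have hq' : 0 < τ + q := by linarith [show 0 < q from hq]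
      have e : lap (QF2 a b) = fun y => 1 * pd1 (pd1 (pd1 b)) y
          + (-1) * pd1 (pd2 (pd2 b)) y + (-2) * pd1 (pd1 (pd2 a)) y := by
        funext y; rw [lap_QF2 ha hb pa pb]; ring
      rw [e, HS_pd3 _ _ _ _ hb.pd1.pd1.pd1 hb.pd2.pd2.pd1 ha.pd2.pd1.pd1]
      simp only [Pi.sub_apply]
      rw [HE_pd1 2 0 hq' hb, HE_pd1 1 0 hq' hb.pd1, HE_pd1 0 0 hq' hb.pd1.pd1, HE_pd2 1 1 hq' hb,
        HE_pd2 1 0 hq' hb.pd2, HE_pd1 0 0 hq' hb.pd2.pd2, HE_pd2 2 0 hq' ha, HE_pd1 1 0 hq' ha.pd2,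
        HE_pd1 0 0 hq' ha.pd2.pd1]
      ring)
  rw [integral_sub' (i1.sub i2) i3, integral_sub' i1 i2, integral_const_mul] at key
  simp only [HN]
  linarith

end

theorem hasDerivAt_of_right_deriv {v R : ℝ → ℝ} (hI : IsOpen I) (hv : ContinuousOn v I)
    (hR : ContinuousOn R I) (hd : ∀ s ∈ I, HasDerivWithinAt v (R s) (Ici s) s) (ht : t ∈ I) :
    HasDerivAt v (R t) t := by
  obtain ⟨δ, hδ, hb⟩ := Metric.isOpen_iff.1 hI t ht
  have hJ : Icc (t - δ / 2) (t + δ / 2) ⊆ I := fun s hs => hb (by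
    rw [Metric.mem_ball, Real.dist_eq, abs_lt]; constructor <;> linarith [hs.1, hs.2])
  set c := t - δ / 2
  set d := t + δ / 2
  have hcd : c ≤ d := by simp only [c, d]; linarith
  set R' : ℝ → ℝ := fun s => R (projIcc c d hcd s)
  have hR' : Continuous R' := (hR.mono hJ).comp_continuous (by fun_prop) fun s => (projIcc c d hcd s).2
  have e : ∀ s ∈ Icc c d, R' s = R s := fun s hs => by simp only [R', projIcc_of_mem hcd hs]
  have hint : ∀ s, HasDerivAt (fun u => ∫ r in c..u, R' r) (R' s) s := fun s =>
    intervalIntegral.integral_hasDerivAt_right (hR'.intervalIntegrable _ _)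
      hR'.aestronglyMeasurable.stronglyMeasurableAtFilter hR'.continuousAt
  have key := constant_of_has_deriv_right_zero (a := c) (b := d)
    (f := fun s => v s - ∫ r in c..s, R' r)
    ((hv.mono hJ).sub (continuous_iff_continuousAt.2 fun s => (hint s).continuousAt).continuousOn)
    (fun s hs => ((hd s (hJ ⟨hs.1, hs.2.le⟩)).fun_sub (hint s).hasDerivWithinAt).congr_deriv
      (by rw [e s ⟨hs.1, hs.2.le⟩, sub_self]))
  have htm : t ∈ Icc c d := by simp only [c, d]; constructor <;> linarith
  rw [← e t htm]
  refine ((hint t).const_add (v c)).congr_of_eventuallyEq ?_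
  filter_upwards [Icc_mem_nhds (by simp only [c]; linarith : c < t) (by simp only [d]; linarith : t < d)] with s hs
  have := key s hs
  simp only [intervalIntegral.integral_same, sub_zero] at this
  linarith

theorem HS_hasDerivWithinAt_zero (hf : Sm f) (x : ℝ²) :
    HasDerivWithinAt (fun q => HS q f x) (lap f x) (Ici 0) 0 := by
  obtain ⟨C, -, c⟩ := hf.bc
  obtain ⟨D, -, d⟩ := hf.lap.bc
  have c1 : Continuous fun q => HS q f x :=
    (HS_continuous c.cont c.bd).comp (by fun_prop : Continuous fun q : ℝ => (q, x))
  have c2 : Continuous fun q => HS q (lap f) x :=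
    (HS_continuous d.cont d.bd).comp (by fun_prop : Continuous fun q : ℝ => (q, x))
  refine hasDerivWithinAt_Ici_of_tendsto_deriv (s := Ioi 0)
    (fun q hq => (hf.HS_hasDerivAt hq x).differentiableAt.differentiableWithinAt)
    c1.continuousWithinAt self_mem_nhdsWithin ?_
  have : Tendsto (fun q => HS q (lap f) x) (𝓝[>] 0) (𝓝 (lap f x)) := by
    have := (c2.tendsto 0).mono_left (nhdsWithin_le_nhds (s := Ioi 0))
    rwa [HS_zero] at this
  refine this.congr' ?_
  filter_upwards [self_mem_nhdsWithin] with q hq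
  exact ((hf.HS_hasDerivAt hq x).deriv).symm

theorem duhamel_right_deriv (hI : IsOpen I) {v Q : ℝ → ℝ² → ℝ} (hv : SB I v)
    (hQ : SB I Q) (hs : s ∈ I) (x : ℝ²) {δ : ℝ} (hδ : 0 < δ)
    (hD : ∀ h, 0 ≤ h → h ≤ δ →
      v (s + h) x = HS h (v s) x - ∫ r in Ioc 0 h, HS r (Q (s + h - r)) x) :
    HasDerivWithinAt (fun t => v t x) (lap (v s) x - Q s x) (Ici s) s := by
  obtain ⟨C, -, hC⟩ := hQ.bd
  set S : Set ℝ² := {p | s + p.2 - p.1 ∈ I}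
  have hS : IsOpen S := hI.preimage (by fun_prop : Continuous fun p : ℝ² => s + p.2 - p.1)
  have h0S : ((0, 0) : ℝ²) ∈ S := by simpa [S] using hs
  have hcont : ContinuousOn (fun p : ℝ² => HS p.1 (Q (s + p.2 - p.1)) x) S :=
    HS_contOn (q := fun p : ℝ² => p.1) (F := fun p : ℝ² => Q (s + p.2 - p.1)) (x := fun _ => x)
      (by fun_prop)
      (hQ.cont.comp (f := fun w : ℝ² × ℝ² => (s + w.1.2 - w.1.1, w.2)) (by fun_prop)
        fun w hw => ⟨hw.1, trivial⟩) continuousOn_const (fun p hp y => hC _ hp y)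
  have hJ : HasDerivWithinAt (fun h => ∫ r in Ioc 0 h, HS r (Q (s + h - r)) x) (Q s x) (Ici 0) 0 := by
    rw [hasDerivWithinAt_iff_isLittleO, Asymptotics.isLittleO_iff]
    intro ε hε
    have hca : ContinuousAt (fun p : ℝ² => HS p.1 (Q (s + p.2 - p.1)) x) (0, 0) :=
      hcont.continuousAt (hS.mem_nhds h0S)
    have hev := (hca.eventually (Metric.ball_mem_nhds _ hε)).and (hS.mem_nhds h0S)
    obtain ⟨η, hη, hball⟩ := Metric.eventually_nhds_iff.1 hev
    filter_upwards [mem_nhdsWithin_of_mem_nhds (Iio_mem_nhds hη), self_mem_nhdsWithin] with h hh h0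
    rw [mem_Ici] at h0
    have hb : ∀ r ∈ Icc 0 h, dist (r, h) ((0, 0) : ℝ²) < η := fun r hr => by
      rw [Prod.dist_eq, max_lt_iff, dist_zero_right, dist_zero_right, norm_of_nonneg hr.1,
        norm_of_nonneg h0]
      exact ⟨hr.2.trans_lt hh, hh⟩
    have hi : IntegrableOn (fun r => HS r (Q (s + h - r)) x) (Ioc 0 h) := by
      refine (ContinuousOn.integrableOn_Icc ?_).mono_set Ioc_subset_Icc_self
      exact hcont.comp (f := fun r : ℝ => (r, h)) (by fun_prop) fun r hr => (hball (hb r hr)).2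
    have e : (∫ r in Ioc 0 h, HS r (Q (s + h - r)) x) - h * Q s x =
        ∫ r in Ioc 0 h, (HS r (Q (s + h - r)) x - Q s x) := by
      rw [integral_sub hi (by simp), setIntegral_const]
      simp [h0]
    simp only [sub_zero, smul_eq_mul, Ioc_self, Measure.restrict_empty, integral_zero_measure]
    rw [e]
    refine (norm_setIntegral_le_of_norm_le_const (C := ε) (by simp) fun r hr => ?_).trans ?_
    · have := (hball (hb r ⟨hr.1.le, hr.2⟩)).1
      simp only [HS_zero, sub_zero, add_zero, dist_eq_norm] at this
      exact this.le
    · simp [h0, abs_of_nonneg h0]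
  have h1 : HasDerivWithinAt (fun h => v (s + h) x) (lap (v s) x - Q s x) (Ici 0) 0 := by
    refine ((HS_hasDerivWithinAt_zero (hv.slice hs) x).fun_sub hJ).congr_of_eventuallyEq ?_ ?_
    · filter_upwards [mem_nhdsWithin_of_mem_nhds (Iio_mem_nhds hδ), self_mem_nhdsWithin] with h hh h0
      exact hD h h0 (le_of_lt hh)
    · exact hD 0 le_rfl hδ.le
  have h2 : HasDerivWithinAt (fun t : ℝ => t - s) 1 (Ici s) s := (hasDerivWithinAt_id s _).sub_const s
  have h3 := HasDerivWithinAt.scomp (h := fun t : ℝ => t - s) (h' := 1) s (t' := Ici 0)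
    (g₁ := fun h => v (s + h) x) (g₁' := lap (v s) x - Q s x)
    (by simpa using h1) h2 (fun t ht => by simpa using ht)
  simpa [Function.comp_def] using h3

theorem Mild.per (h : Mild T M u1 u2) (p1 : Per (u1 0)) (p2 : Per (u2 0)) (ht : 0 ≤ t)
    (htT : t ≤ T) : Per (u1 t) ∧ Per (u2 t) := by
  have e : ∀ x : ℝ², x + (0, 1) = (x.1, x.2 + 1) := fun x => by ext <;> simp
  have := (h.shift (0, 1)).unique h (funext fun x => by rw [e]; exact p1 x)
    (funext fun x => by rw [e]; exact p2 x) t ht htT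
  exact ⟨fun x => by rw [← e]; exact congrFun this.1 x, fun x => by rw [← e]; exact congrFun this.2 x⟩

theorem qa_per (h1 : Per (u1 t)) (h2 : Per (u2 t)) : Per (qa u1 u2 t) := fun x => by
  simp only [qa, h1 x, h2 x]
theorem qb_per (h1 : Per (u1 t)) (h2 : Per (u2 t)) : Per (qb u1 u2 t) := fun x => by
  simp only [qb, h1 x, h2 x]

theorem Mild.sb (h : Mild T M u1 u2) (hσ : 0 < σ) :
    SB (Ioo σ T) u1 ∧ SB (Ioo σ T) u2 := by
  refine ⟨⟨h.tb1.cont.continuousOn, fun n => ?_⟩, ⟨h.tb2.cont.continuousOn, fun n => ?_⟩⟩ <;>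
  obtain ⟨A, hA, H⟩ := Mild.fd_bound n h.tb1.nonneg hσ <;>
  refine ⟨A, h.tb1.nonneg.trans hA, fun L hL t ht x => ?_⟩
  · exact (H T u1 u2 h t ht.1.le ht.2.le L hL.le x).1
  · exact (H T u1 u2 h t ht.1.le ht.2.le L hL.le x).2

theorem TS.sub (hI : IsOpen I) (h : TS I j F) (h' : TS I j G) : TS I j (fun t x => F t x - G t x) :=
  (h.add (h'.const_mul (-1))).congr hI fun t _ => by funext x; ring

theorem TS.qa (hI : IsOpen I) (h1 : TS I j u1) (h2 : TS I j u2) : TS I j (qa u1 u2) :=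
  (((h1.mul h1).sub hI (h2.mul h2)).const_mul 2⁻¹).congr hI fun t _ => by
    funext x; simp only [NS.qa]; ring

theorem TS.qb (h1 : TS I j u1) (h2 : TS I j u2) : TS I j (qb u1 u2) := h1.mul h2

theorem TS.cF (hI : IsOpen I) (h1 : TS I j F) (h2 : TS I j G) : TS I j (fun t => cF (F t) (G t)) :=
  (h2.d1 hI).sub hI (h1.d2 hI)

theorem TS.BB (hI : IsOpen I) (h : TS I j F) : TS I j (fun t => BB (F t)) :=
  h.av hI (kk_integrable le_rfl) measurable_neg

theorem TS.QF1 (hI : IsOpen I) (h1 : TS I j F) (h2 : TS I j G) : TS I j (fun t => QF1 (F t) (G t)) :=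
  (h2.d2 hI).sub hI ((((h1.cF hI h2).BB hI).d1 hI).const_mul 2)

theorem TS.QF2 (hI : IsOpen I) (h1 : TS I j F) (h2 : TS I j G) : TS I j (fun t => QF2 (F t) (G t)) :=
  ((((h1.cF hI h2).const_mul 2).sub hI (h2.d1 hI))).sub hI ((((h1.cF hI h2).BB hI).d2 hI).const_mul 2)

theorem TS.lap (hI : IsOpen I) (h : TS I j F) : TS I j (fun t => lap (F t)) :=
  ((h.d1 hI).d1 hI).add ((h.d2 hI).d2 hI)

theorem DW_eq_integral {a b : ℝ → ℝ² → ℝ} (ha : TB A a) (hb : TB B b)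
    (sm : ∀ q ∈ Ioc 0 t, Sm (a (t - q)) ∧ Sm (b (t - q)) ∧ Per (a (t - q)) ∧ Per (b (t - q)))
    (x : ℝ²) : DW 0 1 a b t x = ∫ q in Ioc 0 t, HS q (QF1 (a (t - q)) (b (t - q))) x ∧
      DW 1 0 a b t x = -∫ q in Ioc 0 t, HS q (QF2 (a (t - q)) (b (t - q))) x := by
  have D {j k} (h : j + k = 1) {f : ℝ → ℝ} (e : ∀ q ∈ Ioc 0 t, HN (j + 2) k q (b (t - q)) x
      - HN j (k + 2) q (b (t - q)) x - 2 * HN (j + 1) (k + 1) q (a (t - q)) x = f q) :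
      DW j k a b t x = ∫ q in Ioc 0 t, f q := by
    have i := DU_integrable (j := j + 2) (k := k) (by omega) hb t x
    have i' := DU_integrable (j := j) (k := k + 2) (by omega) hb t x
    rw [DW, DU, DU, DU, ← integral_const_mul, ← integral_sub i i', ← integral_sub _
      ((DU_integrable (by omega) ha t x).const_mul 2)]
    exacts [setIntegral_congr_fun measurableSet_Ioc e, i.sub i']
  rw [← integral_neg]
  constructor <;> refine D rfl fun q hq => ?_ <;> obtain ⟨h1, h2, h3, h4⟩ := sm q hq
  exacts [HN_eq_QF1 h1 h2 h3 h4 hq.1 x, HN_eq_QF2 h1 h2 h3 h4 hq.1 x]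

theorem Mild.duhamel (h : Mild T M u1 u2) (p1 : Per (u1 0)) (p2 : Per (u2 0)) (hs : 0 < s)
    (hr : 0 ≤ r) (hsr : s + r < T) (x : ℝ²) :
    u1 (s + r) x = HS r (u1 s) x
      - ∫ q in Ioc 0 r, HS q (QF1 (qa u1 u2 (s + r - q)) (qb u1 u2 (s + r - q))) x ∧
    u2 (s + r) x = HS r (u2 s) x
      - ∫ q in Ioc 0 r, HS q (QF2 (qa u1 u2 (s + r - q)) (qb u1 u2 (s + r - q))) x := by
  have hR := h.restart hs.le (by linarith : s ≤ T)
  have hsb := h.sb (half_pos hs)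
  obtain ⟨d1, d2⟩ := DW_eq_integral (t := r) (hR.tb1.qa hR.tb2) (hR.tb1.qb hR.tb2) (fun q hq => by
    have hm : s + (r - q) ∈ Ioo (s / 2) T := ⟨by linarith [hq.2], by linarith [hq.1]⟩
    have hp := h.per p1 p2 (t := s + (r - q)) (by linarith [hm.1]) hm.2.le
    exact ⟨(TS.qa (j := 0) isOpen_Ioo hsb.1 hsb.2).sb.slice hm,
      (TS.qb (j := 0) hsb.1 hsb.2).sb.slice hm, qa_per hp.1 hp.2, qb_per hp.1 hp.2⟩) x
  simp only [add_sub_assoc]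
  rw [hR.eq1 r hr (by linarith) x, hR.eq2 r hr (by linarith) x, d1, d2, add_zero, ← sub_eq_add_neg]
  exact ⟨rfl, rfl⟩

theorem Mild.time_deriv (h : Mild T M u1 u2) (p1 : Per (u1 0)) (p2 : Per (u2 0)) (ht : 0 < t)
    (htT : t < T) (x : ℝ²) :
    HasDerivAt (fun s => u1 s x) (lap (u1 t) x - QF1 (qa u1 u2 t) (qb u1 u2 t) x) t ∧
    HasDerivAt (fun s => u2 s x) (lap (u2 t) x - QF2 (qa u1 u2 t) (qb u1 u2 t) x) t := by
  obtain ⟨s1, s2⟩ := h.sb (half_pos ht)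
  have hI : IsOpen (Ioo (t / 2) T) := isOpen_Ioo
  have qa' := TS.qa (j := 0) hI s1 s2
  have qb' := TS.qb (j := 0) s1 s2
  have hQ1 := (TS.QF1 hI qa' qb').sb
  have hQ2 := (TS.QF2 hI qa' qb').sb
  constructor
  · refine hasDerivAt_of_right_deriv (R := fun t => lap (u1 t) x - QF1 (qa u1 u2 t) (qb u1 u2 t) x) hI
      (s1.time_cont x) (((TS.lap (j := 0) hI s1).sub hI (TS.QF1 hI qa' qb')).sb.time_cont x)
      (fun s hs => ?_) ⟨by linarith, htT⟩
    exact duhamel_right_deriv hI s1 hQ1 hs x (half_pos (sub_pos.2 hs.2)) fun r hr hr' =>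
      (h.duhamel p1 p2 (by linarith [hs.1]) hr (by linarith [hs.2]) x).1
  · refine hasDerivAt_of_right_deriv (R := fun t => lap (u2 t) x - QF2 (qa u1 u2 t) (qb u1 u2 t) x) hI
      (s2.time_cont x) (((TS.lap (j := 0) hI s2).sub hI (TS.QF2 hI qa' qb')).sb.time_cont x)
      (fun s hs => ?_) ⟨by linarith, htT⟩
    exact duhamel_right_deriv hI s2 hQ2 hs x (half_pos (sub_pos.2 hs.2)) fun r hr hr' =>
      (h.duhamel p1 p2 (by linarith [hs.1]) hr (by linarith [hs.2]) x).2

theorem Mild.ts (h : Mild T M u1 u2) (p1 : Per (u1 0)) (p2 : Per (u2 0)) (hσ : 0 < σ) (j : ℕ) :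
    TS (Ioo σ T) j u1 ∧ TS (Ioo σ T) j u2 := by
  have hI : IsOpen (Ioo σ T) := isOpen_Ioo
  induction j with
  | zero => exact h.sb hσ
  | succ j ih =>
    obtain ⟨i1, i2⟩ := ih
    have hd := fun t (ht : t ∈ Ioo σ T) x => h.time_deriv p1 p2 (hσ.trans ht.1) ht.2 x
    exact ⟨⟨i1.sb, _, (i1.lap hI).sub hI ((i1.qa hI i2).QF1 hI (i1.qb i2)), fun t ht x => (hd t ht x).1⟩,
      ⟨i2.sb, _, (i2.lap hI).sub hI ((i1.qa hI i2).QF2 hI (i1.qb i2)), fun t ht x => (hd t ht x).2⟩⟩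

theorem heat_duhamel (hI : IsOpen I) {v Q : ℝ → ℝ² → ℝ} (hv : SB I v) (hQ : SB I Q)
    (hd : ∀ t ∈ I, ∀ x, HasDerivAt (fun s => v s x) (lap (v t) x - Q t x) t) (hst : s ≤ t)
    (hJ : Icc s t ⊆ I) (x : ℝ²) :
    v t x = HS (t - s) (v s) x - ∫ r in s..t, HS (t - r) (Q r) x := by
  have hL : SB I (fun t => lap (v t)) := (TS.lap (j := 0) hI hv).sb
  have hR : SB I (fun t x => lap (v t) x - Q t x) := (TS.sub (j := 0) hI hL hQ).sb
  have hc {F : ℝ → ℝ² → ℝ} (hF : SB I F) :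
      ContinuousOn (fun p : ℝ² => HS p.1 (F p.2) x) (univ ×ˢ I) := by
    obtain ⟨C, -, hC⟩ := hF.bd
    exact HS_contOn (q := fun p : ℝ² => p.1) (F := fun p : ℝ² => F p.2) (x := fun _ => x)
      (by fun_prop) (hF.cont.comp (f := fun w : ℝ² × ℝ² => (w.1.2, w.2)) (by fun_prop)
        fun w hw => ⟨hw.1.2, trivial⟩) continuousOn_const (fun p hp y => hC _ hp.2 y)
  have hcJ {F : ℝ → ℝ² → ℝ} (hF : SB I F) : ContinuousOn (fun r => HS (t - r) (F r) x) (Icc s t) :=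
    (hc hF).comp (f := fun r : ℝ => (t - r, r)) (by fun_prop) fun r hr => ⟨trivial, hJ hr⟩
  have key : ∀ r ∈ Ioo s t, HasDerivAt (fun r => HS (t - r) (v r) x) (-HS (t - r) (Q r) x) r := by
    intro r hr
    have hrI := hJ (Ioo_subset_Icc_self hr)
    have hO : Ioi (0:ℝ) ×ˢ I ∈ 𝓝 (t - r, r) := (isOpen_Ioi.prod hI).mem_nhds ⟨sub_pos.2 hr.2, hrI⟩
    have hca {F : ℝ → ℝ² → ℝ} (hF : SB I F) :
        ContinuousAt (fun p : ℝ² => HS p.1 (F p.2) x) (t - r, r) :=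
      (hc hF).continuousAt (mem_of_superset hO (prod_mono (subset_univ _) subset_rfl))
    have hcl {f : ℝ² → ℝ} (h : ContinuousAt f (t - r, r)) :
        ContinuousAt (fun p => ContinuousLinearMap.toSpanSingleton ℝ (f p)) (t - r, r) :=
      (ContinuousLinearMap.toSpanSingletonCLE (𝕜 := ℝ) (E := ℝ)).continuous.continuousAt.comp h
    have h1 := hasStrictFDerivAt_uncurry_coprod (𝕜 := ℝ) (u := (t - r, r))
      (f := fun q r => HS q (v r) x)
      (f₁ := fun q r => ContinuousLinearMap.toSpanSingleton ℝ (HS q (lap (v r)) x))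
      (f₂ := fun q r => ContinuousLinearMap.toSpanSingleton ℝ (HS q (fun x => lap (v r) x - Q r x) x))
      (by filter_upwards [hO] with p hp
          exact (Sm.HS_hasDerivAt (hv.slice hp.2) hp.1 x).hasFDerivAt)
      (by filter_upwards [hO] with p hp
          have := SB.av_time (m := volume) (κ := hk 0 0) (φ := fun z => √(2 * p.1) • z) I hI hv hR hd
            (hk_integrable 0 0) (by fun_prop) p.2 hp.2 x
          simp only [HS_eq]
          exact this.hasFDerivAt)
      (hcl (hca hL)) (hcl (hca hR))
    have h2 : HasDerivAt (fun r => (t - r, r)) ((-1 : ℝ), (1 : ℝ)) r :=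
      ((hasDerivAt_id r).const_sub t).prodMk (hasDerivAt_id r)
    have h3 := HasFDerivAt.comp_hasDerivAt (f := fun r => (t - r, r)) r h1.hasFDerivAt h2
    refine h3.congr_deriv ?_
    obtain ⟨C, hC⟩ := hL.bc
    obtain ⟨D, hD⟩ := hQ.bc
    have e := HS_sub (f := lap (v r)) (g := Q r) (t - r) (hC r hrI).cont (hD r hrI).cont (hC r hrI).bd
      (hD r hrI).bd x
    simp only [Function.HasUncurry.uncurry, id, e, ContinuousLinearMap.coprod_apply, ContinuousLinearMap.toSpanSingleton_apply, smul_eq_mul]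
    ring
  have := intervalIntegral.integral_eq_sub_of_hasDerivAt_of_le hst (hcJ hv) key
    ((hcJ hQ).neg.intervalIntegrable_of_Icc hst)
  rw [intervalIntegral.integral_neg] at this
  simp only [sub_self, HS_zero] at this
  linarith

theorem Sm.zero : Sm (fun _ => 0) := SB.const univ 0

theorem HS_eq_of_lap (h : Sm g) (hl : lap g = fun _ => 0) (hq : 0 ≤ q) (x : ℝ²) :
    g x = HS q g x := by
  have := heat_duhamel isOpen_univ (v := fun _ => g) (Q := fun _ _ => 0) h Sm.zero
    (fun t _ x => by rw [hl]; simpa using hasDerivAt_const t (g x)) hq (subset_univ _) x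
  simpa [HS_eq, GA] using this

theorem pd_zero_of_lap (h : Sm g) (hl : lap g = fun _ => 0) (x : ℝ²) : pd1 g x = 0 ∧ pd2 g x = 0 := by
  have z1 : ∀ x, pd1 (fun _ : ℝ² => (0:ℝ)) x = 0 := fun x => by simp [pd1]
  have z2 : ∀ x, pd2 (fun _ : ℝ² => (0:ℝ)) x = 0 := fun x => by simp [pd2]
  constructor
  · have l1 : lap (pd1 g) = fun _ => 0 := by rw [lap_pd1 h, hl]; exact funext z1
    have := HS_div_tendsto h Sm.zero x
    simp only [z2, add_zero] at this
    refine tendsto_nhds_unique (tendsto_const_nhds.congr' ?_) this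
    filter_upwards [eventually_ge_atTop 0] with q hq using HS_eq_of_lap h.pd1 l1 hq x
  · have l1 : lap (pd2 g) = fun _ => 0 := by rw [lap_pd2 h, hl]; exact funext z2
    have := HS_div_tendsto Sm.zero h x
    simp only [z1, zero_add] at this
    refine tendsto_nhds_unique (tendsto_const_nhds.congr' ?_) this
    filter_upwards [eventually_ge_atTop 0] with q hq using HS_eq_of_lap h.pd2 l1 hq x

theorem eq_of_pd_zero (h : Sm g) (h1 : ∀ x, pd1 g x = 0) (h2 : ∀ x, pd2 g x = 0) (x y : ℝ²) :
    g x = g y := by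
  have := lip_of_DD h.DD1 h.DD2 (C1 := 0) (C2 := 0) (by simp [h1]) (by simp [h2]) y (x - y)
  simpa [sub_eq_zero] using this

/-- Liouville's theorem: bounded harmonic functions are constant. -/
theorem eq_of_lap (h : Sm g) (hl : lap g = fun _ => 0) (x y : ℝ²) : g x = g y :=
  eq_of_pd_zero h (fun x => (pd_zero_of_lap h hl x).1) (fun x => (pd_zero_of_lap h hl x).2) x y

section
variable {a b : ℝ² → ℝ}

theorem div_QF (ha : Sm a) (hb : Sm b) (pa : Per a) (pb : Per b) (x : ℝ²) :
    pd1 (QF1 a b) x + pd2 (QF2 a b) x = 0 := by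
  have hc := cF_sm ha hb
  have hB := BB_sm hc
  have e1 : pd1 (QF1 a b) = _ := pd1_sub hb.pd2 (hB.pd1.const_mul 2)
  have e2 : pd2 (QF2 a b) = _ := pd2_sub ((hc.const_mul 2).sub hb.pd1) (hB.pd2.const_mul 2)
  rw [e1, e2, pd2_sub (hc.const_mul 2) hb.pd1, pd1_const_mul 2 hB.pd1, pd2_const_mul 2 hB.pd2,
    pd2_const_mul 2 hc, pd_comm hb]
  have := congrFun (lap_BB hc (cF_per pa pb)) x
  simp only [lap] at this
  linarith

theorem curl_QF (ha : Sm a) (hb : Sm b) (x : ℝ²) :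
    pd1 (QF2 a b) x - pd2 (QF1 a b) x = 2 * pd1 (cF a b) x - lap b x := by
  have hc := cF_sm ha hb
  have hB := BB_sm hc
  have e1 : pd2 (QF1 a b) = _ := pd2_sub hb.pd2 (hB.pd1.const_mul 2)
  have e2 : pd1 (QF2 a b) = _ := pd1_sub ((hc.const_mul 2).sub hb.pd1) (hB.pd2.const_mul 2)
  rw [e1, e2, pd1_sub (hc.const_mul 2) hb.pd1, pd2_const_mul 2 hB.pd1, pd1_const_mul 2 hB.pd2,
    pd1_const_mul 2 hc, pd_comm hB, lap]
  ring

end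

theorem WeakDivFree.scaled {v : ℝ² → ℝ²} (h : WeakDivFree v) (hσ : 0 < σ) (x : ℝ²)
    {ψ : ℝ² → ℝ} (hψ : ContDiff ℝ ∞ ψ) (hc : HasCompactSupport ψ) :
    ∫ z, ((v (x + σ • z)).1 * fderiv ℝ ψ z (1, 0) + (v (x + σ • z)).2 * fderiv ℝ ψ z (0, 1)) = 0 := by
  set A : ℝ² → ℝ² := fun y => σ⁻¹ • (y - x)
  have hA : ContDiff ℝ ∞ A := by fun_prop
  have hemb : Topology.IsClosedEmbedding A :=
    ((Homeomorph.subRight x).trans (Homeomorph.smulOfNeZero σ⁻¹ (inv_ne_zero hσ.ne'))).isClosedEmbedding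
  have key := h (fun y => ψ (A y)) (hψ.comp hA) (hc.comp_isClosedEmbedding hemb)
  have hd : ∀ y, HasFDerivAt ψ (fderiv ℝ ψ y) y := fun y =>
    (hψ.differentiable (by simp) y).hasFDerivAt
  have p1 : ∀ y, pd1 (fun y => ψ (A y)) y = σ⁻¹ * fderiv ℝ ψ (A y) (1, 0) := fun y => by
    have e : HasDerivAt (fun s : ℝ => A (s, y.2)) (σ⁻¹ • (1, 0)) y.1 :=
      (((hasDerivAt_id y.1).prodMk (hasDerivAt_const y.1 y.2)).sub_const x).const_smul σ⁻¹
    have := (HasFDerivAt.comp_hasDerivAt (f := fun s : ℝ => A (s, y.2)) y.1 (hd _) e).deriv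
    rw [ContinuousLinearMap.map_smul] at this
    exact this
  have p2 : ∀ y, pd2 (fun y => ψ (A y)) y = σ⁻¹ * fderiv ℝ ψ (A y) (0, 1) := fun y => by
    have e : HasDerivAt (fun s : ℝ => A (y.1, s)) (σ⁻¹ • (0, 1)) y.2 :=
      (((hasDerivAt_const y.2 y.1).prodMk (hasDerivAt_id y.2)).sub_const x).const_smul σ⁻¹
    have := (HasFDerivAt.comp_hasDerivAt (f := fun s : ℝ => A (y.1, s)) y.2 (hd _) e).deriv
    rw [ContinuousLinearMap.map_smul] at this
    exact this
  simp only [p1, p2] at key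
  set G : ℝ² → ℝ := fun y => (v y).1 * fderiv ℝ ψ (A y) (1, 0) + (v y).2 * fderiv ℝ ψ (A y) (0, 1)
  have k2 : ∫ y, G y = 0 := by
    have : ∀ y, (v y).1 * (σ⁻¹ * fderiv ℝ ψ (A y) (1, 0)) + (v y).2 * (σ⁻¹ * fderiv ℝ ψ (A y) (0, 1)) =
        σ⁻¹ * G y := fun y => by simp only [G]; ring
    simp only [this, integral_const_mul] at key
    exact (mul_eq_zero.1 key).resolve_left (inv_ne_zero hσ.ne')
  have e := Measure.integral_comp_smul (volume : Measure ℝ²) (fun z => G (x + z)) σ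
  rw [integral_add_left_eq_self G x, k2, smul_zero] at e
  refine Eq.trans ?_ e
  refine integral_congr_ae (.of_forall fun z => ?_)
  have : A (x + σ • z) = z := by simp [A, smul_smul, hσ.ne']
  simp only [G, this]

theorem hef_contDiff (n : ℕ) : ContDiff ℝ ∞ (hef n) := by
  have h : ContDiff ℝ ∞ fun z : ℝ => Polynomial.aeval z (Polynomial.hermite n) :=
    Polynomial.contDiff_aeval _ _
  unfold hef
  fun_prop

theorem WeakDivFree.heat {v : ℝ² → ℝ²} (h : WeakDivFree v) (h1 : BC C fun x => (v x).1)
    (h2 : BC C fun x => (v x).2) (hq : 0 < q) (x : ℝ²) :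
    HE 1 0 q (fun x => (v x).1) x + HE 0 1 q (fun x => (v x).2) x = 0 := by
  set σ := √(2 * q)
  have hσ : 0 < σ := by positivity
  set χ : ContDiffBump (0 : ℝ²) := ⟨1, 2, one_pos, one_lt_two⟩
  have hχ : ContDiff ℝ ∞ χ := χ.contDiff
  have hχc : HasCompactSupport χ := χ.hasCompactSupport
  have hc' : Continuous (fderiv ℝ χ) := hχ.continuous_fderiv (by simp)
  obtain ⟨D, hD⟩ := (hχc.fderiv (𝕜 := ℝ)).exists_bound_of_continuous hc'
  have hhk : ContDiff ℝ ∞ (hk 0 0) := by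
    have := hef_contDiff 0
    unfold hk; fun_prop
  have hC0 := h1.nonneg
  have hD0 : 0 ≤ D := (norm_nonneg _).trans (hD 0)
  have fk : ∀ z : ℝ², HasFDerivAt (hk 0 0) (-(hk 1 0 z) • ContinuousLinearMap.fst ℝ ℝ ℝ +
      -(hk 0 1 z) • ContinuousLinearMap.snd ℝ ℝ ℝ) z := fun z => by
    have a1 := (hef_hasDerivAt 0 z.1).comp_hasFDerivAt z (hasFDerivAt_fst (𝕜 := ℝ) (p := z))
    have a2 := (hef_hasDerivAt 0 z.2).comp_hasFDerivAt z (hasFDerivAt_snd (𝕜 := ℝ) (p := z))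
    refine (a1.mul a2).congr_fderiv ?_
    ext <;> simp [hk] <;> ring
  set a : ℕ → ℝ := fun n => ((n:ℝ) + 1)⁻¹
  have ha0 : ∀ n, 0 ≤ a n := fun n => by positivity
  have ha1 : ∀ n, a n ≤ 1 := fun n => inv_le_one_of_one_le₀ (by simp)
  have ha : Tendsto a atTop (𝓝 0) := by simpa [a] using tendsto_one_div_add_atTop_nhds_zero_nat (𝕜 := ℝ)
  set w := fun z => x + σ • z
  have hw : Continuous w := by fun_prop
  set Φ : ℕ → ℝ² → ℝ := fun n z =>
    (v (w z)).1 * (hk 0 0 z * (a n * fderiv ℝ χ (a n • z) (1, 0)) - χ (a n • z) * hk 1 0 z) +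
    (v (w z)).2 * (hk 0 0 z * (a n * fderiv ℝ χ (a n • z) (0, 1)) - χ (a n • z) * hk 0 1 z)
  have e : ∀ n, ∫ z, Φ n z = 0 := fun n => by
    have hs : ContDiff ℝ ∞ fun z : ℝ² => χ (a n • z) := hχ.comp (by fun_prop)
    have hcs : HasCompactSupport fun z : ℝ² => χ (a n • z) :=
      hχc.comp_smul (c := a n) (by simp only [a]; positivity)
    rw [← h.scaled hσ x (ψ := fun z => hk 0 0 z * χ (a n • z)) (hhk.mul hs) hcs.mul_left]
    refine integral_congr_ae (.of_forall fun z => ?_)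
    have b1 : HasFDerivAt (fun z : ℝ² => χ (a n • z))
        ((fderiv ℝ χ (a n • z)).comp (a n • ContinuousLinearMap.id ℝ ℝ²)) z :=
      HasFDerivAt.comp (f := fun z : ℝ² => a n • z) z
        (hχ.differentiable (by simp) _).hasFDerivAt ((hasFDerivAt_id z).const_smul (a n))
    have := ((fk z).fun_mul b1).fderiv
    simp only [Φ, w, this]
    simp [sub_eq_add_neg]
  have b : ∀ (n : ℕ) z (d : ℝ²), ‖d‖ ≤ 1 → |a n * fderiv ℝ χ (a n • z) d| ≤ D := fun n z d hd => by
    rw [abs_mul, abs_of_nonneg (ha0 n)]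
    have := (fderiv ℝ χ (a n • z)).le_of_opNorm_le (hD _) d
    calc _ ≤ 1 * (D * ‖d‖) := by gcongr; exact ha1 n; exact this
      _ ≤ 1 * (D * 1) := by gcongr
      _ = D := by ring
  have lim : Tendsto (fun n => ∫ z, Φ n z) atTop
      (𝓝 (∫ z, ((v (w z)).1 * (-hk 1 0 z) + (v (w z)).2 * (-hk 0 1 z)))) := by
    refine tendsto_integral_of_dominated_convergence
      (fun z => C * (hk 0 0 z * D + |hk 1 0 z|) + C * (hk 0 0 z * D + |hk 0 1 z|)) (fun n => ?_) ?_ ?_ ?_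
    · have := h1.cont.comp hw
      have := h2.cont.comp hw
      have := hk_continuous 0 0
      have := hk_continuous 0 1
      have := hk_continuous 1 0
      have := hχ.continuous
      refine Continuous.aestronglyMeasurable ?_
      simp only [Φ]
      fun_prop
    · have i1 := ((((hk_integrable 0 0).mul_const D).add (hk_integrable 1 0).abs).const_mul C)
      have i2 := ((((hk_integrable 0 0).mul_const D).add (hk_integrable 0 1).abs).const_mul C)
      exact i1.add i2
    · refine fun n => Eventually.of_forall fun z => ?_
      have c1 : |χ (a n • z)| ≤ 1 := by rw [abs_of_nonneg χ.nonneg]; exact χ.le_one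
      have bd : ∀ (s k : ℝ) (d : ℝ²), ‖d‖ ≤ 1 → |s| ≤ C →
          |s * (hk 0 0 z * (a n * fderiv ℝ χ (a n • z) d) - χ (a n • z) * k)| ≤ C * (hk 0 0 z * D + |k|) := by
        intro s k d hd hs
        rw [abs_mul]
        refine mul_le_mul hs ((abs_sub _ _).trans (add_le_add ?_ ?_)) (abs_nonneg _) hC0
        · rw [abs_mul, abs_of_nonneg (hk_zero_nonneg z)]
          exact mul_le_mul_of_nonneg_left (b n z d hd) (hk_zero_nonneg z)
        · rw [abs_mul]
          exact mul_le_of_le_one_left (abs_nonneg _) c1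
      exact (abs_add_le _ _).trans (add_le_add (bd _ _ _ (by simp [Prod.norm_def]) (h1.bd _))
        (bd _ _ _ (by simp [Prod.norm_def]) (h2.bd _)))
    · refine .of_forall fun z => ?_
      have c0 : Tendsto (fun n => a n • z) atTop (𝓝 0) := by simpa using ha.smul_const z
      have c1 : Tendsto (fun n => χ (a n • z)) atTop (𝓝 1) := by
        have := (hχ.continuous.tendsto 0).comp c0
        rwa [χ.one_of_mem_closedBall (by simp [χ])] at this
      have c2 : ∀ d : ℝ², Tendsto (fun n => a n * fderiv ℝ χ (a n • z) d) atTop (𝓝 0) := fun d => by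
        have : Continuous fun y => fderiv ℝ χ y d := by fun_prop
        simpa using ha.mul ((this.tendsto 0).comp c0)
      have := (((c2 (1, 0)).const_mul (hk 0 0 z)).sub (c1.mul_const (hk 1 0 z))).const_mul (v (w z)).1
      have := this.add
        ((((c2 (0, 1)).const_mul (hk 0 0 z)).sub (c1.mul_const (hk 0 1 z))).const_mul (v (w z)).2)
      simpa using this
  have k := tendsto_nhds_unique lim (tendsto_const_nhds.congr fun n => (e n).symm)
  have i1 : Integrable fun z => hk 1 0 z * (v (w z)).1 :=
    avg_integrable (hk_integrable 1 0) (h1.cont.comp hw).aestronglyMeasurable fun _ => h1.bd _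
  have i2 : Integrable fun z => hk 0 1 z * (v (w z)).2 :=
    avg_integrable (hk_integrable 0 1) (h2.cont.comp hw).aestronglyMeasurable fun _ => h2.bd _
  have k' : (∫ z, hk 1 0 z * (v (w z)).1) + ∫ z, hk 0 1 z * (v (w z)).2 = 0 := by
    rw [← integral_add i1 i2, ← neg_eq_zero, ← integral_neg, ← k]
    exact integral_congr_ae (.of_forall fun z => by ring)
  simp only [HE, GA, add_zero, zero_add, pow_one, ← mul_add]
  rw [k', mul_zero]

theorem Mild.div (h : Mild T M u1 u2) (p1 : Per (u1 0)) (p2 : Per (u2 0))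
    (hd : ∀ q, 0 < q → ∀ x, HE 1 0 q (u1 0) x + HE 0 1 q (u2 0) x = 0) (ht : 0 < t)
    (htT : t < T) (x : ℝ²) : pd1 (u1 t) x + pd2 (u2 t) x = 0 := by
  have step : ∀ s, 0 < s → s < t →
      pd1 (u1 t) x + pd2 (u2 t) x = HE 1 0 (t - s) (u1 s) x + HE 0 1 (t - s) (u2 s) x := by
    intro s hs hst
    obtain ⟨s1, s2⟩ := h.sb (half_pos hs)
    obtain ⟨t1, t2⟩ := h.ts p1 p2 (half_pos hs) 0
    have hI : IsOpen (Ioo (s / 2) T) := isOpen_Ioo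
    have a' := TS.qa hI t1 t2
    have b' := TS.qb t1 t2
    have hR1 := (((t1.lap hI).sub hI (a'.QF1 hI b'))).sb
    have hR2 := (((t2.lap hI).sub hI (a'.QF2 hI b'))).sb
    have hdt := fun t (ht : t ∈ Ioo (s / 2) T) x => h.time_deriv p1 p2 ((half_pos hs).trans ht.1) ht.2 x
    have d1 := SB.time_deriv_swap hI s1 hR1 (fun t ht x => (hdt t ht x).1)
      (fun t ht => s1.dd1 ht) (fun t ht => hR1.dd1 ht)
    have d2 := SB.time_deriv_swap hI s2 hR2 (fun t ht x => (hdt t ht x).2)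
      (fun t ht => s2.dd2 ht) (fun t ht => hR2.dd2 ht)
    have := heat_duhamel hI (v := fun t x => pd1 (u1 t) x + pd2 (u2 t) x) (Q := fun _ _ => 0)
      (s1.d1.add s2.d2) (SB.const _ 0) (fun t ht x => by
        refine ((d1 t ht x).fun_add (d2 t ht x)).congr_deriv ?_
        have hp := h.per p1 p2 ((half_pos hs).trans ht.1).le ht.2.le
        have sm1 : Sm (u1 t) := s1.slice ht
        have sm2 : Sm (u2 t) := s2.slice ht
        have sa : Sm (qa u1 u2 t) := a'.sb.slice ht
        have sb : Sm (qb u1 u2 t) := b'.sb.slice ht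
        have e0 := div_QF sa sb (qa_per hp.1 hp.2) (qb_per hp.1 hp.2) x
        have e1 := congrFun (pd1_sub sm1.lap (QF1_sm sa sb)) x
        have e2 := congrFun (pd2_sub sm2.lap (QF2_sm sa sb)) x
        have e3 : lap (fun x => pd1 (u1 t) x + pd2 (u2 t) x) x = pd1 (lap (u1 t)) x + pd2 (lap (u2 t)) x := by
          rw [← lap_pd1 sm1, ← lap_pd2 sm2, lap, pd1_add sm1.pd1 sm2.pd2, pd2_add sm1.pd1 sm2.pd2,
            pd1_add sm1.pd1.pd1 sm2.pd2.pd1, pd2_add sm1.pd1.pd2 sm2.pd2.pd2]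
          simp only [lap]; ring
        rw [e3]
        linarith) hst.le (fun r hr => ⟨by linarith [hr.1], hr.2.trans_lt htT⟩) x
    have sI : s ∈ Ioo (s / 2) T := ⟨by linarith, hst.trans htT⟩
    have sm1 : Sm (u1 s) := s1.slice sI
    have sm2 : Sm (u2 s) := s2.slice sI
    obtain ⟨C1, -, c1⟩ := sm1.pd1.bc
    obtain ⟨C2, -, c2⟩ := sm2.pd2.bc
    rw [HE_pd1 0 0 (sub_pos.2 hst) sm1, HE_pd2 0 0 (sub_pos.2 hst) sm2,
      ← HS_add (f := pd1 (u1 s)) (g := pd2 (u2 s)) _ c1.cont c2.cont c1.bd c2.bd, this]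
    simp [HS_eq, GA]
  have cont : ∀ (j k : ℕ) (F : ℝ → ℝ² → ℝ), TB M F →
      Tendsto (fun s => HE j k (t - s) (F s) x) (𝓝[>] 0) (𝓝 (HE j k t (F 0) x)) := fun j k F hF => by
    have : ContinuousOn (fun s => HE j k (t - s) (F s) x) (Iio t) :=
      HE_contOn j k (q := fun s => t - s) (F := F) (x := fun _ => x) (by fun_prop)
        (fun s hs => sub_pos.2 hs) hF.cont.continuousOn (by fun_prop) (fun s _ y => hF.bd s y)
    have := (this.continuousAt (Iio_mem_nhds ht)).tendsto
    simp only [sub_zero] at this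
    exact this.mono_left nhdsWithin_le_nhds
  have lim := (cont 1 0 u1 h.tb1).add (cont 0 1 u2 h.tb2)
  rw [hd t ht x] at lim
  refine tendsto_nhds_unique (tendsto_const_nhds.congr' ?_) lim
  filter_upwards [Ioo_mem_nhdsGT ht] with s hs using step s hs.1 hs.2

theorem second_deriv_nonpos_of_isLocalMax {f f' : ℝ → ℝ} {c : ℝ} (h1 : ∀ s, HasDerivAt f (f' s) s)
    (h2 : HasDerivAt f' c s) (hm : IsLocalMax f s) : c ≤ 0 := by
  by_contra! hc
  have e : deriv f = f' := funext fun s => (h1 s).deriv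
  have hmin := isLocalMin_of_deriv_deriv_pos (f := f) (x₀ := s) (by rw [e, h2.deriv]; exact hc)
    (by rw [e]; exact hm.hasDerivAt_eq_zero (h1 s)) (h1 s).continuousAt
  have hcst : f =ᶠ[𝓝 s] fun _ => f s := by
    filter_upwards [hm, hmin] with r h h' using le_antisymm h h'
  have : f' =ᶠ[𝓝 s] fun _ => 0 := by
    rw [← e]
    filter_upwards [hcst.deriv] with r hr
    rw [hr, deriv_const]
  have := (h2.congr_of_eventuallyEq this.symm).unique (hasDerivAt_const s 0)
  linarith

theorem log_barrier {f f' : ℝ → ℝ} {c : ℝ} (h1 : ∀ s, HasDerivAt f (f' s) s)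
    (h2 : HasDerivAt f' c s) (hε : 0 ≤ ε) (hm : IsLocalMax (fun s => f s - ε * log (1 + s ^ 2)) s) :
    |f' s| ≤ ε ∧ c ≤ 2 * ε := by
  have hp : ∀ s : ℝ, 0 < 1 + s ^ 2 := fun s => by positivity
  have b0 : ∀ s : ℝ, HasDerivAt (fun s : ℝ => 1 + s ^ 2) (2 * s) s := fun s => by
    simpa using (hasDerivAt_pow 2 s).const_add 1
  have b1 : ∀ s : ℝ, HasDerivAt (fun s : ℝ => log (1 + s ^ 2)) (2 * s / (1 + s ^ 2)) s := fun s =>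
    (b0 s).log (hp s).ne'
  have b2 : HasDerivAt (fun s : ℝ => 2 * s / (1 + s ^ 2))
      ((2 * (1 + s ^ 2) - 2 * s * (2 * s)) / (1 + s ^ 2) ^ 2) s := by
    have := ((hasDerivAt_id s).const_mul 2).fun_div (b0 s) (hp s).ne'
    simpa using this
  have d1 := fun s => (h1 s).fun_sub ((b1 s).const_mul ε)
  have z1 := hm.hasDerivAt_eq_zero (d1 s)
  have z2 := second_deriv_nonpos_of_isLocalMax d1 (h2.fun_sub (b2.const_mul ε)) hm
  have e1 : |2 * s / (1 + s ^ 2)| ≤ 1 := by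
    rw [abs_div, abs_of_pos (hp s), div_le_one (hp s), abs_le]
    constructor <;> nlinarith [sq_nonneg (s - 1), sq_nonneg (s + 1)]
  have e2 : (2 * (1 + s ^ 2) - 2 * s * (2 * s)) / (1 + s ^ 2) ^ 2 ≤ 2 := by
    rw [div_le_iff₀ (pow_pos (hp s) 2)]
    nlinarith [sq_nonneg s, sq_nonneg (s ^ 2)]
  constructor
  · rw [sub_eq_zero.1 z1, abs_mul, abs_of_nonneg hε]
    exact mul_le_of_le_one_right hε e1
  · nlinarith

theorem max_principle {w b1 b2 : ℝ → ℝ² → ℝ} (hw : SB I w)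
    (h1 : ∀ t ∈ I, ∀ x, |b1 t x| ≤ M) (h2 : ∀ t ∈ I, ∀ x, |b2 t x| ≤ M)
    (hd : ∀ t ∈ I, ∀ x, HasDerivAt (fun s => w s x)
      (lap (w t) x - (b1 t x * pd1 (w t) x + b2 t x * pd2 (w t) x)) t)
    (hst : s ≤ t) (hJ : Icc s t ⊆ I) (hK : ∀ x, w s x ≤ K) (x : ℝ²) : w t x ≤ K := by
  set Φ : ℝ² → ℝ := fun x => log (1 + x.1 ^ 2) + log (1 + x.2 ^ 2)
  have hp : ∀ s : ℝ, 1 + s ^ 2 ≠ 0 := fun s => by positivity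
  have l0 : ∀ s : ℝ, 0 ≤ log (1 + s ^ 2) := fun s => log_nonneg (by nlinarith [sq_nonneg s])
  have hΦ : Continuous Φ := by
    have := fun x : ℝ² => hp x.1
    have := fun x : ℝ² => hp x.2
    fun_prop (disch := assumption)
  have hM : 0 ≤ M := (abs_nonneg _).trans (h1 s (hJ ⟨le_rfl, hst⟩) x)
  suffices H : ∀ ε > 0, w t x - K - ε * (Φ x + (2 * M + 5) * (t - s)) ≤ 0 by
    refine le_of_forall_pos_le_add fun δ hδ => ?_
    set B := Φ x + (2 * M + 5) * (t - s)
    have hB : 0 ≤ B := add_nonneg (add_nonneg (l0 _) (l0 _)) (mul_nonneg (by linarith) (by linarith))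
    have := H (δ / (B + 1)) (by positivity)
    have : δ / (B + 1) * B ≤ δ := by
      rw [div_mul_eq_mul_div, div_le_iff₀ (by linarith)]
      nlinarith
    linarith
  intro ε hε
  by_contra! hpos
  set z : ℝ × ℝ² → ℝ := fun p => w p.1 p.2 - K - ε * (Φ p.2 + (2 * M + 5) * (p.1 - s))
  obtain ⟨C, hC0, hC⟩ := hw.bd
  set ρ := 1 + |x.1| + |x.2| + exp ((C + |K|) / ε)
  have hρ : (C + |K|) / ε < log (1 + ρ ^ 2) := by
    rw [lt_log_iff_exp_lt (by positivity)]
    have h0 := exp_pos ((C + |K|) / ε)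
    have : exp ((C + |K|) / ε) ≤ ρ := by
      simp only [ρ]; linarith [abs_nonneg x.1, abs_nonneg x.2]
    nlinarith
  have hρ0 : 0 ≤ ρ := by positivity
  set Q : Set ℝ² := Icc (-ρ) ρ ×ˢ Icc (-ρ) ρ
  have hzc : ContinuousOn z (Icc s t ×ˢ Q) :=
    ((hw.cont.mono (prod_mono hJ (subset_univ _))).sub continuousOn_const).sub (by fun_prop)
  have hxQ : x ∈ Q := by
    have := exp_pos ((C + |K|) / ε)
    have := neg_abs_le x.1
    have := neg_abs_le x.2
    have := le_abs_self x.1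
    have := le_abs_self x.2
    have := abs_nonneg x.1
    have := abs_nonneg x.2
    refine ⟨⟨?_, ?_⟩, ⟨?_, ?_⟩⟩ <;> simp only [ρ] <;> linarith
  obtain ⟨⟨r, y⟩, ⟨hr, hy⟩, hmax⟩ := (isCompact_Icc.prod (isCompact_Icc.prod isCompact_Icc)).exists_isMaxOn
    ⟨(t, x), ⟨⟨hst, le_rfl⟩, hxQ⟩⟩ hzc
  have hrI := hJ hr
  have zpos : 0 < z (r, y) := hpos.trans_le (hmax (a := (t, x)) ⟨⟨hst, le_rfl⟩, hxQ⟩)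
  have hT : 0 ≤ ε * ((2 * M + 5) * (r - s)) :=
    mul_nonneg hε.le (mul_nonneg (by linarith) (sub_nonneg.2 hr.1))
  have zΦ : ε * Φ y < C + |K| := by
    have := (abs_le.1 (hC r hrI y)).2
    have := neg_abs_le K
    simp only [z] at zpos
    linarith
  have hin : ∀ c : ℝ, c ∈ Icc (-ρ) ρ → ε * log (1 + c ^ 2) < C + |K| → c ∈ Ioo (-ρ) ρ := by
    intro c hc hl
    have : c ^ 2 ≠ ρ ^ 2 := fun e => by
      rw [e] at hl
      rw [div_lt_iff₀ hε] at hρ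
      linarith
    exact ⟨lt_of_le_of_ne hc.1 fun e => this (by rw [← e]; ring), lt_of_le_of_ne hc.2 fun e => this (by rw [e])⟩
  have hy1 := hin y.1 hy.1 (by have := mul_nonneg hε.le (l0 y.2); simp only [Φ] at zΦ; linarith)
  have hy2 := hin y.2 hy.2 (by have := mul_nonneg hε.le (l0 y.1); simp only [Φ] at zΦ; linarith)
  have hrs : s < r := by
    refine lt_of_le_of_ne hr.1 fun e => ?_
    have := hK y
    have : 0 ≤ ε * Φ y := mul_nonneg hε.le (add_nonneg (l0 _) (l0 _))
    simp only [z, ← e, sub_self, mul_zero, add_zero] at zpos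
    linarith
  have sm : Sm (w r) := hw.slice hrI
  have m1 := log_barrier (f := fun c => w r (c, y.2)) (fun c => sm.DD1.fst (c, y.2)) (sm.pd1.DD1.fst y) hε.le (by
    filter_upwards [isOpen_Ioo.mem_nhds hy1] with c hc
    have := hmax (a := (r, (c, y.2))) ⟨hr, Ioo_subset_Icc_self hc, hy.2⟩
    simp only [mem_ofPred_eq, z, Φ] at this
    simp only [Prod.mk.eta]
    linarith)
  have m2 := log_barrier (f := fun c => w r (y.1, c)) (fun c => sm.DD2.snd (y.1, c)) (sm.pd2.DD2.snd y) hε.le (by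
    filter_upwards [isOpen_Ioo.mem_nhds hy2] with c hc
    have := hmax (a := (r, (y.1, c))) ⟨hr, hy.1, Ioo_subset_Icc_self hc⟩
    simp only [mem_ofPred_eq, z, Φ] at this
    simp only [Prod.mk.eta]
    linarith)
  have dz : HasDerivAt (fun r' => z (r', y)) (lap (w r) y -
      (b1 r y * pd1 (w r) y + b2 r y * pd2 (w r) y) - ε * (2 * M + 5)) r := by
    refine (((hd r hrI y).sub_const K).fun_sub
      (((((hasDerivAt_id r).sub_const s).const_mul (2 * M + 5)).const_add (Φ y)).const_mul ε)).congr_deriv ?_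
    ring
  have hge : 0 ≤ lap (w r) y - (b1 r y * pd1 (w r) y + b2 r y * pd2 (w r) y) - ε * (2 * M + 5) := by
    refine ge_of_tendsto (hasDerivAt_iff_tendsto_slope_left_right.1 dz).1 ?_
    filter_upwards [Ioo_mem_nhdsLT hrs] with c hc
    have := hmax (a := (c, y)) ⟨⟨hc.1.le, hc.2.le.trans hr.2⟩, hy⟩
    rw [slope_def_field]
    exact div_nonneg_of_nonpos (by simpa using this) (by linarith [hc.2])
  have p1 : |b1 r y * pd1 (w r) y| ≤ M * ε := by
    rw [abs_mul]; exact mul_le_mul (h1 r hrI y) m1.1 (abs_nonneg _) hM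
  have p2 : |b2 r y * pd2 (w r) y| ≤ M * ε := by
    rw [abs_mul]; exact mul_le_mul (h2 r hrI y) m2.1 (abs_nonneg _) hM
  have := neg_abs_le (b1 r y * pd1 (w r) y)
  have := neg_abs_le (b2 r y * pd2 (w r) y)
  have := m1.2
  have := m2.2
  simp only [lap] at hge
  simp only [NS.pd1, NS.pd2] at *
  nlinarith

theorem cF_eq (h1 : Sm (u1 t)) (h2 : Sm (u2 t)) (hd : ∀ x, pd1 (u1 t) x + pd2 (u2 t) x = 0) :
    cF (qa u1 u2 t) (qb u1 u2 t) = fun x => (pd1 (u2 t) x - pd2 (u1 t) x) * u1 t x := by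
  have e1 : pd1 (qb u1 u2 t) = _ := pd1_mul h1 h2
  have e2 : pd2 (qa u1 u2 t) = fun x => u1 t x * pd2 (u1 t) x - u2 t x * pd2 (u2 t) x := by
    have : qa u1 u2 t = fun x => 2⁻¹ * (u1 t x * u1 t x - u2 t x * u2 t x) := by funext x; simp only [qa]; ring
    rw [this, pd2_const_mul _ ((h1.mul h1).sub (h2.mul h2)), pd2_sub (h1.mul h1) (h2.mul h2),
      pd2_mul h1 h1, pd2_mul h2 h2]
    funext x; ring
  funext x
  rw [cF, e1, e2]
  linear_combination u2 t x * hd x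

theorem curl_eq (h1 : Sm (u1 t)) (h2 : Sm (u2 t)) (hd : ∀ x, pd1 (u1 t) x + pd2 (u2 t) x = 0) :
    lap (u1 t) = (fun x => - pd2 (fun x => pd1 (u2 t) x - pd2 (u1 t) x) x) ∧
    lap (u2 t) = pd1 (fun x => pd1 (u2 t) x - pd2 (u1 t) x) := by
  have hd' : (fun x => pd1 (u1 t) x + pd2 (u2 t) x) = fun _ => 0 := funext hd
  have d1 := pd1_add h1.pd1 h2.pd2
  have d2 := pd2_add h1.pd1 h2.pd2
  rw [hd'] at d1 d2
  have z1 : ∀ x, pd1 (fun _ : ℝ² => (0:ℝ)) x = 0 := fun x => by simp [pd1]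
  have z2 : ∀ x, pd2 (fun _ : ℝ² => (0:ℝ)) x = 0 := fun x => by simp [pd2]
  constructor <;> funext x
  · rw [pd2_sub h2.pd1 h1.pd2, lap]
    have := congrFun d1 x
    rw [z1, pd_comm h2] at this
    linarith
  · rw [pd1_sub h2.pd1 h1.pd2, lap]
    have := congrFun d2 x
    rw [z2, ← pd_comm h1] at this
    linarith

theorem pressure_eq (h1 : Sm (u1 t)) (h2 : Sm (u2 t)) (p1 : Per (u1 t)) (p2 : Per (u2 t))
    (hd : ∀ x, pd1 (u1 t) x + pd2 (u2 t) x = 0) :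
    pressure (fun x => (u1 t x, u2 t x)) =
      fun x => -1 * (u1 t x * u1 t x) - 2 * BB (cF (qa u1 u2 t) (qb u1 u2 t)) x := by
  have hc := cF_eq h1 h2 hd
  have hp : Per (cF (qa u1 u2 t) (qb u1 u2 t)) := cF_per (qa_per p1 p2) (qb_per p1 p2)
  have hm : Measurable (cF (qa u1 u2 t) (qb u1 u2 t)) := by
    rw [hc]; exact ((h2.pd1.sub h1.pd2).mul h1).continuous.measurable
  funext x
  rw [← conv_eq_BB hp hm, hc]
  simp only [pressure, vort]
  ring

theorem QF_eq_pressure (h1 : Sm (u1 t)) (h2 : Sm (u2 t)) (p1 : Per (u1 t)) (p2 : Per (u2 t))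
    (hd : ∀ x, pd1 (u1 t) x + pd2 (u2 t) x = 0) (x : ℝ²) :
    QF1 (qa u1 u2 t) (qb u1 u2 t) x = u1 t x * pd1 (u1 t) x + u2 t x * pd2 (u1 t) x +
      pd1 (pressure fun x => (u1 t x, u2 t x)) x ∧
    QF2 (qa u1 u2 t) (qb u1 u2 t) x = u1 t x * pd1 (u2 t) x + u2 t x * pd2 (u2 t) x +
      pd2 (pressure fun x => (u1 t x, u2 t x)) x := by
  have hc := cF_eq h1 h2 hd
  have hB : Sm (BB (cF (qa u1 u2 t) (qb u1 u2 t))) := by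
    rw [hc]; exact BB_sm ((h2.pd1.sub h1.pd2).mul h1)
  have e1 : pd1 (qb u1 u2 t) = _ := pd1_mul h1 h2
  have e2 : pd2 (qb u1 u2 t) = _ := pd2_mul h1 h2
  have := hd x
  rw [pressure_eq h1 h2 p1 p2 hd, pd1_sub ((h1.mul h1).const_mul (-1)) (hB.const_mul 2),
    pd2_sub ((h1.mul h1).const_mul (-1)) (hB.const_mul 2), pd1_const_mul _ (h1.mul h1),
    pd2_const_mul _ (h1.mul h1), pd1_mul h1 h1, pd2_mul h1 h1, pd1_const_mul 2 hB, pd2_const_mul 2 hB,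
    QF1, QF2, e1, e2]
  constructor
  · linear_combination u1 t x * this
  · rw [hc]
    linear_combination -u2 t x * this

theorem curl_QF_eq (h1 : Sm (u1 t)) (h2 : Sm (u2 t))
    (hd : ∀ x, pd1 (u1 t) x + pd2 (u2 t) x = 0) (x : ℝ²) :
    pd1 (QF2 (qa u1 u2 t) (qb u1 u2 t)) x - pd2 (QF1 (qa u1 u2 t) (qb u1 u2 t)) x =
      u1 t x * pd1 (fun x => pd1 (u2 t) x - pd2 (u1 t) x) x +
      u2 t x * pd2 (fun x => pd1 (u2 t) x - pd2 (u1 t) x) x := by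
  have ha : Sm (qa u1 u2 t) := (((h1.mul h1).sub (h2.mul h2)).const_mul 2⁻¹).congr fun _ _ => by
    funext x; simp only [qa]; ring
  have hb : Sm (qb u1 u2 t) := h1.mul h2
  have hω := h2.pd1.sub h1.pd2
  obtain ⟨c1, c2⟩ := curl_eq h1 h2 hd
  have lb : lap (qb u1 u2 t) x = u1 t x * lap (u2 t) x + u2 t x * lap (u1 t) x +
      2 * (pd1 (u1 t) x * pd1 (u2 t) x + pd2 (u1 t) x * pd2 (u2 t) x) := by
    have e1 : pd1 (qb u1 u2 t) = _ := pd1_mul h1 h2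
    have e2 : pd2 (qb u1 u2 t) = _ := pd2_mul h1 h2
    rw [lap, e1, e2, pd1_add (h1.pd1.mul h2) (h1.mul h2.pd1), pd2_add (h1.pd2.mul h2) (h1.mul h2.pd2),
      pd1_mul h1.pd1 h2, pd1_mul h1 h2.pd1, pd2_mul h1.pd2 h2, pd2_mul h1 h2.pd2]
    simp only [lap]
    ring
  rw [curl_QF ha hb, lb, cF_eq h1 h2 hd, pd1_mul hω h1, c1, c2]
  linear_combination -2 * pd2 (u1 t) x * hd x

/-- Smooth periodic solutions of the projected Navier–Stokes equations on a time set. -/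
structure NSE (I : Set ℝ) (u1 u2 : ℝ → ℝ² → ℝ) : Prop where
  s1 : SB I u1
  s2 : SB I u2
  p1 : ∀ t ∈ I, Per (u1 t)
  p2 : ∀ t ∈ I, Per (u2 t)
  d1 : ∀ t ∈ I, ∀ x, HasDerivAt (fun s => u1 s x) (lap (u1 t) x - QF1 (qa u1 u2 t) (qb u1 u2 t) x) t
  d2 : ∀ t ∈ I, ∀ x, HasDerivAt (fun s => u2 s x) (lap (u2 t) x - QF2 (qa u1 u2 t) (qb u1 u2 t) x) t
  div : ∀ t ∈ I, ∀ x, pd1 (u1 t) x + pd2 (u2 t) x = 0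

theorem Mild.nse (h : Mild T M u1 u2) (p1 : Per (u1 0)) (p2 : Per (u2 0))
    (hd : ∀ q, 0 < q → ∀ x, HE 1 0 q (u1 0) x + HE 0 1 q (u2 0) x = 0) (hσ : 0 < σ) :
    NSE (Ioo σ T) u1 u2 where
  s1 := (h.sb hσ).1
  s2 := (h.sb hσ).2
  p1 _ ht := (h.per p1 p2 (hσ.trans ht.1).le ht.2.le).1
  p2 _ ht := (h.per p1 p2 (hσ.trans ht.1).le ht.2.le).2
  d1 _ ht x := (h.time_deriv p1 p2 (hσ.trans ht.1) ht.2 x).1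
  d2 _ ht x := (h.time_deriv p1 p2 (hσ.trans ht.1) ht.2 x).2
  div _ ht x := h.div p1 p2 hd (hσ.trans ht.1) ht.2 x

theorem NSE.sm_qa (h : NSE I u1 u2) (ht : t ∈ I) : Sm (qa u1 u2 t) := by
  have h1 : Sm (u1 t) := h.s1.slice ht
  have h2 : Sm (u2 t) := h.s2.slice ht
  exact (((h1.mul h1).sub (h2.mul h2)).const_mul 2⁻¹).congr fun _ _ => by
    funext x; simp only [qa]; ring

theorem NSE.sm_qb (h : NSE I u1 u2) (ht : t ∈ I) : Sm (qb u1 u2 t) :=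
  (h.s1.mul h.s2).slice ht

/-- The vorticity in terms of the components of the velocity. -/
def om (u1 u2 : ℝ → ℝ² → ℝ) (t : ℝ) (x : ℝ²) : ℝ := pd1 (u2 t) x - pd2 (u1 t) x

theorem NSE.om_sb (h : NSE I u1 u2) (hI : IsOpen I) : SB I (om u1 u2) :=
  (TS.sub (j := 0) hI (F := fun t => pd1 (u2 t)) (G := fun t => pd2 (u1 t)) h.s2.d1 h.s1.d2).sb

theorem NSE.om_deriv (h : NSE I u1 u2) (hI : IsOpen I) (ht : t ∈ I) (x : ℝ²) :
    HasDerivAt (fun s => om u1 u2 s x)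
      (lap (om u1 u2 t) x - (u1 t x * pd1 (om u1 u2 t) x + u2 t x * pd2 (om u1 u2 t) x)) t := by
  have t1 : TS I 0 u1 := h.s1
  have t2 : TS I 0 u2 := h.s2
  have a' := TS.qa hI t1 t2
  have b' := TS.qb t1 t2
  have hR1 := (((t1.lap hI).sub hI (a'.QF1 hI b'))).sb
  have hR2 := (((t2.lap hI).sub hI (a'.QF2 hI b'))).sb
  have d1 := SB.time_deriv_swap hI h.s1 hR1 h.d1 (fun t ht => h.s1.dd2 ht) (fun t ht => hR1.dd2 ht)
  have d2 := SB.time_deriv_swap hI h.s2 hR2 h.d2 (fun t ht => h.s2.dd1 ht) (fun t ht => hR2.dd1 ht)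
  refine ((d2 t ht x).fun_sub (d1 t ht x)).congr_deriv ?_
  have sm1 : Sm (u1 t) := h.s1.slice ht
  have sm2 : Sm (u2 t) := h.s2.slice ht
  have sa := h.sm_qa ht
  have sb := h.sm_qb ht
  have e0 := curl_QF_eq sm1 sm2 (h.div t ht) x
  have e1 := congrFun (pd2_sub sm1.lap (QF1_sm sa sb)) x
  have e2 := congrFun (pd1_sub sm2.lap (QF2_sm sa sb)) x
  have e3 : lap (om u1 u2 t) = _ := lap_sub sm2.pd1 sm1.pd2
  rw [e3, lap_pd1 sm2, lap_pd2 sm1]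
  change _ = u1 t x * pd1 (om u1 u2 t) x + u2 t x * pd2 (om u1 u2 t) x at e0
  linarith

theorem NSE.om_bound (h : NSE I u1 u2) (hI : IsOpen I) (hst : s ≤ t) (hJ : Icc s t ⊆ I)
    (hK : ∀ x, |om u1 u2 s x| ≤ K) (x : ℝ²) : |om u1 u2 t x| ≤ K := by
  obtain ⟨C, -, hC⟩ := h.s1.bd
  obtain ⟨D, -, hD⟩ := h.s2.bd
  have b1 := fun t ht x => (hC t ht x).trans (le_max_left C D)
  have b2 := fun t ht x => (hD t ht x).trans (le_max_right C D)
  refine abs_le.2 ⟨?_, max_principle (h.om_sb hI) b1 b2 (fun t ht x => h.om_deriv hI ht x) hst hJ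
    (fun x => (abs_le.1 (hK x)).2) x⟩
  have := max_principle ((h.om_sb hI).const_mul (-1)) b1 b2 (fun t ht x => ?_) hst hJ (K := K)
    (fun x => by linarith [(abs_le.1 (hK x)).1]) x
  · linarith
  have so : Sm (om u1 u2 t) := (h.om_sb hI).slice ht
  refine ((h.om_deriv hI ht x).const_mul (-1)).congr_deriv ?_
  have e1 := congrFun (lap_const_mul (-1) so) x
  have e2 := congrFun (pd1_const_mul (-1) so) x
  have e3 := congrFun (pd2_const_mul (-1) so) x
  rw [e1, e2, e3]
  ring

/-- Average over the periodic variable. -/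
def A2 (f : ℝ² → ℝ) : ℝ² → ℝ := AV (volume.restrict (Icc (0:ℝ) 1)) 1 (fun w => (0, w)) f

theorem A2_int : Integrable (1 : ℝ → ℝ) (volume.restrict (Icc (0:ℝ) 1)) := integrableOn_const (by simp)
theorem A2_meas : Measurable fun w : ℝ => ((0:ℝ), w) := by fun_prop

theorem A2_abs_le (hC : ∀ x, |f x| ≤ C) (x : ℝ²) : |A2 f x| ≤ C := by
  simpa [A2] using AV_abs_le A2_int hC x (φ := fun w => (0, w))

theorem Sm.A2 (h : Sm f) : Sm (A2 f) := SB.av h A2_int A2_meas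

theorem A2_sub (hf : Sm f) (hg : Sm g) : A2 (fun x => f x - g x) = fun x => A2 f x - A2 g x := by
  obtain ⟨_, -, h⟩ := hf.bc
  obtain ⟨_, -, h'⟩ := hg.bc
  exact funext fun x => AV_sub A2_int A2_meas h h' x

theorem A2_add (hf : Sm f) (hg : Sm g) : A2 (fun x => f x + g x) = fun x => A2 f x + A2 g x := by
  obtain ⟨_, -, h⟩ := hf.bc
  obtain ⟨_, -, h'⟩ := hg.bc
  exact funext fun x => AV_add A2_int A2_meas h h' x

theorem A2_const_mul (c : ℝ) (f : ℝ² → ℝ) : A2 (fun x => c * f x) = fun x => c * A2 f x :=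
  funext fun x => AV_const_mul c f x

theorem pd1_A2 (h : Sm f) : pd1 (A2 f) = A2 (pd1 f) := by
  obtain ⟨_, -, c⟩ := h.bc
  obtain ⟨_, -, c'⟩ := h.pd1.bc
  exact (AV_DD A2_int A2_meas h.DD1 c c').pd1_eq

theorem pd2_A2 (h : Sm f) : pd2 (A2 f) = A2 (pd2 f) := by
  obtain ⟨_, -, c⟩ := h.bc
  obtain ⟨_, -, c'⟩ := h.pd2.bc
  exact (AV_DD A2_int A2_meas h.DD2 c c').pd2_eq

theorem A2_eq (f : ℝ² → ℝ) (x : ℝ²) : A2 f x = ∫ w in (0:ℝ)..1, f (x + (0, w)) := by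
  rw [A2, AV, integral_Icc_eq_integral_Ioc, ← intervalIntegral.integral_of_le zero_le_one]
  simp

theorem A2_pd2 (h : Sm f) (hp : Per f) : A2 (pd2 f) = fun _ => 0 := by
  funext x
  have hd : ∀ w, HasDerivAt (fun w => f (x + (0, w))) (pd2 f (x + (0, w))) w := fun w => by
    have := h.DD2.at x w
    simpa using this
  rw [A2_eq, intervalIntegral.integral_eq_sub_of_hasDerivAt (fun w _ => hd w)
    ((h.pd2.continuous.comp (by fun_prop : Continuous fun w : ℝ => x + (0, w))).intervalIntegrable _ _)]
  have := hp x
  simp only [show x + ((0:ℝ), (1:ℝ)) = (x.1, x.2 + 1) by ext <;> simp, this]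
  simp [show x + ((0:ℝ), (0:ℝ)) = x by ext <;> simp]

theorem pd2_A2_zero (h : Sm f) (hp : Per f) : pd2 (A2 f) = fun _ => 0 := (pd2_A2 h).trans (A2_pd2 h hp)

theorem A2_apply_eq (h : Sm f) (hp : Per f) (x : ℝ²) (w : ℝ) : A2 f (x + (0, w)) = A2 f x := by
  have := h.A2.DD2.lip (C := 0) (fun x => by rw [pd2_A2_zero h hp]; simp) x w
  simpa [sub_eq_zero] using this

theorem A2_mul (hf : Sm f) (hp : Per f) (g : ℝ² → ℝ) :
    A2 (fun x => A2 f x * g x) = fun x => A2 f x * A2 g x := by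
  funext x
  rw [A2_eq, A2_eq g]
  simp only [A2_apply_eq hf hp, intervalIntegral.integral_const_mul]

theorem A2_A2 (hf : Sm f) (hp : Per f) : A2 (A2 f) = A2 f := by
  funext x
  rw [A2_eq (A2 f)]
  simp only [A2_apply_eq hf hp]
  simp

theorem A2_lap (h : Sm f) : A2 (lap f) = lap (A2 f) := by
  have : A2 (lap f) = _ := A2_add h.pd1.pd1 h.pd2.pd2
  rw [this]
  funext x
  rw [lap, pd1_A2 h, pd1_A2 h.pd1, pd2_A2 h, pd2_A2 h.pd2]

theorem pd1_A2_BB (h : Sm f) (hp : Per f) : pd1 (A2 (BB f)) = fun _ => 0 := by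
  have : lap (A2 (BB f)) = fun _ => 0 := by rw [← A2_lap (BB_sm h), lap_BB h hp, A2_pd2 h hp]
  exact funext fun x => (pd_zero_of_lap (BB_sm h).A2 this x).1

theorem sub_A2_abs_le (h : Sm f) (hC : ∀ x, |pd2 f x| ≤ C) (x : ℝ²) : |f x - A2 f x| ≤ C := by
  have e : A2 f x - f x = ∫ w in (0:ℝ)..1, (f (x + (0, w)) - f x) := by
    have hc : Continuous fun w : ℝ => f (x + (0, w)) := h.continuous.comp (by fun_prop)
    rw [intervalIntegral.integral_sub (hc.intervalIntegrable _ _) (by simp), A2_eq]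
    simp
  have C0 : 0 ≤ C := (abs_nonneg _).trans (hC x)
  rw [abs_sub_comm, e]
  have := intervalIntegral.norm_integral_le_of_norm_le_const (a := 0) (b := 1) (C := C)
    (f := fun w => f (x + (0, w)) - f x) (fun w hw => ?_)
  · simpa using this
  rw [uIoc_of_le zero_le_one] at hw
  have := h.DD2.lip hC x w
  rw [abs_of_pos hw.1] at this
  simp only [Prod.smul_mk, smul_eq_mul, mul_zero, mul_one] at this
  exact this.trans (mul_le_of_le_one_right C0 hw.2)

theorem abs_integral_le_sqrt {φ : ℝ → ℝ} (hst : s ≤ t)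
    (h : ∀ r, s < r → r < t → |φ r| ≤ (√(2 * (t - r)))⁻¹ * C) :
    |∫ r in s..t, φ r| ≤ √(2 * (t - s)) * C := by
  have i0 : IntervalIntegrable (fun r => (√(2 * r))⁻¹) volume 0 (t - s) :=
    (intervalIntegrable_iff_integrableOn_Ioc_of_le (sub_nonneg.2 hst)).2 (inv_sqrt_integrable _)
  have hi : IntervalIntegrable (fun r => (√(2 * (t - r)))⁻¹) volume s t := by
    have := (i0.comp_sub_left t).symm
    simpa using this
  have := intervalIntegral.norm_integral_le_of_norm_le hst (f := φ) (μ := volume)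
    ((Measure.ae_ne volume t).mono fun r hr h' => h r h'.1 (lt_of_le_of_ne h'.2 hr)) (hi.mul_const C)
  rw [intervalIntegral.integral_mul_const,
    intervalIntegral.integral_comp_sub_left (fun r => (√(2 * r))⁻¹), sub_self,
    intervalIntegral.integral_of_le (sub_nonneg.2 hst), integral_inv_sqrt le_rfl (sub_nonneg.2 hst)] at this
  simpa using this

theorem Sm.HS (h : Sm f) (q : ℝ) : Sm (HS q f) := by
  rw [HS_eq]
  exact SB.av h (hk_integrable 0 0) (by fun_prop)

theorem A2_HS (h : Sm f) (q : ℝ) : A2 (HS q f) = HS q (A2 f) := by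
  obtain ⟨C, -, hC⟩ := h.bc
  have e : A2 f = fun x => ∫ r in Icc (0:ℝ) 1, f (x + (0, r)) := by funext x; simp [A2, AV]
  funext x
  rw [e, ← integral_HS (G := fun r x => f (x + (0, r))) q measurableSet_Icc
    (hC.cont.comp (by fun_prop)).continuousOn (w := fun _ => C) (integrableOn_const (by simp))
    (fun r _ x => hC.bd _)]
  simp only [HS_shift]
  simp [A2, AV]

theorem heat_static (h : Sm f) (hq : 0 ≤ q) (x : ℝ²) :
    f x = HS q f x - ∫ r in (0:ℝ)..q, HS (q - r) (lap f) x := by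
  have := heat_duhamel isOpen_univ (v := fun _ => f) (Q := fun _ => lap f) h h.lap
    (fun t _ x => by simpa using hasDerivAt_const t (f x)) hq (subset_univ _) x
  simpa using this

theorem mean_zero_bound : ∃ C, 0 ≤ C ∧ ∀ f g, Sm f → Sm g → A2 f = (fun _ => 0) →
    (lap f = pd1 g ∨ lap f = pd2 g) → ∀ K, (∀ x, |g x| ≤ K) → ∀ x, |f x| ≤ C * K := by
  set q : ℝ := 2 * (hm 0 1 + 1) ^ 2
  have h1 := hm_nonneg 0 1
  have h2 := hm_nonneg 1 0
  have hq : 0 < q := by positivity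
  have eq : √(2 * q) = 2 * (hm 0 1 + 1) := by
    rw [show 2 * q = (2 * (hm 0 1 + 1)) ^ 2 by simp only [q]; ring, sqrt_sq (by positivity)]
  set D := √(2 * q) * (hm 0 1 + hm 1 0)
  have hD : 0 ≤ D := by positivity
  refine ⟨2 * D, by positivity, fun f g hf hg hA hl K hK => ?_⟩
  have K0 : 0 ≤ K := (abs_nonneg _).trans (hK 0)
  have step : ∀ B, (∀ x, |f x| ≤ B) → ∀ x, |f x| ≤ B / 2 + D * K := by
    intro B hB x
    rw [heat_static hf hq.le x]
    have B0 : 0 ≤ B := (abs_nonneg _).trans (hB 0)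
    refine (abs_sub _ _).trans (add_le_add ?_ ?_)
    · have := sub_A2_abs_le (hf.HS q) (C := (√(2 * q))⁻¹ * (hm 0 1 * B)) (fun y => ?_) x
      · rw [A2_HS hf, hA, show HS q (fun _ : ℝ² => (0:ℝ)) x = 0 by simp [HS_eq, GA], sub_zero] at this
        refine this.trans ?_
        rw [eq, inv_mul_le_iff₀ (by positivity)]
        nlinarith
      · rw [(HE_DD2 0 0 hq hf.continuous hB).pd2_eq]
        simpa using HE_abs_le 0 1 q hB y
    · refine (abs_integral_le_sqrt hq.le (C := (hm 0 1 + hm 1 0) * K) fun r _ hr => ?_).trans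
        (by rw [sub_zero, mul_assoc])
      rcases hl with hl | hl
      · have e : HE 1 0 (q - r) g = HS (q - r) (pd1 g) := HE_pd1 0 0 (sub_pos.2 hr) hg
        rw [hl, ← e]
        refine (HE_abs_le 1 0 _ hK x).trans ?_
        simp only [add_zero, pow_one]
        gcongr; linarith
      · have e : HE 0 1 (q - r) g = HS (q - r) (pd2 g) := HE_pd2 0 0 (sub_pos.2 hr) hg
        rw [hl, ← e]
        refine (HE_abs_le 0 1 _ hK x).trans ?_
        simp only [zero_add, pow_one]
        gcongr; linarith
  obtain ⟨B, hB0, hB⟩ := hf.bc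
  have it : ∀ n : ℕ, ∀ x, |f x| ≤ B / 2 ^ n + 2 * D * K := by
    intro n
    induction n with
    | zero => exact fun x => (hB.bd x).trans (by simp only [pow_zero, div_one]; nlinarith)
    | succ n ih =>
      refine fun x => (step _ ih x).trans (le_of_eq ?_)
      rw [pow_succ]; field_simp; ring
  intro x
  have lim : Tendsto (fun n : ℕ => B / 2 ^ n + 2 * D * K) atTop (𝓝 (0 + 2 * D * K)) :=
    (tendsto_const_nhds.div_atTop (tendsto_pow_atTop_atTop_of_one_lt one_lt_two)).add_const _
  rw [zero_add] at lim
  exact ge_of_tendsto' lim fun n => it n x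

theorem NSE.A2_u1_const (h : NSE I u1 u2) (ht : t ∈ I) (x y : ℝ²) : A2 (u1 t) x = A2 (u1 t) y := by
  have s1 : Sm (u1 t) := h.s1.slice ht
  have s2 : Sm (u2 t) := h.s2.slice ht
  refine eq_of_pd_zero s1.A2 (fun x => ?_) (fun x => congrFun (pd2_A2_zero s1 (h.p1 t ht)) x) x y
  have : pd1 (u1 t) = fun x => -1 * pd2 (u2 t) x := funext fun x => by linarith [h.div t ht x]
  rw [pd1_A2 s1, this, A2_const_mul, A2_pd2 s2 (h.p2 t ht)]
  simp

theorem NSE.sm_cF (h : NSE I u1 u2) (ht : t ∈ I) : Sm (cF (qa u1 u2 t) (qb u1 u2 t)) :=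
  cF_sm (h.sm_qa ht) (h.sm_qb ht)

theorem NSE.A2_cF (h : NSE I u1 u2) (ht : t ∈ I) :
    A2 (cF (qa u1 u2 t) (qb u1 u2 t)) = pd1 (A2 (qb u1 u2 t)) ∧
    pd1 (A2 (BB (cF (qa u1 u2 t) (qb u1 u2 t)))) = (fun _ => 0) := by
  have pa := qa_per (h.p1 t ht) (h.p2 t ht)
  have pb := qb_per (h.p1 t ht) (h.p2 t ht)
  have sa := h.sm_qa ht
  have sb := h.sm_qb ht
  refine ⟨?_, pd1_A2_BB (h.sm_cF ht) (cF_per pa pb)⟩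
  have : A2 (cF (qa u1 u2 t) (qb u1 u2 t)) = _ := A2_sub sb.pd1 sa.pd2
  rw [this, A2_pd2 sa pa, pd1_A2 sb]
  simp

theorem NSE.A2_u1_deriv (h : NSE I u1 u2) (hI : IsOpen I) (ht : t ∈ I) (x : ℝ²) :
    HasDerivAt (fun s => A2 (u1 s) x) 0 t := by
  have t1 : TS I 0 u1 := h.s1
  have t2 : TS I 0 u2 := h.s2
  have hR := (((t1.lap hI).sub hI ((TS.qa hI t1 t2).QF1 hI (TS.qb t1 t2)))).sb
  refine (SB.av_time I hI h.s1 hR h.d1 A2_int A2_meas t ht x).congr_deriv ?_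
  have s1 : Sm (u1 t) := h.s1.slice ht
  have sa := h.sm_qa ht
  have sb := h.sm_qb ht
  have sB := BB_sm (h.sm_cF ht)
  change A2 (fun x => lap (u1 t) x - QF1 (qa u1 u2 t) (qb u1 u2 t) x) x = 0
  have e : A2 (QF1 (qa u1 u2 t) (qb u1 u2 t)) = _ := A2_sub sb.pd2 (sB.pd1.const_mul 2)
  have hl : lap (A2 (u1 t)) = fun _ => 0 := by
    have : A2 (u1 t) = fun _ => A2 (u1 t) 0 := funext fun y => h.A2_u1_const ht y 0
    rw [this]
    funext y
    simp [lap, pd1, pd2]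
  rw [A2_sub s1.lap (QF1_sm sa sb), e, A2_lap s1, hl, A2_const_mul, ← pd1_A2 sB, (h.A2_cF ht).2,
    A2_pd2 sb (qb_per (h.p1 t ht) (h.p2 t ht))]
  simp

theorem NSE.A2_u2_deriv (h : NSE I u1 u2) (hI : IsOpen I) (ht : t ∈ I) (x : ℝ²) :
    HasDerivAt (fun s => A2 (u2 s) x) (lap (A2 (u2 t)) x - pd1 (A2 (qb u1 u2 t)) x) t := by
  have t1 : TS I 0 u1 := h.s1
  have t2 : TS I 0 u2 := h.s2
  have hR := (((t2.lap hI).sub hI ((TS.qa hI t1 t2).QF2 hI (TS.qb t1 t2)))).sb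
  refine (SB.av_time I hI h.s2 hR h.d2 A2_int A2_meas t ht x).congr_deriv ?_
  have s2 : Sm (u2 t) := h.s2.slice ht
  have sa := h.sm_qa ht
  have sb := h.sm_qb ht
  have sB := BB_sm (h.sm_cF ht)
  change A2 (fun x => lap (u2 t) x - QF2 (qa u1 u2 t) (qb u1 u2 t) x) x = _
  have e : A2 (QF2 (qa u1 u2 t) (qb u1 u2 t)) = _ :=
    A2_sub (((h.sm_cF ht).const_mul 2).sub sb.pd1) (sB.pd2.const_mul 2)
  have e' : A2 (fun x => 2 * cF (qa u1 u2 t) (qb u1 u2 t) x - pd1 (qb u1 u2 t) x) = _ :=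
    A2_sub ((h.sm_cF ht).const_mul 2) sb.pd1
  rw [A2_sub s2.lap (QF2_sm sa sb), e, e', A2_lap s2, A2_const_mul, A2_const_mul, (h.A2_cF ht).1,
    ← pd1_A2 sb, A2_pd2 sB (BB_per (cF_per (qa_per (h.p1 t ht) (h.p2 t ht)) (qb_per (h.p1 t ht) (h.p2 t ht))))]
  ring

theorem SB.moving (h : SB I F) (c : ℝ) : SB I (fun r x => F r (x + (c * r, 0))) := by
  refine ⟨h.cont.comp (g := fun p : ℝ × ℝ² => F p.1 p.2)
    (f := fun p : ℝ × ℝ² => (p.1, p.2 + (c * p.1, 0))) (by fun_prop) fun p hp => ⟨hp.1, trivial⟩,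
    fun n => ?_⟩
  obtain ⟨C, h0, hC⟩ := h.fd n
  exact ⟨C, h0, fun L hL t ht x => by rw [FD_shift]; exact hC L hL t ht _⟩

theorem lap_shift (h : Sm f) (a x : ℝ²) :
    pd1 (fun y => f (y + a)) x = pd1 f (x + a) ∧ lap (fun y => f (y + a)) x = lap f (x + a) := by
  have e1 : ∀ {f : ℝ² → ℝ}, Sm f → pd1 (fun y => f (y + a)) = fun y => pd1 f (y + a) :=
    fun h => (h.DD1.comp_add a).pd1_eq
  have e2 : ∀ {f : ℝ² → ℝ}, Sm f → pd2 (fun y => f (y + a)) = fun y => pd2 f (y + a) :=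
    fun h => (h.DD2.comp_add a).pd2_eq
  refine ⟨congrFun (e1 h) x, ?_⟩
  rw [lap, lap, e1 h, e2 h, e1 h.pd1, e2 h.pd2]

theorem NSE.hat_bound (hC : ∀ f g, Sm f → Sm g → A2 f = (fun _ => 0) →
    (lap f = pd1 g ∨ lap f = pd2 g) → ∀ K, (∀ x, |g x| ≤ K) → ∀ x, |f x| ≤ C * K)
    (h : NSE I u1 u2) (hI : IsOpen I) (ht : t ∈ I) (hK : ∀ x, |om u1 u2 t x| ≤ K) (x : ℝ²) :
    |u1 t x - A2 (u1 t) x| ≤ C * (2 * K) ∧ |u2 t x - A2 (u2 t) x| ≤ C * (2 * K) := by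
  have s1 : Sm (u1 t) := h.s1.slice ht
  have s2 : Sm (u2 t) := h.s2.slice ht
  have so : Sm (om u1 u2 t) := (h.om_sb hI).slice ht
  have K0 : 0 ≤ K := (abs_nonneg _).trans (hK 0)
  obtain ⟨l1, l2⟩ := curl_eq s1 s2 (h.div t ht)
  change lap (u1 t) = fun x => -pd2 (om u1 u2 t) x at l1
  change lap (u2 t) = pd1 (om u1 u2 t) at l2
  have po : Per (om u1 u2 t) := fun x => by simp only [om, (h.p2 t ht).pd1 x, (h.p1 t ht).pd2 x]
  have z1 : A2 (fun x => u1 t x - A2 (u1 t) x) = fun _ => 0 := by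
    rw [A2_sub s1 s1.A2, A2_A2 s1 (h.p1 t ht)]; simp
  have z2 : A2 (fun x => u2 t x - A2 (u2 t) x) = fun _ => 0 := by
    rw [A2_sub s2 s2.A2, A2_A2 s2 (h.p2 t ht)]; simp
  constructor
  · refine hC _ (fun x => -1 * om u1 u2 t x) (s1.sub s1.A2) (so.const_mul _) z1 (Or.inr ?_) _ (fun x => ?_) x
    · have e : (fun x => -pd2 (om u1 u2 t) x) = fun x => -1 * pd2 (om u1 u2 t) x := by simp
      rw [lap_sub s1 s1.A2, ← A2_lap s1, l1, e, A2_const_mul, A2_pd2 so po, pd2_const_mul _ so]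
      simp
    · simpa using (hK x).trans (by linarith)
  · refine hC _ (fun x => om u1 u2 t x - A2 (om u1 u2 t) x) (s2.sub s2.A2) (so.sub so.A2) z2 (Or.inl ?_) _
      (fun x => ?_) x
    · rw [lap_sub s2 s2.A2, ← A2_lap s2, l2, pd1_sub so so.A2, pd1_A2 so]
    · exact (abs_sub _ _).trans (by linarith [hK x, A2_abs_le hK x])

theorem NSE.bound : ∃ C, 0 ≤ C ∧ ∀ {σ T : ℝ} {u1 u2 : ℝ → ℝ² → ℝ}, NSE (Ioo σ T) u1 u2 →
    ∀ {s t : ℝ}, s ≤ t → Icc s t ⊆ Ioo σ T → ∀ {B K : ℝ}, (∀ x, |u1 s x| ≤ B) → (∀ x, |u2 s x| ≤ B) →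
    (∀ x, |om u1 u2 s x| ≤ K) → ∀ x, |u1 t x| ≤ B + C * K + C * K ^ 2 * √(t - s) ∧
      |u2 t x| ≤ B + C * K + C * K ^ 2 * √(t - s) := by
  obtain ⟨C, C0, hC⟩ := mean_zero_bound
  have hm0 := hm_nonneg 1 0
  refine ⟨2 * C + √2 * (hm 1 0 * (C * 2) ^ 2), by positivity, ?_⟩
  intro σ T u1 u2 h s t hst hJ B K hB1 hB2 hK x
  have hI : IsOpen (Ioo σ T) := isOpen_Ioo
  have K0 : 0 ≤ K := (abs_nonneg _).trans (hK 0)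
  have sI := hJ ⟨le_rfl, hst⟩
  have tI := hJ ⟨hst, le_rfl⟩
  have hat : ∀ r, s ≤ r → r ≤ t → ∀ x, |u1 r x - A2 (u1 r) x| ≤ C * (2 * K) ∧
      |u2 r x - A2 (u2 r) x| ≤ C * (2 * K) := fun r hr hr' x =>
    h.hat_bound hC hI (hJ ⟨hr, hr'⟩) (h.om_bound hI hr ((Icc_subset_Icc_right hr').trans hJ) hK) x
  set c := A2 (u1 s) 0
  have hc : ∀ r ∈ Ioo σ T, ∀ x, A2 (u1 r) x = c := fun r hr x => by
    rw [h.A2_u1_const hr x 0]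
    have := fun r hr => h.A2_u1_deriv hI (t := r) hr 0
    exact hI.is_const_of_deriv_eq_zero isPreconnected_Ioo (fun r hr => (this r hr).differentiableAt.differentiableWithinAt)
      (fun r hr => (this r hr).deriv) hr sI
  have hsqrt : √(2 * (t - s)) = √2 * √(t - s) := sqrt_mul (by norm_num) _
  have rest : 0 ≤ √2 * (hm 1 0 * (C * 2) ^ 2) * K + 2 * C * K ^ 2 * √(t - s) := by positivity
  have hu : ∀ i : ℝ → ℝ² → ℝ, |i t x - A2 (i t) x| ≤ C * (2 * K) →
      |A2 (i t) x| ≤ B + √(2 * (t - s)) * (hm 1 0 * (C * (2 * K)) ^ 2) →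
      |i t x| ≤ B + (2 * C + √2 * (hm 1 0 * (C * 2) ^ 2)) * K +
        (2 * C + √2 * (hm 1 0 * (C * 2) ^ 2)) * K ^ 2 * √(t - s) := fun i h1 h2 => by
    have := abs_add_le (i t x - A2 (i t) x) (A2 (i t) x)
    rw [sub_add_cancel] at this
    rw [hsqrt] at h2
    nlinarith
  refine ⟨hu u1 (hat t hst le_rfl x).1 ?_, hu u2 (hat t hst le_rfl x).2 ?_⟩
  · rw [hc t tI]
    exact (A2_abs_le hB1 0).trans (le_add_of_nonneg_right (by positivity))
  have sm := h.s2.av A2_int A2_meas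
  have t1 : TS (Ioo σ T) 0 u1 := h.s1
  have t2 : TS (Ioo σ T) 0 u2 := h.s2
  have tg := (t1.sub hI (t1.av hI A2_int A2_meas)).mul (t2.sub hI (t2.av hI A2_int A2_meas))
  have sg := tg.sb.av A2_int A2_meas
  change SB _ fun r => A2 (u2 r) at sm
  change SB _ fun r => A2 (fun x => (u1 r x - A2 (u1 r) x) * (u2 r x - A2 (u2 r) x)) at sg
  set g : ℝ → ℝ² → ℝ := fun r => A2 (fun x => (u1 r x - A2 (u1 r) x) * (u2 r x - A2 (u2 r) x))
  have gb : ∀ r, s ≤ r → r ≤ t → ∀ x, |g r x| ≤ (C * (2 * K)) ^ 2 := fun r hr hr' => by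
    refine A2_abs_le fun x => ?_
    rw [abs_mul, sq]
    exact mul_le_mul (hat r hr hr' x).1 (hat r hr hr' x).2 (abs_nonneg _) (by positivity)
  have eb : ∀ r ∈ Ioo σ T, A2 (qb u1 u2 r) = fun x => g r x + c * A2 (u2 r) x := fun r hr => by
    have s1 : Sm (u1 r) := h.s1.slice hr
    have s2 : Sm (u2 r) := h.s2.slice hr
    have e : qb u1 u2 r = fun x => ((u1 r x - A2 (u1 r) x) * (u2 r x - A2 (u2 r) x) + c * u2 r x) +
        (A2 (u2 r) x * u1 r x - c * A2 (u2 r) x) := by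
      funext x; rw [hc r hr]; simp only [qb]; ring
    rw [e, A2_add (((s1.sub s1.A2).mul (s2.sub s2.A2)).add (s2.const_mul c))
      ((s2.A2.mul s1).sub (s2.A2.const_mul c)), A2_add ((s1.sub s1.A2).mul (s2.sub s2.A2)) (s2.const_mul c),
      A2_sub (s2.A2.mul s1) (s2.A2.const_mul c), A2_mul s2 (h.p2 r hr), A2_const_mul, A2_const_mul,
      A2_A2 s2 (h.p2 r hr)]
    funext x
    change g r x + c * A2 (u2 r) x + (A2 (u2 r) x * A2 (u1 r) x - c * A2 (u2 r) x) = _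
    rw [hc r hr]
    ring
  have sQ : SB (Ioo σ T) fun r x => pd1 (g r) (x + (c * r, 0)) := sg.d1.moving c
  have tR : TS (Ioo σ T) 0 fun r x => lap (A2 (u2 r)) x - (pd1 (g r) x + c * pd1 (A2 (u2 r)) x) :=
    TS.sub (j := 0) hI (TS.lap (j := 0) hI sm) (sg.d1.add (sm.d1.const_mul c))
  have hdm : ∀ r ∈ Ioo σ T, ∀ x, HasDerivAt (fun r => A2 (u2 r) x)
      (lap (A2 (u2 r)) x - (pd1 (g r) x + c * pd1 (A2 (u2 r)) x)) r := fun r hr x => by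
    refine (h.A2_u2_deriv hI hr x).congr_deriv ?_
    have m : Sm (A2 (u2 r)) := sm.slice hr
    have g' : Sm (g r) := sg.slice hr
    rw [eb r hr, pd1_add g' (m.const_mul c), pd1_const_mul c m]
  have main := heat_duhamel hI (v := fun r x => A2 (u2 r) (x + (c * r, 0))) (sm.moving c) sQ
    (fun r hr x => by
      have hF := SB.hasFDerivAt hI sm tR.sb hdm hr (x + (c * r, 0))
      have hγ : HasDerivAt (fun r => (r, x + ((c * r, 0) : ℝ²))) ((1:ℝ), ((c, 0) : ℝ²)) r :=
        (hasDerivAt_id r).prodMk ((HasDerivAt.prodMk (by simpa using (hasDerivAt_id r).const_mul c)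
          (hasDerivAt_const r 0)).const_add x)
      refine (hF.comp_hasDerivAt (f := fun r => (r, x + ((c * r, 0) : ℝ²))) r hγ).congr_deriv ?_
      rw [(lap_shift (sm.slice hr : Sm (A2 (u2 r))) _ x).2]
      simp
      ring) hst hJ (x - (c * t, 0))
  simp only [sub_add_cancel] at main
  rw [main]
  refine (abs_sub _ _).trans (add_le_add (HS_abs_le _ (fun y => A2_abs_le hB2 _) _)
    (abs_integral_le_sqrt hst fun r hr hr' => ?_))
  have rI := hJ ⟨hr.le, hr'.le⟩
  have sg' : Sm (g r) := sg.slice rI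
  have sh : Sm (fun y => g r (y + (c * r, 0))) := (sg.moving c).slice rI
  have e : HE 1 0 (t - r) (fun y => g r (y + (c * r, 0))) = HS (t - r) _ := HE_pd1 0 0 (sub_pos.2 hr') sh
  rw [funext fun x => (lap_shift sg' (c * r, 0) x).1] at e
  rw [← e]
  simpa using HE_abs_le 1 0 (t - r) (fun y => gb r hr.le hr'.le _) (x - (c * t, 0))

theorem DD.abs_le (h : DD e f f') (he : ‖e‖ = 1) (hA : 0 ≤ A)
    (hL : ∀ a x, |FD [a] f x| ≤ A * nP [a]) (x : ℝ²) : |f' x| ≤ A := by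
  refine (h x).le_of_lip' hA (.of_forall fun s => ?_)
  have := hL (s • e) x
  simpa [FD, nP, norm_smul, he] using this

/-- A priori growth bound for mild solutions. -/
theorem Mild.growth (hM : 0 ≤ M) : ∃ C, 0 < C ∧ ∀ T L u1 u2, Mild T L u1 u2 →
    (∀ x, |u1 0 x| ≤ M) → (∀ x, |u2 0 x| ≤ M) → Per (u1 0) → Per (u2 0) →
    (∀ q, 0 < q → ∀ x, HE 1 0 q (u1 0) x + HE 0 1 q (u2 0) x = 0) →
    ∀ t, 0 ≤ t → t ≤ T → ∀ x, |u1 t x| ≤ C * (1 + √t) ∧ |u2 t x| ≤ C * (1 + √t) := by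
  obtain ⟨C, C0, hC⟩ := NSE.bound
  have hτ := T0_pos hM
  set s := T0 M / 2
  have hs : 0 < s := half_pos hτ
  have hs' : s ≤ T0 M := half_le_self hτ.le
  obtain ⟨A, hA, hfd⟩ := Mild.fd_bound 1 (by linarith : 0 ≤ 2 * M) hs
  have A0 : 0 ≤ A := by linarith
  refine ⟨2 * M + C * (2 * A) + C * (2 * A) ^ 2 + 1, by positivity, ?_⟩
  intro T L u1 u2 h b1 b2 p1 p2 hd
  have loc : ∀ t, 0 ≤ t → t ≤ T → t ≤ T0 M → ∀ x, |u1 t x| ≤ 2 * M ∧ |u2 t x| ≤ 2 * M := by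
    intro t ht htT htM x
    obtain ⟨w1, w2, hw, e1, e2⟩ := Mild.exists_local hM ⟨(h.tb1.slice 0).cont, b1⟩ ⟨(h.tb2.slice 0).cont, b2⟩
    obtain ⟨e1, e2⟩ := (hw.mono htM).unique (h.mono htT) e1 e2 t ht le_rfl
    rw [← e1, ← e2]
    exact ⟨hw.tb1.bd t x, hw.tb2.bd t x⟩
  have easy : ∀ {t y : ℝ}, |y| ≤ 2 * M → |y| ≤ (2 * M + C * (2 * A) + C * (2 * A) ^ 2 + 1) * (1 + √t) :=
    fun {t y} hy => by
      have : 0 ≤ (2 * M + C * (2 * A) + C * (2 * A) ^ 2 + 1) * √t := by positivity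
      have : 0 ≤ C * (2 * A) + C * (2 * A) ^ 2 := by positivity
      linarith
  have main : ∀ t, s ≤ t → t < T → ∀ x, |u1 t x| ≤ (2 * M + C * (2 * A) + C * (2 * A) ^ 2 + 1) * (1 + √t) ∧
      |u2 t x| ≤ (2 * M + C * (2 * A) + C * (2 * A) ^ 2 + 1) * (1 + √t) := by
    intro t hst htT x
    have sT : s ≤ T := hst.trans htT.le
    obtain ⟨w1, w2, hw, e1, e2⟩ := Mild.exists_local hM ⟨(h.tb1.slice 0).cont, b1⟩ ⟨(h.tb2.slice 0).cont, b2⟩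
    have hw' := hw.mono hs'
    obtain ⟨e1, e2⟩ := hw'.unique (h.mono sT) e1 e2 s hs.le le_rfl
    have hF := fun a => hfd s w1 w2 hw' s le_rfl le_rfl [a] le_rfl
    rw [e1, e2] at hF
    have hN := h.nse p1 p2 hd (half_pos hs)
    have sI : s ∈ Ioo (s / 2) T := ⟨by linarith, hst.trans_lt htT⟩
    have hom : ∀ x, |om u1 u2 s x| ≤ 2 * A := fun x => by
      have h1 := (hN.s2.dd1 sI).abs_le (by simp) A0 (fun a x => (hF a x).2) x
      have h2 := (hN.s1.dd2 sI).abs_le (by simp) A0 (fun a x => (hF a x).1) x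
      exact (abs_sub _ _).trans (by linarith)
    have lb := loc s hs.le sT hs'
    have := hC hN hst (fun r hr => ⟨by linarith [hr.1], hr.2.trans_lt htT⟩)
      (fun x => (lb x).1) (fun x => (lb x).2) hom x
    have hq : √(t - s) ≤ √t := sqrt_le_sqrt (by linarith)
    have h1 := mul_le_mul_of_nonneg_left hq (by positivity : 0 ≤ C * (2 * A) ^ 2)
    have h2 : 0 ≤ (2 * M + C * (2 * A) + 1) * √t := by positivity
    have h3 : 0 ≤ C * (2 * A) ^ 2 := by positivity
    constructor <;> linarith [this.1, this.2]
  intro t ht htT x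
  rcases le_or_gt t (T0 M) with htM | htM
  · exact ⟨easy (loc t ht htT htM x).1, easy (loc t ht htT htM x).2⟩
  have lim {F : ℝ → ℝ² → ℝ} (hF : TB L F) : Tendsto (fun r => |F r x|) (𝓝[<] t) (𝓝 |F t x|) := by
    have : Continuous fun r => |F r x| :=
      (hF.cont.comp (by fun_prop : Continuous fun r : ℝ => (r, x))).abs
    exact this.continuousAt.tendsto.mono_left nhdsWithin_le_nhds
  have lim' : Tendsto (fun r => (2 * M + C * (2 * A) + C * (2 * A) ^ 2 + 1) * (1 + √r)) (𝓝[<] t)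
      (𝓝 ((2 * M + C * (2 * A) + C * (2 * A) ^ 2 + 1) * (1 + √t))) :=
    (by fun_prop : Continuous fun r : ℝ => (2 * M + C * (2 * A) + C * (2 * A) ^ 2 + 1) * (1 + √r)
      ).continuousAt.tendsto.mono_left nhdsWithin_le_nhds
  have ev : ∀ᶠ r in 𝓝[<] t, s ≤ r ∧ r < T := by
    filter_upwards [Ioo_mem_nhdsLT (hs'.trans_lt htM)] with r hr using ⟨hr.1.le, hr.2.trans_le htT⟩
  exact ⟨le_of_tendsto_of_tendsto (lim h.tb1) lim' (ev.mono fun r hr => (main r hr.1 hr.2 x).1),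
    le_of_tendsto_of_tendsto (lim h.tb2) lim' (ev.mono fun r hr => (main r hr.1 hr.2 x).2)⟩

theorem Mild.exists_all (h1 : BC M f1) (h2 : BC M f2) (p1 : Per f1) (p2 : Per f2)
    (hd : ∀ q, 0 < q → ∀ x, HE 1 0 q f1 x + HE 0 1 q f2 x = 0) (hT : 0 ≤ T) :
    ∃ L u1 u2, Mild T L u1 u2 ∧ u1 0 = f1 ∧ u2 0 = f2 := by
  obtain ⟨C, hC, H⟩ := Mild.growth h1.nonneg
  refine Mild.exists_of_bound h1 h2 hT (B := C * (1 + √T)) ?_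
  rintro S L u1 u2 hS hST h rfl rfl x
  have := H S L u1 u2 h h1.bd h2.bd p1 p2 hd S hS le_rfl x
  have h' : C * (1 + √S) ≤ C * (1 + √T) := by gcongr
  exact ⟨this.1.trans h', this.2.trans h'⟩

theorem HS_sub_abs_le (hf : BC C f)
    (h : ∀ x h, |f (x + h) - f x| ≤ ε + D * (|h.1| + |h.2|)) (q : ℝ) (x : ℝ²) :
    |HS q f x - f x| ≤ ε + D * (√(2 * q) * (hm 1 0 + hm 0 1)) := by
  have i0 := hk_integrable 0 0
  have i1 := (hk_integrable 1 0).abs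
  have i2 := (hk_integrable 0 1).abs
  have e1 : ∀ z, |hk 1 0 z| = hk 0 0 z * |z.1| := fun z => by
    rw [← abs_of_nonneg (hk_zero_nonneg z), ← abs_mul]; simp only [hk, hef_one, hef_zero]; ring_nf
  have e2 : ∀ z, |hk 0 1 z| = hk 0 0 z * |z.2| := fun z => by
    rw [← abs_of_nonneg (hk_zero_nonneg z), ← abs_mul]; simp only [hk, hef_one, hef_zero]; ring_nf
  have ig : Integrable (fun z : ℝ² => hk 0 0 z * f (x + √(2 * q) • z)) :=
    avg_integrable i0 (hf.cont.comp (by fun_prop : Continuous fun z : ℝ² => x + √(2 * q) • z)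
      ).aestronglyMeasurable fun _ => hf.bd _
  have e : HS q f x - f x = ∫ z : ℝ², hk 0 0 z * (f (x + √(2 * q) • z) - f x) := by
    simp only [mul_sub]
    rw [integral_sub ig (i0.mul_const _), integral_mul_const, integral_hk_zero, one_mul, HS_eq, GA]
  rw [e]
  have hj : Integrable fun z => D * (√(2 * q) * (|hk 1 0 z| + |hk 0 1 z|)) :=
    ((i1.add i2).const_mul _).const_mul D
  have hi := (i0.mul_const ε).add hj
  rw [← norm_eq_abs]
  refine (norm_integral_le_of_norm_le hi (.of_forall fun z => ?_)).trans_eq ?_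
  · rw [Pi.add_apply, norm_mul, norm_of_nonneg (hk_zero_nonneg z), e1, e2]
    refine (mul_le_mul_of_nonneg_left (h x _) (hk_zero_nonneg z)).trans_eq ?_
    simp only [Prod.smul_fst, Prod.smul_snd, smul_eq_mul, abs_mul, abs_of_nonneg (sqrt_nonneg _)]
    ring
  · rw [integral_add' (i0.mul_const ε) hj, integral_mul_const,
      integral_hk_zero, integral_const_mul, integral_const_mul, integral_add i1 i2, one_mul]
    rfl

theorem NSE.congr (hI : IsOpen I) (h : NSE I u1 u2)
    (e1 : ∀ t ∈ I, u1 t = v1 t) (e2 : ∀ t ∈ I, u2 t = v2 t) : NSE I v1 v2 := by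
  have ea : ∀ t ∈ I, qa v1 v2 t = qa u1 u2 t ∧ qb v1 v2 t = qb u1 u2 t := fun t ht => by
    constructor <;> funext x <;> simp only [qa, qb, e1 t ht, e2 t ht]
  refine ⟨h.s1.congr e1, h.s2.congr e2, fun t ht => e1 t ht ▸ h.p1 t ht, fun t ht => e2 t ht ▸ h.p2 t ht,
    fun t ht x => ?_, fun t ht x => ?_, fun t ht x => by rw [← e1 t ht, ← e2 t ht]; exact h.div t ht x⟩
  · rw [(ea t ht).1, (ea t ht).2, ← e1 t ht]
    refine (h.d1 t ht x).congr_of_eventuallyEq ?_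
    filter_upwards [hI.mem_nhds ht] with s hs using congrFun (e1 s hs).symm x
  · rw [(ea t ht).1, (ea t ht).2, ← e2 t ht]
    refine (h.d2 t ht x).congr_of_eventuallyEq ?_
    filter_upwards [hI.mem_nhds ht] with s hs using congrFun (e2 s hs).symm x

theorem vnorm_le (v : ℝ²) : vnorm v ≤ |v.1| + |v.2| :=
  sqrt_le_iff.2 ⟨by positivity, by
    rw [vnorm2, ← sq_abs v.1, ← sq_abs v.2]
    nlinarith [mul_nonneg (abs_nonneg v.1) (abs_nonneg v.2)]⟩

theorem abs_fst_le_vnorm (v : ℝ²) : |v.1| ≤ vnorm v :=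
  abs_le_sqrt (by rw [vnorm2]; nlinarith [sq_nonneg v.2])

theorem abs_snd_le_vnorm (v : ℝ²) : |v.2| ≤ vnorm v :=
  abs_le_sqrt (by rw [vnorm2]; nlinarith [sq_nonneg v.1])

section
variable {v : ℝ² → ℝ²}

theorem BUCField.le_iSup (h : BUCField v) (x : ℝ²) : vnorm (v x) ≤ ⨆ x, vnorm (v x) := by
  obtain ⟨B, hB⟩ := h.2.1
  exact le_ciSup (f := fun x => vnorm (v x)) ⟨B, by rintro _ ⟨x, rfl⟩; exact hB x⟩ x

theorem BUCField.bc1 (h : BUCField v) : BC (⨆ x, vnorm (v x)) fun x => (v x).1 :=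
  ⟨h.1.continuous.fst, fun x => (abs_fst_le_vnorm _).trans (h.le_iSup x)⟩

theorem BUCField.bc2 (h : BUCField v) : BC (⨆ x, vnorm (v x)) fun x => (v x).2 :=
  ⟨h.1.continuous.snd, fun x => (abs_snd_le_vnorm _).trans (h.le_iSup x)⟩

theorem BUCField.per1 (h : BUCField v) : Per fun x => (v x).1 := fun x => by
  simpa using congrArg Prod.fst (h.2.2 x)

theorem BUCField.per2 (h : BUCField v) : Per fun x => (v x).2 := fun x => by
  simpa using congrArg Prod.snd (h.2.2 x)

theorem BUCField.mk' (hf : Sm f) (hg : Sm g) (pf : Per f) (pg : Per g) :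
    BUCField fun x => (f x, g x) := by
  have uc {g : ℝ² → ℝ} (hg : Sm g) : UniformContinuous g := by
    obtain ⟨C, hC, h⟩ := hg.fd 1
    refine (LipschitzWith.of_dist_le_mul (K := ⟨C, hC⟩) fun x y => ?_).uniformContinuous
    have := h [x - y] rfl 0 (mem_univ _) y
    simp only [FD, nP, add_sub_cancel, List.map_cons, List.map_nil, List.prod_cons, List.prod_nil, mul_one] at this
    rwa [dist_eq_norm, dist_eq_norm]
  obtain ⟨C, -, hC⟩ := hf.bc
  obtain ⟨D, -, hD⟩ := hg.bc
  exact ⟨(uc hf).prodMk (uc hg), ⟨C + D, fun x => (vnorm_le _).trans (add_le_add (hC.bd x) (hD.bd x))⟩,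
    fun x => Prod.ext (by simpa using pf x) (by simpa using pg x)⟩

end

theorem abs_sub_le_of_uniformContinuous (hf : UniformContinuous f) (hC : ∀ x, |f x| ≤ C)
    (hε : 0 < ε) : ∃ D, ∀ x h, |f (x + h) - f x| ≤ ε + D * (|h.1| + |h.2|) := by
  obtain ⟨δ, hδ, H⟩ := Metric.uniformContinuous_iff.1 hf ε hε
  refine ⟨2 * C / δ, fun x h => ?_⟩
  have C0 := (abs_nonneg _).trans (hC 0)
  by_cases hh : ‖h‖ < δ
  · have := H (a := x + h) (b := x) (by simpa [dist_eq_norm] using hh)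
    have h2 : 0 ≤ 2 * C / δ * (|h.1| + |h.2|) := by positivity
    rw [Real.dist_eq] at this
    linarith
  · have h1 : δ ≤ |h.1| + |h.2| := by
      refine (not_lt.1 hh).trans ?_
      rw [Prod.norm_def, norm_eq_abs, norm_eq_abs]
      exact max_le (by linarith [abs_nonneg h.2]) (by linarith [abs_nonneg h.1])
    have h2 : 2 * C / δ * δ ≤ 2 * C / δ * (|h.1| + |h.2|) := by gcongr
    rw [div_mul_cancel₀ _ hδ.ne'] at h2
    have h3 := abs_sub (f (x + h)) (f x)
    linarith [hC (x + h), hC x]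

/-- Mild solutions attain their initial data uniformly. -/
theorem Mild.uniform_zero (h : Mild T M u1 u2) (hT : 0 < T)
    (h1 : UniformContinuous (u1 0)) (h2 : UniformContinuous (u2 0)) (hε : 0 < ε) :
    ∃ δ > 0, ∀ s, 0 ≤ s → s < δ → s ≤ T ∧ ∀ x, |u1 s x - u1 0 x| ≤ ε ∧ |u2 s x - u2 0 x| ≤ ε := by
  obtain ⟨D1, hD1⟩ := abs_sub_le_of_uniformContinuous h1 (h.tb1.bd 0) (half_pos hε)
  obtain ⟨D2, hD2⟩ := abs_sub_le_of_uniformContinuous h2 (h.tb2.bd 0) (half_pos hε)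
  have ha := h.tb1.qa h.tb2
  have hb := h.tb1.qb h.tb2
  have key (c : ℝ) : ∀ᶠ s in 𝓝 (0 : ℝ), √(2 * s) * c < ε / 2 := by
    have : Continuous fun s : ℝ => √(2 * s) * c := by fun_prop
    exact this.continuousAt.eventually (gt_mem_nhds (by simpa using half_pos hε))
  obtain ⟨δ, hδ, H⟩ := Metric.eventually_nhds_iff.1 (((key (D1 * (hm 1 0 + hm 0 1) + KW * (M * M))).and
    (key (D2 * (hm 1 0 + hm 0 1) + KW * (M * M)))).and (gt_mem_nhds hT))
  refine ⟨δ, hδ, fun s hs hsδ => ?_⟩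
  obtain ⟨⟨k1, k2⟩, hsT⟩ := H (y := s) (by rwa [dist_0_eq_abs, abs_of_nonneg hs])
  refine ⟨hsT.le, fun x => ⟨?_, ?_⟩⟩
  · have e1 := HS_sub_abs_le (h.tb1.slice 0) hD1 s x
    have e2 := DW_abs_le (j := 0) (k := 1) rfl (t := s) (fun r _ _ x => ha.bd r x) (fun r _ _ x => hb.bd r x) ha.nonneg x
    rw [h.eq1 s hs hsT.le, sub_right_comm]
    refine (abs_sub _ _).trans ?_
    linarith
  · have e1 := HS_sub_abs_le (h.tb2.slice 0) hD2 s x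
    have e2 := DW_abs_le (j := 1) (k := 0) rfl (t := s) (fun r _ _ x => ha.bd r x) (fun r _ _ x => hb.bd r x) ha.nonneg x
    rw [h.eq2 s hs hsT.le, add_sub_right_comm]
    refine (abs_add_le _ _).trans ?_
    linarith

/-- A global mild solution is a classical solution. -/
theorem isSolution_of_mild {u₀ : ℝ² → ℝ²} (hu : BUCField u₀) (hd : WeakDivFree u₀)
    {U1 U2 : ℝ → ℝ² → ℝ} (H : ∀ n : ℕ, ∃ L v1 v2, Mild n L v1 v2 ∧ (v1 0 = fun x => (u₀ x).1) ∧
      (v2 0 = fun x => (u₀ x).2) ∧ ∀ t : ℝ, 0 ≤ t → t ≤ n → v1 t = U1 t ∧ v2 t = U2 t) :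
    IsSolution u₀ fun t x => (U1 t x, U2 t x) := by
  have loc : ∀ t, 0 < t → ∃ I : Set ℝ, IsOpen I ∧ Convex ℝ I ∧ t ∈ I ∧ NSE I U1 U2 ∧
      ∀ j, TS I j U1 ∧ TS I j U2 := by
    intro t ht
    obtain ⟨n, hn⟩ := exists_nat_gt t
    obtain ⟨L, v1, v2, h, e1, e2, e⟩ := H n
    have p1 : Per (v1 0) := e1 ▸ hu.per1
    have p2 : Per (v2 0) := e2 ▸ hu.per2
    have h2 := half_pos ht
    have e' := fun s (hs : s ∈ Ioo (t / 2) (n : ℝ)) => e s (h2.trans hs.1).le hs.2.le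
    refine ⟨Ioo (t / 2) n, isOpen_Ioo, convex_Ioo _ _, ⟨by linarith, hn⟩,
      (h.nse p1 p2 (fun q hq x => ?_) h2).congr isOpen_Ioo (fun s hs => (e' s hs).1)
      (fun s hs => (e' s hs).2), fun j => ⟨(h.ts p1 p2 h2 j).1.congr isOpen_Ioo (fun s hs => (e' s hs).1),
      (h.ts p1 p2 h2 j).2.congr isOpen_Ioo (fun s hs => (e' s hs).2)⟩⟩
    rw [e1, e2]
    exact hd.heat hu.bc1 hu.bc2 hq x
  have zero : U1 0 = (fun x => (u₀ x).1) ∧ U2 0 = fun x => (u₀ x).2 := by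
    obtain ⟨L, v1, v2, h, e1, e2, e⟩ := H 1
    obtain ⟨e3, e4⟩ := e 0 le_rfl (by simp)
    exact ⟨e3.symm.trans e1, e4.symm.trans e2⟩
  have sm : ∀ t, 0 < t → Sm (U1 t) ∧ Sm (U2 t) := fun t ht => by
    obtain ⟨I, -, -, hI, h, -⟩ := loc t ht
    exact ⟨h.s1.slice hI, h.s2.slice hI⟩
  have per : ∀ t, 0 < t → Per (U1 t) ∧ Per (U2 t) := fun t ht => by
    obtain ⟨I, -, -, hI, h, -⟩ := loc t ht
    exact ⟨h.p1 t hI, h.p2 t hI⟩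
  have div : ∀ t, 0 < t → ∀ x, pd1 (U1 t) x + pd2 (U2 t) x = 0 := fun t ht x => by
    obtain ⟨I, -, -, hI, h, -⟩ := loc t ht
    exact h.div t hI x
  have ini : (fun x => (U1 0 x, U2 0 x)) = u₀ := by rw [zero.1, zero.2]
  refine ⟨ini, fun t ht => ?_, fun t ht ε hε => ?_, fun p hp => ?_, div, fun t ht x => ?_, fun t ht x => ?_⟩
  · rcases ht.eq_or_lt with rfl | ht
    · exact ini.symm.subst (motive := BUCField) hu
    · exact BUCField.mk' (sm t ht).1 (sm t ht).2 (per t ht).1 (per t ht).2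
  · rcases ht.eq_or_lt with rfl | ht
    · obtain ⟨L, v1, v2, h, e1, e2, e⟩ := H 1
      obtain ⟨δ, hδ, hh⟩ := h.uniform_zero (by simp)
        (e1 ▸ uniformContinuous_fst.comp hu.1) (e2 ▸ uniformContinuous_snd.comp hu.1) (half_pos hε)
      refine ⟨δ, hδ, fun s hs hsδ x => (vnorm_le _).trans ?_⟩
      rw [sub_zero, abs_of_nonneg hs] at hsδ
      obtain ⟨hs1, hx⟩ := hh s hs hsδ
      have := hx x
      rw [(e s hs hs1).1, (e s hs hs1).2, (e 0 le_rfl (by simp)).1, (e 0 le_rfl (by simp)).2] at this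
      exact (add_le_add this.1 this.2).trans_eq (add_halves ε)
    · obtain ⟨I, oI, cI, hI, -, hts⟩ := loc t ht
      have lip {F : ℝ → ℝ² → ℝ} (hF : TS I 1 F) : ∃ C, 0 ≤ C ∧ ∀ s ∈ I, ∀ x, |F s x - F t x| ≤ C * |s - t| := by
        obtain ⟨-, G, hG, hd⟩ := hF
        obtain ⟨C, C0, hC⟩ := hG.sb.bd
        exact ⟨C, C0, fun s hs x => cI.norm_image_sub_le_of_norm_hasDerivWithin_le (f := fun s => F s x)
          (fun r hr => (hd r hr x).hasDerivWithinAt) (fun r hr => hC r hr x) hI hs⟩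
      obtain ⟨C, C0, hC⟩ := lip (hts 1).1
      obtain ⟨D, D0, hD⟩ := lip (hts 1).2
      obtain ⟨r, hr, hrI⟩ := Metric.isOpen_iff.1 oI t hI
      refine ⟨min r (ε / (C + D + 1)), by positivity, fun s _ hs x => (vnorm_le _).trans ?_⟩
      have hsI : s ∈ I := hrI (by rw [Metric.mem_ball, Real.dist_eq]; exact hs.trans_le (min_le_left _ _))
      have h1 := (lt_div_iff₀ (by positivity)).1 (hs.trans_le (min_le_right _ _))
      have h2 := hC s hsI x
      have h3 := hD s hsI x
      simp only [Prod.fst_sub, Prod.snd_sub]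
      linarith [abs_nonneg (s - t)]
  · obtain ⟨I, oI, -, hI, -, hts⟩ := loc p.1 hp
    have : (I ×ˢ univ : Set (ℝ × ℝ²)) ∈ 𝓝 p := (oI.prod isOpen_univ).mem_nhds ⟨hI, mem_univ _⟩
    exact (((contDiffOn_of_TS oI fun j => (hts j).1).contDiffAt this).prodMk
      ((contDiffOn_of_TS oI fun j => (hts j).2).contDiffAt this)).contDiffWithinAt
  · obtain ⟨I, -, -, hI, h, -⟩ := loc t ht
    have := (QF_eq_pressure (sm t ht).1 (sm t ht).2 (per t ht).1 (per t ht).2 (div t ht) x).1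
    have e := (h.d1 t hI x).deriv
    simp only [lap] at e
    rw [e, this]
    ring
  · obtain ⟨I, -, -, hI, h, -⟩ := loc t ht
    have := (QF_eq_pressure (sm t ht).1 (sm t ht).2 (per t ht).1 (per t ht).2 (div t ht) x).2
    have e := (h.d2 t hI x).deriv
    simp only [lap] at e
    rw [e, this]
    ring

theorem exists_solution : ∃ Cf : ℝ → ℝ, (∀ B, 0 < Cf B) ∧ ∀ u₀, BUCField u₀ → WeakDivFree u₀ →
    ∃ U1 U2 : ℝ → ℝ² → ℝ, IsSolution u₀ (fun t x => (U1 t x, U2 t x)) ∧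
      (∀ t, 0 ≤ t → ∀ x, vnorm (U1 t x, U2 t x) ≤ Cf (⨆ x, vnorm (u₀ x)) * (1 + √t)) ∧
      ∀ T L v1 v2, 0 ≤ T → Mild T L v1 v2 → (v1 0 = fun x => (u₀ x).1) → (v2 0 = fun x => (u₀ x).2) →
        v1 T = U1 T ∧ v2 T = U2 T := by
  choose C hC H using fun B : ℝ => Mild.growth (abs_nonneg B)
  refine ⟨fun B => 2 * C B, fun B => by linarith [hC B], fun u₀ hu hd => ?_⟩
  have hq : ∀ q, 0 < q → ∀ x, HE 1 0 q (fun x => (u₀ x).1) x + HE 0 1 q (fun x => (u₀ x).2) x = 0 :=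
    fun q hq x => hd.heat hu.bc1 hu.bc2 hq x
  choose L V1 V2 hV E1 E2 using fun n : ℕ =>
    Mild.exists_all hu.bc1 hu.bc2 hu.per1 hu.per2 hq (Nat.cast_nonneg (α := ℝ) n)
  have key : ∀ T M v1 v2, 0 ≤ T → Mild T M v1 v2 → (v1 0 = fun x => (u₀ x).1) → (v2 0 = fun x => (u₀ x).2) →
      v1 T = V1 ⌈T⌉₊ T ∧ v2 T = V2 ⌈T⌉₊ T := fun T M v1 v2 hT h e1 e2 =>
    h.unique ((hV ⌈T⌉₊).mono (Nat.le_ceil T)) (e1.trans (E1 _).symm) (e2.trans (E2 _).symm) T hT le_rfl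
  refine ⟨fun t => V1 ⌈t⌉₊ t, fun t => V2 ⌈t⌉₊ t, isSolution_of_mild hu hd fun n =>
    ⟨L n, V1 n, V2 n, hV n, E1 n, E2 n, fun t ht htn => key t _ _ _ ht ((hV n).mono htn) (E1 n) (E2 n)⟩,
    fun t ht x => (vnorm_le _).trans ?_, key⟩
  have hb : ∀ x, vnorm (u₀ x) ≤ |⨆ x, vnorm (u₀ x)| := fun x => (hu.le_iSup x).trans (le_abs_self _)
  have := H _ ⌈t⌉₊ _ _ _ (hV ⌈t⌉₊) (fun x => by rw [E1]; exact (abs_fst_le_vnorm _).trans (hb x))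
    (fun x => by rw [E2]; exact (abs_snd_le_vnorm _).trans (hb x)) (by rw [E1]; exact hu.per1)
    (by rw [E2]; exact hu.per2) (by rw [E1, E2]; exact hq) t ht (Nat.le_ceil t) x
  linarith [this.1, this.2]

theorem DD.FD (L : List ℝ²) (h : DD e f g) : DD e (FD L f) (FD L g) := by
  induction L with
  | nil => exact h
  | cons a L ih =>
    intro x
    simp only [FD_cons]
    exact (((ih (x + a)).congr_of_eventuallyEq (.of_forall fun s => by
      simp only [add_right_comm])).fun_sub (ih x))

/-- A class of families of bounded functions that is closed under the two partial derivatives consists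
of smooth families. -/
theorem SB.of_closed {P : (ℝ → ℝ² → ℝ) → Prop}
    (hP : ∀ F, P F → (∃ C, 0 ≤ C ∧ ∀ t ∈ I, ∀ x, |F t x| ≤ C) ∧ ∃ F1 F2, P F1 ∧ P F2 ∧
      ∀ t ∈ I, DD (1, 0) (F t) (F1 t) ∧ DD (0, 1) (F t) (F2 t))
    (hF : P F) (hc : ContinuousOn (fun p : ℝ × ℝ² => F p.1 p.2) (I ×ˢ univ)) :
    SB I F := by
  refine ⟨hc, fun n => ?_⟩
  clear hc
  induction n generalizing F with
  | zero =>
    obtain ⟨⟨C, hC0, hC⟩, -⟩ := hP F hF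
    refine ⟨C, hC0, fun L hL t ht x => ?_⟩
    rw [List.length_eq_zero_iff.1 hL]
    simpa [NS.FD, nP] using hC t ht x
  | succ n ih =>
    obtain ⟨-, F1, F2, h1, h2, hd⟩ := hP F hF
    obtain ⟨C1, hC10, hC1⟩ := ih h1
    obtain ⟨C2, hC20, hC2⟩ := ih h2
    refine ⟨C1 + C2, by positivity, fun L hL t ht x => ?_⟩
    match L, hL with
    | a :: L, hL =>
      have hL' : L.length = n := by simpa using hL
      rw [FD_cons, nP_cons]
      refine (lip_of_DD ((hd t ht).1.FD L) ((hd t ht).2.FD L) (hC1 L hL' t ht) (hC2 L hL' t ht) x a).trans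
        (le_of_eq (by ring))

theorem hasDerivAt_line {E : Type*} [NormedAddCommGroup E] [NormedSpace ℝ E] {g : E → ℝ} {x : E}
    (h : DifferentiableAt ℝ g x) (e : E) : HasDerivAt (fun s : ℝ => g (x + s • e)) (fderiv ℝ g x e) 0 := by
  have h1 : HasDerivAt (fun s : ℝ => x + s • e) e 0 := by
    simpa using ((hasDerivAt_id (0:ℝ)).smul_const e).const_add x
  exact HasFDerivAt.comp_hasDerivAt (f := fun s : ℝ => x + s • e) 0 (by simpa using h.hasFDerivAt) h1

theorem sm_of_support (hg : ContDiff ℝ ∞ g) (hp : Per g) {n : ℝ}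
    (hn : ∀ x : ℝ², n < |x.1| → g x = 0) : Sm g := by
  refine SB.of_closed (P := fun F => ∃ g, F = (fun _ => g) ∧ ContDiff ℝ ∞ g ∧ Per g ∧
    ∀ x : ℝ², n < |x.1| → g x = 0) ?_ ⟨g, rfl, hg, hp, hn⟩
    (hg.continuous.comp continuous_snd).continuousOn
  rintro _ ⟨g, rfl, hg, hp, hn⟩
  have key : ∀ e : ℝ², ContDiff ℝ ∞ (fun x => fderiv ℝ g x e) ∧ Per (fun x => fderiv ℝ g x e) ∧
      (∀ x : ℝ², n < |x.1| → fderiv ℝ g x e = 0) ∧ DD e g (fun x => fderiv ℝ g x e) := by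
    intro e
    have hd : DD e g (fun x => fderiv ℝ g x e) := fun x =>
      hasDerivAt_line (hg.differentiable (by simp) x) e
    refine ⟨(hg.fderiv_right (m := ∞) (by simp)).clm_apply contDiff_const, fun x => ?_,
      fun x hx => ?_, hd⟩
    · refine (hd _).unique ((hd x).congr_of_eventuallyEq (.of_forall fun s =>
        Eq.trans (congrArg g ?_) (hp (x + s • e))))
      ext <;> simp; ring
    · have : g =ᶠ[𝓝 x] fun _ => 0 := by
        filter_upwards [(isOpen_lt continuous_const (continuous_fst.abs)).mem_nhds hx] with y hy
          using hn y hy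
      rw [this.fderiv_eq]; simp
  refine ⟨?_, _, _, ⟨_, rfl, (key (1, 0)).1, (key (1, 0)).2.1, (key (1, 0)).2.2.1⟩,
    ⟨_, rfl, (key (0, 1)).1, (key (0, 1)).2.1, (key (0, 1)).2.2.1⟩, fun t _ =>
    ⟨(key (1, 0)).2.2.2, (key (0, 1)).2.2.2⟩⟩
  obtain ⟨C, hC⟩ := (isCompact_Icc (a := -n) (b := n)).prod (isCompact_Icc (a := (0:ℝ)) (b := 1))
    |>.exists_bound_of_continuousOn hg.continuous.continuousOn
  refine ⟨max C 0, le_max_right _ _, fun t _ x => ?_⟩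
  by_cases h : n < |x.1|
  · simp [hn x h]
  · change |g x| ≤ _
    rw [show g x = g (x.1, Int.fract x.2) from (hp.fract _ _).symm]
    exact (hC (x.1, Int.fract x.2) ⟨abs_le.1 (not_lt.1 h), Int.fract_nonneg _, (Int.fract_lt_one _).le⟩).trans
      (le_max_left _ _)

/-- Differentiability of a function that is approximated, up to functions with small Lipschitz
constants, by differentiable functions. -/
theorem exists_hasDerivAt_of_approx {φ : ℝ → ℝ} {ψ : ℕ → ℝ → ℝ} {ψ' ε : ℕ → ℝ}
    (hψ : ∀ n, HasDerivAt (ψ n) (ψ' n) 0) (hε : Tendsto ε atTop (𝓝 0))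
    (h : ∀ n s, |s| ≤ 1 → |(φ s - ψ n s) - (φ 0 - ψ n 0)| ≤ ε n * |s|) :
    ∃ l, HasDerivAt φ l 0 ∧ ∀ n, |l - ψ' n| ≤ ε n := by
  have h0 : ∀ n, 0 ≤ ε n := fun n => by simpa using (abs_nonneg _).trans (h n 1 (by simp))
  have near : ∀ᶠ s : ℝ in 𝓝 0, |s| ≤ 1 := by
    filter_upwards [Metric.closedBall_mem_nhds (0:ℝ) one_pos] with s hs
    simpa using hs
  have hd : ∀ n m, |ψ' n - ψ' m| ≤ ε n + ε m := fun n m => by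
    refine ((hψ n).fun_sub (hψ m)).le_of_lip' (add_nonneg (h0 n) (h0 m)) ?_
    filter_upwards [near] with s hs
    have h1 := abs_le.1 (h n s hs)
    have h2 := abs_le.1 (h m s hs)
    rw [norm_eq_abs, sub_zero, norm_eq_abs, abs_le]
    constructor <;> linarith [h1.1, h1.2, h2.1, h2.2]
  have hca : CauchySeq ψ' := by
    refine Metric.cauchySeq_iff.2 fun δ hδ => ?_
    obtain ⟨N, hN⟩ := eventually_atTop.1 (hε.eventually (gt_mem_nhds (half_pos hδ)))
    exact ⟨N, fun m hm n hn => (hd m n).trans_lt (by linarith [hN m hm, hN n hn])⟩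
  obtain ⟨l, hl⟩ := cauchySeq_tendsto_of_complete hca
  have hln : ∀ n, |l - ψ' n| ≤ ε n := fun n => by
    have := le_of_tendsto_of_tendsto' (hl.sub_const (ψ' n)).abs (hε.add_const (ε n)) (fun m => hd m n)
    simpa using this
  refine ⟨l, ?_, hln⟩
  rw [hasDerivAt_iff_isLittleO, Asymptotics.isLittleO_iff]
  intro c hc
  obtain ⟨n, hn⟩ := (hε.eventually (gt_mem_nhds (show 0 < c / 3 by positivity))).exists
  filter_upwards [near, (Asymptotics.isLittleO_iff.1 (hasDerivAt_iff_isLittleO.1 (hψ n)))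
    (show 0 < c / 3 by positivity)] with s hs hs2
  simp only [sub_zero, smul_eq_mul, norm_eq_abs] at hs2 ⊢
  have h1 := h n s hs
  have h2 : |s * (l - ψ' n)| ≤ |s| * ε n := by
    rw [abs_mul]; exact mul_le_mul_of_nonneg_left (hln n) (abs_nonneg _)
  have h3 : ε n * |s| ≤ c / 3 * |s| := mul_le_mul_of_nonneg_right hn.le (abs_nonneg _)
  calc |φ s - φ 0 - s * l| = |((φ s - ψ n s) - (φ 0 - ψ n 0)) + (ψ n s - ψ n 0 - s * ψ' n)
        - s * (l - ψ' n)| := by congr 1; ring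
    _ ≤ _ := (abs_sub _ _).trans (add_le_add_left (abs_add_le _ _) _)
    _ ≤ c * |s| := by linarith

theorem abs_cosh_sub_le (a b : ℝ) : |cosh a - cosh b| ≤ |a - b| * (cosh a + cosh b) := by
  have key : ∀ a b : ℝ, |exp a - exp b| ≤ |a - b| * (exp a + exp b) := by
    have half : ∀ a b : ℝ, exp a - exp b ≤ (a - b) * exp a := fun a b => by
      have h1 := mul_le_mul_of_nonneg_left (add_one_le_exp (b - a)) (exp_pos a).le
      rw [← exp_add, add_sub_cancel] at h1
      linarith
    intro a b
    have p := mul_le_mul_of_nonneg_right (le_abs_self (a - b)) (exp_pos a).le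
    have q := mul_le_mul_of_nonneg_right (neg_le_abs (a - b)) (exp_pos b).le
    have r := mul_nonneg (abs_nonneg (a - b)) (exp_pos b).le
    have r' := mul_nonneg (abs_nonneg (a - b)) (exp_pos a).le
    rw [abs_le]; constructor <;> linarith [half a b, half b a]
  rw [cosh_eq, cosh_eq, show (exp a + exp (-a)) / 2 - (exp b + exp (-b)) / 2
    = (exp a - exp b) / 2 + (exp (-a) - exp (-b)) / 2 by ring]
  have h := key (-a) (-b)
  rw [show -a - -b = -(a - b) by ring, abs_neg] at h
  refine (abs_add_le _ _).trans ?_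
  rw [abs_div, abs_div, abs_two]
  linarith [key a b]

theorem cosh_le_Dk {z : ℝ²} (hz : 1 ≤ |z.1|) : cosh (2 * π * z.1) ≤ Dk 0 z := by
  have h1 : 6 ≤ |2 * π * z.1| := by
    rw [abs_mul, abs_of_pos (by positivity)]; nlinarith [pi_gt_three]
  have h2 : 2 ≤ cosh (2 * π * z.1) := by
    rw [← cosh_abs, cosh_eq]
    linarith [add_one_le_exp |2 * π * z.1|, exp_pos (-|2 * π * z.1|)]
  rw [Dk]; linarith [cos_le_one (2 * π * z.2)]

theorem kk_sub_le {z w : ℝ²} (hz : 1 ≤ |z.1|) (hw : 1 ≤ |w.1|) :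
    |kk 0 z - kk 0 w| ≤ 24 * π * ‖z - w‖ * (cw z + cw w) := by
  have hD := cosh_le_Dk hz
  have hD' := cosh_le_Dk hw
  have hc := one_le_cosh (2 * π * z.1)
  have hc' := one_le_cosh (2 * π * w.1)
  have n1 : |2 * π * z.1 - 2 * π * w.1| ≤ 2 * π * ‖z - w‖ := by
    rw [← mul_sub, abs_mul, abs_of_pos (by positivity)]
    exact mul_le_mul_of_nonneg_left (norm_fst_le (z - w)) (by positivity)
  have n2 : |2 * π * z.2 - 2 * π * w.2| ≤ 2 * π * ‖z - w‖ := by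
    rw [← mul_sub, abs_mul, abs_of_pos (by positivity)]
    exact mul_le_mul_of_nonneg_left (norm_snd_le (z - w)) (by positivity)
  have h1 := (abs_sin_sub_sin_le (2 * π * z.2) (2 * π * w.2)).trans n2
  have h2 := (abs_cos_sub_cos_le (2 * π * z.2) (2 * π * w.2)).trans n2
  have h3 := (abs_cosh_sub_le (2 * π * z.1) (2 * π * w.1)).trans
    (mul_le_mul_of_nonneg_right n1 (by positivity))
  have hDD : |Dk 0 w - Dk 0 z| ≤ 2 * π * ‖z - w‖ * (4 * (cosh (2 * π * z.1) + cosh (2 * π * w.1))) := by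
    have e : Dk 0 w - Dk 0 z = -(2 * (cosh (2 * π * z.1) - cosh (2 * π * w.1)))
      + 2 * (cos (2 * π * z.2) - cos (2 * π * w.2)) := by rw [Dk, Dk]; ring
    rw [e]
    refine (abs_add_le _ _).trans ?_
    rw [abs_neg, abs_mul, abs_mul, abs_two]
    have : 2 * π * ‖z - w‖ * 1 ≤ 2 * π * ‖z - w‖ * (cosh (2 * π * z.1) + cosh (2 * π * w.1)) := by
      gcongr; linarith
    linarith
  have p1 : 0 < Dk 0 z := by linarith
  have p2 : 0 < Dk 0 w := by linarith
  have e : kk 0 z - kk 0 w = (sin (2 * π * z.2) - sin (2 * π * w.2)) * (Dk 0 z)⁻¹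
      + sin (2 * π * w.2) * ((Dk 0 w - Dk 0 z) * ((Dk 0 z)⁻¹ * (Dk 0 w)⁻¹)) := by
    rw [kk, kk]; field_simp; ring
  have i1 : (Dk 0 z)⁻¹ ≤ cw z := inv_anti₀ (by linarith) hD
  have i2 : (Dk 0 w)⁻¹ ≤ cw w := inv_anti₀ (by linarith) hD'
  have hN : 0 ≤ 2 * π * ‖z - w‖ := by positivity
  have c1 := cw_pos z
  have c2 := cw_pos w
  rw [e]
  refine (abs_add_le _ _).trans ?_
  rw [abs_mul, abs_mul, abs_mul, abs_of_pos (inv_pos.2 p1),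
    abs_of_pos (mul_pos (inv_pos.2 p1) (inv_pos.2 p2))]
  calc _ ≤ 2 * π * ‖z - w‖ * cw z + 1 * (2 * π * ‖z - w‖ * (4 * (cosh (2 * π * z.1) + cosh (2 * π * w.1)))
        * (cw z * cw w)) := by
        gcongr
        exact abs_sin_le_one _
    _ = 2 * π * ‖z - w‖ * (cw z + 4 * (cw z + cw w)) := by
        rw [cw, cw]; field_simp; ring
    _ ≤ _ := by nlinarith [mul_nonneg hN c1.le, mul_nonneg hN c2.le]

theorem cw_sub_le (x y : ℝ²) : cw (x - y) ≤ 2 * cosh (2 * π * x.1) * cw y := by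
  have h : cosh (2 * π * y.1) ≤ 2 * cosh (2 * π * x.1) * cosh (2 * π * (x - y).1) := by
    rw [show 2 * π * y.1 = 2 * π * x.1 - 2 * π * (x - y).1 by simp; ring, cosh_sub]
    have := cosh_add (2 * π * x.1) (2 * π * (x - y).1)
    nlinarith [cosh_pos (2 * π * x.1 + 2 * π * (x - y).1)]
  rw [cw, cw, inv_le_iff_one_le_mul₀ (cosh_pos _), ← div_eq_mul_inv, div_mul_eq_mul_div,
    one_le_div (cosh_pos _)]
  exact h

theorem inv_le_Dk (x y : ℝ²) : cw y ≤ 8 * cosh (2 * π * x.1) * (Dk 0 (x - y))⁻¹ ∨ Dk 0 (x - y) = 0 := by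
  by_cases h0 : Dk 0 (x - y) = 0
  · exact .inr h0
  left
  have hp : 0 < Dk 0 (x - y) := lt_of_le_of_ne (by rw [Dk_zero_eq]; positivity) (Ne.symm h0)
  have h : Dk 0 (x - y) ≤ 8 * cosh (2 * π * x.1) * cosh (2 * π * y.1) := by
    have e : Dk 0 (x - y) ≤ 4 * cosh (2 * π * (x - y).1) := by
      rw [Dk]; linarith [neg_one_le_cos (2 * π * (x - y).2), one_le_cosh (2 * π * (x - y).1)]
    rw [show 2 * π * (x - y).1 = 2 * π * x.1 - 2 * π * y.1 by simp; ring, cosh_sub] at e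
    have := cosh_add (2 * π * x.1) (2 * π * y.1)
    nlinarith [cosh_pos (2 * π * x.1 + 2 * π * y.1)]
  rw [cw, inv_le_iff_one_le_mul₀ (cosh_pos _), mul_right_comm, ← div_eq_mul_inv, one_le_div hp]
  exact h

theorem cw_mul_integrable (hf : Continuous f) {x x' : ℝ²} (hx : Integrable (fun y => kk 0 (x - y) * f y) μΩ)
    (hx' : Integrable (fun y => kk 0 (x' - y) * f y) μΩ) (hs : sin (2 * π * (x.2 - x'.2)) ≠ 0) :
    Integrable (fun y => cw y * f y) μΩ := by
  set c := |sin (2 * π * (x.2 - x'.2))| with hc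
  have c0 : 0 < c := abs_pos.2 hs
  refine ((hx.abs.const_mul (8 * cosh (2 * π * x.1))).add (hx'.abs.const_mul (8 * cosh (2 * π * x'.1)))
    |>.const_mul c⁻¹).mono' (cw_continuous.mul hf).aestronglyMeasurable ?_
  have hne : ∀ x : ℝ², ∀ᵐ y ∂μΩ, Dk 0 (x - y) ≠ 0 := fun x => by
    refine ((mp_strip_sub x).quasiMeasurePreserving.ae ae_strip).mono fun y hy => ?_
    rw [Dk_zero_eq]
    have : sinh (π * (x - y).1) ≠ 0 := by
      rw [Ne, sinh_eq_zero]; exact mul_ne_zero pi_ne_zero hy.1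
    positivity
  filter_upwards [hne x, hne x'] with y h1 h2
  have i1 := (inv_le_Dk x y).resolve_right h1
  have i2 := (inv_le_Dk x' y).resolve_right h2
  have p : ∀ x : ℝ², 0 ≤ (Dk 0 x)⁻¹ := fun x => inv_nonneg.2 (by rw [Dk_zero_eq]; positivity)
  have hk : ∀ x : ℝ², |kk 0 x| = |sin (2 * π * x.2)| * (Dk 0 x)⁻¹ := fun x => by
    rw [kk, div_eq_mul_inv, abs_mul, abs_of_nonneg (p x)]
  have hsin : c ≤ |sin (2 * π * (x - y).2)| + |sin (2 * π * (x' - y).2)| := by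
    rw [hc, show 2 * π * (x.2 - x'.2) = 2 * π * (x - y).2 - 2 * π * (x' - y).2 by simp; ring, sin_sub]
    refine (abs_sub _ _).trans ?_
    rw [abs_mul, abs_mul]
    nlinarith [abs_nonneg (sin (2 * π * (x - y).2)), abs_nonneg (sin (2 * π * (x' - y).2)),
      abs_cos_le_one (2 * π * (x - y).2), abs_cos_le_one (2 * π * (x' - y).2)]
  simp only [Pi.add_apply, abs_mul, hk, norm_eq_abs, abs_of_pos (cw_pos y)]
  rw [← div_eq_inv_mul, le_div_iff₀ c0]
  have a1 := mul_le_mul_of_nonneg_left i1 (abs_nonneg (sin (2 * π * (x - y).2)))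
  have a2 := mul_le_mul_of_nonneg_left i2 (abs_nonneg (sin (2 * π * (x' - y).2)))
  calc cw y * |f y| * c = c * cw y * |f y| := by ring
    _ ≤ (|sin (2 * π * (x - y).2)| + |sin (2 * π * (x' - y).2)|) * cw y * |f y| := by
        have := (cw_pos y).le
        gcongr
    _ ≤ (|sin (2 * π * (x - y).2)| * (8 * cosh (2 * π * x.1) * (Dk 0 (x - y))⁻¹)
        + |sin (2 * π * (x' - y).2)| * (8 * cosh (2 * π * x'.1) * (Dk 0 (x' - y))⁻¹)) * |f y| := by
        refine mul_le_mul_of_nonneg_right ?_ (abs_nonneg _)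
        linarith
    _ = _ := by ring

theorem conv_approx (hf : ContDiff ℝ ∞ f) (hp : Per f) (hi : Integrable (fun y => cw y * f y) μΩ) (R : ℝ) :
    ∃ g : ℕ → ℝ² → ℝ, (∀ n, Sm (g n) ∧ Per (g n)) ∧ ∃ ε : ℕ → ℝ, Tendsto ε atTop (𝓝 0) ∧
      ∀ n (x x' : ℝ²), |x.1| ≤ R → |x'.1| ≤ R →
        |((∫ y, pd2 Kker (x - y) * f y ∂μΩ) - BB (g n) x) - ((∫ y, pd2 Kker (x' - y) * f y ∂μΩ) - BB (g n) x')|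
          ≤ ε n * ‖x - x'‖ := by
  let χ : ℕ → ContDiffBump (0:ℝ) := fun n => ⟨|R| + 1 + n, |R| + 2 + n, by positivity, by linarith⟩
  have χ0 : ∀ (n : ℕ) (y : ℝ²), |R| + 2 + n ≤ |y.1| → χ n y.1 = 0 := fun n y hy =>
    (χ n).zero_of_le_dist (by simpa [χ, Real.dist_eq] using hy)
  have χ1 : ∀ (n : ℕ) (y : ℝ²), |y.1| ≤ |R| + 1 + n → χ n y.1 = 1 := fun n y hy =>
    (χ n).one_of_mem_closedBall (by simpa [χ] using hy)
  have hc : ∀ n (y : ℝ²), 0 ≤ 1 - χ n y.1 ∧ 1 - χ n y.1 ≤ 1 := fun n y =>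
    ⟨by linarith [(χ n).le_one (x := y.1)], by linarith [(χ n).nonneg (x := y.1)]⟩
  have sm : ∀ n, ContDiff ℝ ∞ fun y : ℝ² => χ n y.1 := fun n => (χ n).contDiff.comp contDiff_fst
  have hg : ∀ n, Sm (fun y : ℝ² => χ n y.1 * f y) ∧ Per (fun y : ℝ² => χ n y.1 * f y) := fun n => by
    have P : Per (fun y : ℝ² => χ n y.1 * f y) := fun y => congrArg (χ n y.1 * ·) (hp y)
    exact ⟨sm_of_support ((sm n).mul hf) P (n := |R| + 2 + n) fun y hy => by rw [χ0 n y hy.le, zero_mul], P⟩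
  have hE : ∀ n, Integrable (fun y : ℝ² => (1 - χ n y.1) * (cw y * f y)) μΩ := fun n =>
    hi.bdd_mul (c := 1) (continuous_const.sub (sm n).continuous).aestronglyMeasurable
      (.of_forall fun y => by rw [norm_eq_abs, abs_of_nonneg (hc n y).1]; exact (hc n y).2)
  have far : ∀ n (x y : ℝ²), |x.1| ≤ R → 1 - χ n y.1 = 0 ∨ 1 ≤ |(x - y).1| := fun n x y hx => by
    by_cases h : |y.1| ≤ |R| + 1 + n
    · exact .inl (by rw [χ1 n y h, sub_self])
    · refine .inr ?_
      have h2 := abs_sub_abs_le_abs_sub y.1 x.1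
      rw [abs_sub_comm] at h2
      have : (0:ℝ) ≤ n := n.cast_nonneg
      have := le_abs_self R
      rw [Prod.fst_sub]
      linarith [not_le.1 h]
  set K := 2 * cosh (2 * π * R) with hK
  have K0 : 0 < K := by positivity
  have cwK : ∀ x y : ℝ², |x.1| ≤ R → cw (x - y) ≤ K * cw y := fun x y hx => by
    refine (cw_sub_le x y).trans (mul_le_mul_of_nonneg_right ?_ (cw_pos y).le)
    refine mul_le_mul_of_nonneg_left (cosh_le_cosh.2 ?_) zero_le_two
    rw [abs_mul, abs_mul (2 * π) R]
    exact mul_le_mul_of_nonneg_left (hx.trans (le_abs_self _)) (abs_nonneg _)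
  have iE : ∀ n (x : ℝ²), |x.1| ≤ R → Integrable (fun y => kk 0 (x - y) * ((1 - χ n y.1) * f y)) μΩ := by
    intro n x hx
    refine ((hE n).abs.const_mul K).mono' (((kk_measurable 0).comp (measurable_const.sub measurable_id)).mul
      ((continuous_const.sub (sm n).continuous).mul hf.continuous).measurable).aestronglyMeasurable
      (.of_forall fun y => ?_)
    rw [norm_eq_abs, abs_mul, abs_mul, abs_mul, abs_mul, abs_of_pos (cw_pos y)]
    rcases far n x y hx with h | h
    · simp [h]
    · have k : |kk 0 (x - y)| ≤ K * cw y := by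
        refine le_trans ?_ (cwK x y hx)
        have := cosh_le_Dk h
        rw [kk, abs_div, abs_of_pos ((cosh_pos _).trans_le this), cw, div_eq_mul_inv]
        exact (mul_le_mul (abs_sin_le_one _) (inv_anti₀ (cosh_pos _) this) (inv_nonneg.2
          ((cosh_pos _).le.trans this)) zero_le_one).trans_eq (one_mul _)
      calc _ ≤ K * cw y * (|1 - χ n y.1| * |f y|) := by gcongr
        _ = _ := by ring
  have eE : ∀ n (x : ℝ²), |x.1| ≤ R → (∫ y, pd2 Kker (x - y) * f y ∂μΩ) - BB (fun y => χ n y.1 * f y) x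
      = ∫ y, kk 0 (x - y) * ((1 - χ n y.1) * f y) ∂μΩ := by
    intro n x hx
    obtain ⟨C, -, hC⟩ := (hg n).1.bc
    have i1 : Integrable (fun y => kk 0 (x - y) * (χ n y.1 * f y)) μΩ :=
      (integrable_strip_sub (kk_per 0) (kk_integrable le_rfl) x).mul_bdd (c := C)
        (hg n).1.continuous.aestronglyMeasurable (.of_forall hC.bd)
    rw [← conv_eq_BB (hg n).2 (hg n).1.continuous.measurable]
    simp only [pd2_Kker]
    rw [sub_eq_iff_eq_add, ← integral_add (iE n x hx) i1]
    congr 1; ext y; ring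
  refine ⟨fun n y => χ n y.1 * f y, hg, fun n => 48 * π * K * ∫ y, |(1 - χ n y.1) * (cw y * f y)| ∂μΩ, ?_, ?_⟩
  · have := (tendsto_integral_of_dominated_convergence (f := fun _ => (0:ℝ)) (fun y => |cw y * f y|)
      (fun n => (hE n).abs.1) hi.abs (fun n => .of_forall fun y => ?_)
      (.of_forall fun y => ?_)).const_mul (48 * π * K)
    · simpa only [integral_zero, mul_zero] using this
    · rw [norm_eq_abs, abs_abs, abs_mul, abs_of_nonneg (hc n y).1]
      exact mul_le_of_le_one_left (abs_nonneg _) (hc n y).2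
    · refine tendsto_const_nhds.congr' ?_
      filter_upwards [eventually_ge_atTop ⌈|y.1|⌉₊] with n hn
      rw [χ1 n y (by linarith [Nat.ceil_le.1 hn, abs_nonneg R]), sub_self, zero_mul, abs_zero]
  · intro n x x' hx hx'
    rw [eE n x hx, eE n x' hx', ← integral_sub (iE n x hx) (iE n x' hx'), ← norm_eq_abs,
      mul_right_comm, ← integral_const_mul]
    refine norm_integral_le_of_norm_le ((hE n).abs.const_mul _) (.of_forall fun y => ?_)
    rw [← sub_mul, norm_eq_abs, abs_mul, abs_mul, abs_mul, abs_mul, abs_of_pos (cw_pos y)]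
    rcases far n x y hx with h | h
    · simp [h]
    rcases far n x' y hx' with h' | h'
    · simp [h']
    have k := kk_sub_le h h'
    rw [sub_sub_sub_cancel_right] at k
    have k2 : |kk 0 (x - y) - kk 0 (x' - y)| ≤ 24 * π * ‖x - x'‖ * (2 * (K * cw y)) := k.trans
      (mul_le_mul_of_nonneg_left (by linarith [cwK x y hx, cwK x' y hx']) (by positivity))
    calc _ ≤ 24 * π * ‖x - x'‖ * (2 * (K * cw y)) * (|1 - χ n y.1| * |f y|) := by gcongr
      _ = _ := by ring

theorem conv_deriv (hf : ContDiff ℝ ∞ f) (hp : Per f) (hi : Integrable (fun y => cw y * f y) μΩ) (R : ℝ) :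
    ∃ g : ℕ → ℝ² → ℝ, (∀ n, Sm (g n) ∧ Per (g n)) ∧ ∃ ε : ℕ → ℝ, Tendsto ε atTop (𝓝 0) ∧
      ∀ (e : ℝ²), ‖e‖ ≤ 1 → ∀ g' : ℕ → ℝ² → ℝ, (∀ n, DD e (BB (g n)) (g' n)) → ∀ x : ℝ², |x.1| ≤ R →
        ∃ l, HasDerivAt (fun s : ℝ => ∫ y, pd2 Kker (x + s • e - y) * f y ∂μΩ) l 0 ∧ ∀ n, |l - g' n x| ≤ ε n := by
  obtain ⟨g, hg, ε, hε, h⟩ := conv_approx hf hp hi (R + 1)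
  refine ⟨g, hg, ε, hε, fun e he g' hg' x hx => exists_hasDerivAt_of_approx (fun n => hg' n x) hε
    fun n s hs => ?_⟩
  have hse : ‖s • e‖ ≤ |s| := by
    rw [norm_smul, norm_eq_abs]; exact mul_le_of_le_one_right (abs_nonneg _) he
  have h1 : |(x + s • e).1| ≤ R + 1 :=
    (abs_add_le _ _).trans (add_le_add hx ((norm_fst_le (s • e)).trans (hse.trans hs)))
  have := h n (x + s • e) x h1 (by linarith)
  rw [add_sub_cancel_left] at this
  have e0 : 0 ≤ ε n := by
    have := (abs_nonneg _).trans (h n (x + (1:ℝ) • (1, 0)) x ?_ (by linarith))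
    · simpa [Prod.norm_def] using this
    · simpa using (abs_add_le _ _).trans (add_le_add hx (abs_one).le)
  simpa using this.trans (mul_le_mul_of_nonneg_left hse e0)

theorem conv_grad (hf : ContDiff ℝ ∞ f) (hp : Per f) (hi : Integrable (fun y => cw y * f y) μΩ) :
    ∃ G1 G2, DD (1, 0) (fun x => ∫ y, pd2 Kker (x - y) * f y ∂μΩ) G1 ∧
      DD (0, 1) (fun x => ∫ y, pd2 Kker (x - y) * f y ∂μΩ) G2 ∧
      (Continuous G1 → A2 G1 = fun _ => 0) ∧ (Continuous G2 → A2 G2 = fun _ => 0) := by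
  have ex : ∀ e : ℝ², ‖e‖ ≤ 1 → (∀ g, Sm g → ∃ g', DD e g g') → ∀ x : ℝ²,
      ∃ l, HasDerivAt (fun s : ℝ => ∫ y, pd2 Kker (x + s • e - y) * f y ∂μΩ) l 0 := by
    intro e he hD x
    obtain ⟨g, hg, ε, -, h⟩ := conv_deriv hf hp hi |x.1|
    choose g' hg' using fun n => hD (BB (g n)) (BB_sm (hg n).1)
    exact (h e he g' hg' x le_rfl).imp fun l hl => hl.1
  choose G1 hG1 using ex (1, 0) (by simp [Prod.norm_def]) fun g hg => ⟨_, hg.DD1⟩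
  choose G2 hG2 using ex (0, 1) (by simp [Prod.norm_def]) fun g hg => ⟨_, hg.DD2⟩
  refine ⟨G1, G2, hG1, hG2, fun hc => funext fun x => ?_, fun hc => funext fun x => ?_⟩
  · obtain ⟨g, hg, ε, hε, h⟩ := conv_deriv hf hp hi |x.1|
    have hn : ∀ n, |A2 G1 x| ≤ ε n := fun n => by
      have s := BB_sm (hg n).1
      have z : A2 (pd1 (BB (g n))) x = 0 := by rw [← pd1_A2 s, pd1_A2_BB (hg n).1 (hg n).2]
      have i1 : Continuous fun w : ℝ => G1 (x + (0, w)) := hc.comp (by fun_prop)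
      have i2 : Continuous fun w : ℝ => pd1 (BB (g n)) (x + (0, w)) := s.pd1.continuous.comp (by fun_prop)
      rw [← sub_zero (A2 G1 x), ← z, A2_eq, A2_eq, ← intervalIntegral.integral_sub
        (i1.intervalIntegrable _ _) (i2.intervalIntegrable _ _)]
      have := intervalIntegral.norm_integral_le_of_norm_le_const (a := 0) (b := 1) (C := ε n)
        (f := fun w => G1 (x + (0, w)) - pd1 (BB (g n)) (x + (0, w))) fun w _ => ?_
      · simpa using this
      obtain ⟨l, hl, hl2⟩ := h (1, 0) (by simp [Prod.norm_def]) (fun n => pd1 (BB (g n)))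
        (fun n => (BB_sm (hg n).1).DD1) (x + (0, w)) (by simp)
      rw [(hG1 _).unique hl]
      exact hl2 n
    exact abs_nonpos_iff.1 (ge_of_tendsto' hε hn)
  · rw [A2_eq, intervalIntegral.integral_eq_sub_of_hasDerivAt
      (f := fun w => ∫ y, pd2 Kker (x + (0, w) - y) * f y ∂μΩ) (fun w _ => ?_)
      ((show Continuous fun w : ℝ => G2 (x + (0, w)) from hc.comp (by fun_prop)).intervalIntegrable _ _), sub_eq_zero]
    · congr 1; ext y
      rw [pd2_Kker, pd2_Kker, ← kk_per 0 (x + (0, 0) - y)]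
      congr 2; ext <;> simp; ring
    · have := HasDerivAt.comp_sub_const w w (f := fun s : ℝ => ∫ y, pd2 Kker (x + (0, w) + s • (0, 1) - y) * f y ∂μΩ)
        (by simpa using hG2 (x + (0, w)))
      refine this.congr_of_eventuallyEq (.of_forall fun s => ?_)
      simp [add_assoc]

theorem pd_congr {x : ℝ²} (h : f =ᶠ[𝓝 x] g) : pd1 f x = pd1 g x ∧ pd2 f x = pd2 g x := by
  have h1 := ((show Continuous fun y : ℝ => (y, x.2) by fun_prop).tendsto x.1).eventually h
  have h2 := ((show Continuous fun y : ℝ => (x.1, y) by fun_prop).tendsto x.2).eventually h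
  exact ⟨EventuallyEq.deriv_eq h1, EventuallyEq.deriv_eq h2⟩

/-- Whether or not the integral defining the pressure converges, the non-local part of the pressure
gradient is curl-free and has vanishing averages in the periodic direction. -/
theorem pressure_grad (hf : ContDiff ℝ ∞ f) (hp : Per f) {w w1 w2 p J1 J2 : ℝ² → ℝ}
    (hw1 : DD (1, 0) w w1) (hw2 : DD (0, 1) w w2) (hJ1 : ContDiff ℝ 1 J1) (hJ2 : ContDiff ℝ 1 J2)
    (ep : p = fun x => -w x - 2 * ∫ y, pd2 Kker (x - y) * f y ∂μΩ)
    (e1 : ∀ x, pd1 p x = -w1 x - 2 * J1 x) (e2 : ∀ x, pd2 p x = -w2 x - 2 * J2 x) :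
    (∀ x, fderiv ℝ J1 x (0, 1) = fderiv ℝ J2 x (1, 0)) ∧ A2 J1 = (fun _ => 0) ∧ A2 J2 = fun _ => 0 := by
  by_cases hg : ∃ x x' : ℝ², Integrable (fun y => kk 0 (x - y) * f y) μΩ ∧
      Integrable (fun y => kk 0 (x' - y) * f y) μΩ ∧ sin (2 * π * (x.2 - x'.2)) ≠ 0
  · obtain ⟨x, x', h, h', hs⟩ := hg
    obtain ⟨G1, G2, d1, d2, a1, a2⟩ := conv_grad hf hp (cw_mul_integrable hf.continuous h h' hs)
    have E1 : G1 = J1 := funext fun x => by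
      have := e1 x
      rw [ep, (hw1.neg.sub (d1.const_mul 2)).pd1_eq] at this
      linarith
    have E2 : G2 = J2 := funext fun x => by
      have := e2 x
      rw [ep, (hw2.neg.sub (d2.const_mul 2)).pd2_eq] at this
      linarith
    subst E1 E2
    refine ⟨fun x => ?_, a1 hJ1.continuous, a2 hJ2.continuous⟩
    have hF := d1.hasFDerivAt d2 hJ1.continuous hJ2.continuous
    have h1 := (hJ1.differentiable one_ne_zero x).hasFDerivAt
    have h2 := (hJ2.differentiable one_ne_zero x).hasFDerivAt
    have H : HasFDerivAt (fun x => (ContinuousLinearMap.toSpanSingleton ℝ (G1 x)).coprod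
        (ContinuousLinearMap.toSpanSingleton ℝ (G2 x)))
      ((fderiv ℝ G1 x).smulRight (ContinuousLinearMap.fst ℝ ℝ ℝ)
        + (fderiv ℝ G2 x).smulRight (ContinuousLinearMap.snd ℝ ℝ ℝ)) x := by
      refine ((h1.smul_const (ContinuousLinearMap.fst ℝ ℝ ℝ)).add
        (h2.smul_const (ContinuousLinearMap.snd ℝ ℝ ℝ))).congr_of_eventuallyEq (.of_forall fun y => ?_)
      ext <;> simp
    simpa using second_derivative_symmetric hF H (0, 1) (1, 0)
  · push Not at hg
    obtain ⟨a, ha⟩ : ∃ a : ℝ, ∀ x : ℝ², sin (2 * π * (x.2 - a)) ≠ 0 →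
        ∫ y, pd2 Kker (x - y) * f y ∂μΩ = 0 := by
      simp only [pd2_Kker]
      by_cases h : ∃ x' : ℝ², Integrable (fun y => kk 0 (x' - y) * f y) μΩ
      · obtain ⟨x', h⟩ := h
        exact ⟨x'.2, fun x hx => integral_undef fun hI => hx (hg x x' hI h)⟩
      · exact ⟨0, fun x _ => integral_undef fun hI => h ⟨x, hI⟩⟩
    have loc : ∀ x : ℝ², sin (2 * π * (x.2 - a)) ≠ 0 → J1 x = 0 ∧ J2 x = 0 := by
      intro x hx
      have ev : p =ᶠ[𝓝 x] fun x => -w x := by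
        filter_upwards [(isOpen_ne_fun (f := fun x : ℝ² => sin (2 * π * (x.2 - a))) (g := fun _ => 0)
          (by fun_prop) continuous_const).mem_nhds hx] with y hy
        rw [ep]; simp only [ha y hy]; ring
      have h1 := e1 x
      have h2 := e2 x
      rw [(pd_congr ev).1, hw1.neg.pd1_eq] at h1
      rw [(pd_congr ev).2, hw2.neg.pd2_eq] at h2
      constructor <;> linarith
    have zero : ∀ J : ℝ² → ℝ, Continuous J → (∀ x : ℝ², sin (2 * π * (x.2 - a)) ≠ 0 → J x = 0) →
        J = fun _ => 0 := by
      intro J hJ h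
      funext x
      by_contra hx
      have ev : ∀ᶠ s in 𝓝 x.2, sin (2 * π * (s - a)) = 0 := by
        have : Tendsto (fun s : ℝ => J (x.1, s)) (𝓝 x.2) (𝓝 (J x)) :=
          (hJ.comp (by fun_prop : Continuous fun s : ℝ => (x.1, s))).tendsto x.2
        filter_upwards [this.eventually_ne hx] with s hs
        by_contra h'
        exact hs (h (x.1, s) h')
      have d1 : HasDerivAt (fun s : ℝ => sin (2 * π * (s - a))) (cos (2 * π * (x.2 - a)) * (2 * π * 1)) x.2 :=
        (((hasDerivAt_id x.2).sub_const a).const_mul (2 * π)).sin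
      have d2 := d1.unique ((hasDerivAt_const x.2 (0:ℝ)).congr_of_eventuallyEq ev)
      have := sin_sq_add_cos_sq (2 * π * (x.2 - a))
      rw [ev.self_of_nhds] at this
      have hc : cos (2 * π * (x.2 - a)) ≠ 0 := fun h => by rw [h] at this; norm_num at this
      exact mul_ne_zero hc (by positivity) d2
    have z1 := zero J1 hJ1.continuous fun x hx => (loc x hx).1
    have z2 := zero J2 hJ2.continuous fun x hx => (loc x hx).2
    have zA : A2 (fun _ => (0:ℝ)) = fun _ => 0 := funext fun x => by rw [A2_eq]; simp
    subst z1 z2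
    exact ⟨fun x => by simp, zA, zA⟩

/-- Directional derivative. -/
def Dd (d : ℝ × ℝ²) (f : ℝ × ℝ² → ℝ) (p : ℝ × ℝ²) : ℝ := fderiv ℝ f p d

/-- Test functions on space-time. -/
def Test (ρ : ℝ × ℝ² → ℝ) : Prop := ContDiff ℝ ∞ ρ ∧ HasCompactSupport ρ

/-- Convolution on space-time. -/
def Cv (ρ g : ℝ × ℝ² → ℝ) (p : ℝ × ℝ²) : ℝ := ∫ w, ρ w * g (p - w)

instance : (volume : Measure (ℝ × ℝ²)).IsAddHaarMeasure :=
  haveI : ((volume : Measure ℝ).prod (volume : Measure ℝ)).IsAddHaarMeasure := inferInstance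
  inferInstanceAs ((volume : Measure ℝ).prod ((volume : Measure ℝ).prod volume)).IsAddHaarMeasure

variable {ρ g h : ℝ × ℝ² → ℝ} {d : ℝ × ℝ²}

theorem Dd_contDiff (d : ℝ × ℝ²) (hg : ContDiff ℝ ∞ g) : ContDiff ℝ ∞ (Dd d g) :=
  (hg.fderiv_right (m := ∞) (by simp)).clm_apply contDiff_const

theorem Test.Dd (h : Test ρ) (d : ℝ × ℝ²) : Test (Dd d ρ) :=
  ⟨Dd_contDiff d h.1, h.2.fderiv_apply ℝ d⟩

theorem Cv_integrable (h : Test ρ) (hg : Continuous g) (p : ℝ × ℝ²) :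
    Integrable fun w => ρ w * g (p - w) :=
  (h.1.continuous.mul (hg.comp (by fun_prop))).integrable_of_hasCompactSupport h.2.mul_right

theorem Cv_add (h : Test ρ) (hg : Continuous g) {g' : ℝ × ℝ² → ℝ} (hg' : Continuous g') (c : ℝ)
    (p : ℝ × ℝ²) : Cv ρ (fun q => g q + c * g' q) p = Cv ρ g p + c * Cv ρ g' p := by
  rw [Cv, Cv, Cv, ← integral_const_mul, ← integral_add (Cv_integrable h hg p)
    ((Cv_integrable h hg' p).const_mul c)]
  exact integral_congr_ae (.of_forall fun w => by simp only []; ring)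

theorem Cv_hasFDerivAt (h : Test ρ) (hg : Continuous g) (p : ℝ × ℝ²) :
    DifferentiableAt ℝ (Cv ρ g) p ∧ ∀ d, fderiv ℝ (Cv ρ g) p d = Cv (Dd d ρ) g p := by
  have h1 := h.2.hasFDerivAt_convolution_left (ContinuousLinearMap.lsmul ℝ ℝ)
    (h.1.of_le (by simp)) (hg.locallyIntegrable (μ := volume)) p
  refine ⟨h1.differentiableAt, fun d => ?_⟩
  change fderiv ℝ (convolution ρ g (ContinuousLinearMap.lsmul ℝ ℝ) volume) p d = _
  rw [h1.fderiv, convolution, ContinuousLinearMap.integral_apply]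
  · rfl
  · exact (h.2.fderiv (𝕜 := ℝ)).convolutionExists_left _ (h.1.continuous_fderiv (by simp))
      hg.locallyIntegrable p

theorem Cv_Dd (h : Test ρ) (hg : ContDiff ℝ ∞ g) (d p : ℝ × ℝ²) :
    Cv (Dd d ρ) g p = Cv ρ (Dd d g) p := by
  have hd : ∀ w, HasFDerivAt (fun w => g (p - w)) (-(fderiv ℝ g (p - w))) w := fun w => by
    have := (hg.differentiable (by simp) (p - w)).hasFDerivAt.comp w ((hasFDerivAt_id w).const_sub p)
    rw [ContinuousLinearMap.comp_neg, ContinuousLinearMap.comp_id] at this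
    exact this
  have h1 := Cv_integrable (h.Dd d) hg.continuous p
  have h2 := Cv_integrable h (Dd_contDiff d hg).continuous p
  have e : ∀ w, fderiv ℝ (fun w => g (p - w)) w d = -Dd d g (p - w) := fun w => by
    rw [(hd w).fderiv]; rfl
  have := integral_mul_fderiv_eq_neg_fderiv_mul_of_integrable (μ := volume) (f := ρ)
    (g := fun w => g (p - w)) (v := d) h1 (by simp only [e, mul_neg]; exact h2.neg)
    (Cv_integrable h hg.continuous p) (fun w _ => h.1.differentiable (by simp) w)
    (fun w _ => (hd w).differentiableAt)
  simp only [e, mul_neg, integral_neg] at this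
  exact (neg_injective this).symm

theorem Dd_Cv (h : Test ρ) (hg : ContDiff ℝ ∞ g) (d : ℝ × ℝ²) :
    Dd d (Cv ρ g) = Cv ρ (Dd d g) :=
  funext fun p => ((Cv_hasFDerivAt h hg.continuous p).2 d).trans (Cv_Dd h hg d p)

theorem Cv_DD (h : Test ρ) (hg : ContDiff ℝ ∞ g) (e : ℝ²) (t : ℝ) :
    DD e (fun x => Cv ρ g (t, x)) (fun x => Cv ρ (Dd (0, e) g) (t, x)) := fun x => by
  have := hasDerivAt_line (Cv_hasFDerivAt h hg.continuous (t, x)).1 (0, e)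
  rw [show fderiv ℝ (Cv ρ g) (t, x) (0, e) = _ from congrFun (Dd_Cv h hg _) _] at this
  simpa using this

theorem Cv_time (h : Test ρ) (hg : ContDiff ℝ ∞ g) (c t : ℝ) (x : ℝ²) :
    HasDerivAt (fun s => Cv ρ g (s + c, x)) (Cv ρ (Dd (1, 0) g) (t + c, x)) t := by
  have := hasDerivAt_line (Cv_hasFDerivAt h hg.continuous (t + c, x)).1 (1, 0)
  rw [show fderiv ℝ (Cv ρ g) (t + c, x) (1, 0) = _ from congrFun (Dd_Cv h hg _) _] at this
  have h2 : HasDerivAt (fun s : ℝ => Cv ρ g ((t + c, x) + s • ((1:ℝ), (0 : ℝ²))))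
      (Cv ρ (Dd (1, 0) g) (t + c, x)) (t - t) := by
    simpa using this
  refine (h2.comp_sub_const t t).congr_of_eventuallyEq (.of_forall fun s => ?_)
  exact congrArg (Cv ρ g) (Prod.ext (by simp; ring) (by simp))

theorem Cv_abs_le (h : Test ρ) (hM : ∀ p, |g p| ≤ M) (p : ℝ × ℝ²) :
    |Cv ρ g p| ≤ (∫ w, |ρ w|) * M := by
  rw [Cv, ← norm_eq_abs, ← integral_mul_const]
  refine norm_integral_le_of_norm_le
    ((h.1.continuous.abs.integrable_of_hasCompactSupport (h.2.abs)).mul_const M)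
    (.of_forall fun w => ?_)
  rw [norm_eq_abs, abs_mul]
  exact mul_le_mul_of_nonneg_left (hM _) (abs_nonneg _)

theorem Cv_continuous (h : Test ρ) (hg : Continuous g) : Continuous (Cv ρ g) :=
  continuous_iff_continuousAt.2 fun p => (Cv_hasFDerivAt h hg p).1.continuousAt

theorem Cv_SB (h : Test ρ) (hg : ContDiff ℝ ∞ g) (hM : ∀ p, |g p| ≤ M) (c : ℝ) (I : Set ℝ) :
    SB I (fun t x => Cv ρ g (t + c, x)) := by
  refine SB.of_closed (P := fun F => ∃ ρ, Test ρ ∧ F = fun t x => Cv ρ g (t + c, x)) ?_ ⟨ρ, h, rfl⟩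
    ((Cv_continuous h hg.continuous).comp (by fun_prop)).continuousOn
  rintro _ ⟨ρ, h, rfl⟩
  refine ⟨⟨_, mul_nonneg (integral_nonneg fun w => abs_nonneg _) ((abs_nonneg _).trans (hM 0)),
    fun t _ x => Cv_abs_le h hM _⟩, _, _, ⟨_, h.Dd (0, (1, 0)), rfl⟩, ⟨_, h.Dd (0, (0, 1)), rfl⟩,
    fun t _ => ⟨?_, ?_⟩⟩ <;>
  simp only [Cv_Dd h hg] <;> exact Cv_DD h hg _ _

theorem Cv_A2 (h : Test ρ) (hg : Continuous g)
    (h0 : ∀ w ∈ support ρ, A2 (fun x => g (t - w.1, x)) = fun _ => 0) :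
    A2 (fun x => Cv ρ g (t, x)) = fun _ => 0 := by
  funext x
  rw [A2_eq]
  have hc : Continuous fun q : ℝ × (ℝ × ℝ²) => ρ q.2 * g ((t, x + (0, q.1)) - q.2) :=
    (h.1.continuous.comp continuous_snd).mul (hg.comp (by fun_prop))
  simp only [Cv]
  rw [intervalIntegral_integral_swap]
  · refine (integral_congr_ae (.of_forall fun w => ?_)).trans (integral_zero _ _)
    simp only [intervalIntegral.integral_const_mul, mul_eq_zero]
    by_cases hw : ρ w = 0
    · exact .inl hw
    · right
      have := congrFun (h0 w hw) (x - w.2)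
      rw [A2_eq] at this
      refine Eq.trans ?_ this
      refine intervalIntegral.integral_congr fun s _ => congrArg g ?_
      ext <;> simp; ring
  · rw [← Measure.restrict_univ (μ := (volume : Measure (ℝ × ℝ²))), Measure.prod_restrict]
    change IntegrableOn (fun q : ℝ × (ℝ × ℝ²) => ρ q.2 * g ((t, x + (0, q.1)) - q.2)) _ _
    refine IntegrableOn.of_forall_sdiff_eq_zero (s := uIcc 0 1 ×ˢ tsupport ρ) ?_ ?_ ?_
    · exact hc.continuousOn.integrableOn_compact (isCompact_uIcc.prod h.2)
    · exact measurableSet_uIoc.prod .univ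
    · rintro ⟨s, w⟩ ⟨hs, hn⟩
      have : w ∉ tsupport ρ := fun hw => hn ⟨uIoc_subset_uIcc hs.1, hw⟩
      simp [image_eq_zero_of_notMem_tsupport this]

theorem grad_BB_unique {Z1 Z2 c : ℝ² → ℝ} (h1 : Sm Z1) (h2 : Sm Z2) (hc : Sm c) (pc : Per c)
    (hr : pd2 Z1 = pd1 Z2) (hd : ∀ x, pd1 Z1 x + pd2 Z2 x = 2 * pd2 c x)
    (a1 : A2 Z1 = fun _ => 0) (a2 : A2 Z2 = fun _ => 0) :
    ∀ x, Z1 x = 2 * pd1 (BB c) x ∧ Z2 x = 2 * pd2 (BB c) x := by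
  have hN := BB_sm hc
  have s1 := h1.sub (hN.pd1.const_mul 2)
  have s2 := h2.sub (hN.pd2.const_mul 2)
  have hl : ∀ x, pd1 (pd1 (BB c)) x + pd2 (pd2 (BB c)) x = pd2 c x := congrFun (lap_BB hc pc)
  have d11 : pd1 (fun x => Z1 x - 2 * pd1 (BB c) x) = fun x => pd1 Z1 x - 2 * pd1 (pd1 (BB c)) x := by
    rw [pd1_sub h1 (hN.pd1.const_mul 2), pd1_const_mul 2 hN.pd1]
  have d12 : pd2 (fun x => Z1 x - 2 * pd1 (BB c) x) = fun x => pd2 Z1 x - 2 * pd2 (pd1 (BB c)) x := by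
    rw [pd2_sub h1 (hN.pd1.const_mul 2), pd2_const_mul 2 hN.pd1]
  have d21 : pd1 (fun x => Z2 x - 2 * pd2 (BB c) x) = fun x => pd1 Z2 x - 2 * pd1 (pd2 (BB c)) x := by
    rw [pd1_sub h2 (hN.pd2.const_mul 2), pd1_const_mul 2 hN.pd2]
  have d22 : pd2 (fun x => Z2 x - 2 * pd2 (BB c) x) = fun x => pd2 Z2 x - 2 * pd2 (pd2 (BB c)) x := by
    rw [pd2_sub h2 (hN.pd2.const_mul 2), pd2_const_mul 2 hN.pd2]
  have hcurl : pd2 (fun x => Z1 x - 2 * pd1 (BB c) x) = pd1 fun x => Z2 x - 2 * pd2 (BB c) x := by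
    rw [d12, d21, hr, pd_comm hN]
  have hdiv : (fun x => pd1 (fun x => Z1 x - 2 * pd1 (BB c) x) x) =
      fun x => (-1) * pd2 (fun x => Z2 x - 2 * pd2 (BB c) x) x := funext fun x => by
    rw [d11, d22]; linarith [hd x, hl x]
  have l1 : lap (fun x => Z1 x - 2 * pd1 (BB c) x) = fun _ => 0 := funext fun x => by
    have : pd1 (pd1 fun x => Z1 x - 2 * pd1 (BB c) x) x = _ :=
      congrFun (congrArg pd1 hdiv) x
    rw [lap, this, pd1_const_mul (-1) s2.pd2, hcurl, pd_comm s2]; ring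
  have l2 : lap (fun x => Z2 x - 2 * pd2 (BB c) x) = fun _ => 0 := funext fun x => by
    have : pd2 (pd1 fun x => Z1 x - 2 * pd1 (BB c) x) x = _ :=
      congrFun (congrArg pd2 hdiv) x
    rw [pd2_const_mul (-1) s2.pd2] at this
    rw [lap, ← hcurl, pd_comm s1]
    linarith [this]
  have hA : ∀ H : ℝ² → ℝ, Sm H → lap H = (fun _ => 0) → A2 H = (fun _ => 0) → ∀ x, H x = 0 := by
    intro H hs hl ha x
    rw [← congrFun ha x, A2_eq]
    simp [eq_of_lap hs hl _ x]
  intro x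
  refine ⟨sub_eq_zero.1 (hA _ s1 l1 ?_ x), sub_eq_zero.1 (hA _ s2 l2 ?_ x)⟩
  · have e : A2 (fun x => Z1 x - 2 * pd1 (BB c) x) = _ := A2_sub h1 (hN.pd1.const_mul 2)
    rw [e, A2_const_mul, a1, ← pd1_A2 hN, pd1_A2_BB hc pc]; simp
  · have e : A2 (fun x => Z2 x - 2 * pd2 (BB c) x) = _ := A2_sub h2 (hN.pd2.const_mul 2)
    rw [e, A2_const_mul, a2, A2_pd2 hN (BB_per pc)]; simp

local notation "∇ₜ" => Dd (1, 0)
local notation "∇₁" => Dd (0, (1, 0))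
local notation "∇₂" => Dd (0, (0, 1))

section

variable {ρ g g1 g2 : ℝ × ℝ² → ℝ}

/-- Twice the nonlocal pressure gradient, first component. -/
def PG1 (g1 g2 : ℝ × ℝ² → ℝ) (q : ℝ × ℝ²) : ℝ :=
  ∇ₜ g1 q + (-1) * ∇₁ (∇₁ g1) q + (-1) * ∇₂ (∇₂ g1) q
    + 1 * ∇₂ (fun p => g1 p * g2 p) q

/-- Twice the nonlocal pressure gradient, second component. -/
def PG2 (g1 g2 : ℝ × ℝ² → ℝ) (q : ℝ × ℝ²) : ℝ :=
  ∇ₜ g2 q + (-1) * ∇₁ (∇₁ g2) q + (-1) * ∇₂ (∇₂ g2) q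
    + 1 * ∇₁ (fun p => g1 p * g2 p) q
    + (-2) * ∇₂ (fun p => (g1 p * g1 p - g2 p * g2 p) / 2) q

theorem contDiff_qa (h1 : ContDiff ℝ ∞ g1) (h2 : ContDiff ℝ ∞ g2) :
    ContDiff ℝ ∞ fun p => (g1 p * g1 p - g2 p * g2 p) / 2 :=
  ((h1.mul h1).sub (h2.mul h2)).div_const 2

theorem abs_qa_qb_le (b1 : ∀ p, |g1 p| ≤ M) (b2 : ∀ p, |g2 p| ≤ M) :
    (∀ p, |(g1 p * g1 p - g2 p * g2 p) / 2| ≤ M * M) ∧ ∀ p, |g1 p * g2 p| ≤ M * M := by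
  refine ⟨fun p => ?_, fun p => ?_⟩ <;> have := abs_le.1 (b1 p) <;> have := abs_le.1 (b2 p) <;>
    rw [abs_le] <;> constructor <;> nlinarith

theorem PG_contDiff (h1 : ContDiff ℝ ∞ g1) (h2 : ContDiff ℝ ∞ g2) :
    ContDiff ℝ ∞ (PG1 g1 g2) ∧ ContDiff ℝ ∞ (PG2 g1 g2) := by
  have hA := contDiff_qa h1 h2
  have l : ∀ {g}, ContDiff ℝ ∞ g → ∀ d : ℝ × ℝ², ContDiff ℝ ∞ fun q => (-1) * Dd d (Dd d g) q :=
    fun h d => contDiff_const.mul (Dd_contDiff d (Dd_contDiff d h))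
  have b : ∀ d : ℝ × ℝ², ContDiff ℝ ∞ fun q => 1 * Dd d (fun p => g1 p * g2 p) q :=
    fun d => contDiff_const.mul (Dd_contDiff d (h1.mul h2))
  exact ⟨(((Dd_contDiff _ h1).add (l h1 _)).add (l h1 _)).add (b _),
    ((((Dd_contDiff _ h2).add (l h2 _)).add (l h2 _)).add (b _)).add
      (contDiff_const.mul (Dd_contDiff _ hA))⟩

theorem mollified_mild (hρ : Test ρ) (h1 : ContDiff ℝ ∞ g1) (h2 : ContDiff ℝ ∞ g2)
    (b1 : ∀ p, |g1 p| ≤ M) (b2 : ∀ p, |g2 p| ≤ M) (p1 : ∀ t, Per fun x => g1 (t, x))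
    (p2 : ∀ t, Per fun x => g2 (t, x)) {S : Set ℝ}
    (hdiv : ∀ t ∈ S, ∀ x, ∇₁ g1 (t, x) + ∇₂ g2 (t, x) = 0)
    (hcurl : ∀ t ∈ S, ∀ x, ∇₂ (PG1 g1 g2) (t, x) = ∇₁ (PG2 g1 g2) (t, x))
    (hA1 : ∀ t ∈ S, A2 (fun x => PG1 g1 g2 (t, x)) = fun _ => 0)
    (hA2 : ∀ t ∈ S, A2 (fun x => PG2 g1 g2 (t, x)) = fun _ => 0)
    (hI : IsOpen I) {c : ℝ} (hS : ∀ t ∈ I, ∀ w ∈ support ρ, t + c - w.1 ∈ S)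
    {α β : ℝ → ℝ² → ℝ} (ev1 : v1 = fun t x => Cv ρ g1 (t + c, x))
    (ev2 : v2 = fun t x => Cv ρ g2 (t + c, x))
    (eα : α = fun t x => Cv ρ (fun p => (g1 p * g1 p - g2 p * g2 p) / 2) (t + c, x))
    (eβ : β = fun t x => Cv ρ (fun p => g1 p * g2 p) (t + c, x)) (ht : 0 ≤ t) (htI : Icc 0 t ⊆ I)
    (x : ℝ²) : v1 t x = HS t (v1 0) x - DW 0 1 α β t x ∧ v2 t x = HS t (v2 0) x + DW 1 0 α β t x := by
  have hA := contDiff_qa h1 h2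
  have hB := h1.mul h2
  obtain ⟨bA, bB⟩ := abs_qa_qb_le b1 b2
  have per : ∀ {g : ℝ × ℝ² → ℝ}, (∀ t, Per fun x => g (t, x)) → ∀ t, Per fun x => Cv ρ g (t, x) := by
    intro g hg t x
    refine integral_congr_ae (.of_forall fun w => congrArg (ρ w * ·) ?_)
    refine Eq.trans (congrArg g ?_) (hg (t - w.1) (x - w.2))
    ext <;> simp; ring
  have s1 : SB I v1 := ev1 ▸ Cv_SB hρ h1 b1 c I
  have s2 : SB I v2 := ev2 ▸ Cv_SB hρ h2 b2 c I
  have sα : SB I α := eα ▸ Cv_SB hρ hA bA c I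
  have sβ : SB I β := eβ ▸ Cv_SB hρ hB bB c I
  have sw : ∀ {g}, ContDiff ℝ ∞ g → (∀ p, |g p| ≤ M) →
      SB I fun t x => Cv ρ (∇ₜ g) (t + c, x) := fun h b => by
    simpa only [Cv_Dd hρ h] using Cv_SB (hρ.Dd (1, 0)) h b c I
  have w1 := sw h1 b1
  have w2 := sw h2 b2
  have td1 : ∀ t ∈ I, ∀ x, HasDerivAt (fun s => v1 s x) (Cv ρ (∇ₜ g1) (t + c, x)) t :=
    fun t _ x => ev1 ▸ Cv_time hρ h1 c t x
  have td2 : ∀ t ∈ I, ∀ x, HasDerivAt (fun s => v2 s x) (Cv ρ (∇ₜ g2) (t + c, x)) t :=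
    fun t _ x => ev2 ▸ Cv_time hρ h2 c t x
  have P1 : ∀ {g}, ContDiff ℝ ∞ g → ∀ t, pd1 (fun x => Cv ρ g (t, x)) = fun x => Cv ρ (∇₁ g) (t, x) :=
    fun h t => (Cv_DD hρ h _ t).pd1_eq
  have P2 : ∀ {g}, ContDiff ℝ ∞ g → ∀ t, pd2 (fun x => Cv ρ g (t, x)) = fun x => Cv ρ (∇₂ g) (t, x) :=
    fun h t => (Cv_DD hρ h _ t).pd2_eq
  have cong : ∀ {f g : ℝ × ℝ² → ℝ}, (∀ t ∈ S, ∀ x, f (t, x) = g (t, x)) → ∀ t ∈ I, ∀ x,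
      Cv ρ f (t + c, x) = Cv ρ g (t + c, x) := fun {f g} h t ht x => by
    refine integral_congr_ae (.of_forall fun w => ?_)
    by_cases hw : ρ w = 0
    · simp [hw]
    · exact congrArg (ρ w * ·) (h _ (hS t ht w hw) (x - w.2))
  have dv : ∀ t ∈ I, ∀ x, pd1 (v1 t) x + pd2 (v2 t) x = 0 := fun t ht x => by
    rw [ev1, ev2, P1 h1, P2 h2]
    have := cong (f := fun p => ∇₁ g1 p + 1 * ∇₂ g2 p) (g := fun _ => 0)
      (fun t ht x => by simpa using hdiv t ht x) t ht x
    rw [Cv_add hρ (Dd_contDiff _ h1).continuous (Dd_contDiff _ h2).continuous] at this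
    simpa [Cv] using this
  have dw : ∀ t ∈ I, ∀ x, pd1 (fun x => Cv ρ (∇ₜ g1) (t + c, x)) x
      + pd2 (fun x => Cv ρ (∇ₜ g2) (t + c, x)) x = 0 := fun t ht x => by
    refine (((s1.time_deriv_swap hI w1 td1 (fun _ h => s1.dd1 h) (fun _ h => w1.dd1 h) t ht x).fun_add
      (s2.time_deriv_swap hI w2 td2 (fun _ h => s2.dd2 h) (fun _ h => w2.dd2 h) t ht x)).unique
      ((hasDerivAt_const t (0:ℝ)).congr_of_eventuallyEq ?_))
    filter_upwards [hI.mem_nhds ht] with s hs using dv s hs x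
  obtain ⟨k1, k2⟩ := PG_contDiff h1 h2
  have z1 : ∀ t, (fun x => Cv ρ (PG1 g1 g2) (t + c, x)) = fun x => Cv ρ (∇ₜ g1) (t + c, x)
      - lap (v1 t) x + pd2 (β t) x := fun t => funext fun x => by
    have l : ∀ d : ℝ × ℝ², Continuous (Dd d (Dd d g1)) := fun d =>
      (Dd_contDiff d (Dd_contDiff d h1)).continuous
    have c0 := (Dd_contDiff (1, 0) h1).continuous
    rw [ev1, eβ, lap, P1 h1, P1 (Dd_contDiff _ h1), P2 h1, P2 (Dd_contDiff _ h1), P2 hB]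
    rw [show Cv ρ (PG1 g1 g2) (t + c, x) = _ from Cv_add hρ ((c0.fun_add ((l _).const_mul _)).fun_add
      ((l _).const_mul _)) (Dd_contDiff _ hB).continuous _ _,
      Cv_add hρ (c0.fun_add ((l _).const_mul _)) (l _), Cv_add hρ c0 (l _)]
    ring
  have z2 : ∀ t, (fun x => Cv ρ (PG2 g1 g2) (t + c, x)) = fun x => Cv ρ (∇ₜ g2) (t + c, x)
      - lap (v2 t) x + (pd1 (β t) x - 2 * pd2 (α t) x) := fun t => funext fun x => by
    have l : ∀ d : ℝ × ℝ², Continuous (Dd d (Dd d g2)) := fun d =>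
      (Dd_contDiff d (Dd_contDiff d h2)).continuous
    have c0 := (Dd_contDiff (1, 0) h2).continuous
    have cB := fun d => (Dd_contDiff d hB).continuous
    rw [ev2, eβ, eα, lap, P1 h2, P1 (Dd_contDiff _ h2), P2 h2, P2 (Dd_contDiff _ h2), P1 hB, P2 hA]
    rw [show Cv ρ (PG2 g1 g2) (t + c, x) = _ from Cv_add hρ (((c0.fun_add ((l _).const_mul _)).fun_add
      ((l _).const_mul _)).fun_add ((cB _).const_mul _)) (Dd_contDiff _ hA).continuous _ _,
      Cv_add hρ ((c0.fun_add ((l _).const_mul _)).fun_add ((l _).const_mul _)) (cB _),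
      Cv_add hρ (c0.fun_add ((l _).const_mul _)) (l _), Cv_add hρ c0 (l _)]
    ring
  have pα : ∀ t, Per (α t) := fun t => eα ▸ per (fun s x =>
    congrArg₂ (fun a b : ℝ => (a * a - b * b) / 2) (p1 s x) (p2 s x)) _
  have pβ : ∀ t, Per (β t) := fun t => eβ ▸ per (fun s x => congrArg₂ (· * ·) (p1 s x) (p2 s x)) _
  have key : ∀ t ∈ I, ∀ x, Cv ρ (PG1 g1 g2) (t + c, x) = 2 * pd1 (BB (cF (α t) (β t))) x ∧
      Cv ρ (PG2 g1 g2) (t + c, x) = 2 * pd2 (BB (cF (α t) (β t))) x := by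
    intro t ht
    have m1 : Sm (v1 t) := s1.slice ht
    have m2 : Sm (v2 t) := s2.slice ht
    have mα : Sm (α t) := sα.slice ht
    have mβ : Sm (β t) := sβ.slice ht
    have n1 : Sm fun x => Cv ρ (∇ₜ g1) (t + c, x) := w1.slice ht
    have n2 : Sm fun x => Cv ρ (∇ₜ g2) (t + c, x) := w2.slice ht
    refine grad_BB_unique ?_ ?_ (cF_sm mα mβ) (cF_per (pα t) (pβ t)) ?_ ?_
      (Cv_A2 hρ k1.continuous fun w hw => hA1 _ (hS t ht w hw))
      (Cv_A2 hρ k2.continuous fun w hw => hA2 _ (hS t ht w hw))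
    · rw [z1]; exact (n1.sub m1.lap).add mβ.pd2
    · rw [z2]; exact (n2.sub m2.lap).add (mβ.pd1.sub (mα.pd2.const_mul 2))
    · rw [P2 k1, P1 k2]; exact funext (cong hcurl t ht)
    · intro x
      have hl : pd1 (lap (v1 t)) x + pd2 (lap (v2 t)) x = 0 := by
        rw [← lap_pd1 m1, ← lap_pd2 m2, show pd1 (v1 t) = fun x => (-1) * pd2 (v2 t) x from
          funext fun x => by linarith [dv t ht x], lap_const_mul _ m2.pd2]; ring
      rw [z1, z2, pd1_add (n1.sub m1.lap) mβ.pd2, pd1_sub n1 m1.lap,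
        pd2_add (n2.sub m2.lap) (mβ.pd1.sub (mα.pd2.const_mul 2)), pd2_sub n2 m2.lap,
        pd2_sub mβ.pd1 (mα.pd2.const_mul 2), pd2_const_mul _ mα.pd2, pd_comm mβ,
        show pd2 (cF (α t) (β t)) = _ from pd2_sub mβ.pd1 mα.pd2]
      linarith [dw t ht x]
  have q1 : SB I fun t => QF1 (α t) (β t) := (TS.QF1 (j := 0) hI sα sβ).sb
  have q2 : SB I fun t => QF2 (α t) (β t) := (TS.QF2 (j := 0) hI sα sβ).sb
  have e1 := heat_duhamel hI s1 q1 (fun t ht x => (td1 t ht x).congr_deriv (by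
    have := congrFun (z1 t) x
    rw [(key t ht x).1] at this
    rw [QF1]; linarith)) ht htI x
  have e2 := heat_duhamel hI s2 q2 (fun t ht x => (td2 t ht x).congr_deriv (by
    have := congrFun (z2 t) x
    rw [(key t ht x).2] at this
    rw [QF2, cF]; linarith)) ht htI x
  have ta : ∀ {g}, ContDiff ℝ ∞ g → (∀ p, |g p| ≤ M * M) →
      TB ((∫ w, |ρ w|) * (M * M)) fun t x => Cv ρ g (t + c, x) := fun h b =>
    ⟨(Cv_continuous hρ h.continuous).comp (by fun_prop), fun t x => Cv_abs_le hρ b _⟩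
  obtain ⟨d1, d2⟩ := DW_eq_integral (eα ▸ ta hA bA) (eβ ▸ ta hB bB) (t := t) (fun q hq => by
    have : t - q ∈ I := htI ⟨by linarith [hq.2], by linarith [hq.1]⟩
    exact ⟨sα.slice this, sβ.slice this, pα _, pβ _⟩) x
  have sw : ∀ Q : ℝ → ℝ² → ℝ, ∫ r in (0:ℝ)..t, HS (t - r) (Q r) x = ∫ q in Ioc 0 t, HS q (Q (t - q)) x := by
    intro Q
    rw [← intervalIntegral.integral_of_le ht]
    simpa using intervalIntegral.integral_comp_sub_left (a := 0) (b := t) (fun q => HS q (Q (t - q)) x) t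
  rw [d1, d2, e1, e2, sw, sw, sub_zero]
  exact ⟨rfl, by ring⟩
end

theorem dist_le_vnorm (v w : ℝ²) : dist v w ≤ vnorm (v - w) := by
  rw [dist_eq_norm, Prod.norm_def]
  exact max_le (abs_fst_le_vnorm _) (abs_snd_le_vnorm _)

theorem IsSolution.modulus {u₀ u} (h : IsSolution u₀ u) (T : ℝ) (hε : 0 < ε) : ∃ δ > 0, ∀ s ∈ Icc 0 T,
    ∀ t, 0 ≤ t → |s - t| < δ → ∀ x y, dist x y < δ → dist (u s x) (u t y) ≤ ε := by
  refine isCompact_Icc.induction_on (p := fun S => ∃ δ > 0, ∀ s ∈ S, ∀ t, 0 ≤ t → |s - t| < δ →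
    ∀ x y, dist x y < δ → dist (u s x) (u t y) ≤ ε) ⟨1, one_pos, by simp⟩
    (fun S S' hS ⟨δ, hδ, H⟩ => ⟨δ, hδ, fun s hs => H s (hS hs)⟩) ?_ fun t₀ ht₀ => ?_
  · rintro S S' ⟨δ, hδ, H⟩ ⟨δ', hδ', H'⟩
    refine ⟨min δ δ', lt_min hδ hδ', ?_⟩
    rintro s (hs | hs) t ht hst x y hxy
    · exact H s hs t ht (hst.trans_le (min_le_left _ _)) x y (hxy.trans_le (min_le_left _ _))
    · exact H' s hs t ht (hst.trans_le (min_le_right _ _)) x y (hxy.trans_le (min_le_right _ _))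
  · obtain ⟨δ1, hδ1, H1⟩ := h.2.2.1 t₀ ht₀.1 (ε / 3) (by positivity)
    obtain ⟨δ2, hδ2, H2⟩ := Metric.uniformContinuous_iff.1 (h.2.1 t₀ ht₀.1).1 (ε / 3) (by positivity)
    refine ⟨Icc 0 T ∩ Metric.ball t₀ (δ1 / 2), inter_mem self_mem_nhdsWithin
      (mem_nhdsWithin_of_mem_nhds (Metric.ball_mem_nhds _ (by positivity))), min (δ1 / 2) δ2,
      lt_min (by positivity) hδ2, fun s hs t ht hst x y hxy => ?_⟩
    have d := hs.2
    rw [Metric.mem_ball, Real.dist_eq] at d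
    have e := hst.trans_le (min_le_left _ _)
    have c1 := (dist_le_vnorm _ _).trans (H1 s hs.1.1 (by linarith) x)
    have c2 := (dist_le_vnorm _ _).trans (H1 t ht
      (by rw [abs_lt] at *; constructor <;> linarith) y)
    have c₃ := H2 (hxy.trans_le (min_le_right _ _))
    have c₄ := dist_triangle4_right (u s x) (u t y) (u t₀ x) (u t₀ y)
    linarith

theorem IsSolution.bounded {u₀ u} (h : IsSolution u₀ u) (T : ℝ) : ∃ M, 0 ≤ M ∧ ∀ s ∈ Icc 0 T, ∀ x, ‖u s x‖ ≤ M := by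
  refine isCompact_Icc.induction_on (p := fun S => ∃ M, 0 ≤ M ∧ ∀ s ∈ S, ∀ x, ‖u s x‖ ≤ M) ⟨0, le_rfl, by simp⟩
    (fun S S' hS ⟨M, h0, H⟩ => ⟨M, h0, fun s hs => H s (hS hs)⟩) ?_ fun t₀ ht₀ => ?_
  · rintro S S' ⟨M, h0, H⟩ ⟨M', h0', H'⟩
    refine ⟨max M M', le_max_of_le_left h0, ?_⟩
    rintro s (hs | hs) x
    · exact (H s hs x).trans (le_max_left _ _)
    · exact (H' s hs x).trans (le_max_right _ _)
  · obtain ⟨δ, hδ, H⟩ := h.2.2.1 t₀ ht₀.1 1 one_pos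
    obtain ⟨B, hB⟩ := (h.2.1 t₀ ht₀.1).2.1
    refine ⟨Icc 0 T ∩ Metric.ball t₀ δ, inter_mem self_mem_nhdsWithin
      (mem_nhdsWithin_of_mem_nhds (Metric.ball_mem_nhds _ hδ)), max B 0 + 1, by positivity, fun s hs x => ?_⟩
    have d := hs.2
    rw [Metric.mem_ball, Real.dist_eq] at d
    have c1 := (dist_le_vnorm _ _).trans (H s hs.1.1 d x)
    have c2 := (dist_le_vnorm (u t₀ x) 0).trans ((sub_zero (u t₀ x)).symm ▸ hB x)
    rw [dist_zero_right] at c2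
    have c₃ := norm_le_norm_add_norm_sub' (u s x) (u t₀ x)
    rw [← dist_eq_norm] at c₃
    linarith [le_max_left B 0]

/-- A smooth time change that is the identity on `[a, b]` and takes values in a slightly larger interval. -/
theorem exists_time_change (ha : 0 < a) (hab : a < b) : ∃ φ : ℝ → ℝ, ContDiff ℝ ∞ φ ∧
    (∀ t ∈ Icc a b, φ t = t) ∧ ∀ t, φ t ∈ Icc (a / 2) (b + a / 2) := by
  let χ : ContDiffBump ((a + b) / 2) := ⟨(b - a) / 2, (b - a) / 2 + a / 2, by linarith, by linarith⟩
  refine ⟨fun t => (a + b) / 2 + χ t * (t - (a + b) / 2),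
    contDiff_const.add (χ.contDiff.mul (contDiff_id.sub contDiff_const)), fun t ht => ?_, fun t => ?_⟩
  · have : χ t = 1 := χ.one_of_mem_closedBall (by
      rw [Metric.mem_closedBall, Real.dist_eq, abs_le]; change _ ≤ _ ∧ _ ≤ (b - a) / 2
      constructor <;> [change -((b - a) / 2) ≤ _; skip] <;> linarith [ht.1, ht.2])
    simp [this]
  · have k : |χ t * (t - (a + b) / 2)| ≤ (b - a) / 2 + a / 2 := by
      rw [abs_mul, abs_of_nonneg (χ.nonneg' t)]
      rcases le_or_gt ((b - a) / 2 + a / 2) (dist t ((a + b) / 2)) with H | H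
      · rw [χ.zero_of_le_dist H, zero_mul]; linarith
      · rw [Real.dist_eq] at H
        nlinarith [χ.le_one (x := t), χ.nonneg' t, abs_nonneg (t - (a + b) / 2)]
    rw [abs_le] at k
    constructor <;> dsimp only <;> linarith

theorem slice_DD {g : ℝ × ℝ² → ℝ} (hg : ContDiff ℝ ∞ g) (t : ℝ) (e : ℝ²) :
    DD e (fun x => g (t, x)) fun x => Dd (0, e) g (t, x) := fun x => by
  simpa [Dd] using hasDerivAt_line (hg.differentiable (by simp) (t, x)) (0, e)

theorem IsSolution.slice {u₀ u} (h : IsSolution u₀ u) {g1 g2 : ℝ × ℝ² → ℝ}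
    (h1 : ContDiff ℝ ∞ g1) (h2 : ContDiff ℝ ∞ g2) (ha : 0 < a)
    (e : ∀ t ∈ Ioo a b, ∀ x, u t x = (g1 (t, x), g2 (t, x))) (ht : t ∈ Ioo a b) :
    (∀ x, ∇₁ g1 (t, x) + ∇₂ g2 (t, x) = 0) ∧
    (∀ x, ∇₂ (PG1 g1 g2) (t, x) = ∇₁ (PG2 g1 g2) (t, x)) ∧
    (A2 (fun x => PG1 g1 g2 (t, x)) = fun _ => 0) ∧ A2 (fun x => PG2 g1 g2 (t, x)) = fun _ => 0 := by
  have t0 := ha.trans ht.1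
  have eu : u t = fun x => (g1 (t, x), g2 (t, x)) := funext (e t ht)
  have P1 : ∀ {g}, ContDiff ℝ ∞ g → pd1 (fun x => g (t, x)) = fun x => ∇₁ g (t, x) :=
    fun h => (slice_DD h t _).pd1_eq
  have P2 : ∀ {g}, ContDiff ℝ ∞ g → pd2 (fun x => g (t, x)) = fun x => ∇₂ g (t, x) :=
    fun h => (slice_DD h t _).pd2_eq
  have td : ∀ {g : ℝ × ℝ² → ℝ}, ContDiff ℝ ∞ g → ∀ x, deriv (fun s => g (s, x)) t = ∇ₜ g (t, x) :=
    fun {g} h x => by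
      have : HasDerivAt (fun s => g (s, x)) (fderiv ℝ g (t, x) (1, 0)) t :=
        HasFDerivAt.comp_hasDerivAt (f := fun s : ℝ => (s, x)) t
          (h.differentiable (by simp) (t, x)).hasFDerivAt ((hasDerivAt_id t).prodMk (hasDerivAt_const t x))
      exact this.deriv
  have ev : ∀ x, (fun s => u s x) =ᶠ[𝓝 t] fun s => (g1 (s, x), g2 (s, x)) := fun x => by
    filter_upwards [isOpen_Ioo.mem_nhds ht] with s hs using e s hs x
  obtain ⟨-, hb, -, -, hd, hm1, hm2⟩ := h
  replace hd := hd t t0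
  replace hm1 := hm1 t t0
  replace hm2 := hm2 t t0
  have pu := (hb t t0.le).2.2
  simp only [eu, P1 h1, P2 h2] at hd
  have pg1 : Per fun x => g1 (t, x) := fun x => by simpa [eu] using congrArg Prod.fst (pu x)
  have pg2 : Per fun x => g2 (t, x) := fun x => by simpa [eu] using congrArg Prod.snd (pu x)
  have D1 := slice_DD h1 t
  have D2 := slice_DD h2 t
  have hA := contDiff_qa h1 h2
  have eB : ∀ d x, Dd (0, d) (fun p => g1 p * g2 p) (t, x) = _ := fun d x =>
    congrFun ((slice_DD (h1.mul h2) t d).unique ((D1 d).mul (D2 d))) x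
  have eA : ∀ d x, Dd (0, d) (fun p => (g1 p * g1 p - g2 p * g2 p) / 2) (t, x) = _ := fun d x =>
    congrFun ((slice_DD hA t d).unique (g' := fun x => 1 / 2 * _) (by
      have := (((D1 d).mul (D1 d)).sub ((D2 d).mul (D2 d))).const_mul (1 / 2)
      simpa only [div_eq_inv_mul, mul_one] using this)) x
  have dt1 : ∀ x, deriv (fun s => (u s x).1) t = ∇ₜ g1 (t, x) := fun x =>
    ((ev x).fun_comp Prod.fst).deriv_eq.trans (td h1 x)
  have dt2 : ∀ x, deriv (fun s => (u s x).2) t = ∇ₜ g2 (t, x) := fun x =>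
    ((ev x).fun_comp Prod.snd).deriv_eq.trans (td h2 x)
  generalize hp : pressure (u t) = p at hm1 hm2
  simp only [dt1, eu, P1 h1, P2 h1, P1 (Dd_contDiff _ h1), P2 (Dd_contDiff _ h1)] at hm1
  simp only [dt2, eu, P1 h2, P2 h2, P1 (Dd_contDiff _ h2), P2 (Dd_contDiff _ h2)] at hm2
  obtain ⟨k1, k2⟩ := PG_contDiff h1 h2
  have sl : ContDiff ℝ ∞ fun x : ℝ² => (t, x) := contDiff_const.prodMk contDiff_id
  have J : ∀ {g : ℝ × ℝ² → ℝ}, ContDiff ℝ ∞ g → ContDiff ℝ 1 fun x : ℝ² => 1 / 2 * g (t, x) := fun h =>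
    (contDiff_const.mul (h.comp sl)).of_le (by simp)
  have R := pressure_grad (f := fun x => (∇₁ g2 (t, x) - ∇₂ g1 (t, x)) * g1 (t, x))
    (w := fun x => g1 (t, x) * g1 (t, x)) (p := p) (J1 := fun x => 1 / 2 * PG1 g1 g2 (t, x))
    (J2 := fun x => 1 / 2 * PG2 g1 g2 (t, x))
    ((((Dd_contDiff _ h2).comp sl).sub ((Dd_contDiff _ h1).comp sl)).mul (h1.comp sl)) ?_
    ((D1 _).mul (D1 _)) ((D1 _).mul (D1 _)) (J k1) (J k2) ?_ (fun x => ?_) (fun x => ?_)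
  · obtain ⟨r1, r2, r₃⟩ := R
    have half : ∀ {f : ℝ² → ℝ}, (A2 fun x => 1 / 2 * f x) = (fun _ => 0) → A2 f = fun _ => 0 := fun {f} h => by
      rw [A2_const_mul] at h
      exact funext fun x => by simpa using congrFun h x
    refine ⟨hd, fun x => ?_, half r2, half r₃⟩
    have q : ∀ {g : ℝ × ℝ² → ℝ}, ContDiff ℝ ∞ g → ∀ e, fderiv ℝ (fun x => 1 / 2 * g (t, x)) x e = 1 / 2 * Dd (0, e) g (t, x) :=
      fun {g} hg e => (hasDerivAt_line ((J hg).differentiable (by simp) x) e).unique ((slice_DD hg t e).const_mul (1 / 2) x)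
    have := r1 x
    rw [q k1, q k2] at this
    linarith
  · have c1 := P1 h2 ▸ pg2.pd1
    have c2 := P2 h1 ▸ pg1.pd2
    intro x
    have := c1 x; have := c2 x; have := pg1 x
    simp_all
  · rw [← hp]
    funext x
    simp only [pressure, vort, eu, P1 h2, P2 h1, sq]
  · have := hm1 x
    have := hd x
    simp only [PG1, eB]
    rw [show ∇₂ g2 (t, x) = - ∇₁ g1 (t, x) by linarith]
    linarith
  · have := hm2 x
    have := hd x
    simp only [PG2, eB, eA]
    rw [show ∇₁ g1 (t, x) = - ∇₂ g2 (t, x) by linarith]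
    linarith

theorem exists_mollifier (hr : 0 < r) : ∃ ρ, Test ρ ∧ support ρ ⊆ Metric.ball 0 r ∧
    ∀ g : ℝ × ℝ² → ℝ, Continuous g → ∀ p z ε, 0 ≤ ε → (∀ q ∈ Metric.ball p r, |g q - z| ≤ ε) →
      |Cv ρ g p - z| ≤ ε := by
  let χ : ContDiffBump (0 : ℝ × ℝ²) := ⟨r / 2, r, by linarith, by linarith⟩
  have hs := (χ.support_normed_eq (μ := volume)).subset
  exact ⟨χ.normed volume, ⟨χ.contDiff_normed, χ.hasCompactSupport_normed⟩, hs, fun g hg p z ε hε H =>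
    dist_convolution_le hε hs χ.nonneg_normed χ.integral_normed hg.aestronglyMeasurable H⟩

theorem IsSolution.approx {u₀ u} (h : IsSolution u₀ u) (hT : 0 ≤ T) (hM : ∀ s ∈ Icc 0 (T + 1), ∀ x, ‖u s x‖ ≤ M)
    (hε : 0 < ε) : ∃ (C : ℝ) (v1 v2 α β : ℝ → ℝ² → ℝ), TB C v1 ∧ TB C v2 ∧ TB C α ∧ TB C β ∧
      (∀ t ∈ Icc 0 T, ∀ x, v1 t x = HS t (v1 0) x - DW 0 1 α β t x ∧ v2 t x = HS t (v2 0) x + DW 1 0 α β t x) ∧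
      ∀ s ∈ Icc 0 T, ∀ x, |v1 s x - (u s x).1| ≤ ε ∧ |v2 s x - (u s x).2| ≤ ε ∧
        |α s x - ((u s x).1 * (u s x).1 - (u s x).2 * (u s x).2) / 2| ≤ 2 * M * ε ∧
        |β s x - (u s x).1 * (u s x).2| ≤ 2 * M * ε := by
  obtain ⟨δ, hδ, Hδ⟩ := h.modulus T hε
  obtain ⟨η, hη, h4, h1⟩ : ∃ η > 0, 4 * η ≤ δ ∧ 4 * η ≤ 1 :=
    ⟨min δ 1 / 4, by positivity, by linarith [min_le_left δ 1], by linarith [min_le_right δ 1]⟩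
  obtain ⟨φ, hφ, hid, hr⟩ := exists_time_change hη (show η < T + 3 * η by linarith)
  obtain ⟨ρ, hρ, hs, conv⟩ := exists_mollifier (half_pos hη)
  have hφ0 : ∀ t, φ t ∈ Icc 0 (T + 1) := fun t => ⟨by linarith [(hr t).1], by linarith [(hr t).2]⟩
  have hg : ContDiff ℝ ∞ fun p : ℝ × ℝ² => u (φ p.1) p.2 :=
    contDiffOn_univ.1 (h.2.2.2.1.comp (f := fun p : ℝ × ℝ² => (φ p.1, p.2))
      ((hφ.comp contDiff_fst).prodMk contDiff_snd).contDiffOn fun p _ =>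
        show 0 < φ p.1 by linarith [(hr p.1).1])
  set g1 : ℝ × ℝ² → ℝ := fun p => (u (φ p.1) p.2).1 with e1
  set g2 : ℝ × ℝ² → ℝ := fun p => (u (φ p.1) p.2).2 with e2
  have h1 : ContDiff ℝ ∞ g1 := contDiff_fst.comp hg
  have h2 : ContDiff ℝ ∞ g2 := contDiff_snd.comp hg
  have hA := contDiff_qa h1 h2
  have b1 : ∀ p, |g1 p| ≤ M := fun p => (norm_fst_le _).trans (hM _ (hφ0 _) _)
  have b2 : ∀ p, |g2 p| ≤ M := fun p => (norm_snd_le _).trans (hM _ (hφ0 _) _)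
  have M0 := (abs_nonneg _).trans (b1 0)
  obtain ⟨bA, bB⟩ := abs_qa_qb_le b1 b2
  have per := fun t => (h.2.1 (φ t) (hφ0 t).1).2.2
  have sl := fun t ht => h.slice h1 h2 hη (b := T + 3 * η)
    (fun t ht x => by rw [e1, e2]; simp only [hid t (Ioo_subset_Icc_self ht)]) (t := t) ht
  have tb : ∀ {g}, ContDiff ℝ ∞ g → ∀ {L}, (∀ p, |g p| ≤ L) → L ≤ M + M * M →
      TB ((∫ w, |ρ w|) * (M + M * M)) fun t x => Cv ρ g (t + 2 * η, x) := fun h _ b hL =>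
    ⟨(Cv_continuous hρ h.continuous).comp (by fun_prop), fun t x => Cv_abs_le hρ (fun p => (b p).trans hL) _⟩
  refine ⟨_, _, _, _, _, tb h1 b1 (by nlinarith), tb h2 b2 (by nlinarith), tb hA bA (by nlinarith),
    tb (h1.mul h2) bB (by nlinarith), fun t ht x => ?_, fun s hs x => ?_⟩
  · refine mollified_mild hρ h1 h2 b1 b2 (fun t x => congrArg Prod.fst (per t x))
      (fun t x => congrArg Prod.snd (per t x)) (S := Ioo η (T + 3 * η)) (fun t ht => (sl t ht).1)
      (fun t ht => (sl t ht).2.1) (fun t ht => (sl t ht).2.2.1) (fun t ht => (sl t ht).2.2.2)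
      (I := Ioo (-(η / 2)) (T + η / 2)) isOpen_Ioo (c := 2 * η) (fun t ht w hw => ?_) rfl rfl rfl rfl ht.1
      (fun r hr => ⟨by linarith [hr.1], by linarith [hr.2, ht.2]⟩) x
    have := (norm_fst_le w).trans_lt (mem_ball_zero_iff.1 (hs hw))
    rw [norm_eq_abs, abs_lt] at this
    exact ⟨by linarith [ht.1], by linarith [ht.2]⟩
  · have us := hM s ⟨hs.1, by linarith [hs.2]⟩ x
    have u1 : |(u s x).1| ≤ M := (norm_fst_le _).trans us
    have u2 : |(u s x).2| ≤ M := (norm_snd_le _).trans us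
    have near : ∀ q ∈ Metric.ball ((s + 2 * η, x) : ℝ × ℝ²) (η / 2),
        |g1 q - (u s x).1| ≤ ε ∧ |g2 q - (u s x).2| ≤ ε := fun q hq => by
      rw [Metric.mem_ball, Prod.dist_eq, max_lt_iff, Real.dist_eq, abs_lt] at hq
      have d := Hδ s hs q.1 (by linarith [hs.1]) (by rw [abs_lt]; constructor <;> linarith) x q.2
        (by rw [dist_comm]; linarith)
      rw [dist_comm, Prod.dist_eq, max_le_iff] at d
      rw [e1, e2]; simp only [hid q.1 ⟨by linarith [hs.1], by linarith [hs.2]⟩]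
      exact d
    rw [abs_le] at u1 u2
    refine ⟨conv _ h1.continuous _ _ _ hε.le fun q hq => (near q hq).1,
      conv _ h2.continuous _ _ _ hε.le fun q hq => (near q hq).2,
      conv _ hA.continuous _ _ _ (by positivity) fun q hq => ?_,
      conv _ (h1.mul h2).continuous _ _ _ (by positivity) fun q hq => ?_⟩
    all_goals
      obtain ⟨n1, n2⟩ := near q hq
      have c1 := abs_le.1 (b1 q)
      have c2 := abs_le.1 (b2 q)
    · have k : ∀ {y z}, |y| ≤ M → |z| ≤ M → |y - z| ≤ ε → |y * y - z * z| ≤ 2 * M * ε := fun {y z} hy hz hd => by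
        rw [show y * y - z * z = (y + z) * (y - z) by ring, abs_mul]
        exact mul_le_mul ((abs_add_le _ _).trans (by linarith)) hd (abs_nonneg _) (by linarith)
      have := abs_le.1 (k (b1 q) (abs_le.2 u1) n1)
      have := abs_le.1 (k (b2 q) (abs_le.2 u2) n2)
      rw [abs_le]; constructor <;> linarith
    · rw [show g1 q * g2 q - (u s x).1 * (u s x).2 = g1 q * (g2 q - (u s x).2) + (g1 q - (u s x).1) * (u s x).2 by ring]
      refine (abs_add_le _ _).trans ?_
      rw [abs_mul, abs_mul]
      nlinarith [mul_le_mul (b1 q) n2 (abs_nonneg _) M0, mul_le_mul n1 (abs_le.2 u2) (abs_nonneg _) hε.le]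

theorem eq_of_forall_abs_sub_le (h : ∀ ε > 0, |a - b| ≤ K * ε) : a = b := by
  have l : Tendsto (fun ε : ℝ => K * ε) (𝓝[>] 0) (𝓝 (K * 0)) :=
    ((continuous_const.mul continuous_id).tendsto 0).mono_left nhdsWithin_le_nhds
  have := ge_of_tendsto l (eventually_mem_nhdsWithin.mono fun ε hε => h ε hε)
  rw [mul_zero, abs_nonpos_iff] at this
  exact sub_eq_zero.1 this

theorem IsSolution.mild {u₀ u} (h : IsSolution u₀ u) (hT : 0 ≤ T) : ∃ M,
    Mild T M (fun t x => (u (max 0 (min t T)) x).1) fun t x => (u (max 0 (min t T)) x).2 := by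
  obtain ⟨M, M0, hM⟩ := h.bounded (T + 1)
  have cl := clamp_mem hT
  have hM' : ∀ t x, ‖u (max 0 (min t T)) x‖ ≤ M := fun t => hM _ ⟨(cl t).1, by linarith [(cl t).2]⟩
  have hc : Continuous fun p : ℝ × ℝ² => u (max 0 (min p.1 T)) p.2 := by
    have : ContinuousOn (fun p : ℝ × ℝ² => u p.1 p.2) (Icc 0 T ×ˢ univ) := fun p hp => by
      refine Metric.continuousWithinAt_iff.2 fun ε hε => ?_
      obtain ⟨δ, hδ, H⟩ := h.modulus T (half_pos hε)
      refine ⟨δ, hδ, fun {q} hq d => ?_⟩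
      rw [Prod.dist_eq, max_lt_iff] at d
      exact (H q.1 hq.1 p.1 hp.1.1 d.1 _ _ d.2).trans_lt (half_lt_self hε)
    exact this.comp_continuous (f := fun p : ℝ × ℝ² => (max 0 (min p.1 T), p.2)) (by fun_prop)
      fun p => ⟨cl _, mem_univ _⟩
  set U1 : ℝ → ℝ² → ℝ := fun t x => (u (max 0 (min t T)) x).1 with e1
  set U2 : ℝ → ℝ² → ℝ := fun t x => (u (max 0 (min t T)) x).2 with e2
  have t1 : TB M U1 := ⟨continuous_fst.comp hc, fun t x => (norm_fst_le _).trans (hM' t x)⟩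
  have t2 : TB M U2 := ⟨continuous_snd.comp hc, fun t x => (norm_snd_le _).trans (hM' t x)⟩
  have key : ∀ t ∈ Icc 0 T, ∀ x, ∀ ε > 0,
      |U1 t x - (HS t (U1 0) x - DW 0 1 (qa U1 U2) (qb U1 U2) t x)| ≤ (2 + √(2 * t) * (KW * (2 * M))) * ε ∧
      |U2 t x - (HS t (U2 0) x + DW 1 0 (qa U1 U2) (qb U1 U2) t x)| ≤ (2 + √(2 * t) * (KW * (2 * M))) * ε := by
    intro t ht x ε hε
    obtain ⟨C, v1, v2, α, β, w1, w2, hα, hβ, E, N⟩ := h.approx hT hM hε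
    have N' : ∀ s ∈ Icc 0 T, ∀ x, |v1 s x - U1 s x| ≤ ε ∧ |v2 s x - U2 s x| ≤ ε ∧
        |α s x - qa U1 U2 s x| ≤ 2 * M * ε ∧ |β s x - qb U1 U2 s x| ≤ 2 * M * ε := fun s hs x => by
      have := N s hs x
      simpa only [e1, e2, qa, qb, clamp_eq hs.1 hs.2] using this
    have m0 : (0:ℝ) ∈ Icc 0 T := ⟨le_rfl, hT⟩
    have d : ∀ {j k}, j + k = 1 → |DW j k α β t x - DW j k (qa U1 U2) (qb U1 U2) t x| ≤
        √(2 * t) * (KW * (2 * M * ε)) := fun hjk => by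
      rw [← DW_sub hjk hα hβ (t1.qa t2) (t1.qb t2)]
      exact DW_abs_le hjk (fun s h0 hs x => (N' s ⟨h0, hs.le.trans ht.2⟩ x).2.2.1)
        (fun s h0 hs x => (N' s ⟨h0, hs.le.trans ht.2⟩ x).2.2.2) (by positivity) x
    have k1 := HS_abs_le t (fun y => (N' 0 m0 y).1) x
    have k2 := HS_abs_le t (fun y => (N' 0 m0 y).2.1) x
    rw [HS_sub t (w1.slice 0).cont (t1.slice 0).cont (w1.slice 0).bd (t1.slice 0).bd] at k1
    rw [HS_sub t (w2.slice 0).cont (t2.slice 0).cont (w2.slice 0).bd (t2.slice 0).bd] at k2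
    have n := N' t ht x
    rw [(E t ht x).1, (E t ht x).2] at n
    have d1 := abs_le.1 (d (j := 0) (k := 1) rfl)
    have d2 := abs_le.1 (d (j := 1) (k := 0) rfl)
    rw [abs_le] at k1 k2
    have n1 := abs_le.1 n.1
    have n2 := abs_le.1 n.2.1
    rw [show (2 + √(2 * t) * (KW * (2 * M))) * ε = 2 * ε + √(2 * t) * (KW * (2 * M * ε)) by ring]
    constructor <;> rw [abs_le] <;> constructor <;> linarith
  exact ⟨M, t1, t2, fun t h0 h1 x => eq_of_forall_abs_sub_le fun ε hε => (key t ⟨h0, h1⟩ x ε hε).1,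
    fun t h0 h1 x => eq_of_forall_abs_sub_le fun ε hε => (key t ⟨h0, h1⟩ x ε hε).2⟩

end

/-- Global well-posedness of the Navier-Stokes equations in `BUC(Ω)²` together with the
bound `‖u(·,t)‖_{L∞} ≤ C(1 + √t)`, where `C` depends only on `‖u₀‖_{L∞}`. -/
theorem global_wellposedness :
    ∃ Cf : ℝ → ℝ, (∀ B : ℝ, 0 < Cf B) ∧
      ∀ u₀ : ℝ × ℝ → ℝ × ℝ, BUCField u₀ → WeakDivFree u₀ →
        (∃ u, IsSolution u₀ u) ∧
        (∀ u v, IsSolution u₀ u → IsSolution u₀ v → ∀ t : ℝ, 0 ≤ t → u t = v t) ∧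
        (∀ u, IsSolution u₀ u → ∀ t : ℝ, 0 ≤ t → ∀ x : ℝ × ℝ,
          vnorm (u t x) ≤ Cf (⨆ x : ℝ × ℝ, vnorm (u₀ x)) * (1 + Real.sqrt t)) := by
  obtain ⟨Cf, hC, H⟩ := exists_solution
  refine ⟨Cf, hC, fun u₀ h₀ hd => ?_⟩
  obtain ⟨U₁, U₂, hU, hb, uniq⟩ := H u₀ h₀ hd
  have key : ∀ u, IsSolution u₀ u → ∀ t, 0 ≤ t → u t = fun x => (U₁ t x, U₂ t x) := fun u hu t ht => by
    obtain ⟨M, m⟩ := hu.mild ht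
    obtain ⟨k₁, k₂⟩ := uniq t M _ _ ht m (by simp [ht, hu.1]) (by simp [ht, hu.1])
    simp only [min_self, max_eq_right ht] at k₁ k₂
    funext x
    exact Prod.ext (congrFun k₁ x) (congrFun k₂ x)
  refine ⟨⟨_, hU⟩, fun u v hu hv t ht => (key u hu t ht).trans (key v hv t ht).symm, fun u hu t ht x => ?_⟩
  rw [key u hu t ht]
  exact hb t ht x

end NS
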